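/- Let R be a commutative noetherian local ring that is complete with respect to its maximal-ideal-adic topology and Gorenstein, i.e., R has finite injective dimension as an R-module. Let A be a Noether R-algebra such that A ≠ 0, Ext^i_R(A, R) = 0 for all i > 0 (i.e., A is a maximal Cohen–Macaulay R-module), and Hom_R(A, R) is projective as a right A-module (i.e., A is a Gorenstein R-order). Then the following are equivalent: (1) there are, up to isomorphism, only finitely many indecomposable finitely generated right A-modules N with Ext^i_A(N, A) = 0 for all i > 0 (i.e., A is of finite Cohen–Macaulay representation type); (2) every Gorenstein-projective right A-module is a direct sum of finitely generated Gorenstein-projective right A-modules. -/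

import Mathlib

open CategoryTheory Limits

universe v u

/-- The Jacobson radical `rad A` (the intersection of the maximal left ideals of `A`,
a two-sided ideal), viewed as a submodule of the right regular module `A`
(formalized as the left regular `Aᵐᵒᵖ`-module). -/
def radRight (A : Type u) [Ring A] : Submodule Aᵐᵒᵖ Aᵐᵒᵖ where
  carrier := {x | x.unop ∈ TwoSidedIdeal.jacobson (⊥ : TwoSidedIdeal A)}
  add_mem' := by
    intro x y hx hy
    simp only [Set.mem_setOf_eq, MulOpposite.unop_add] at *
    exact TwoSidedIdeal.add_mem _ hx hy
  zero_mem' := by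
    simp only [Set.mem_setOf_eq, MulOpposite.unop_zero]
    exact TwoSidedIdeal.zero_mem _
  smul_mem' := by
    intro c x hx
    simp only [Set.mem_setOf_eq] at *
    exact (TwoSidedIdeal.jacobson (⊥ : TwoSidedIdeal A)).mul_mem_right _ _ hx

/-- `A/rad A`, regarded as a right `A`-module (i.e. a left `Aᵐᵒᵖ`-module). -/
abbrev modRad (A : Type u) [Ring A] := Aᵐᵒᵖ ⧸ radRight A

/-- `Ext^n` in the category of modules over a ring `B`; taking `B = Aᵐᵒᵖ` gives the
Ext groups of right `A`-modules. -/
noncomputable abbrev extGrp (B : Type u) [Ring B] (n : ℕ) (X Y : ModuleCat.{u} B) :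
    ModuleCat ℤ :=
  ((Ext ℤ (ModuleCat.{u} B) n).obj (Opposite.op X)).obj Y

/-- A module `M` has injective dimension `≤ d` iff `Ext^i(N, M) = 0` for all `i > d` and all
modules `N` (the standard characterization, equivalent to the existence of an injective
resolution of length `d`). -/
def hasInjDimLE (B : Type u) [Ring B] (d : ℕ) (M : ModuleCat.{u} B) : Prop :=
  ∀ i : ℕ, d < i → ∀ N : ModuleCat.{u} B, Subsingleton (extGrp B i N M)

/-- A module is indecomposable if it is nonzero and is not the (internal) direct sum of two
nonzero submodules. -/
def IsIndecomposableModule (B : Type*) [Ring B] (M : Type*) [AddCommGroup M]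
    [Module B M] : Prop :=
  Nontrivial M ∧ ∀ P Q : Submodule B M, IsCompl P Q → P = ⊥ ∨ Q = ⊥

/-- A module `M` is Gorenstein-projective if there is a totally acyclic complex `X` of
projective modules (acyclic, and `Hom(X, P)` is acyclic for every projective module `P`)
with `M ≅ ker(X⁰ → X¹)`. -/
def IsGorensteinProjective {B : Type u} [Ring B] (M : ModuleCat.{max u v} B) : Prop :=
  ∃ X : CochainComplex (ModuleCat.{max u v} B) ℤ,
    (∀ i : ℤ, Projective (X.X i)) ∧
    (∀ i : ℤ, X.ExactAt i) ∧
    (∀ (P : ModuleCat.{max u v} B), Projective P → ∀ (i : ℤ) (f : X.X i ⟶ P),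
       X.d (i - 1) i ≫ f = 0 → ∃ g : X.X (i + 1) ⟶ P, X.d i (i + 1) ≫ g = f) ∧
    Nonempty (M ≅ kernel (X.d 0 1))

universe w w₁ w₂ w₃ w₄ w₅

namespace GorensteinOrder

section LinearAlgebra

variable {Λ : Type u} [Ring Λ]
variable {K : Type w₁} {F : Type w₂} {M : Type w₃} {N : Type w₄} {P : Type w₅}
variable [AddCommGroup K] [Module Λ K] [AddCommGroup F] [Module Λ F]
variable [AddCommGroup M] [Module Λ M] [AddCommGroup N] [Module Λ N]
variable [AddCommGroup P] [Module Λ P]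

lemma exists_desc (h : P →ₗ[Λ] F) (hs : Function.Surjective h) (l : P →ₗ[Λ] N)
    (hk : ∀ x, h x = 0 → l x = 0) : ∃ l' : F →ₗ[Λ] N, ∀ x, l' (h x) = l x := by
  refine ⟨((LinearMap.ker h).liftQ l fun x hx => hk x hx) ∘ₗ
    (h.quotKerEquivOfSurjective hs).symm.toLinearMap, fun x => ?_⟩
  have : (h.quotKerEquivOfSurjective hs).symm (h x) = (LinearMap.ker h).mkQ x := by
    rw [LinearEquiv.symm_apply_eq]; simp
  simp only [LinearMap.comp_apply, LinearEquiv.coe_coe, this]; rfl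

lemma exists_codlift (f : K →ₗ[Λ] F) (hf : Function.Injective f) (g : P →ₗ[Λ] F)
    (h : ∀ x, ∃ k, f k = g x) : ∃ g' : P →ₗ[Λ] K, ∀ x, f (g' x) = g x := by
  refine ⟨(LinearEquiv.ofInjective f hf).symm.toLinearMap ∘ₗ g.codRestrict (LinearMap.range f) h,
    fun x => ?_⟩
  have := LinearEquiv.apply_symm_apply (LinearEquiv.ofInjective f hf)
    (g.codRestrict (LinearMap.range f) h x)
  exact congrArg Subtype.val this

/-- Vanishing of the first extension group of `M` by `N`, for modules in arbitrary universes. -/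
def Ext1Z (Λ : Type u) [Ring Λ] (M : Type w₃) (N : Type w₄) [AddCommGroup M] [Module Λ M]
    [AddCommGroup N] [Module Λ N] : Prop :=
  ∀ φ : LinearMap.ker (Finsupp.linearCombination Λ (id : M → M)) →ₗ[Λ] N,
    ∃ ψ : (M →₀ Λ) →ₗ[Λ] N, ∀ x, ψ x.1 = φ x

lemma linearCombination_id_surjective :
    Function.Surjective (Finsupp.linearCombination Λ (id : M → M)) :=
  Finsupp.linearCombination_id_surjective Λ M

lemma Ext1Z.extend (h : Ext1Z Λ M N) {f : K →ₗ[Λ] F} {g : F →ₗ[Λ] M}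
    (hf : Function.Injective f) (hfg : Function.Exact f g) (hg : Function.Surjective g)
    (φ : K →ₗ[Λ] N) : ∃ ψ : F →ₗ[Λ] N, ∀ x, ψ (f x) = φ x := by
  obtain ⟨s, hs⟩ := Module.projective_lifting_property g
    (Finsupp.linearCombination Λ (id : M → M)) hg
  replace hs : ∀ x, g (s x) = Finsupp.linearCombination Λ (id : M → M) x :=
    fun x => LinearMap.congr_fun hs x
  obtain ⟨s', hs'⟩ := exists_codlift (P := LinearMap.ker (Finsupp.linearCombination Λ (id : M → M))) f hf
    (s ∘ₗ (LinearMap.ker (Finsupp.linearCombination Λ (id : M → M))).subtype) (fun x =>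
      (hfg _).1 ((hs _).trans (LinearMap.mem_ker.1 x.2)))
  obtain ⟨ψ₀, hψ₀⟩ := h (φ ∘ₗ s')
  obtain ⟨ψ, hψ⟩ := exists_desc (f.coprod s) (fun x => by
    obtain ⟨u, hu⟩ := linearCombination_id_surjective (Λ := Λ) (g x)
    obtain ⟨k, hk⟩ := (hfg (x - s u)).1 (by simp [hs, hu])
    exact ⟨(k, u), by simp [hk]⟩) (φ.coprod ψ₀) (by
    rintro ⟨k, x⟩ hx
    simp only [LinearMap.coprod_apply] at hx ⊢
    have hx0 : Finsupp.linearCombination Λ (id : M → M) x = 0 := by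
      have := congrArg g hx
      rwa [map_add, hfg.apply_apply_eq_zero, zero_add, hs, map_zero] at this
    have h1 := hs' ⟨x, hx0⟩
    have h2 := hψ₀ ⟨x, hx0⟩
    have h3 : k = - s' ⟨x, hx0⟩ := hf (by
      rw [map_neg, h1]; exact eq_neg_of_add_eq_zero_left hx)
    simp only at h2
    rw [h2, h3]; simp)
  exact ⟨ψ, fun k => by simpa using hψ (k, 0)⟩

lemma Ext1Z.of_presentation (hF : Ext1Z Λ F N) {f : K →ₗ[Λ] F} {g : F →ₗ[Λ] M}
    (hfg : Function.Exact f g) (hg : Function.Surjective g)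
    (h : ∀ φ : K →ₗ[Λ] N, ∃ ψ : F →ₗ[Λ] N, ∀ x, ψ (f x) = φ x) : Ext1Z Λ M N := by
  rw [Ext1Z]
  set lc := Finsupp.linearCombination Λ (id : M → M) with hlc
  intro φ
  obtain ⟨s, hs⟩ := Module.projective_lifting_property g lc hg
  replace hs : ∀ x, g (s x) = lc x := fun x => LinearMap.congr_fun hs x
  let Q := LinearMap.ker (g.coprod (-lc))
  have hQ : ∀ x u, (x, u) ∈ Q ↔ g x = lc u := fun x u => by
    simp [Q, LinearMap.mem_ker, ← sub_eq_add_neg, sub_eq_zero]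
  let a : LinearMap.ker lc →ₗ[Λ] Q := LinearMap.codRestrict Q
    (LinearMap.inr Λ F (M →₀ Λ) ∘ₗ (LinearMap.ker lc).subtype) (fun c => by
      rw [LinearMap.comp_apply, LinearMap.inr_apply, hQ]; simp)
  let b : Q →ₗ[Λ] F := LinearMap.fst Λ F (M →₀ Λ) ∘ₗ Q.subtype
  obtain ⟨θ, hθ⟩ := hF.extend (K := LinearMap.ker lc) (F := Q) (f := a) (g := b) (fun x y hxy => Subtype.ext (congrArg (fun z => z.1.2) hxy)) (by
      rintro ⟨⟨x, u⟩, hx⟩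
      constructor
      · intro h0
        have hx' : x = 0 := h0
        subst hx'
        exact ⟨⟨u, by simpa using ((hQ _ _).1 hx).symm⟩, rfl⟩
      · rintro ⟨y, hy⟩
        rw [← hy]; rfl) (fun x => by
      obtain ⟨u, hu⟩ := linearCombination_id_surjective (Λ := Λ) (g x)
      exact ⟨⟨(x, u), (hQ _ _).2 hu.symm⟩, rfl⟩) φ
  let c : K →ₗ[Λ] Q := LinearMap.codRestrict Q (LinearMap.inl Λ F (M →₀ Λ) ∘ₗ f)
    (fun k => by rw [LinearMap.comp_apply, LinearMap.inl_apply, hQ]; simp [hfg.apply_apply_eq_zero])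
  obtain ⟨ψ, hψ⟩ := h (θ ∘ₗ c)
  let e : (M →₀ Λ) →ₗ[Λ] Q := LinearMap.codRestrict Q (s.prod LinearMap.id) (fun u => by
    exact (hQ _ _).2 (hs u))
  refine ⟨θ ∘ₗ e - ψ ∘ₗ s, fun u => ?_⟩
  obtain ⟨k, hk⟩ := (hfg (s u.1)).1 (by rw [hs]; exact u.2)
  have h1 : e u.1 = a u + c k := by
    apply Subtype.ext
    simp [e, a, c, hk]
    rfl
  simp only [LinearMap.sub_apply, LinearMap.comp_apply]
  rw [h1, map_add, hθ, ← hk, hψ]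
  simp

lemma Ext1Z.of_projective [Module.Projective Λ M] : Ext1Z Λ M N := by
  intro φ
  obtain ⟨s, hs⟩ := Module.projective_lifting_property
    (Finsupp.linearCombination Λ (id : M → M)) LinearMap.id linearCombination_id_surjective
  replace hs : ∀ x, Finsupp.linearCombination Λ (id : M → M) (s x) = x :=
    fun x => LinearMap.congr_fun hs x
  refine ⟨φ ∘ₗ LinearMap.codRestrict _ (LinearMap.id - s ∘ₗ Finsupp.linearCombination Λ (id : M → M))
    (fun c => by simp [LinearMap.mem_ker, hs]), fun x => ?_⟩
  have hx : Finsupp.linearCombination Λ (id : M → M) x.1 = 0 := x.2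
  simp only [LinearMap.comp_apply]
  congr 1
  apply Subtype.ext
  simp [hx]

end LinearAlgebra

section Ext

variable {Λ : Type u} [Ring Λ] [Small.{w} Λ]

/-- Vanishing of `Ext^n(M, N)`. -/
def ExtZ (Λ : Type u) [Ring Λ] [Small.{w} Λ] (n : ℕ) (M N : Type w) [AddCommGroup M] [Module Λ M]
    [AddCommGroup N] [Module Λ N] : Prop :=
  Subsingleton (Abelian.Ext (ModuleCat.of Λ M) (ModuleCat.of Λ N) n)

variable {A B C : Type w} [AddCommGroup A] [Module Λ A] [AddCommGroup B] [Module Λ B]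
  [AddCommGroup C] [Module Λ C] {M N : Type w} [AddCommGroup M] [Module Λ M]
  [AddCommGroup N] [Module Λ N]

lemma extZ_iff {n : ℕ} : ExtZ Λ n M N ↔
    ∀ x : Abelian.Ext (ModuleCat.of Λ M) (ModuleCat.of Λ N) n, x = 0 :=
  ⟨fun h x => h.elim _ _, fun h => ⟨fun x y => (h x).trans (h y).symm⟩⟩

omit [Small.{w} Λ] in
lemma shortExact {f : A →ₗ[Λ] B} {g : B →ₗ[Λ] C} (hf : Function.Injective f)
    (hfg : Function.Exact f g) (hg : Function.Surjective g) :
    (ModuleCat.shortComplexOfCompEqZero f g hfg.linearMap_comp_eq_zero).ShortExact :=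
  ModuleCat.shortComplex_shortExact _ hfg hf hg

variable {f : A →ₗ[Λ] B} {g : B →ₗ[Λ] C} (hf : Function.Injective f) (hfg : Function.Exact f g) (hg : Function.Surjective g)

include hf hfg hg

lemma ExtZ.left {n : ℕ} (hB : ExtZ Λ n B N) (hC : ExtZ Λ (n + 1) C N) : ExtZ Λ n A N := by
  rw [extZ_iff] at *
  intro x
  obtain ⟨y, rfl⟩ := Abelian.Ext.contravariant_sequence_exact₁ (shortExact hf hfg hg) _ x
    (add_comm 1 n) (hC _)
  rw [hB y, Abelian.Ext.comp_zero]

lemma ExtZ.right {n : ℕ} (hA : ExtZ Λ n A N) (hB : ExtZ Λ (n + 1) B N) : ExtZ Λ (n + 1) C N := by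
  rw [extZ_iff] at *
  intro x
  obtain ⟨y, rfl⟩ := Abelian.Ext.contravariant_sequence_exact₃ (shortExact hf hfg hg) _ x
    (hB _) (add_comm 1 n)
  rw [hA y, Abelian.Ext.comp_zero]

lemma ExtZ.mid {n : ℕ} (hA : ExtZ Λ n A N) (hC : ExtZ Λ n C N) : ExtZ Λ n B N := by
  rw [extZ_iff] at *
  intro x
  obtain ⟨y, rfl⟩ := Abelian.Ext.contravariant_sequence_exact₂ (shortExact hf hfg hg) _ x (hA _)
  rw [hC y, Abelian.Ext.comp_zero]

lemma ExtZ.right₂ {n : ℕ} (hB : ExtZ Λ n N B) (hA : ExtZ Λ (n + 1) N A) : ExtZ Λ n N C := by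
  rw [extZ_iff] at *
  intro x
  obtain ⟨y, rfl⟩ := Abelian.Ext.covariant_sequence_exact₃ _ (shortExact hf hfg hg) x rfl (hA _)
  rw [hB y, Abelian.Ext.zero_comp]

lemma ExtZ.mid₂ {n : ℕ} (hA : ExtZ Λ n N A) (hC : ExtZ Λ n N C) : ExtZ Λ n N B := by
  rw [extZ_iff] at *
  intro x
  obtain ⟨y, rfl⟩ := Abelian.Ext.covariant_sequence_exact₂ _ (shortExact hf hfg hg) x (hC _)
  rw [hA y, Abelian.Ext.zero_comp]

omit hf hfg hg

lemma ExtZ.of_projective [Module.Projective Λ M] {n : ℕ} : ExtZ Λ (n + 1) M N :=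
  extZ_iff.2 fun _ => Abelian.Ext.eq_zero_of_projective _

lemma ExtZ.of_retract {n : ℕ} (h : ExtZ Λ n B N) (i : A →ₗ[Λ] B) (r : B →ₗ[Λ] A)
    (hr : ∀ x, r (i x) = x) :
    ExtZ Λ n A N := by
  rw [extZ_iff] at *
  intro x
  have : (Abelian.Ext.mk₀ (ModuleCat.ofHom i)).comp
      ((Abelian.Ext.mk₀ (ModuleCat.ofHom r)).comp x (zero_add n)) (zero_add n) = x := by
    have e : ModuleCat.ofHom i ≫ ModuleCat.ofHom r = 𝟙 (ModuleCat.of Λ A) := by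
      ext x; exact hr x
    rw [Abelian.Ext.mk₀_comp_mk₀_assoc, e, Abelian.Ext.mk₀_id_comp]
  rw [← this, h (Abelian.Ext.comp _ _ _), Abelian.Ext.comp_zero]

lemma ExtZ.of_retract₂ {n : ℕ} (h : ExtZ Λ n N B) (i : A →ₗ[Λ] B) (r : B →ₗ[Λ] A)
    (hr : ∀ x, r (i x) = x) :
    ExtZ Λ n N A := by
  rw [extZ_iff] at *
  intro x
  have e : ModuleCat.ofHom i ≫ ModuleCat.ofHom r = 𝟙 (ModuleCat.of Λ A) := by
    ext x; exact hr x
  have : (x.comp (Abelian.Ext.mk₀ (ModuleCat.ofHom i)) (add_zero n)).comp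
      (Abelian.Ext.mk₀ (ModuleCat.ofHom r)) (add_zero n) = x := by
    rw [Abelian.Ext.comp_assoc_of_third_deg_zero, Abelian.Ext.mk₀_comp_mk₀, e,
      Abelian.Ext.comp_mk₀_id]
  rw [← this, h (Abelian.Ext.comp _ _ _), Abelian.Ext.zero_comp]

lemma ExtZ.prod {n : ℕ} (hA : ExtZ Λ n A N) (hB : ExtZ Λ n B N) : ExtZ Λ n (A × B) N :=
  ExtZ.mid (f := LinearMap.inl Λ A B) (g := LinearMap.snd Λ A B) LinearMap.inl_injective
    Function.Exact.inl_snd LinearMap.snd_surjective hA hB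

lemma ExtZ.prod₂ {n : ℕ} (hA : ExtZ Λ n N A) (hB : ExtZ Λ n N B) : ExtZ Λ n N (A × B) :=
  ExtZ.mid₂ (f := LinearMap.inl Λ A B) (g := LinearMap.snd Λ A B) LinearMap.inl_injective
    Function.Exact.inl_snd LinearMap.snd_surjective hA hB

lemma ExtZ.congr {n : ℕ} (e : A ≃ₗ[Λ] B) (h : ExtZ Λ n B N) : ExtZ Λ n A N :=
  h.of_retract e.toLinearMap e.symm.toLinearMap (by simp)

lemma ExtZ.congr₂ {n : ℕ} (e : A ≃ₗ[Λ] B) (h : ExtZ Λ n N B) : ExtZ Λ n N A :=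
  h.of_retract₂ e.toLinearMap e.symm.toLinearMap (by simp)

lemma ExtZ.of_subsingleton [Subsingleton M] {n : ℕ} : ExtZ Λ n M N := by
  have h : IsZero (ModuleCat.of Λ M) := ModuleCat.isZero_of_subsingleton _
  rw [extZ_iff]
  intro x
  rw [← Abelian.Ext.mk₀_id_comp x, h.eq_of_src (𝟙 _) 0, Abelian.Ext.mk₀_zero,
    Abelian.Ext.zero_comp]

lemma ExtZ.of_subsingleton₂ [Subsingleton M] {n : ℕ} : ExtZ Λ n N M := by
  have h : IsZero (ModuleCat.of Λ M) := ModuleCat.isZero_of_subsingleton _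
  rw [extZ_iff]
  intro x
  rw [← Abelian.Ext.comp_mk₀_id x, h.eq_of_src (𝟙 _) 0, Abelian.Ext.mk₀_zero,
    Abelian.Ext.comp_zero]

lemma ExtZ.finPi {n : ℕ} (m : ℕ) (h : ExtZ Λ n M N) : ExtZ Λ n (Fin m → M) N := by
  induction m with
  | zero => exact ExtZ.of_subsingleton
  | succ m ih => exact (h.prod ih).congr (Fin.consLinearEquiv Λ fun _ => M).symm

lemma ExtZ.finPi₂ {n : ℕ} (m : ℕ) (h : ExtZ Λ n N M) : ExtZ Λ n N (Fin m → M) := by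
  induction m with
  | zero => exact ExtZ.of_subsingleton₂
  | succ m ih => exact (h.prod₂ ih).congr₂ (Fin.consLinearEquiv Λ fun _ => M).symm

lemma ExtZ.extend (h : ExtZ Λ 1 C N) {f : A →ₗ[Λ] B} {g : B →ₗ[Λ] C}
    (hf : Function.Injective f) (hfg : Function.Exact f g) (hg : Function.Surjective g)
    (φ : A →ₗ[Λ] N) : ∃ ψ : B →ₗ[Λ] N, ∀ x, ψ (f x) = φ x := by
  rw [extZ_iff] at h
  obtain ⟨y, hy⟩ := Abelian.Ext.contravariant_sequence_exact₁ (shortExact hf hfg hg) _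
    (Abelian.Ext.mk₀ (ModuleCat.ofHom φ)) (add_comm 1 0) (h _)
  obtain ⟨ψ, rfl⟩ := Abelian.Ext.homEquiv₀.symm.surjective y
  simp only [Abelian.Ext.homEquiv₀_symm_apply, Abelian.Ext.mk₀_comp_mk₀] at hy
  refine ⟨ψ.hom, fun x => ?_⟩
  have := Abelian.Ext.homEquiv₀.symm.injective hy
  exact ConcreteCategory.congr_hom this x

lemma ExtZ.of_extend [Module.Projective Λ B] {f : A →ₗ[Λ] B} {g : B →ₗ[Λ] C}
    (hf : Function.Injective f) (hfg : Function.Exact f g) (hg : Function.Surjective g)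
    (h : ∀ φ : A →ₗ[Λ] N, ∃ ψ : B →ₗ[Λ] N, ∀ x, ψ (f x) = φ x) : ExtZ Λ 1 C N := by
  rw [extZ_iff]
  intro x
  obtain ⟨y, rfl⟩ := Abelian.Ext.contravariant_sequence_exact₃ (shortExact hf hfg hg) _ x
    (extZ_iff.1 (ExtZ.of_projective (M := B)) _) (add_comm 1 0)
  obtain ⟨φ, rfl⟩ := Abelian.Ext.homEquiv₀.symm.surjective y
  obtain ⟨ψ, hψ⟩ := h φ.hom
  have : φ = ModuleCat.ofHom f ≫ ModuleCat.ofHom ψ := by ext x; exact (hψ x).symm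
  simp only [Abelian.Ext.homEquiv₀_symm_apply]
  rw [this, ← Abelian.Ext.mk₀_comp_mk₀, ← Abelian.Ext.comp_assoc _ _ _ (add_comm 1 0)
    (add_zero 0) (by simp)]
  rw [show (shortExact hf hfg hg).extClass.comp (Abelian.Ext.mk₀ (ModuleCat.ofHom f)) rfl = 0 from
    (shortExact hf hfg hg).extClass_comp, Abelian.Ext.zero_comp]

lemma extZ_one_iff : ExtZ Λ 1 M N ↔ Ext1Z Λ M N := by
  constructor
  · intro h
    let F := M →₀ Shrink.{w} Λ
    let b : Module.Basis M Λ F := ⟨Finsupp.mapRange.linearEquiv (Shrink.linearEquiv.{w} Λ Λ)⟩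
    have : Module.Projective Λ F := Module.Projective.of_basis b
    let g : F →ₗ[Λ] M := b.constr ℕ id
    have hg : Function.Surjective g := fun m => ⟨b m, b.constr_basis ℕ _ _⟩
    exact Ext1Z.of_presentation (K := LinearMap.ker g) (F := F) (Ext1Z.of_projective)
      (f := (LinearMap.ker g).subtype) (g := g) (LinearMap.exact_subtype_ker_map g) hg
      (h.extend (A := LinearMap.ker g) (B := F) Subtype.val_injective
        (LinearMap.exact_subtype_ker_map g) hg)
  · intro h
    let F := M →₀ Shrink.{w} Λ
    let b : Module.Basis M Λ F := ⟨Finsupp.mapRange.linearEquiv (Shrink.linearEquiv.{w} Λ Λ)⟩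
    have : Module.Projective Λ F := Module.Projective.of_basis b
    let g : F →ₗ[Λ] M := b.constr ℕ id
    have hg : Function.Surjective g := fun m => ⟨b m, b.constr_basis ℕ _ _⟩
    exact ExtZ.of_extend (A := LinearMap.ker g) (B := F) (f := (LinearMap.ker g).subtype) (g := g)
      Subtype.val_injective (LinearMap.exact_subtype_ker_map g) hg
      (h.extend (K := LinearMap.ker g) (F := F) Subtype.val_injective
        (LinearMap.exact_subtype_ker_map g) hg)

end Ext

section Linear

variable {R : Type u} [CommRing R] {L : Type u} [AddCommGroup L] [Module R L]
  {N : Type u} [AddCommGroup N] [Module R N]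

/-- Nakayama-type descent of vanishing along a nonzerodivisor of a local ring. -/
lemma ExtZ.of_regular [IsNoetherianRing R] [IsLocalRing R] [Module.Finite R L] [Module.Finite R N]
    {y : R} (hy : y ∈ IsLocalRing.maximalIdeal R) (hreg : ∀ x : L, y • x = 0 → x = 0)
    {Q : Type u} [AddCommGroup Q] [Module R Q] {g : L →ₗ[R] Q} (hg : Function.Surjective g)
    (hker : ∀ x, g x = 0 ↔ ∃ z, y • z = x) {n : ℕ} (h : ExtZ R (n + 1) Q N) : ExtZ R n L N := by
  have hex : Function.Exact (y • LinearMap.id : L →ₗ[R] L) g := fun x => by simp [hker x]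
  have hinj : Function.Injective (y • LinearMap.id : L →ₗ[R] L) :=
    (injective_iff_map_eq_zero _).2 fun x hx => hreg x (by simpa using hx)
  rw [extZ_iff] at h ⊢
  have hsurj : ∀ x : Abelian.Ext (ModuleCat.of R L) (ModuleCat.of R N) n, ∃ z, y • z = x := by
    intro x
    obtain ⟨z, rfl⟩ := Abelian.Ext.contravariant_sequence_exact₁ (shortExact hinj hex hg) _ x
      (add_comm 1 n) (h _)
    refine ⟨z, ?_⟩
    have : ModuleCat.ofHom (y • LinearMap.id : L →ₗ[R] L) = y • 𝟙 (ModuleCat.of R L) := rfl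
    change _ = (Abelian.Ext.mk₀ (ModuleCat.ofHom (y • LinearMap.id : L →ₗ[R] L))).comp z _
    rw [this, Abelian.Ext.mk₀_smul, Abelian.Ext.smul_comp, Abelian.Ext.mk₀_id_comp]
  have htop : (⊤ : Submodule R (Abelian.Ext (ModuleCat.of R L) (ModuleCat.of R N) n)) = ⊥ := by
    refine Submodule.eq_bot_of_le_smul_of_le_jacobson_bot (IsLocalRing.maximalIdeal R) _
      (Module.finite_def.1 inferInstance) (fun x _ => ?_)
      (IsLocalRing.maximalIdeal_le_jacobson _)
    obtain ⟨z, rfl⟩ := hsurj x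
    exact Submodule.smul_mem_smul hy trivial
  exact fun x => (Submodule.mem_bot R).1 (htop ▸ Submodule.mem_top)

end Linear

lemma extGrp_iff {B : Type u} [Ring B] {n : ℕ} (hn : 0 < n) (X Y : ModuleCat.{u} B) :
    Subsingleton (extGrp B n X Y) ↔ ExtZ B n X Y := by
  obtain ⟨n, rfl⟩ := Nat.exists_eq_succ_of_ne_zero hn.ne'
  let P := projectiveResolution X
  have key : Subsingleton (extGrp B (n + 1) X Y) ↔ ∀ f : P.complex.X (n + 1) ⟶ Y,
      P.complex.d (n + 2) (n + 1) ≫ f = 0 →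
        ∃ g : P.complex.X n ⟶ Y, P.complex.d (n + 1) n ≫ g = f := by
    have e := P.isoExt (R := ℤ) (n + 1) Y
    rw [← ModuleCat.isZero_iff_subsingleton, e.isZero_iff,
      ← HomologicalComplex.exactAt_iff_isZero_homology,
      HomologicalComplex.exactAt_iff' _ n (n + 1) (n + 2) (by simp) (by simp),
      ShortComplex.moduleCat_exact_iff]
    rfl
  rw [key, ExtZ]
  constructor
  · intro h
    refine extZ_iff.2 fun x => ?_
    obtain ⟨f, hf, rfl⟩ := P.extMk_surjective x (n + 2) rfl
    exact (P.extMk_eq_zero_iff f (n + 2) rfl hf n rfl).2 (h f hf)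
  · intro h f hf
    exact (P.extMk_eq_zero_iff f (n + 2) rfl hf n rfl).1 (h.elim _ _)

section KrullSchmidt

/-- Induction over direct sum decompositions of a noetherian module. -/
theorem decomposition_induction {Λ : Type u} [Ring Λ]
    (Pr : ∀ (M : Type w) [AddCommGroup M] [Module Λ M], Prop)
    (hiso : ∀ (M N : Type w) [AddCommGroup M] [Module Λ M] [AddCommGroup N] [Module Λ N],
      (M ≃ₗ[Λ] N) → Pr M → Pr N)
    (hsub : ∀ (M : Type w) [AddCommGroup M] [Module Λ M], Subsingleton M → Pr M)
    (hind : ∀ (M : Type w) [AddCommGroup M] [Module Λ M] [IsNoetherian Λ M],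
      IsIndecomposableModule Λ M → Pr M)
    (hprod : ∀ (M N : Type w) [AddCommGroup M] [Module Λ M] [AddCommGroup N] [Module Λ N],
      Pr M → Pr N → Pr (M × N))
    (M : Type w) [AddCommGroup M] [Module Λ M] [IsNoetherian Λ M] : Pr M := by
  have key : ∀ P Q : Submodule Λ M, IsCompl P Q → Pr Q := by
    intro P
    induction P using (wellFounded_gt (α := Submodule Λ M)).induction with
    | _ P ih =>
    intro Q hPQ
    by_cases hQ : Subsingleton Q
    · exact hsub _ hQ
    by_cases hi : IsIndecomposableModule Λ Q
    · exact hind _ hi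
    rw [IsIndecomposableModule, not_and] at hi
    have hi := hi (not_subsingleton_iff_nontrivial.1 hQ)
    push Not at hi
    obtain ⟨Q₁, Q₂, hc, h₁, h₂⟩ := hi
    have aux : ∀ Q₁ Q₂ : Submodule Λ Q, IsCompl Q₁ Q₂ → Q₁ ≠ ⊥ → Pr Q₂ := by
      intro Q₁ Q₂ hc h₁
      have e₁ : IsCompl (P ⊔ Q₁.map Q.subtype) (Q₂.map Q.subtype) := by
        constructor
        · rw [Submodule.disjoint_def]
          rintro x hx ⟨q₂, hq₂, rfl⟩
          obtain ⟨p, hp, _, ⟨q₁, hq₁, rfl⟩, he⟩ := Submodule.mem_sup.1 hx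
          have hp0 : p = 0 := by
            refine (Submodule.disjoint_def.1 hPQ.disjoint) p hp ?_
            have : p = Q.subtype (q₂ - q₁) := by rw [map_sub, ← he]; abel
            rw [this]; exact (q₂ - q₁).2
          rw [hp0, zero_add] at he
          have : q₁ = q₂ := Subtype.ext he
          subst this
          rw [(Submodule.disjoint_def.1 hc.disjoint) q₁ hq₁ hq₂, map_zero]
        · rw [codisjoint_iff, sup_assoc, ← Submodule.map_sup, hc.sup_eq_top, Submodule.map_top,
            Submodule.range_subtype, hPQ.sup_eq_top]
      have lt : P < P ⊔ Q₁.map Q.subtype := by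
        refine lt_of_le_of_ne le_sup_left fun h => h₁ ?_
        rw [eq_comm, sup_eq_left] at h
        rw [eq_bot_iff]
        intro x hx
        have := (Submodule.disjoint_def.1 hPQ.disjoint) x.1 (h ⟨x, hx, rfl⟩) x.2
        exact (Submodule.mem_bot _).2 (Subtype.ext this)
      exact hiso _ _ (Submodule.equivMapOfInjective _ Q.injective_subtype Q₂).symm (ih _ lt _ e₁)
    exact hiso _ _ (Submodule.prodEquivOfIsCompl _ _ hc)
      (hprod _ _ (aux _ _ hc.symm h₂) (aux _ _ hc h₁))
  exact hiso _ _ Submodule.topEquiv (key ⊥ ⊤ isCompl_bot_top)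

end KrullSchmidt

section LocalEnd

variable {R : Type u} [CommRing R]

/-- A finite module over a complete noetherian local ring is adically complete. -/
theorem isAdicComplete_of_finite [IsNoetherianRing R] [IsLocalRing R]
    [IsAdicComplete (IsLocalRing.maximalIdeal R) R] (M : Type w) [AddCommGroup M] [Module R M]
    [Module.Finite R M] : IsAdicComplete (IsLocalRing.maximalIdeal R) M := by
  have : IsPrecomplete (IsLocalRing.maximalIdeal R) M := by
    rw [← AdicCompletion.of_surjective_iff]
    intro y
    obtain ⟨t, rfl⟩ := AdicCompletion.ofTensorProduct_surjective_of_finite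
      (IsLocalRing.maximalIdeal R) M y
    induction t using TensorProduct.induction_on with
    | zero => exact ⟨0, by simp⟩
    | tmul r m =>
      obtain ⟨r, rfl⟩ := AdicCompletion.of_surjective (IsLocalRing.maximalIdeal R) R r
      refine ⟨r • m, ?_⟩
      rw [AdicCompletion.ofTensorProduct_tmul]
      ext n
      rfl
    | add a b ha hb =>
      obtain ⟨x, hx⟩ := ha
      obtain ⟨z, hz⟩ := hb
      exact ⟨x + z, by rw [map_add, map_add, hx, hz]⟩
  exact {}

variable {Λ : Type u} [Ring Λ] [Algebra R Λ]

theorem finite_hom [IsNoetherianRing R] (M : Type w₁) (N : Type w₂) [AddCommGroup M] [Module Λ M]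
    [AddCommGroup N] [Module Λ N] [Module R N] [IsScalarTower R Λ N] [Module.Finite Λ M]
    [Module.Finite R N] : Module.Finite R (M →ₗ[Λ] N) := by
  obtain ⟨n, p, hp⟩ := Module.Finite.exists_fin' Λ M
  let ev : (M →ₗ[Λ] N) →ₗ[R] (Fin n → N) :=
    { toFun := fun f i => f (p (Pi.single i 1))
      map_add' := fun f g => rfl
      map_smul' := fun r f => rfl }
  refine Module.Finite.of_injective ev fun f g h => ?_
  have : f ∘ₗ p = g ∘ₗ p := LinearMap.pi_ext' fun i => LinearMap.ext_ring (congrFun h i)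
  ext x
  obtain ⟨y, rfl⟩ := hp x
  exact LinearMap.congr_fun this y

theorem exists_idempotent_of_mem {S : Type w} [CommRing S] (I : Ideal S) [HenselianRing S I]
    (e : S) (he : e * e - e ∈ I) : ∃ e' : S, e' * e' = e' ∧ e' - e ∈ I := by
  have hu : IsUnit (Ideal.Quotient.mk I (2 * e - 1)) := by
    refine .of_mul_eq_one (Ideal.Quotient.mk I (2 * e - 1)) ?_
    rw [← map_mul, ← map_one (Ideal.Quotient.mk I), Ideal.Quotient.eq]
    convert I.mul_mem_left 4 he using 1
    ring
  have hm : (Polynomial.X ^ 2 - Polynomial.X : Polynomial S).Monic := by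
    have := Polynomial.monic_X_pow_sub (R := S) (p := Polynomial.X) (n := 2)
    refine this ?_
    exact Polynomial.degree_X_le.trans_lt (by norm_num)
  obtain ⟨e', h, h'⟩ := HenselianRing.is_henselian (I := I)
    (Polynomial.X ^ 2 - Polynomial.X : Polynomial S) hm e
    (by simpa [sq] using he) (by convert hu using 2; simp [two_mul, one_add_one_eq_two])
  refine ⟨e', ?_, h'⟩
  have := h.eq_zero
  simp at this
  linear_combination this

/-- Surjective endomorphisms of noetherian modules are units. -/
theorem isUnit_of_surjective {M : Type w} [AddCommGroup M] [Module Λ M] [IsNoetherian Λ M]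
    (f : Module.End Λ M) (hf : Function.Surjective f) : IsUnit f :=
  (Module.End.isUnit_iff f).2 (IsNoetherian.bijective_of_surjective_endomorphism f hf)

theorem isUnit_of_mul_left {M : Type w} [AddCommGroup M] [Module Λ M] [IsNoetherian Λ M]
    {f g : Module.End Λ M} (h : IsUnit (f * g)) : IsUnit f ∧ IsUnit g := by
  have hf : IsUnit f := isUnit_of_surjective f
    (Function.Surjective.of_comp ((Module.End.isUnit_iff _).1 h).2)
  refine ⟨hf, ?_⟩
  obtain ⟨u, rfl⟩ := hf
  simpa using h

variable [IsLocalRing R]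

/-- An endomorphism which is onto modulo the maximal ideal is invertible. -/
theorem isUnit_of_sub_mem {M : Type w} [AddCommGroup M] [Module Λ M] [IsNoetherian Λ M]
    [Module R M] [IsScalarTower R Λ M] [Module.Finite R M]
    (f : Module.End Λ M) (h : ∀ x, x - f x ∈ IsLocalRing.maximalIdeal R • (⊤ : Submodule R M)) :
    IsUnit f := by
  apply isUnit_of_surjective
  have : (⊤ : Submodule R M) ≤ LinearMap.range (f.restrictScalars R) := by
    refine Submodule.le_of_le_smul_of_le_jacobson_bot (Module.Finite.fg_top)
      (IsLocalRing.maximalIdeal_le_jacobson ⊥) (fun x _ => ?_)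
    rw [← sub_add_cancel x (f x)]
    exact add_mem (Submodule.mem_sup_right (h x)) (Submodule.mem_sup_left ⟨x, rfl⟩)
  intro x
  exact this (Submodule.mem_top (x := x))

variable [IsNoetherianRing R] [IsAdicComplete (IsLocalRing.maximalIdeal R) R]

omit [IsNoetherianRing R] [IsAdicComplete (IsLocalRing.maximalIdeal R) R] in
theorem isArtinianRing_quotient_map (S : Type w) [CommRing S] [Algebra R S] [Module.Finite R S] :
    IsArtinianRing (S ⧸ (IsLocalRing.maximalIdeal R).map (algebraMap R S)) := by
  set 𝔪 := IsLocalRing.maximalIdeal R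
  set I : Ideal S := 𝔪.map (algebraMap R S)
  let _ : Field (R ⧸ 𝔪) := Ideal.Quotient.field 𝔪
  have : Module.Finite (R ⧸ 𝔪) (S ⧸ I) := Module.Finite.of_restrictScalars_finite R _ _
  have : IsArtinianRing (R ⧸ 𝔪) := inferInstance
  exact IsArtinianRing.of_finite (R ⧸ 𝔪) (S ⧸ I)

theorem exists_fitting_idempotent (S : Type w) [CommRing S] [Algebra R S] [Module.Finite R S]
    (x : S) : ∃ (k : ℕ) (y e : S), k ≠ 0 ∧ e * e = e ∧
      x ^ k * (1 - x ^ k * y) ∈ (IsLocalRing.maximalIdeal R).map (algebraMap R S) ∧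
      e - x ^ k * y ∈ (IsLocalRing.maximalIdeal R).map (algebraMap R S) := by
  set I : Ideal S := (IsLocalRing.maximalIdeal R).map (algebraMap R S)
  have : IsAdicComplete I S :=
    (IsAdicComplete.map_algebraMap_iff _ _).2 (isAdicComplete_of_finite S)
  have : HenselianRing S I := inferInstance
  have : IsArtinianRing (S ⧸ I) := isArtinianRing_quotient_map S
  obtain ⟨k, y, hk⟩ : ∃ (k : ℕ) (y : S), x ^ (k + 1) * (1 - x ^ (k + 1) * y) ∈ I := by
    obtain ⟨k, y, hy⟩ := IsArtinian.exists_pow_succ_smul_dvd (R := S ⧸ I)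
      (Ideal.Quotient.mk I x) (1 : S ⧸ I)
    obtain ⟨y, rfl⟩ := Ideal.Quotient.mk_surjective y
    simp only [smul_eq_mul, mul_one] at hy
    have key : ∀ j : ℕ, (Ideal.Quotient.mk I x) ^ (k + j) * (Ideal.Quotient.mk I y) ^ j =
        (Ideal.Quotient.mk I x) ^ k := by
      intro j
      induction j with
      | zero => simp
      | succ j ih =>
        calc _ = (Ideal.Quotient.mk I x ^ k.succ * Ideal.Quotient.mk I y) *
              ((Ideal.Quotient.mk I x) ^ j * (Ideal.Quotient.mk I y) ^ j) := by
                rw [Nat.succ_eq_add_one]; ring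
          _ = _ := by rw [hy, ← mul_assoc, ← pow_add, ih]
    refine ⟨k, y ^ (k + 1), ?_⟩
    rw [← Ideal.Quotient.eq_zero_iff_mem]
    simp only [map_mul, map_sub, map_pow, map_one]
    linear_combination -(Ideal.Quotient.mk I x) * key (k + 1)
  obtain ⟨e, he, hee⟩ := exists_idempotent_of_mem I (x ^ (k + 1) * y) (by
    convert I.mul_mem_right (-y) hk using 1; ring)
  exact ⟨k + 1, y, e, k.succ_ne_zero, he, hk, hee⟩

omit [IsNoetherianRing R] [IsLocalRing R] [IsAdicComplete (IsLocalRing.maximalIdeal R) R] in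
theorem exists_commutative_model {E : Type w} [Ring E] [Algebra R E] [Module.Finite R E] (a : E) :
    ∃ (S : Type u) (_ : CommRing S) (_ : Algebra R S) (_ : Module.Finite R S)
      (θ : S →ₐ[R] E) (x : S), θ x = a := by
  obtain ⟨p, hp, hpa⟩ := IsIntegral.of_finite R a
  refine ⟨Polynomial R ⧸ Ideal.span {p}, inferInstance, inferInstance, hp.finite_quotient,
    Ideal.Quotient.liftₐ _ (Polynomial.aeval a) ?_, Ideal.Quotient.mk _ Polynomial.X, ?_⟩
  · intro q hq
    obtain ⟨c, rfl⟩ := Ideal.mem_span_singleton'.1 hq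
    rw [map_mul, show Polynomial.aeval a p = 0 from hpa, mul_zero]
  · exact (Ideal.Quotient.lift_mk _ _ _).trans (Polynomial.aeval_X a)

theorem isUnit_or_isUnit_one_sub {M : Type w} [AddCommGroup M] [Module Λ M] [Module.Finite Λ M]
    [Module R M] [IsScalarTower R Λ M] [Module.Finite R Λ]
    (hM : IsIndecomposableModule Λ M) (a : Module.End Λ M) : IsUnit a ∨ IsUnit (1 - a) := by
  set 𝔪 := IsLocalRing.maximalIdeal R with h𝔪
  have : Module.Finite R M := Module.Finite.trans Λ M
  have : IsNoetherian Λ M := isNoetherian_of_tower R inferInstance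
  have : Module.Finite R (Module.End Λ M) := finite_hom M M
  obtain ⟨S, _, _, _, θ, x, hx⟩ := exists_commutative_model (R := R) a
  have hI : ∀ s ∈ 𝔪.map (algebraMap R S), ∀ m, θ s m ∈ 𝔪 • (⊤ : Submodule R M) := by
    intro s hs
    induction hs using Submodule.span_induction with
    | mem s hs =>
      obtain ⟨r, hr, rfl⟩ := hs
      intro m
      rw [AlgHom.commutes]
      exact Submodule.smul_mem_smul hr Submodule.mem_top
    | zero => simp
    | add s t _ _ hs ht => intro m; rw [map_add]; exact add_mem (hs m) (ht m)
    | smul c s _ hs =>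
      intro m
      rw [smul_eq_mul, mul_comm, map_mul]
      exact hs _
  obtain ⟨k, y, e, hk0, he, hk, hee⟩ := exists_fitting_idempotent (R := R) S x
  have hε : θ e * θ e = θ e := by rw [← map_mul, he]
  have hε' : ∀ z, z - θ e z ∈ LinearMap.ker (θ e) := fun z => by
    rw [LinearMap.mem_ker, map_sub, sub_eq_zero]
    exact (LinearMap.congr_fun hε z).symm
  have hc : IsCompl (LinearMap.ker (θ e)) (LinearMap.range (θ e)) := by
    constructor
    · rw [Submodule.disjoint_def]
      rintro _ h ⟨z, rfl⟩
      exact (LinearMap.congr_fun hε z).symm.trans h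
    · rw [codisjoint_iff, eq_top_iff]
      exact fun z _ => Submodule.mem_sup.2 ⟨z - θ e z, hε' z, θ e z, ⟨z, rfl⟩, by simp⟩
  rcases hM.2 _ _ hc with h | h
  · left
    have hu : IsUnit (θ (x ^ k * y)) := by
      refine isUnit_of_sub_mem (R := R) _ fun m => ?_
      have h1 := hI _ hee m
      rw [map_sub, LinearMap.sub_apply] at h1
      have h2 := hε' m
      rw [h, Submodule.mem_bot, sub_eq_zero] at h2
      rwa [← h2] at h1
    rw [map_mul, map_pow, hx] at hu
    exact (isUnit_pow_iff hk0).1 (isUnit_of_mul_left hu).1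
  · right
    have he0 : θ e = 0 := LinearMap.range_eq_bot.1 h
    have hu : IsUnit (1 - a ^ k) := by
      refine isUnit_of_sub_mem (R := R) _ fun m => ?_
      have h1 := hI (x ^ k - x ^ k * e) (by
        convert sub_mem hk (Ideal.mul_mem_left _ (x ^ k) hee) using 1; ring) m
      rw [map_sub, map_mul, he0, mul_zero, sub_zero, map_pow, hx] at h1
      simpa using h1
    rw [← mul_neg_geom_sum] at hu
    exact (isUnit_of_mul_left hu).1

end LocalEnd

section Exchange

variable {Λ : Type u} [Ring Λ] {M : Type w} [AddCommGroup M] [Module Λ M]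

theorem isCompl_of_forall {P Q : Submodule Λ M} (h : ∀ x ∈ P, x ∈ Q → x = 0)
    (h' : ∀ m, ∃ p ∈ P, ∃ q ∈ Q, m = p + q) : IsCompl P Q := by
  refine ⟨Submodule.disjoint_def.2 h, codisjoint_iff.2 (eq_top_iff.2 fun m _ => ?_)⟩
  obtain ⟨p, hp, q, hq, rfl⟩ := h' m
  exact add_mem (Submodule.mem_sup_left hp) (Submodule.mem_sup_right hq)

theorem exists_add_of_isCompl {P Q : Submodule Λ M} (h : IsCompl P Q) (m : M) :
    ∃ p ∈ P, ∃ q ∈ Q, m = p + q := by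
  obtain ⟨p, hp, q, hq, e⟩ := Submodule.mem_sup.1 (h.sup_eq_top ▸ Submodule.mem_top (x := m))
  exact ⟨p, hp, q, hq, e.symm⟩

theorem eq_zero_of_isCompl {P Q : Submodule Λ M} (h : IsCompl P Q) {x : M} (hp : x ∈ P)
    (hq : x ∈ Q) : x = 0 := Submodule.disjoint_def.1 h.disjoint x hp hq

/-- The exchange property for two-term decompositions, in a fixed universe. -/
def Exchange (Λ : Type u) [Ring Λ] (L : Type w) [AddCommGroup L] [Module Λ L] : Prop :=
  ∀ (M : Type w) [AddCommGroup M] [Module Λ M] (N C X Z : Submodule Λ M),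
    Nonempty (L ≃ₗ[Λ] N) → IsCompl N C → IsCompl X Z →
    ∃ X' ≤ X, ∃ Z' ≤ Z, IsCompl N (X' ⊔ Z')

theorem exchange_aux {N C X Z : Submodule Λ M} (hN : IsCompl N C) (hX : IsCompl X Z)
    (hu : IsUnit ((Submodule.projectionOnto N C hN ∘ₗ Submodule.projection X Z hX) ∘ₗ N.subtype :
      Module.End Λ N)) : IsCompl N (X ⊓ C ⊔ Z) := by
  obtain ⟨hinj, hsurj⟩ := (Module.End.isUnit_iff _).1 hu
  refine isCompl_of_forall (fun x hx hx' => ?_) fun m => ?_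
  · obtain ⟨x', ⟨hx1, hx2⟩, z, hz, rfl⟩ := Submodule.mem_sup.1 hx'
    have : (⟨x' + z, hx⟩ : N) = 0 := by
      apply hinj
      simp only [LinearMap.comp_apply, Submodule.subtype_apply, map_add, map_zero]
      rw [Submodule.projection_apply_of_mem_left hX hx1,
        (Submodule.projection_apply_eq_zero_iff hX).2 hz, map_zero, add_zero,
        (Submodule.projectionOnto_apply_eq_zero_iff hN).2 hx2]
    exact congrArg Subtype.val this
  · obtain ⟨x, hx, z, hz, rfl⟩ := exists_add_of_isCompl hX m
    obtain ⟨n, hn⟩ := hsurj (Submodule.projectionOnto N C hN x)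
    have h1 : x - Submodule.projection X Z hX n ∈ X ⊓ C := by
      refine ⟨sub_mem hx (Submodule.projection_apply_mem _ _), ?_⟩
      rw [SetLike.mem_coe, ← Submodule.projectionOnto_apply_eq_zero_iff hN, map_sub, ← hn]
      simp
    have h2 : (n : M) - Submodule.projection X Z hX n ∈ Z := Submodule.sub_projection_mem _ _
    refine ⟨n, n.2, (x - Submodule.projection X Z hX n) +
      (z - (n - Submodule.projection X Z hX n)), Submodule.add_mem_sup h1 (sub_mem hz h2), ?_⟩
    abel

theorem Exchange.of_local {L : Type w} [AddCommGroup L] [Module Λ L]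
    (h : ∀ a : Module.End Λ L, IsUnit a ∨ IsUnit (1 - a)) : Exchange Λ L := by
  rintro M _ _ N C X Z ⟨e⟩ hN hX
  have h' : ∀ a : Module.End Λ N, IsUnit a ∨ IsUnit (1 - a) := by
    intro a
    have := h (e.symm.conjRingEquiv a)
    rwa [← map_one e.symm.conjRingEquiv, ← map_sub, MulEquiv.isUnit_map, MulEquiv.isUnit_map]
      at this
  rcases h' ((Submodule.projectionOnto N C hN ∘ₗ Submodule.projection X Z hX) ∘ₗ N.subtype)
    with hu | hu
  · exact ⟨_, inf_le_left, Z, le_rfl, exchange_aux hN hX hu⟩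
  · refine ⟨X, le_rfl, Z ⊓ C, inf_le_left, ?_⟩
    rw [sup_comm]
    refine exchange_aux hN hX.symm ?_
    convert hu using 1
    ext n
    have := Submodule.projection_add_projection_eq_self hX (n : M)
    simp only [LinearMap.comp_apply, Submodule.subtype_apply, LinearMap.sub_apply,
      Module.End.one_apply, AddSubgroupClass.coe_sub]
    rw [← eq_sub_iff_add_eq'] at this
    rw [this, map_sub, AddSubgroupClass.coe_sub, Submodule.projectionOnto_apply_left]

theorem Exchange.prod {L₁ L₂ : Type w} [AddCommGroup L₁] [Module Λ L₁] [AddCommGroup L₂]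
    [Module Λ L₂] (h₁ : Exchange Λ L₁) (h₂ : Exchange Λ L₂) : Exchange Λ (L₁ × L₂) := by
  rintro M _ _ N C X Z ⟨e⟩ hN hX
  let j₁ : L₁ →ₗ[Λ] M := N.subtype ∘ₗ e.toLinearMap ∘ₗ LinearMap.inl Λ L₁ L₂
  let j₂ : L₂ →ₗ[Λ] M := N.subtype ∘ₗ e.toLinearMap ∘ₗ LinearMap.inr Λ L₁ L₂
  have hj : ∀ a b, j₁ a + j₂ b = (e (a, b) : M) := fun a b => by
    simp only [j₁, j₂, LinearMap.comp_apply, Submodule.subtype_apply, LinearEquiv.coe_coe]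
    rw [← Submodule.coe_add, ← map_add]; simp
  have hjN : ∀ n ∈ N, ∃ a b, n = j₁ a + j₂ b := fun n hn => by
    refine ⟨(e.symm ⟨n, hn⟩).1, (e.symm ⟨n, hn⟩).2, ?_⟩
    rw [hj]; simp
  have hN' : ∀ a b, j₁ a + j₂ b ∈ N := fun a b => by rw [hj]; exact (e _).2
  have h0 : ∀ a b, j₁ a + j₂ b = 0 → a = 0 ∧ b = 0 := fun a b h => by
    rw [hj] at h
    have : e (a, b) = 0 := Subtype.ext h
    simpa using this
  have i₁ : Function.Injective j₁ := (injective_iff_map_eq_zero _).2 fun a ha =>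
    (h0 a 0 (by simp [ha])).1
  have i₂ : Function.Injective j₂ := (injective_iff_map_eq_zero _).2 fun a ha =>
    (h0 0 a (by simp [ha])).2
  have c₁ : IsCompl (LinearMap.range j₁) (LinearMap.range j₂ ⊔ C) := by
    refine isCompl_of_forall ?_ fun m => ?_
    · rintro _ ⟨a, rfl⟩ h
      obtain ⟨_, ⟨b, rfl⟩, c, hc, e⟩ := Submodule.mem_sup.1 h
      have hc0 : c = 0 := eq_zero_of_isCompl hN (by
        have := hN' a (-b)
        rw [← e, map_neg] at this
        simpa using this) hc
      rw [hc0, add_zero, ← sub_eq_zero, ← neg_eq_zero] at e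
      rw [(h0 a (-b) (by rw [← e, map_neg]; abel)).1, map_zero]
    · obtain ⟨n, hn, c, hc, rfl⟩ := exists_add_of_isCompl hN m
      obtain ⟨a, b, rfl⟩ := hjN n hn
      exact ⟨j₁ a, ⟨a, rfl⟩, j₂ b + c, Submodule.add_mem_sup ⟨b, rfl⟩ hc, add_assoc _ _ _⟩
  obtain ⟨X₁, hX₁, Z₁, hZ₁, c₂⟩ := h₁ M _ _ X Z ⟨LinearEquiv.ofInjective j₁ i₁⟩ c₁ hX
  -- pass to the quotient by the first summand
  let π := (LinearMap.range j₁).mkQ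
  have hπ0 : ∀ m, π m = 0 → ∃ a, m = j₁ a := fun m hm => by
    obtain ⟨a, ha⟩ := (Submodule.Quotient.mk_eq_zero _).1 hm
    exact ⟨a, ha.symm⟩
  have hπ1 : ∀ a, π (j₁ a) = 0 := fun a => (Submodule.Quotient.mk_eq_zero _).2 ⟨a, rfl⟩
  have c₃ : IsCompl (LinearMap.range (π ∘ₗ j₂)) (C.map π) := by
    refine isCompl_of_forall ?_ fun m => ?_
    · rintro _ ⟨b, rfl⟩ ⟨c, hc, e⟩
      obtain ⟨a, ha⟩ := hπ0 (c - j₂ b) (by rw [map_sub, e]; exact sub_self _)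
      rw [sub_eq_iff_eq_add] at ha
      have hc0 : c = 0 := eq_zero_of_isCompl hN (ha ▸ hN' a b) hc
      rw [← e, hc0, map_zero]
    · obtain ⟨m, rfl⟩ := Submodule.mkQ_surjective _ m
      obtain ⟨n, hn, c, hc, rfl⟩ := exists_add_of_isCompl hN m
      obtain ⟨a, b, rfl⟩ := hjN n hn
      refine ⟨π (j₂ b), ⟨b, rfl⟩, π c, ⟨c, hc, rfl⟩, ?_⟩
      rw [map_add, map_add]
      erw [hπ1]
      rw [zero_add]
  have c₄ : IsCompl (X₁.map π) (Z₁.map π) := by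
    refine isCompl_of_forall ?_ fun m => ?_
    · rintro _ ⟨x, hx, rfl⟩ ⟨z, hz, e⟩
      obtain ⟨a, ha⟩ := hπ0 (x - z) (by rw [map_sub, e]; exact sub_self _)
      have := eq_zero_of_isCompl c₂ (x := x - z) (ha ▸ ⟨a, rfl⟩)
        (sub_mem (Submodule.mem_sup_left hx) (Submodule.mem_sup_right hz))
      rw [sub_eq_zero] at this
      rw [eq_zero_of_isCompl hX (hX₁ hx) (hZ₁ (this ▸ hz)), map_zero]
    · obtain ⟨m, rfl⟩ := Submodule.mkQ_surjective _ m
      obtain ⟨_, ⟨a, rfl⟩, y, hy, rfl⟩ := exists_add_of_isCompl c₂ m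
      obtain ⟨x, hx, z, hz, rfl⟩ := Submodule.mem_sup.1 hy
      refine ⟨π x, ⟨x, hx, rfl⟩, π z, ⟨z, hz, rfl⟩, ?_⟩
      rw [map_add, map_add]
      erw [hπ1]
      rw [zero_add]
  have i₃ : Function.Injective (π ∘ₗ j₂) := (injective_iff_map_eq_zero _).2 fun b hb => by
    obtain ⟨a, ha⟩ := hπ0 _ hb
    exact (h0 (-a) b (by rw [ha, map_neg, neg_add_cancel])).2
  obtain ⟨X₂, hX₂, Z₂, hZ₂, c₅⟩ := h₂ _ _ _ _ _ ⟨LinearEquiv.ofInjective _ i₃⟩ c₃ c₄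
  refine ⟨X₁ ⊓ X₂.comap π, inf_le_left.trans hX₁, Z₁ ⊓ Z₂.comap π, inf_le_left.trans hZ₁, ?_⟩
  refine isCompl_of_forall ?_ fun m => ?_
  · intro n hn h
    obtain ⟨x, ⟨hx1, hx2⟩, z, ⟨hz1, hz2⟩, rfl⟩ := Submodule.mem_sup.1 h
    obtain ⟨a, b, hab⟩ := hjN _ hn
    have hp : π (x + z) = π (j₂ b) := by
      rw [hab, map_add]; erw [hπ1]; rw [zero_add]
    have h1 : π (x + z) = 0 := eq_zero_of_isCompl c₅ (hp ▸ ⟨b, rfl⟩)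
      (by rw [map_add]; exact Submodule.add_mem_sup hx2 hz2)
    obtain ⟨a', ha'⟩ := hπ0 _ h1
    exact eq_zero_of_isCompl c₂ (ha' ▸ ⟨a', rfl⟩) (Submodule.add_mem_sup hx1 hz1)
  · obtain ⟨_, ⟨b, rfl⟩, y, hy, e⟩ := exists_add_of_isCompl c₅ (π m)
    obtain ⟨x, hx, z, hz, rfl⟩ := Submodule.mem_sup.1 hy
    obtain ⟨x, hx', rfl⟩ := hX₂ hx
    obtain ⟨z, hz', rfl⟩ := hZ₂ hz
    obtain ⟨a, ha⟩ := hπ0 (m - (j₂ b + (x + z))) (by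
      rw [map_sub, e, map_add, map_add]; exact sub_self _)
    refine ⟨j₁ a + j₂ b, hN' a b, x + z, Submodule.add_mem_sup ⟨hx', hx⟩ ⟨hz', hz⟩, ?_⟩
    rw [← ha]; abel

theorem Exchange.congr {L L' : Type w} [AddCommGroup L] [Module Λ L] [AddCommGroup L']
    [Module Λ L'] (e : L ≃ₗ[Λ] L') (h : Exchange Λ L) : Exchange Λ L' :=
  fun M _ _ N C X Z ⟨e'⟩ => h M N C X Z ⟨e.trans e'⟩

theorem Exchange.of_subsingleton {L : Type w} [AddCommGroup L] [Module Λ L] [Subsingleton L] :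
    Exchange Λ L := by
  rintro M _ _ N C X Z ⟨e⟩ hN hX
  have : Subsingleton N := e.symm.toEquiv.subsingleton
  rw [Submodule.subsingleton_iff_eq_bot] at this
  subst this
  refine ⟨X, le_rfl, Z, le_rfl, ?_⟩
  rw [hX.sup_eq_top]; exact isCompl_bot_top

end Exchange

section KaplanskyWarfield

variable {Λ : Type u} [Ring Λ] {M : Type w} [AddCommGroup M] [Module Λ M]

/-- The submodule `X` is an internal direct sum of finitely generated submodules. -/
def IsFGSum (X : Submodule Λ M) : Prop :=
  ∃ 𝒴 : Set (Submodule Λ M), (∀ Y ∈ 𝒴, Y.FG) ∧ sSupIndep 𝒴 ∧ sSup 𝒴 = X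

theorem sSupIndep_union {s t : Set (Submodule Λ M)} (hs : sSupIndep s) (ht : sSupIndep t)
    (h : Disjoint (sSup s) (sSup t)) : sSupIndep (s ∪ t) := by
  have aux : ∀ s t : Set (Submodule Λ M), sSupIndep s → Disjoint (sSup s) (sSup t) →
      ∀ Y ∈ s, Disjoint Y (sSup ((s ∪ t) \ {Y})) := by
    intro s t hs h Y hY
    rw [Submodule.disjoint_def]
    intro x hx hx'
    have : sSup ((s ∪ t) \ {Y}) ≤ sSup (s \ {Y}) ⊔ sSup t := by
      rw [← sSup_union]
      exact sSup_le_sSup fun Z hZ => hZ.1.imp (fun h => ⟨h, hZ.2⟩) id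
    obtain ⟨a, ha, b, hb, e⟩ := Submodule.mem_sup.1 (this hx')
    have hb0 : b = 0 := by
      refine Submodule.disjoint_def.1 h b ?_ hb
      rw [eq_sub_of_add_eq' e]
      exact sub_mem (le_sSup hY hx) ((sSup_le_sSup Set.sdiff_subset : sSup (s \ {Y}) ≤ sSup s) ha)
    rw [hb0, add_zero] at e
    exact Submodule.disjoint_def.1 (hs hY) x hx (e ▸ ha)
  rintro Y (hY | hY)
  · exact aux s t hs h Y hY
  · rw [Set.union_comm]; exact aux t s ht h.symm Y hY

theorem exists_fg_summand [IsNoetherianRing Λ]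
    (hE : ∀ (L : Type w) [AddCommGroup L] [Module Λ L], Module.Finite Λ L → Exchange Λ L)
    (hS : ∀ x : M, ∃ N C : Submodule Λ M, N.FG ∧ x ∈ N ∧ IsCompl N C)
    {X Z : Submodule Λ M} (hX : IsCompl X Z) {x : M} (hx : x ∈ X) :
    ∃ Y X' : Submodule Λ M, Y.FG ∧ x ∈ Y ∧ Disjoint Y X' ∧ Y ⊔ X' = X := by
  obtain ⟨N, C, hNfg, hxN, hN⟩ := hS x
  have hNf : Module.Finite Λ N := Module.Finite.iff_fg.2 hNfg
  obtain ⟨X', hX', Z', hZ', hc⟩ := hE N hNf M N C X Z ⟨LinearEquiv.refl _ _⟩ hN hX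
  have hd : ∀ y, y ∈ X → y ∈ N ⊔ Z' → y ∈ X' → y = 0 := by
    intro y hyX hy hyX'
    obtain ⟨n, hn, z, hz, rfl⟩ := Submodule.mem_sup.1 hy
    have hn0 : n = 0 := eq_zero_of_isCompl hc hn (by
      rw [eq_sub_of_add_eq (rfl : n + z = n + z)]
      exact sub_mem (Submodule.mem_sup_left hyX') (Submodule.mem_sup_right hz))
    subst hn0
    rw [zero_add] at *
    exact eq_zero_of_isCompl hX hyX (hZ' hz)
  refine ⟨X ⊓ (N ⊔ Z'), X', ?_, ⟨hx, Submodule.mem_sup_left hxN⟩, ?_, ?_⟩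
  · rw [← Module.Finite.iff_fg]
    refine Module.Finite.of_injective
      ((Submodule.projectionOnto N _ hc) ∘ₗ (X ⊓ (N ⊔ Z')).subtype)
      ((injective_iff_map_eq_zero _).2 ?_)
    rintro ⟨y, hy⟩ h
    replace h : y ∈ X' ⊔ Z' := (Submodule.projectionOnto_apply_eq_zero_iff hc).1 h
    obtain ⟨x', hx', z', hz', rfl⟩ := Submodule.mem_sup.1 h
    have : z' = 0 := eq_zero_of_isCompl hX (by
      rw [eq_sub_of_add_eq' (rfl : x' + z' = x' + z')]
      exact sub_mem hy.1 (hX' hx')) (hZ' hz')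
    subst this
    rw [add_zero] at hy
    refine Subtype.ext ?_
    show x' + 0 = 0
    rw [add_zero]
    exact hd _ hy.1 hy.2 hx'
  · rw [Submodule.disjoint_def]
    exact fun y hy hy' => hd y hy.1 hy.2 hy'
  · refine le_antisymm (sup_le inf_le_left hX') fun v hv => ?_
    obtain ⟨n, hn, y, hy, rfl⟩ := exists_add_of_isCompl hc v
    obtain ⟨x', hx', z', hz', rfl⟩ := Submodule.mem_sup.1 hy
    refine Submodule.mem_sup.2 ⟨n + z', ⟨?_, Submodule.add_mem_sup hn hz'⟩, x', hx', by abel⟩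
    have := sub_mem hv (hX' hx')
    rwa [← add_assoc, add_right_comm, add_sub_cancel_right] at this

theorem isFGSum_of_countable [IsNoetherianRing Λ]
    (hE : ∀ (L : Type w) [AddCommGroup L] [Module Λ L], Module.Finite Λ L → Exchange Λ L)
    (hS : ∀ x : M, ∃ N C : Submodule Λ M, N.FG ∧ x ∈ N ∧ IsCompl N C)
    {X Z : Submodule Λ M} (hX : IsCompl X Z) {S : Set M} (hSc : S.Countable)
    (hSX : Submodule.span Λ S = X) : IsFGSum X := by
  let St := {p : Set (Submodule Λ M) × Submodule Λ M // (∀ Y ∈ p.1, Y.FG) ∧ sSupIndep p.1 ∧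
    Disjoint (sSup p.1) p.2 ∧ sSup p.1 ⊔ p.2 = X}
  have step : ∀ (s : St) (v : X), ∃ s' : St, s.1.1 ⊆ s'.1.1 ∧ v.1 ∈ sSup s'.1.1 := by
    rintro ⟨⟨𝒴, X'⟩, h1, h2, h3, h4⟩ ⟨v, hv⟩
    simp only at h1 h2 h3 h4
    have hc : IsCompl X' (sSup 𝒴 ⊔ Z) := by
      refine isCompl_of_forall (fun x hx hx' => ?_) fun m => ?_
      · obtain ⟨y, hy, z, hz, rfl⟩ := Submodule.mem_sup.1 hx'
        have hyX : y ∈ X := h4 ▸ Submodule.mem_sup_left hy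
        have hxX : y + z ∈ X := h4 ▸ Submodule.mem_sup_right hx
        have hz0 : z = 0 := eq_zero_of_isCompl hX ((Submodule.add_mem_iff_right _ hyX).1 hxX) hz
        subst hz0
        rw [add_zero] at *
        exact Submodule.disjoint_def.1 h3 y hy hx
      · obtain ⟨x, hx, z, hz, rfl⟩ := exists_add_of_isCompl hX m
        rw [← h4] at hx
        obtain ⟨y, hy, x', hx', rfl⟩ := Submodule.mem_sup.1 hx
        exact ⟨x', hx', y + z, Submodule.add_mem_sup hy hz, by abel⟩
    rw [← h4] at hv
    obtain ⟨y, hy, x', hx', rfl⟩ := Submodule.mem_sup.1 hv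
    obtain ⟨Y, X'', hY, hxY, hd, hs⟩ := exists_fg_summand hE hS hc hx'
    have hd' : Disjoint (sSup 𝒴) Y := h3.mono_right (hs ▸ le_sup_left)
    have hsu : sSup (𝒴 ∪ {Y}) = sSup 𝒴 ⊔ Y := by rw [sSup_union, sSup_singleton]
    refine ⟨⟨(𝒴 ∪ {Y}, X''), ?_, ?_, ?_, ?_⟩, Set.subset_union_left, ?_⟩
    · rintro W (hW | rfl)
      exacts [h1 W hW, hY]
    · exact sSupIndep_union h2 (sSupIndep_singleton Y) (by rwa [sSup_singleton])
    · simp only [hsu]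
      rw [Submodule.disjoint_def]
      intro x hx hx''
      obtain ⟨a, ha, b, hb, rfl⟩ := Submodule.mem_sup.1 hx
      have hbX : b ∈ X' := hs ▸ Submodule.mem_sup_left hb
      have hxX : a + b ∈ X' := hs ▸ Submodule.mem_sup_right hx''
      have ha0 : a = 0 := Submodule.disjoint_def.1 h3 a ha
        ((Submodule.add_mem_iff_left _ hbX).1 hxX)
      subst ha0
      rw [zero_add] at *
      exact Submodule.disjoint_def.1 hd b hb hx''
    · simp only [hsu]
      rw [sup_assoc, hs, h4]
    · simp only [hsu]
      exact Submodule.add_mem_sup hy hxY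
  choose f hf1 hf2 using step
  have hSX' : ∀ v ∈ S, v ∈ X := fun v hv => hSX ▸ Submodule.subset_span hv
  have hne : (insert 0 S).Nonempty := Set.insert_nonempty _ _
  obtain ⟨x, hx⟩ := (hSc.insert 0).exists_eq_range hne
  have hxX : ∀ n, x n ∈ X := fun n => by
    have : x n ∈ insert 0 S := hx ▸ ⟨n, rfl⟩
    rcases this with h | h
    · rw [h]; exact X.zero_mem
    · exact hSX' _ h
  let s : ℕ → St := fun n => Nat.rec ⟨(∅, X), by simp, by simp, by simp, by simp⟩
    (fun n s => f s ⟨x n, hxX n⟩) n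
  have hmono : Monotone fun n => (s n).1.1 := monotone_nat_of_le_succ fun n => hf1 (s n) _
  refine ⟨⋃ n, (s n).1.1, ?_, ?_, ?_⟩
  · intro Y hY
    obtain ⟨n, hn⟩ := Set.mem_iUnion.1 hY
    exact (s n).2.1 Y hn
  · exact sSupIndep_iUnion_of_directed hmono.directed_le fun n => (s n).2.2.1
  · apply le_antisymm
    · refine sSup_le fun Y hY => ?_
      obtain ⟨n, hn⟩ := Set.mem_iUnion.1 hY
      have := (s n).2.2.2.2
      exact (le_sSup hn).trans (le_sup_left.trans this.le)
    · refine hSX.symm.le.trans (Submodule.span_le.2 ?_)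
      intro v hv
      obtain ⟨n, rfl⟩ : v ∈ Set.range x := hx ▸ Set.mem_insert_of_mem _ hv
      exact sSup_le_sSup (Set.subset_iUnion (fun n => (s n).1.1) (n + 1)) (hf2 (s n) _)

section DFinsupp

variable {ι : Type w} {N : ι → Type w} [∀ i, AddCommGroup (N i)] [∀ i, Module Λ (N i)]

/-- The elements of a direct sum which are supported in `J`. -/
def suppIn (Λ : Type u) [Ring Λ] (N : ι → Type w) [∀ i, AddCommGroup (N i)] [∀ i, Module Λ (N i)]
    (J : Set ι) : Submodule Λ (Π₀ i, N i) where
  carrier := {m | ∀ i ∉ J, m i = 0}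
  add_mem' := fun ha hb i hi => by rw [DFinsupp.add_apply, ha i hi, hb i hi, add_zero]
  zero_mem' := fun i _ => rfl
  smul_mem' := fun r m hm i hi => by rw [DFinsupp.smul_apply, hm i hi, smul_zero]

theorem suppIn_mono {J J' : Set ι} (h : J ⊆ J') : suppIn Λ N J ≤ suppIn Λ N J' :=
  fun _ hm i hi => hm i fun hi' => hi (h hi')

open Classical in
theorem single_mem_suppIn {J : Set ι} {i : ι} (hi : i ∈ J) (n : N i) :
    DFinsupp.single i n ∈ suppIn Λ N J := fun j hj => by
  rw [DFinsupp.single_eq_of_ne]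
  rintro rfl
  exact hj hi

open Classical in
theorem suppIn_le {J : Set ι} {W : Submodule Λ (Π₀ i, N i)}
    (h : ∀ i ∈ J, ∀ n : N i, DFinsupp.single i n ∈ W) : suppIn Λ N J ≤ W := by
  intro m hm
  rw [← DFinsupp.sum_single (f := m)]
  refine Submodule.sum_mem _ fun i hi => ?_
  refine h i ?_ _
  by_contra hiJ
  exact (DFinsupp.mem_support_iff.1 hi) (hm i hiJ)

open Classical in
theorem mem_suppIn_support (m : Π₀ i, N i) : m ∈ suppIn Λ N (m.support : Set ι) := fun i hi => by
  simpa using hi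

open Classical in
theorem suppIn_finset_fg [∀ i, Module.Finite Λ (N i)] (F : Finset ι) :
    (suppIn Λ N (F : Set ι)).FG := by
  have : suppIn Λ N (F : Set ι) ≤ ⨆ i ∈ F, LinearMap.range (DFinsupp.lsingle i : N i →ₗ[Λ] _) :=
    suppIn_le fun i hi n => Submodule.mem_iSup_of_mem i (Submodule.mem_iSup_of_mem hi ⟨n, rfl⟩)
  rw [le_antisymm this (iSup₂_le fun i hi => ?_)]
  · exact Submodule.fg_biSup _ _ fun i _ => by
      rw [LinearMap.range_eq_map]; exact Module.Finite.fg_top.map _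
  · rintro _ ⟨n, rfl⟩
    exact single_mem_suppIn (Finset.mem_coe.2 hi) n

theorem isCompl_suppIn (J : Set ι) : IsCompl (suppIn Λ N J) (suppIn Λ N Jᶜ) := by
  classical
  refine isCompl_of_forall (fun x h h' => ?_) fun m => ?_
  · ext i
    by_cases hi : i ∈ J
    · exact h' i (by simpa)
    · exact h i hi
  · refine ⟨m.filter (· ∈ J), fun i hi => DFinsupp.filter_apply_neg _ hi,
      m.filter (· ∉ J), fun i hi => DFinsupp.filter_apply_neg _ (by simpa using hi), ?_⟩
    exact (DFinsupp.filter_add_filter_not _ _).symm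

open Classical in
theorem exists_countable_stable [∀ i, Module.Finite Λ (N i)]
    (e : (Π₀ i, N i) →ₗ[Λ] (Π₀ i, N i)) (i₀ : ι) :
    ∃ J : Set ι, i₀ ∈ J ∧ J.Countable ∧ suppIn Λ N J ≤ (suppIn Λ N J).comap e := by
  have hF : ∀ i, ∃ F : Finset ι, ∀ n : N i, e (DFinsupp.single i n) ∈ suppIn Λ N (F : Set ι) := by
    intro i
    obtain ⟨G, hG⟩ := Module.Finite.fg_top (R := Λ) (M := N i)
    refine ⟨G.biUnion fun g => (e (DFinsupp.single i g)).support, fun n => ?_⟩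
    have hn : n ∈ Submodule.span Λ (G : Set (N i)) := hG ▸ Submodule.mem_top
    have : Submodule.span Λ (G : Set (N i)) ≤ (suppIn Λ N ((G.biUnion fun g =>
        (e (DFinsupp.single i g)).support : Finset ι) : Set ι)).comap
        (e ∘ₗ DFinsupp.lsingle i) := by
      rw [Submodule.span_le]
      intro g hg
      refine suppIn_mono ?_ (mem_suppIn_support (Λ := Λ) (N := N) (e (DFinsupp.single i g)))
      exact Finset.coe_subset.2 (Finset.subset_biUnion_of_mem
        (fun g => (e (DFinsupp.single i g)).support) hg)
    exact this hn
  choose F hF using hF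
  let s : ℕ → Set ι := fun n => Nat.rec {i₀} (fun _ J => J ∪ ⋃ i ∈ J, (F i : Set ι)) n
  have hs : ∀ n, s (n + 1) = s n ∪ ⋃ i ∈ s n, (F i : Set ι) := fun n => rfl
  refine ⟨⋃ n, s n, Set.mem_iUnion.2 ⟨0, rfl⟩, Set.countable_iUnion fun n => ?_, suppIn_le ?_⟩
  · induction n with
    | zero => exact Set.countable_singleton _
    | succ n ih =>
      rw [hs]
      exact ih.union (ih.biUnion fun i _ => (F i).countable_toSet)
  · intro i hi n
    obtain ⟨k, hk⟩ := Set.mem_iUnion.1 hi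
    refine suppIn_mono ?_ (hF i n)
    refine Set.Subset.trans ?_ (Set.subset_iUnion s (k + 1))
    rw [hs]
    exact fun j hj => Or.inr (Set.mem_biUnion hk hj)

open Classical in
/-- One enlargement step in the decomposition of a direct summand of a direct sum. -/
theorem exists_enlarge [IsNoetherianRing Λ] [∀ i, Module.Finite Λ (N i)]
    (hE : ∀ (L : Type w) [AddCommGroup L] [Module Λ L], Module.Finite Λ L → Exchange Λ L)
    (e : (Π₀ i, N i) →ₗ[Λ] (Π₀ i, N i)) (he : ∀ m, e (e m) = e m) {J J' : Set ι}
    (hJ : suppIn Λ N J ≤ (suppIn Λ N J).comap e)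
    (hJ' : suppIn Λ N J' ≤ (suppIn Λ N J').comap e) (hc : J'.Countable) :
    ∃ 𝒴 : Set (Submodule Λ (Π₀ i, N i)), (∀ Y ∈ 𝒴, Y.FG) ∧ sSupIndep 𝒴 ∧
      Disjoint (suppIn Λ N J) (sSup 𝒴) ∧
      (suppIn Λ N J ⊓ LinearMap.range e) ⊔ sSup 𝒴 = suppIn Λ N (J ∪ J') ⊓ LinearMap.range e := by
  set π : (Π₀ i, N i) →ₗ[Λ] (Π₀ i, N i) := DFinsupp.filterLinearMap Λ N (· ∈ J' \ J) with hπ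
  have hπ1 : ∀ m, π m ∈ suppIn Λ N J' := fun m i hi =>
    DFinsupp.filter_apply_neg _ fun h => hi h.1
  have hπ2 : ∀ m ∈ suppIn Λ N (J ∪ J'), m - π m ∈ suppIn Λ N J := by
    intro m hm i hi
    rw [DFinsupp.sub_apply, sub_eq_zero]
    by_cases hi' : i ∈ J'
    · exact (DFinsupp.filter_apply_pos _ ⟨hi', hi⟩).symm
    · exact (hm i (by simp [hi, hi'])).trans (DFinsupp.filter_apply_neg _ fun h => hi' h.1).symm
  have hπ3 : ∀ m ∈ suppIn Λ N J, π m = 0 := by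
    intro m hm
    ext i
    by_cases hi : i ∈ J' \ J
    · exact (DFinsupp.filter_apply_pos _ hi).trans (hm i hi.2)
    · exact DFinsupp.filter_apply_neg _ hi
  have hle : suppIn Λ N J' ≤ suppIn Λ N (J ∪ J') := suppIn_mono Set.subset_union_right
  have heJ : ∀ m ∈ suppIn Λ N J', e m ∈ suppIn Λ N J' := fun m hm => hJ' hm
  have key : ∀ m ∈ suppIn Λ N J', π (e (π m)) = π (e m) := by
    intro m hm
    have h1 := hJ (hπ2 m (hle hm))
    have := hπ3 _ h1
    rw [map_sub, map_sub, sub_eq_zero] at this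
    exact this.symm
  have hππ : ∀ m, π (π m) = π m := fun m => by
    ext i
    by_cases hi : i ∈ J' \ J
    · exact DFinsupp.filter_apply_pos _ hi
    · exact (DFinsupp.filter_apply_neg _ hi).trans (DFinsupp.filter_apply_neg _ hi).symm
  set ē := π ∘ₗ e ∘ₗ π with hē
  have hid : ∀ m, ē (ē m) = ē m := by
    intro m
    simp only [hē, LinearMap.comp_apply]
    rw [hππ, key _ (heJ _ (hπ1 m)), he]
  have hcompl : IsCompl (LinearMap.range ē) (LinearMap.ker ē) := by
    refine isCompl_of_forall ?_ fun m => ⟨ē m, ⟨m, rfl⟩, m - ē m, ?_, by abel⟩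
    · rintro _ ⟨m, rfl⟩ h
      rw [← hid]; exact h
    · rw [LinearMap.mem_ker, map_sub, hid, sub_self]
  have hS : ∀ x : Π₀ i, N i, ∃ P C : Submodule Λ (Π₀ i, N i), P.FG ∧ x ∈ P ∧ IsCompl P C :=
    fun x => ⟨_, _, suppIn_finset_fg x.support, mem_suppIn_support x, isCompl_suppIn _⟩
  choose G hG using fun i => Module.Finite.fg_top (R := Λ) (M := N i)
  obtain ⟨𝒴, h1, h2, h3⟩ := isFGSum_of_countable hE hS hcompl
    (S := ⋃ i ∈ J', (fun g => ē (DFinsupp.single i g)) '' (G i : Set (N i)))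
    (hc.biUnion fun i _ => (G i).countable_toSet.image _) (by
      apply le_antisymm
      · rw [Submodule.span_le]
        intro x hx
        simp only [Set.mem_iUnion] at hx
        obtain ⟨i, -, g, -, rfl⟩ := hx
        exact ⟨_, rfl⟩
      · rintro _ ⟨m, rfl⟩
        have : suppIn Λ N J' ≤ (Submodule.span Λ (⋃ i ∈ J',
            (fun g => ē (DFinsupp.single i g)) '' (G i : Set (N i)))).comap ē := by
          refine suppIn_le fun i hi n => ?_
          have hn : n ∈ Submodule.span Λ (G i : Set (N i)) := hG i ▸ Submodule.mem_top
          have : Submodule.span Λ (G i : Set (N i)) ≤ (Submodule.span Λ (⋃ i ∈ J',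
            (fun g => ē (DFinsupp.single i g)) '' (G i : Set (N i)))).comap
              (ē ∘ₗ DFinsupp.lsingle i) := by
            rw [Submodule.span_le]
            intro g hg
            exact Submodule.subset_span (Set.mem_biUnion hi ⟨g, hg, rfl⟩)
          exact this hn
        have h := this (hπ1 m)
        rwa [Submodule.mem_comap, show ē (π m) = ē m by
          simp only [hē, LinearMap.comp_apply, hππ]] at h)
  have hπe : ∀ x ∈ LinearMap.range ē, π (e x) = x := by
    rintro _ ⟨m, rfl⟩
    simp only [hē, LinearMap.comp_apply]
    rw [key _ (heJ _ (hπ1 m)), he]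
  have hinj : Set.InjOn e (LinearMap.range ē : Submodule Λ (Π₀ i, N i)) := fun x hx y hy h => by
    rw [← hπe x hx, ← hπe y hy, h]
  have hsup : sSup ((fun Y => Y.map e) '' 𝒴) = (LinearMap.range ē).map e := by
    rw [sSup_image, ← h3, (Submodule.gc_map_comap e).l_sSup]
  refine ⟨(fun Y => Y.map e) '' 𝒴, ?_, ?_, ?_, ?_⟩
  · rintro _ ⟨Y, hY, rfl⟩
    exact (h1 Y hY).map e
  · rintro _ ⟨Y, hY, rfl⟩
    have : sSup (((fun Y => Y.map e) '' 𝒴) \ {Y.map e}) ≤ (sSup (𝒴 \ {Y})).map e := by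
      refine sSup_le ?_
      rintro _ ⟨⟨Y', hY', rfl⟩, hne⟩
      exact Submodule.map_mono (le_sSup ⟨hY', fun h => hne (by rw [Set.mem_singleton_iff.1 h]; rfl)⟩)
    refine Disjoint.mono_right this ?_
    rw [Submodule.disjoint_def]
    rintro _ ⟨y, hy, rfl⟩ ⟨z, hz, h⟩
    have hzr : z ∈ LinearMap.range ē :=
      h3 ▸ (sSup_le_sSup Set.sdiff_subset : sSup (𝒴 \ {Y}) ≤ sSup 𝒴) hz
    have hyr : y ∈ LinearMap.range ē := h3 ▸ le_sSup hY hy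
    have hyz := hinj hzr hyr h
    subst hyz
    rw [Submodule.disjoint_def.1 (h2 hY) z hy hz, map_zero]
  · rw [hsup, Submodule.disjoint_def]
    rintro _ hx ⟨x, hxr, rfl⟩
    have := hπ3 _ hx
    rw [hπe x hxr] at this
    rw [this, map_zero]
  · rw [hsup]
    apply le_antisymm
    · refine sup_le (inf_le_inf_right _ (suppIn_mono Set.subset_union_left)) ?_
      rintro _ ⟨x, ⟨m, rfl⟩, rfl⟩
      exact ⟨hle (heJ _ (hπ1 _)), ⟨_, rfl⟩⟩
    · rintro x ⟨hx, y, rfl⟩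
      have h1 := hπ2 _ hx
      have h2 : π (e y) ∈ LinearMap.range ē := by
        refine ⟨e y, ?_⟩
        simp only [hē, LinearMap.comp_apply]
        have := hπ3 _ (hJ h1)
        rw [map_sub, map_sub, he, sub_eq_zero] at this
        exact this.symm
      refine Submodule.mem_sup.2 ⟨e (e y - π (e y)), ⟨hJ h1, ⟨_, rfl⟩⟩, e (π (e y)), ⟨_, h2, rfl⟩, ?_⟩
      rw [map_sub, he]; abel

open Classical in
/-- A direct summand of a direct sum of finitely generated modules with the exchange property is
again a direct sum of finitely generated modules (Kaplansky, Warfield). -/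
theorem isFGSum_of_isCompl [IsNoetherianRing Λ] [∀ i, Module.Finite Λ (N i)]
    (hE : ∀ (L : Type w) [AddCommGroup L] [Module Λ L], Module.Finite Λ L → Exchange Λ L)
    {X Z : Submodule Λ (Π₀ i, N i)} (hX : IsCompl X Z) : IsFGSum X := by
  set e := X.projection Z hX with he
  have hre : LinearMap.range e = X := Submodule.range_projection hX
  have hee : ∀ m, e (e m) = e m := fun m =>
    Submodule.projection_apply_of_mem_left hX (Submodule.projection_apply_mem _ _)
  let T : Set (Set ι × Set (Submodule Λ (Π₀ i, N i))) :=
    {p | suppIn Λ N p.1 ≤ (suppIn Λ N p.1).comap e ∧ (∀ Y ∈ p.2, Y.FG) ∧ sSupIndep p.2 ∧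
      sSup p.2 = suppIn Λ N p.1 ⊓ X}
  obtain ⟨p, -, hp⟩ := zorn_le_nonempty₀ T (by
    intro c hcT hc p₀ hp₀
    have hfin : ∀ m ∈ suppIn Λ N (⋃ p : c, p.1.1), ∃ p ∈ c, m ∈ suppIn Λ N p.1 := by
      intro m hm
      have : (m.support : Set ι) ⊆ ⋃₀ (Prod.fst '' c) := fun i hi => by
        by_contra h
        refine DFinsupp.mem_support_iff.1 hi (hm i fun h' => h ?_)
        obtain ⟨⟨p, hp⟩, hip⟩ := Set.mem_iUnion.1 h'
        exact ⟨p.1, ⟨p, hp, rfl⟩, hip⟩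
      obtain ⟨J, ⟨p, hp, rfl⟩, hJ⟩ := DirectedOn.exists_mem_subset_of_finite_of_subset_sUnion
        (c := Prod.fst '' c) ⟨p₀.1, p₀, hp₀, rfl⟩ (by
          rintro _ ⟨a, ha, rfl⟩ _ ⟨b, hb, rfl⟩
          obtain ⟨d, hd, h1, h2⟩ := hc.directedOn a ha b hb
          exact ⟨d.1, ⟨d, hd, rfl⟩, h1.1, h2.1⟩) m.support.finite_toSet this
      exact ⟨p, hp, suppIn_mono hJ (mem_suppIn_support m)⟩
    have hJle : ∀ p ∈ c, suppIn Λ N p.1 ≤ suppIn Λ N (⋃ p : c, p.1.1) := fun p hp =>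
      suppIn_mono (Set.subset_iUnion (fun p : c => p.1.1) ⟨p, hp⟩)
    refine ⟨(⋃ p : c, p.1.1, ⋃ p : c, p.1.2), ⟨?_, ?_, ?_, ?_⟩, fun p hp =>
      ⟨Set.subset_iUnion (fun p : c => p.1.1) ⟨p, hp⟩,
        Set.subset_iUnion (fun p : c => p.1.2) ⟨p, hp⟩⟩⟩
    · intro m hm
      obtain ⟨p, hp, hmp⟩ := hfin m hm
      exact hJle p hp ((hcT hp).1 hmp)
    · intro Y hY
      obtain ⟨p, hp⟩ := Set.mem_iUnion.1 hY
      exact (hcT p.2).2.1 Y hp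
    · refine sSupIndep_iUnion_of_directed ?_ fun p => (hcT p.2).2.2.1
      rintro ⟨a, ha⟩ ⟨b, hb⟩
      obtain ⟨d, hd, h1, h2⟩ := hc.directedOn a ha b hb
      exact ⟨⟨d, hd⟩, h1.2, h2.2⟩
    · apply le_antisymm
      · refine sSup_le fun Y hY => ?_
        obtain ⟨p, hp⟩ := Set.mem_iUnion.1 hY
        exact (le_sSup hp).trans ((hcT p.2).2.2.2.le.trans (inf_le_inf_right _ (hJle p p.2)))
      · rintro m ⟨hm, hmX⟩
        obtain ⟨p, hp, hmp⟩ := hfin m hm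
        exact sSup_le_sSup (Set.subset_iUnion (fun p : c => p.1.2) ⟨p, hp⟩)
          ((hcT hp).2.2.2.symm.le ⟨hmp, hmX⟩))
    (∅, ∅) ⟨by
      refine suppIn_le fun i hi => ?_
      exact hi.elim, by simp, by simp, by
      rw [sSup_empty, eq_comm, eq_bot_iff]
      rintro m ⟨hm, -⟩
      rw [Submodule.mem_bot]
      ext i
      exact hm i (by simp)⟩
  obtain ⟨h1, h2, h3, h4⟩ := hp.1
  have huniv : p.1 = Set.univ := by
    rw [Set.eq_univ_iff_forall]
    intro i
    obtain ⟨J', hi, hcount, hJ'⟩ := exists_countable_stable e i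
    obtain ⟨𝒴, k1, k2, k3, k4⟩ := exists_enlarge hE e hee h1 hJ' hcount
    rw [hre] at k4
    have hT : (p.1 ∪ J', p.2 ∪ 𝒴) ∈ T := by
      refine ⟨?_, ?_, ?_, ?_⟩
      · refine suppIn_le ?_
        rintro j (hj | hj) n
        · have := h1 (single_mem_suppIn (Λ := Λ) hj n)
          exact suppIn_mono (Λ := Λ) (N := N) Set.subset_union_left this
        · have := hJ' (single_mem_suppIn (Λ := Λ) hj n)
          exact suppIn_mono (Λ := Λ) (N := N) Set.subset_union_right this
      · rintro Y (hY | hY)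
        exacts [h2 Y hY, k1 Y hY]
      · refine sSupIndep_union h3 k2 (k3.mono_left ?_)
        rw [h4]; exact inf_le_left
      · simp only
        rw [sSup_union, h4, k4]
    exact (hp.2 hT ⟨Set.subset_union_left, Set.subset_union_left⟩).1 (Or.inr hi)
  refine ⟨p.2, h2, h3, ?_⟩
  rw [h4, huniv, inf_eq_right]
  exact fun m _ i hi => (hi trivial).elim

end DFinsupp

end KaplanskyWarfield

section Complete

variable {R : Type u} [CommRing R] [IsNoetherianRing R] [IsLocalRing R]
  [IsAdicComplete (IsLocalRing.maximalIdeal R) R] {Λ : Type u} [Ring Λ] [Algebra R Λ]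
  [Module.Finite R Λ]

include R in
theorem exchange_of_finite (L : Type w) [AddCommGroup L] [Module Λ L] [Module.Finite Λ L] :
    Exchange Λ L := by
  have : IsNoetherianRing Λ := isNoetherian_of_tower R inferInstance
  refine decomposition_induction (fun L [AddCommGroup L] [Module Λ L] => Exchange Λ L)
    (fun M N _ _ _ _ e h => h.congr e) (fun M _ _ _ => Exchange.of_subsingleton) ?_
    (fun M N _ _ _ _ h h' => h.prod h') L
  intro M _ _ _ hM
  let _ : Module R M := Module.compHom M (algebraMap R Λ)
  have : IsScalarTower R Λ M := ⟨fun r l m => by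
    rw [Algebra.smul_def, mul_smul]; rfl⟩
  exact Exchange.of_local (isUnit_or_isUnit_one_sub (R := R) hM)

end Complete

section Lift

variable {Λ : Type u} [Ring Λ] {P : Type w₁} {N : Type w₂} {L : Type w₃} [AddCommGroup P] [Module Λ P]
  [AddCommGroup N] [Module Λ N] [AddCommGroup L] [Module Λ L]

theorem exists_lift [Module.Projective Λ P] (h : N →ₗ[Λ] L) (g : P →ₗ[Λ] L)
    (hg : ∀ p, ∃ n, h n = g p) : ∃ g' : P →ₗ[Λ] N, ∀ p, h (g' p) = g p := by
  obtain ⟨g', hg'⟩ := Module.projective_lifting_property h.rangeRestrict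
    (g.codRestrict (LinearMap.range h) hg) h.surjective_rangeRestrict
  exact ⟨g', fun p => congrArg Subtype.val (LinearMap.congr_fun hg' p)⟩

theorem projective_finPi [Module.Projective Λ P] (m : ℕ) : Module.Projective Λ (Fin m → P) :=
  Module.Projective.of_equiv (DFinsupp.linearEquivFunOnFintype (R := Λ) (M := fun _ : Fin m => P))

end Lift

section SmulTop

variable {R : Type u} [CommRing R] (Λ : Type u) [Ring Λ] [Algebra R Λ] (𝔟 : Ideal R)
  (N : Type w) [AddCommGroup N] [Module R N] [Module Λ N] [IsScalarTower R Λ N]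

/-- The submodule `𝔟 N`, as a submodule over an algebra. -/
def smulTop : Submodule Λ N :=
  { (𝔟 • ⊤ : Submodule R N) with
    smul_mem' := fun l x hx => by
      change l • x ∈ (𝔟 • ⊤ : Submodule R N)
      have hx' : x ∈ (𝔟 • ⊤ : Submodule R N) := hx
      induction hx' using Submodule.smul_induction_on' with
      | smul r hr n _ =>
        rw [smul_comm]
        exact Submodule.smul_mem_smul hr Submodule.mem_top
      | add x _ y _ h h' => rw [smul_add]; exact add_mem (h ‹_›) (h' ‹_›) }

variable {𝔟 N}

theorem mem_smulTop {x : N} : x ∈ smulTop Λ 𝔟 N ↔ x ∈ (𝔟 • ⊤ : Submodule R N) := Iff.rfl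

theorem smul_mem_smulTop {r : R} (hr : r ∈ 𝔟) (x : N) : r • x ∈ smulTop Λ 𝔟 N := by
  rw [mem_smulTop]
  exact Submodule.smul_mem_smul hr Submodule.mem_top

theorem smul_mem_smulTop_of_mem (r : R) {x : N} (hx : x ∈ smulTop Λ 𝔟 N) :
    r • x ∈ smulTop Λ 𝔟 N := by
  rw [mem_smulTop] at *
  exact Submodule.smul_mem _ r hx

theorem smulTop_induction {p : N → Prop} {x : N} (hx : x ∈ smulTop Λ 𝔟 N)
    (h1 : ∀ r ∈ 𝔟, ∀ n : N, p (r • n)) (h2 : ∀ x y, p x → p y → p (x + y)) : p x :=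
  Submodule.smul_induction_on ((mem_smulTop Λ).1 hx) (fun r hr n _ => h1 r hr n) h2

theorem smulTop_mono {𝔠 : Ideal R} (h : 𝔟 ≤ 𝔠) {x : N} (hx : x ∈ smulTop Λ 𝔟 N) :
    x ∈ smulTop Λ 𝔠 N := by
  rw [mem_smulTop] at *
  exact Submodule.smul_mono_left h hx

theorem mem_smulTop_sup_span {y : R} {x : N} :
    x ∈ smulTop Λ (𝔟 ⊔ Ideal.span {y}) N ↔ ∃ n : N, x - y • n ∈ smulTop Λ 𝔟 N := by
  constructor
  · intro hx
    refine smulTop_induction Λ (p := fun x => ∃ n : N, x - y • n ∈ smulTop Λ 𝔟 N) hx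
      (fun r hr n => ?_) ?_
    · obtain ⟨b, hb, c, hc, rfl⟩ := Submodule.mem_sup.1 hr
      obtain ⟨c, rfl⟩ := Ideal.mem_span_singleton'.1 hc
      refine ⟨c • n, ?_⟩
      rw [add_smul, smul_smul, mul_comm c, add_sub_cancel_right]
      exact smul_mem_smulTop Λ hb n
    · rintro x x' ⟨n, hn⟩ ⟨n', hn'⟩
      refine ⟨n + n', ?_⟩
      have := add_mem hn hn'
      rwa [sub_add_sub_comm, ← smul_add] at this
  · rintro ⟨n, hn⟩
    rw [← sub_add_cancel x (y • n)]
    exact add_mem (smulTop_mono Λ le_sup_left hn)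
      (smul_mem_smulTop Λ (Ideal.mem_sup_right (Ideal.mem_span_singleton_self y)) n)

theorem map_mem_smulTop {X : Type w₁} [AddCommGroup X] [Module R X] [Module Λ X]
    [IsScalarTower R Λ X] (f : N →ₗ[Λ] X) {x : N} (hx : x ∈ smulTop Λ 𝔟 N) :
    f x ∈ smulTop Λ 𝔟 X := by
  refine smulTop_induction Λ (p := fun x => f x ∈ smulTop Λ 𝔟 X) hx (fun r hr n => ?_)
    fun x y h h' => ?_
  · rw [LinearMap.map_smul_of_tower]
    exact smul_mem_smulTop Λ hr _
  · rw [map_add]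
    exact add_mem h h'

theorem exists_div {P : Type w₁} [AddCommGroup P] [Module R P] [Module Λ P]
    [IsScalarTower R Λ P] [Module.Projective Λ P] {y : R} (g : P →ₗ[Λ] N)
    (hg : ∀ p, g p ∈ smulTop Λ (𝔟 ⊔ Ideal.span {y}) N) :
    ∃ C : P →ₗ[Λ] N, ∀ p, g p - y • C p ∈ smulTop Λ 𝔟 N := by
  let h : N →ₗ[Λ] N ⧸ smulTop Λ 𝔟 N := (smulTop Λ 𝔟 N).mkQ ∘ₗ (y • LinearMap.id)
  obtain ⟨C, hC⟩ := exists_lift h ((smulTop Λ 𝔟 N).mkQ ∘ₗ g) fun p => by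
    obtain ⟨n, hn⟩ := (mem_smulTop_sup_span Λ).1 (hg p)
    refine ⟨n, ?_⟩
    exact ((Submodule.Quotient.eq _).2 hn).symm
  exact ⟨C, fun p => (Submodule.Quotient.eq _).1 (hC p).symm⟩

/-- `y` is a nonzerodivisor on `N / 𝔟 N`. -/
def RegOn (𝔟 : Ideal R) (y : R) (N : Type w) [AddCommGroup N] [Module R N] : Prop :=
  ∀ x : N, y • x ∈ (𝔟 • ⊤ : Submodule R N) → x ∈ (𝔟 • ⊤ : Submodule R N)

variable {Λ} in
theorem RegOn.mem_smulTop {y : R} (h : RegOn 𝔟 y N) {x : N} (hx : y • x ∈ smulTop Λ 𝔟 N) :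
    x ∈ smulTop Λ 𝔟 N := h x hx

theorem RegOn.sq {y : R} (h : RegOn 𝔟 y N) : RegOn 𝔟 (y ^ 2) N := fun x hx => by
  rw [pow_two, mul_smul] at hx
  exact h _ (h _ hx)

end SmulTop

section MCM

variable {R : Type u} [CommRing R]

/-- Maximal Cohen–Macaulay modules over a Gorenstein ring. -/
structure IsMCM (R : Type u) [CommRing R] (N : Type u) [AddCommGroup N] [Module R N] : Prop where
  finite : Module.Finite R N
  ext : ∀ i, ExtZ R (i + 1) N R

/-- The ring has injective dimension at most `n`, tested on finitely generated modules. -/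
def InjDim (R : Type u) [CommRing R] (n : ℕ) : Prop :=
  ∀ (L : Type u) [AddCommGroup L] [Module R L], Module.Finite R L → ∀ i, n ≤ i → ExtZ R (i + 1) L R

variable {N : Type u} [AddCommGroup N] [Module R N] {A B C : Type u} [AddCommGroup A] [Module R A]
  [AddCommGroup B] [Module R B] [AddCommGroup C] [Module R C]

theorem IsMCM.of_projective [Module.Finite R N] [Module.Projective R N] : IsMCM R N :=
  ⟨inferInstance, fun _ => ExtZ.of_projective⟩

theorem IsMCM.congr (h : IsMCM R A) (e : A ≃ₗ[R] B) : IsMCM R B :=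
  ⟨have := h.1; Module.Finite.equiv e, fun i => (h.2 i).congr e.symm⟩

theorem IsMCM.syzygy [IsNoetherianRing R] (hB : IsMCM R B) (hC : IsMCM R C) {f : A →ₗ[R] B}
    {g : B →ₗ[R] C} (hf : Function.Injective f) (hfg : Function.Exact f g)
    (hg : Function.Surjective g) : IsMCM R A :=
  ⟨have := hB.1; Module.Finite.of_injective f hf, fun i => ExtZ.left hf hfg hg (hB.2 i) (hC.2 _)⟩

variable [IsNoetherianRing R]

omit [IsNoetherianRing R] in
theorem dual_sequence (hN : ExtZ R 1 N R) {q : B →ₗ[R] N} (hq : Function.Surjective q) :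
    Function.Injective (LinearMap.dualMap q) ∧
    Function.Exact (LinearMap.dualMap q) (LinearMap.dualMap (LinearMap.ker q).subtype) ∧
    Function.Surjective (LinearMap.dualMap (LinearMap.ker q).subtype) := by
  refine ⟨LinearMap.dualMap_injective_of_surjective hq, fun φ => ⟨fun h => ?_, ?_⟩, fun φ => ?_⟩
  · obtain ⟨l, hl⟩ := exists_desc q hq φ fun x hx => LinearMap.congr_fun h ⟨x, hx⟩
    exact ⟨l, LinearMap.ext hl⟩
  · rintro ⟨l, rfl⟩
    ext x
    simp
  · obtain ⟨ψ, hψ⟩ := hN.extend (LinearMap.ker q).injective_subtype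
      (LinearMap.exact_subtype_ker_map q) hq φ
    exact ⟨ψ, LinearMap.ext hψ⟩

theorem IsMCM.ext_dual {n : ℕ} (hR : InjDim R n) (j : ℕ) : ∀ i, n ≤ i + j → ∀ (N : Type u)
    [AddCommGroup N] [Module R N], IsMCM R N → ExtZ R (i + 1) (Module.Dual R N) R := by
  induction j with
  | zero =>
    intro i hi N _ _ hN
    have := hN.1
    exact hR _ (finite_hom (Λ := R) N R) i (by omega)
  | succ j ih =>
    intro i hi N _ _ hN
    have := hN.1
    obtain ⟨m, q, hq⟩ := Module.Finite.exists_fin' R N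
    obtain ⟨h1, h2, h3⟩ := dual_sequence (hN.2 0) hq
    refine ExtZ.left h1 h2 h3 ExtZ.of_projective (ih (i + 1) (by omega) _ ?_)
    exact IsMCM.of_projective.syzygy hN (LinearMap.ker q).injective_subtype
      (LinearMap.exact_subtype_ker_map q) hq

theorem IsMCM.dual {n : ℕ} (hR : InjDim R n) (hN : IsMCM R N) : IsMCM R (Module.Dual R N) :=
  ⟨have := hN.1; finite_hom (Λ := R) N R, fun i => IsMCM.ext_dual hR n i (by omega) N hN⟩

/-- Every functional on the dual of a maximal Cohen–Macaulay module is an evaluation. -/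
theorem IsMCM.exists_eval {n : ℕ} (hR : InjDim R n) (hN : IsMCM R N)
    (θ : Module.Dual R (Module.Dual R N)) : ∃ x, ∀ φ, θ φ = φ x := by
  have := hN.1
  obtain ⟨m, q, hq⟩ := Module.Finite.exists_fin' R N
  obtain ⟨h1, h2, h3⟩ := dual_sequence (hN.2 0) hq
  have hK : IsMCM R (LinearMap.ker q) := IsMCM.of_projective.syzygy hN
    (LinearMap.ker q).injective_subtype (LinearMap.exact_subtype_ker_map q) hq
  obtain ⟨Θ, hΘ⟩ := ((hK.dual hR).2 0).extend h1 h2 h3 θ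
  obtain ⟨p, rfl⟩ := (Module.evalEquiv R (Fin m → R)).surjective Θ
  exact ⟨q p, fun φ => by rw [← hΘ]; rfl⟩

/-- Maximal Cohen–Macaulay modules are torsionless. -/
theorem IsMCM.eq_zero {n : ℕ} (hR : InjDim R n) (hN : IsMCM R N) {x : N}
    (hx : ∀ φ : Module.Dual R N, φ x = 0) : x = 0 := by
  have := hN.1
  obtain ⟨m, q, hq⟩ := Module.Finite.exists_fin' R N
  obtain ⟨p, rfl⟩ := hq x
  obtain ⟨h1, h2, h3⟩ := dual_sequence (hN.2 0) hq
  have hK : IsMCM R (LinearMap.ker q) := IsMCM.of_projective.syzygy hN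
    (LinearMap.ker q).injective_subtype (LinearMap.exact_subtype_ker_map q) hq
  obtain ⟨θ, hθ⟩ := exists_desc _ h3 (Module.Dual.eval R _ p) fun ψ hψ => by
    obtain ⟨φ, rfl⟩ := (h2 ψ).1 hψ
    exact hx φ
  obtain ⟨k, hk⟩ := hK.exists_eval hR θ
  have : p = k := by
    refine (Module.forall_dual_apply_eq_zero_iff R (p - k)).1 (fun ψ => ?_) |> sub_eq_zero.1
    have h := hθ ψ
    rw [hk] at h
    rw [map_sub, sub_eq_zero]
    exact h.symm
  rw [this]
  exact k.2

end MCM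

section Quotient

variable {R : Type u} [CommRing R] {Λ : Type u} [Ring Λ] [Algebra R Λ] {𝔟 : Ideal R} {y : R}
  {N : Type u} [AddCommGroup N] [Module R N] [Module Λ N] [IsScalarTower R Λ N]

/-- Multiplication by `y` on `N / 𝔟 N` has cokernel `N / (𝔟, y) N`. -/
theorem RegOn.exact_sequence (h : RegOn 𝔟 y N) :
    ∃ (f : (N ⧸ smulTop Λ 𝔟 N) →ₗ[Λ] (N ⧸ smulTop Λ 𝔟 N))
      (g : (N ⧸ smulTop Λ 𝔟 N) →ₗ[Λ] (N ⧸ smulTop Λ (𝔟 ⊔ Ideal.span {y}) N)),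
      Function.Injective f ∧ Function.Exact f g ∧ Function.Surjective g ∧
      (∀ n, f (Submodule.Quotient.mk n) = Submodule.Quotient.mk (y • n)) ∧
      ∀ n, g (Submodule.Quotient.mk n) = Submodule.Quotient.mk n := by
  let f : (N ⧸ smulTop Λ 𝔟 N) →ₗ[Λ] (N ⧸ smulTop Λ 𝔟 N) :=
    Submodule.mapQ _ _ (y • LinearMap.id) fun x hx => by
      rw [Submodule.mem_comap]
      exact smul_mem_smulTop_of_mem Λ y hx
  let g : (N ⧸ smulTop Λ 𝔟 N) →ₗ[Λ] (N ⧸ smulTop Λ (𝔟 ⊔ Ideal.span {y}) N) :=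
    Submodule.mapQ _ _ LinearMap.id fun x hx => smulTop_mono Λ le_sup_left hx
  have hf : ∀ n, f (Submodule.Quotient.mk n) = Submodule.Quotient.mk (y • n) := fun n => rfl
  have hg : ∀ n, g (Submodule.Quotient.mk n) = Submodule.Quotient.mk n := fun n => rfl
  refine ⟨f, g, ?_, ?_, ?_, hf, hg⟩
  · rw [injective_iff_map_eq_zero]
    intro x hx
    obtain ⟨n, rfl⟩ := Submodule.Quotient.mk_surjective _ x
    rw [hf, Submodule.Quotient.mk_eq_zero] at hx
    rw [Submodule.Quotient.mk_eq_zero]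
    exact h.mem_smulTop hx
  · intro x
    obtain ⟨n, rfl⟩ := Submodule.Quotient.mk_surjective _ x
    rw [hg, Submodule.Quotient.mk_eq_zero, mem_smulTop_sup_span]
    constructor
    · rintro ⟨m, hm⟩
      exact ⟨Submodule.Quotient.mk m, ((Submodule.Quotient.eq _).2 hm).symm⟩
    · rintro ⟨m, hm⟩
      obtain ⟨m, rfl⟩ := Submodule.Quotient.mk_surjective _ m
      exact ⟨m, (Submodule.Quotient.eq _).1 hm.symm⟩
  · intro x
    obtain ⟨n, rfl⟩ := Submodule.Quotient.mk_surjective _ x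
    exact ⟨Submodule.Quotient.mk n, hg n⟩

end Quotient

section Datum

variable {R : Type u} [CommRing R] {Λ : Type u} [Ring Λ] [Algebra R Λ]
  {W : Type u} [AddCommGroup W] [Module R W] [Module Λ W] [IsScalarTower R Λ W] {t : W →ₗ[R] R}

/-- A finitely generated projective module `W` with a functional through which every functional
on a `Λ`-module factors uniquely. -/
structure IsDatum (Λ : Type u) [Ring Λ] [Algebra R Λ] {W : Type u} [AddCommGroup W] [Module R W]
    [Module Λ W] [IsScalarTower R Λ W] (t : W →ₗ[R] R) : Prop where
  finite : Module.Finite Λ W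
  projective : Module.Projective Λ W
  exists_eq : ∀ φ : Λ →ₗ[R] R, ∃ w, ∀ l, φ l = t (l • w)
  eq_zero : ∀ w : W, (∀ l : Λ, t (l • w) = 0) → w = 0

theorem isDatum_self : IsDatum R (LinearMap.id : R →ₗ[R] R) where
  finite := inferInstance
  projective := inferInstance
  exists_eq φ := ⟨φ 1, fun l => by
    rw [LinearMap.id_apply, ← map_smul, smul_eq_mul, mul_one]⟩
  eq_zero w h := by simpa using h 1

variable {X : Type w} [AddCommGroup X] [Module R X] [Module Λ X] [IsScalarTower R Λ X]

omit [Module R X] [IsScalarTower R Λ X] in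
theorem IsDatum.ext (ht : IsDatum Λ t) {f g : X →ₗ[Λ] W} (h : ∀ x, t (f x) = t (g x)) : f = g := by
  ext x
  refine sub_eq_zero.1 (ht.eq_zero _ fun l => ?_)
  rw [smul_sub, ← map_smul, ← map_smul, map_sub, h, sub_self]

theorem IsDatum.exists_hom (ht : IsDatum Λ t) (φ : X →ₗ[R] R) :
    ∃ f : X →ₗ[Λ] W, ∀ x, t (f x) = φ x := by
  have h : ∀ x : X, ∃ w, ∀ l : Λ, φ (l • x) = t (l • w) := fun x =>
    ht.exists_eq (φ ∘ₗ (LinearMap.toSpanSingleton Λ X x).restrictScalars R)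
  choose f hf using h
  have huniq : ∀ x w, (∀ l : Λ, φ (l • x) = t (l • w)) → f x = w := fun x w hw => by
    refine sub_eq_zero.1 (ht.eq_zero _ fun l => ?_)
    rw [smul_sub, map_sub, ← hf, hw, sub_self]
  refine ⟨⟨⟨f, fun x y => huniq _ _ fun l => ?_⟩, fun r x => huniq _ _ fun l => ?_⟩, fun x => ?_⟩
  · rw [smul_add, map_add, smul_add, map_add, hf, hf]
  · rw [RingHom.id_apply, smul_smul, smul_smul, hf]
  · simpa using (hf x 1).symm

theorem IsMCM.cokernel {A B C : Type u} [AddCommGroup A] [Module R A] [AddCommGroup B] [Module R B]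
    [AddCommGroup C] [Module R C] (hA : IsMCM R A) (hB : IsMCM R B) {f : A →ₗ[R] B} {g : B →ₗ[R] C}
    (hf : Function.Injective f) (hfg : Function.Exact f g) (hg : Function.Surjective g)
    (h : ∀ φ : A →ₗ[R] R, ∃ ψ : B →ₗ[R] R, ∀ x, ψ (f x) = φ x) : IsMCM R C := by
  refine ⟨have := hB.1; Module.Finite.of_surjective g hg, fun i => ?_⟩
  cases i with
  | zero => exact extZ_one_iff.2 ((extZ_one_iff.1 (hB.2 0)).of_presentation hfg hg h)
  | succ i => exact ExtZ.right hf hfg hg (hA.2 i) (hB.2 _)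

theorem IsMCM.of_projective_algebra {P : Type u} [AddCommGroup P] [Module R P] [Module Λ P]
    [IsScalarTower R Λ P] [Module.Finite Λ P] [Module.Projective Λ P] (hΛ : IsMCM R Λ) :
    IsMCM R P := by
  obtain ⟨m, q, hq⟩ := Module.Finite.exists_fin' Λ P
  obtain ⟨s, hs⟩ := Module.projective_lifting_property q LinearMap.id hq
  have := hΛ.1
  exact ⟨Module.Finite.trans Λ P, fun i => ((hΛ.2 i).finPi m).of_retract (s.restrictScalars R)
    (q.restrictScalars R) (LinearMap.congr_fun hs)⟩

variable [IsNoetherianRing R]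

theorem IsMCM.exists_embedding (ht : IsDatum Λ t) (hΛ : IsMCM R Λ) {n : ℕ} (hR : InjDim R n)
    {N : Type u} [AddCommGroup N] [Module R N] [Module Λ N] [IsScalarTower R Λ N]
    (hN : IsMCM R N) : ∃ (m : ℕ) (f : N →ₗ[Λ] (Fin m → W)), Function.Injective f ∧
      (∀ φ : N →ₗ[R] R, ∃ ψ : (Fin m → W) →ₗ[R] R, ∀ x, ψ (f x) = φ x) ∧
      IsMCM R ((Fin m → W) ⧸ LinearMap.range f) := by
  have := hN.1
  have : Module.Finite R (Module.Dual R N) := finite_hom (Λ := R) N R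
  obtain ⟨m, q, hq⟩ := Module.Finite.exists_fin' R (Module.Dual R N)
  choose g hg using fun j : Fin m => ht.exists_hom (Λ := Λ) (q (Pi.single j 1))
  let f : N →ₗ[Λ] (Fin m → W) := LinearMap.pi g
  have hext : ∀ φ : N →ₗ[R] R, ∃ ψ : (Fin m → W) →ₗ[R] R, ∀ x, ψ (f x) = φ x := by
    intro φ
    obtain ⟨c, rfl⟩ := hq φ
    refine ⟨∑ j, c j • (t ∘ₗ LinearMap.proj j), fun x => ?_⟩
    conv_rhs => rw [pi_eq_sum_univ' c]
    simp only [LinearMap.sum_apply, LinearMap.smul_apply, map_sum, map_smul]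
    refine Finset.sum_congr rfl fun j _ => ?_
    rw [← hg]
    rfl
  have hf : Function.Injective f := by
    rw [injective_iff_map_eq_zero]
    intro x hx
    refine hN.eq_zero hR fun φ => ?_
    obtain ⟨ψ, hψ⟩ := hext φ
    rw [← hψ, hx, map_zero]
  refine ⟨m, f, hf, hext, ?_⟩
  have := ht.1
  have := ht.2
  have := projective_finPi (Λ := Λ) (P := W) m
  have h1 : IsMCM R (Fin m → W) := IsMCM.of_projective_algebra hΛ
  let f' : N →ₗ[R] (Fin m → W) := f.restrictScalars R
  let g' : (Fin m → W) →ₗ[R] ((Fin m → W) ⧸ LinearMap.range f) :=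
    (LinearMap.range f).mkQ.restrictScalars R
  have h2 : Function.Exact f' g' := LinearMap.exact_map_mkQ_range f
  have h3 : Function.Surjective g' := Submodule.mkQ_surjective (LinearMap.range f)
  exact IsMCM.cokernel (f := f') (g := g') hN h1 hf h2 h3 hext

end Datum

section RegSeq

variable {R : Type u} [CommRing R]

/-- `𝔟` is generated by the squares of a regular sequence of length `k` of elements of `I`. -/
inductive RegSeq (I : Ideal R) : ℕ → Ideal R → Prop
  | zero : RegSeq I 0 ⊥
  | succ {k : ℕ} {𝔟 : Ideal R} (h : RegSeq I k 𝔟) {y : R} (hy : y ∈ I) (hreg : RegOn 𝔟 y R) :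
    RegSeq I (k + 1) (𝔟 ⊔ Ideal.span {y ^ 2})

theorem RegSeq.le {I : Ideal R} {k : ℕ} {𝔟 : Ideal R} (h : RegSeq I k 𝔟) : 𝔟 ≤ I := by
  induction h with
  | zero => exact bot_le
  | succ h hy hreg ih =>
    refine sup_le ih ((Ideal.span_singleton_le_iff_mem _).2 ?_)
    rw [pow_two]
    exact I.mul_mem_left _ hy

theorem mem_smul_top_pi {𝔟 : Ideal R} {m : ℕ} {x : Fin m → R} :
    x ∈ (𝔟 • ⊤ : Submodule R (Fin m → R)) ↔ ∀ j, x j ∈ 𝔟 := by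
  constructor
  · intro h j
    exact Submodule.smul_induction_on (p := fun x : Fin m → R => x j ∈ 𝔟) h
      (fun r hr n _ => 𝔟.mul_mem_right _ hr) fun x y h h' => add_mem h h'
  · intro h
    rw [pi_eq_sum_univ' x]
    exact Submodule.sum_mem _ fun j _ => Submodule.smul_mem_smul (h j) Submodule.mem_top

theorem regOn_self_iff {𝔟 : Ideal R} {y : R} : RegOn 𝔟 y R ↔ ∀ x, y * x ∈ 𝔟 → x ∈ 𝔟 := by
  simp [RegOn]

variable [IsNoetherianRing R] {n : ℕ} {I : Ideal R} {k : ℕ} {𝔟 : Ideal R}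

/-- Short exact sequences with maximal Cohen–Macaulay cokernel stay exact modulo `𝔟`. -/
def IsPure (𝔟 : Ideal R) : Prop :=
  ∀ {A B C : Type u} [AddCommGroup A] [Module R A] [AddCommGroup B] [Module R B]
    [AddCommGroup C] [Module R C] {f : A →ₗ[R] B} {g : B →ₗ[R] C}, Function.Injective f →
    Function.Exact f g → Function.Surjective g → IsMCM R C → ∀ x,
    f x ∈ (𝔟 • ⊤ : Submodule R B) → x ∈ (𝔟 • ⊤ : Submodule R A)

theorem IsPure.regOn (hR : InjDim R n) (hp : IsPure 𝔟) {N : Type u} [AddCommGroup N] [Module R N]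
    (hN : IsMCM R N) {y : R} (hy : RegOn 𝔟 y R) : RegOn 𝔟 y N := by
  intro x hx
  obtain ⟨m, f, hf, -, hC⟩ := IsMCM.exists_embedding isDatum_self
    (IsMCM.of_projective (N := R)) hR hN
  refine hp hf (LinearMap.exact_map_mkQ_range f) (Submodule.mkQ_surjective _) hC x ?_
  have := map_mem_smulTop R f hx
  rw [map_smul, mem_smulTop, mem_smul_top_pi] at this
  exact mem_smul_top_pi.2 fun j => regOn_self_iff.1 hy _ (this j)

theorem RegSeq.isPure (hR : InjDim R n) (h : RegSeq I k 𝔟) : IsPure 𝔟 := by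
  induction h with
  | zero =>
    intro A B C _ _ _ _ _ _ f g hf hfg hg hC x hx
    rw [Submodule.bot_smul, Submodule.mem_bot] at *
    exact hf (hx.trans (map_zero f).symm)
  | @succ k 𝔟 h y hy hreg ih =>
    intro A B C _ _ _ _ _ _ f g hf hfg hg hC x hx
    have hC' := IsPure.regOn hR ih hC hreg.sq
    obtain ⟨q, hq⟩ := (mem_smulTop_sup_span R).1 hx
    have h1 := map_mem_smulTop R g hq
    rw [map_sub, hfg.apply_apply_eq_zero, zero_sub, neg_mem_iff, map_smul] at h1
    have h2 := hC' _ h1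
    have h3 : ∃ b ∈ (𝔟 • ⊤ : Submodule R B), g b = g q := by
      have : (𝔟 • ⊤ : Submodule R C) = (𝔟 • ⊤ : Submodule R B).map g := by
        rw [Submodule.map_smul'', Submodule.map_top, LinearMap.range_eq_top.2 hg]
      rw [this] at h2
      exact h2
    obtain ⟨b, hb, hbq⟩ := h3
    obtain ⟨a, ha⟩ := (hfg (q - b)).1 (by rw [map_sub, hbq, sub_self])
    refine (mem_smulTop_sup_span R).2 ⟨a, ih hf hfg hg hC _ ?_⟩
    have : f (x - y ^ 2 • a) = (f x - y ^ 2 • q) + y ^ 2 • b := by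
      rw [map_sub, map_smul, ha, smul_sub]
      abel
    rw [this]
    exact add_mem hq (Submodule.smul_mem _ _ hb)

theorem RegSeq.regOn (hR : InjDim R n) (h : RegSeq I k 𝔟) {N : Type u} [AddCommGroup N]
    [Module R N] (hN : IsMCM R N) {y : R} (hy : RegOn 𝔟 y R) : RegOn 𝔟 y N :=
  IsPure.regOn hR (h.isPure hR) hN hy

end RegSeq

section ExtQuotient

variable {R : Type u} [CommRing R] [IsNoetherianRing R] {Λ : Type u} [Ring Λ] [Algebra R Λ]
  {I 𝔟 : Ideal R} {n k : ℕ}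
  {N : Type u} [AddCommGroup N] [Module R N] [Module Λ N] [IsScalarTower R Λ N]

omit [IsNoetherianRing R] in
variable (R Λ N) in
theorem smulTop_bot : smulTop Λ (⊥ : Ideal R) N = ⊥ := by
  ext x
  rw [mem_smulTop, Submodule.bot_smul]
  rfl

theorem RegSeq.ext_quotient (hR : InjDim R n) (h : RegSeq I k 𝔟) (hN : IsMCM R N) {V : Type u}
    [AddCommGroup V] [Module Λ V] (hV : ∀ i, ExtZ Λ (i + 1) N V) :
    ∀ i, k ≤ i → ExtZ Λ (i + 1) (N ⧸ smulTop Λ 𝔟 N) V := by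
  induction h with
  | zero => exact fun i _ => (hV i).congr (Submodule.quotEquivOfEqBot _ (smulTop_bot R Λ N))
  | @succ k 𝔟 h y hy hreg ih =>
    intro i hi
    obtain ⟨f, g, hf, hfg, hg, -⟩ := (h.regOn hR hN hreg.sq).exact_sequence (Λ := Λ)
    obtain ⟨i, rfl⟩ : ∃ j, i = j + 1 := ⟨i - 1, by omega⟩
    exact ExtZ.right hf hfg hg (ih i (by omega)) (ih _ (by omega))

theorem RegSeq.ext_quotient₂ (hR : InjDim R n) (h : RegSeq I k 𝔟) (hN : IsMCM R N) {X : Type u}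
    [AddCommGroup X] [Module Λ X] (hX : ∀ i, ExtZ Λ (i + 1) X N) :
    ∀ i, ExtZ Λ (i + 1) X (N ⧸ smulTop Λ 𝔟 N) := by
  induction h with
  | zero => exact fun i => (hX i).congr₂ (Submodule.quotEquivOfEqBot _ (smulTop_bot R Λ N))
  | @succ k 𝔟 h y hy hreg ih =>
    intro i
    obtain ⟨f, g, hf, hfg, hg, -⟩ := (h.regOn hR hN hreg.sq).exact_sequence (Λ := Λ)
    exact ExtZ.right₂ hf hfg hg (ih i) (ih _)

end ExtQuotient

section Depth

variable {R : Type u} [CommRing R] [IsNoetherianRing R] [IsLocalRing R]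

open IsLocalRing

theorem InjDim.pred {n : ℕ} (hR : InjDim R (n + 1))
    (hκ : ExtZ R (n + 1) (R ⧸ maximalIdeal R) R) : InjDim R n := by
  intro L _ _ hL i hi
  obtain rfl | hi := hi.eq_or_lt
  swap
  · exact hR L hL i hi
  refine IsNoetherianRing.induction_on_isQuotientEquivQuotientPrime (A := R) hL
    (motive := fun N [AddCommGroup N] [Module R N] [Module.Finite R N] => ExtZ R (n + 1) N R)
    ?_ ?_ ?_
  · intro N _ _ _ _
    exact ExtZ.of_subsingleton
  · intro N _ _ _ p e
    refine ExtZ.congr e ?_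
    by_cases hp : p.1 = maximalIdeal R
    · rw [hp]; exact hκ
    have hlt : ¬ maximalIdeal R ≤ p.1 := fun hle =>
      hp (((maximalIdeal.isMaximal R).eq_of_le p.2.ne_top hle).symm)
    obtain ⟨y, hy, hyp⟩ := SetLike.not_le_iff_exists.1 hlt
    refine ExtZ.of_regular hy (L := R ⧸ p.1) (fun x hx => ?_)
      (Submodule.mkQ_surjective (LinearMap.range (y • (LinearMap.id : (R ⧸ p.1) →ₗ[R] _))))
      (fun x => ?_) (hR _ inferInstance (n + 1) le_rfl)
    · obtain ⟨x, rfl⟩ := Ideal.Quotient.mk_surjective x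
      have : Ideal.Quotient.mk p.1 (y * x) = 0 := hx
      rw [Ideal.Quotient.eq_zero_iff_mem] at this ⊢
      exact (p.2.mem_or_mem this).resolve_left hyp
    · rw [Submodule.mkQ_apply, Submodule.Quotient.mk_eq_zero]
      rfl
  · intro A _ _ _ B _ _ _ C _ _ _ f g hf hg hfg hA hC
    exact ExtZ.mid hf hfg hg hA hC

theorem exists_regSeq {n : ℕ} (hR : InjDim R n) {a : ℕ} (ha : a ≠ 0) :
    ∃ k 𝔟, RegSeq (maximalIdeal R ^ a) k 𝔟 ∧ InjDim R k ∧
      ∃ f : (R ⧸ maximalIdeal R) →ₗ[R] R ⧸ 𝔟, Function.Injective f := by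
  let S : Set (Ideal R) := {𝔟 | ∃ k, RegSeq (maximalIdeal R ^ a) k 𝔟}
  obtain ⟨𝔟, ⟨k, h⟩, hmax⟩ := set_has_maximal_iff_noetherian.2 ‹IsNoetherianRing R› S
    ⟨⊥, 0, RegSeq.zero⟩
  have hle : 𝔟 ≤ maximalIdeal R := h.le.trans (Ideal.pow_le_self ha)
  have hno : ∀ y ∈ maximalIdeal R, ¬ RegOn 𝔟 y R := by
    intro y hy hreg
    have hpow : ∀ m x, y ^ m * x ∈ 𝔟 → x ∈ 𝔟 := by
      intro m
      induction m with
      | zero => intro x hx; simpa using hx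
      | succ m ih =>
        intro x hx
        rw [pow_succ, mul_assoc] at hx
        exact regOn_self_iff.1 hreg _ (ih _ hx)
    refine hmax _ ⟨_, h.succ (Ideal.pow_mem_pow hy a) (regOn_self_iff.2 (hpow a))⟩
      (lt_of_le_of_ne le_sup_left fun heq => ?_)
    have : (y ^ a) ^ 2 ∈ 𝔟 := by
      rw [heq]; exact Ideal.mem_sup_right (Ideal.mem_span_singleton_self _)
    rw [← pow_mul, ← mul_one (y ^ _)] at this
    exact (maximalIdeal.isMaximal R).ne_top ((Ideal.eq_top_iff_one _).2 (hle (hpow _ _ this)))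
  have hf : ∃ f : (R ⧸ maximalIdeal R) →ₗ[R] R ⧸ 𝔟, Function.Injective f := by
    by_contra hcon
    have hsub : Subsingleton ((R ⧸ maximalIdeal R) →ₗ[R] R ⧸ 𝔟) := by
      refine subsingleton_of_forall_eq 0 fun f => ?_
      have : IsSimpleModule R (R ⧸ maximalIdeal R) :=
        isSimpleModule_iff_isCoatom.2 (Ideal.isMaximal_def.1 (maximalIdeal.isMaximal R))
      exact (LinearMap.injective_or_eq_zero f).resolve_left fun hf => hcon ⟨f, hf⟩
    obtain ⟨y, hy, hreg⟩ := IsSMulRegular.subsingleton_linearMap_iff.1 hsub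
    rw [Ideal.annihilator_quotient] at hy
    refine hno y hy (regOn_self_iff.2 fun x hx => ?_)
    rw [← Ideal.Quotient.eq_zero_iff_mem] at hx ⊢
    exact hreg.right_eq_zero_of_smul hx
  refine ⟨k, 𝔟, h, ?_, hf⟩
  obtain ⟨f, hf⟩ := hf
  have key : ∀ j, InjDim R (k + j) → InjDim R k := by
    intro j
    induction j with
    | zero => exact id
    | succ j ih =>
      intro hj
      refine ih (InjDim.pred (hj : InjDim R (k + j + 1)) ?_)
      have e : (R ⧸ 𝔟) ≃ₗ[R] (R ⧸ smulTop R 𝔟 R) := Submodule.quotEquivOfEq _ _ (by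
        ext x; simp [mem_smulTop])
      have h1 : ExtZ R (k + j + 1) (R ⧸ 𝔟) R := (h.ext_quotient hR IsMCM.of_projective
        (fun _ => ExtZ.of_projective) (k + j) (by omega)).congr e
      exact ExtZ.left hf (LinearMap.exact_map_mkQ_range f) (Submodule.mkQ_surjective _) h1
        (hj _ inferInstance _ le_rfl)
  exact key n fun L _ _ hL i hi => hR L hL i (by omega)

end Depth

section Climb

variable {R : Type u} [CommRing R] {Λ : Type u} [Ring Λ] [Algebra R Λ]
  {𝔟 : Ideal R} {y : R}
  {F F₁ F₂ N X : Type u} [AddCommGroup F] [Module R F] [Module Λ F] [IsScalarTower R Λ F]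
  [AddCommGroup F₁] [Module R F₁] [Module Λ F₁] [IsScalarTower R Λ F₁]
  [AddCommGroup F₂] [Module R F₂] [Module Λ F₂] [IsScalarTower R Λ F₂]
  [AddCommGroup N] [Module R N] [Module Λ N] [IsScalarTower R Λ N]
  [AddCommGroup X] [Module R X] [Module Λ X] [IsScalarTower R Λ X]
  {q : F₁ →ₗ[Λ] F} {q₁ : F₂ →ₗ[Λ] F₁} {Φ : F₁ →ₗ[Λ] N} {Φ₁ : F₂ →ₗ[Λ] N}

omit [Module R F₂] [IsScalarTower R Λ F₂] in
theorem climb_extends [Module.Projective Λ F] (hN : RegOn 𝔟 y N)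
    (hq : ∀ v ∈ smulTop Λ (𝔟 ⊔ Ideal.span {y}) F, ∃ u, q u = v)
    (hΦ : ∀ u, q u ∈ smulTop Λ (𝔟 ⊔ Ideal.span {y}) F → Φ u ∈ smulTop Λ (𝔟 ⊔ Ideal.span {y}) N)
    (hq₁ : ∀ u, q u ∈ smulTop Λ 𝔟 F → ∃ s, q₁ s = u)
    (hΦ₁ : ∀ s, Φ (q₁ s) - y • Φ₁ s ∈ smulTop Λ 𝔟 N)
    {A₁ : F₁ →ₗ[Λ] N} (hA₁ : ∀ s, Φ₁ s - A₁ (q₁ s) ∈ smulTop Λ 𝔟 N) :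
    ∃ A : F →ₗ[Λ] N, ∀ u, Φ u - A (q u) ∈ smulTop Λ (𝔟 ⊔ Ideal.span {y}) N := by
  set Ψ : F₁ →ₗ[Λ] N := Φ - y • A₁ with hΨdef
  have hΨy : ∀ u, Φ u - Ψ u ∈ smulTop Λ (𝔟 ⊔ Ideal.span {y}) N := fun u => by
    rw [hΨdef, LinearMap.sub_apply, sub_sub_cancel]
    exact smul_mem_smulTop Λ (Ideal.mem_sup_right (Ideal.mem_span_singleton_self y)) _
  have hΨ : ∀ u, q u ∈ smulTop Λ 𝔟 F → Ψ u ∈ smulTop Λ 𝔟 N := by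
    intro u hu
    obtain ⟨s, rfl⟩ := hq₁ u hu
    have := add_mem (hΦ₁ s) (smul_mem_smulTop_of_mem Λ y (hA₁ s))
    rwa [smul_sub, sub_add_sub_cancel] at this
  obtain ⟨σ, hσ⟩ := exists_lift q (y • LinearMap.id : F →ₗ[Λ] F) fun v =>
    hq _ (smul_mem_smulTop Λ (Ideal.mem_sup_right (Ideal.mem_span_singleton_self y)) v)
  replace hσ : ∀ v, q (σ v) = y • v := hσ
  obtain ⟨A, hA⟩ := exists_div Λ (𝔟 := 𝔟) (y := y) (Ψ ∘ₗ σ) fun v => by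
    have h1 := hΦ (σ v) (by
      rw [hσ]
      exact smul_mem_smulTop Λ (Ideal.mem_sup_right (Ideal.mem_span_singleton_self y)) v)
    have := sub_mem h1 (hΨy (σ v))
    rwa [sub_sub_cancel] at this
  refine ⟨A, fun u => ?_⟩
  have h1 : Ψ (σ (q u)) - y • Ψ u ∈ smulTop Λ 𝔟 N := by
    have := hΨ (σ (q u) - y • u) (by
      rw [map_sub, hσ, LinearMap.map_smul_of_tower, sub_self]
      exact zero_mem _)
    rwa [map_sub, LinearMap.map_smul_of_tower] at this
  have h2 : Ψ u - A (q u) ∈ smulTop Λ 𝔟 N := hN.mem_smulTop (y := y) (by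
    have := sub_mem (hA (q u)) h1
    rwa [LinearMap.comp_apply, sub_sub_sub_cancel_left, ← smul_sub] at this)
  have := add_mem (hΨy u) (smulTop_mono Λ (le_sup_left (b := Ideal.span {y})) h2)
  rwa [sub_add_sub_cancel] at this

omit [Module R F₂] [IsScalarTower R Λ F₂] in
theorem climb_comp [Module.Projective Λ F₁] (hX : RegOn 𝔟 y X)
    (hq₁ : ∀ s, q (q₁ s) ∈ smulTop Λ 𝔟 F)
    (hΦ₁ : ∀ s, Φ (q₁ s) - y • Φ₁ s ∈ smulTop Λ 𝔟 N) (f : N →ₗ[Λ] X) {B : F →ₗ[Λ] X}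
    (hB : ∀ u, f (Φ u) - B (q u) ∈ smulTop Λ (𝔟 ⊔ Ideal.span {y}) X) :
    ∃ C : F₁ →ₗ[Λ] X, ∀ s, f (Φ₁ s) - C (q₁ s) ∈ smulTop Λ 𝔟 X := by
  obtain ⟨C, hC⟩ := exists_div Λ (𝔟 := 𝔟) (y := y) (f ∘ₗ Φ - B ∘ₗ q) hB
  refine ⟨C, fun s => hX.mem_smulTop (y := y) ?_⟩
  have h1 := hC (q₁ s)
  have h2 := map_mem_smulTop Λ f (hΦ₁ s)
  have h3 := map_mem_smulTop Λ B (hq₁ s)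
  have h4 := add_mem (sub_mem h1 h2) h3
  rw [map_sub, LinearMap.map_smul_of_tower] at h4
  convert h4 using 1
  simp only [LinearMap.sub_apply, LinearMap.comp_apply, smul_sub]
  abel

omit [Module R F₁] [IsScalarTower R Λ F₁] [Module R F₂] [IsScalarTower R Λ F₂] in
theorem climb_ext {V : Type u} [AddCommGroup V] [Module Λ V] {k : ℕ}
    {𝔟' : Ideal R} (hle : 𝔟 ≤ 𝔟')
    (hq : ∀ v ∈ smulTop Λ 𝔟' F, ∃ u, q u = v)
    (hq₁ : ∀ u, q u ∈ smulTop Λ 𝔟 F ↔ ∃ s, q₁ s = u)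
    (hF : ∀ i, k ≤ i → ExtZ Λ (i + 1) (F ⧸ smulTop Λ 𝔟 F) V)
    (hE : ∀ i, k + 1 ≤ i → ExtZ Λ (i + 1) (F ⧸ LinearMap.range q) V) :
    ∀ i, k ≤ i → ExtZ Λ (i + 1) (F₁ ⧸ LinearMap.range q₁) V := by
  intro i hi
  have hle' : smulTop Λ 𝔟 F ≤ LinearMap.range q := fun x hx => hq x (smulTop_mono Λ hle hx)
  let f : (F₁ ⧸ LinearMap.range q₁) →ₗ[Λ] (F ⧸ smulTop Λ 𝔟 F) :=
    Submodule.mapQ _ _ q fun u hu => (hq₁ u).2 hu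
  let g : (F ⧸ smulTop Λ 𝔟 F) →ₗ[Λ] (F ⧸ LinearMap.range q) :=
    Submodule.mapQ _ _ LinearMap.id hle'
  refine ExtZ.left (f := f) (g := g) ?_ ?_ ?_ (hF i hi) (hE (i + 1) (by omega))
  · rw [injective_iff_map_eq_zero]
    intro x hx
    obtain ⟨u, rfl⟩ := Submodule.Quotient.mk_surjective _ x
    exact (Submodule.Quotient.mk_eq_zero _).2
      ((hq₁ u).1 ((Submodule.Quotient.mk_eq_zero _).1 hx))
  · intro x
    obtain ⟨v, rfl⟩ := Submodule.Quotient.mk_surjective _ x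
    constructor
    · intro h
      obtain ⟨u, rfl⟩ := (Submodule.Quotient.mk_eq_zero _).1 h
      exact ⟨Submodule.Quotient.mk u, rfl⟩
    · rintro ⟨u, hu⟩
      obtain ⟨u, rfl⟩ := Submodule.Quotient.mk_surjective _ u
      rw [← hu]
      exact (Submodule.Quotient.mk_eq_zero _).2 ⟨u, rfl⟩
  · intro x
    obtain ⟨v, rfl⟩ := Submodule.Quotient.mk_surjective _ x
    exact ⟨Submodule.Quotient.mk v, rfl⟩

end Climb

section ClimbAll

variable {R : Type u} [CommRing R] [IsNoetherianRing R] {Λ : Type u} [Ring Λ] [Algebra R Λ]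
  {I 𝔟 : Ideal R} {n k : ℕ}

/-- An extension problem modulo a regular sequence lifts to an extension problem over the ring. -/
theorem RegSeq.climb (hR : InjDim R n) (hΛ : IsMCM R Λ) (h : RegSeq I k 𝔟) {m₁ m : ℕ}
    (q : (Fin m₁ → Λ) →ₗ[Λ] (Fin m → Λ))
    (hq : ∀ v ∈ smulTop Λ 𝔟 (Fin m → Λ), ∃ u, q u = v)
    (hE : ∀ i, k ≤ i → ExtZ Λ (i + 1) ((Fin m → Λ) ⧸ LinearMap.range q) Λ) :
    ∃ (m₁' m' : ℕ) (q' : (Fin m₁' → Λ) →ₗ[Λ] (Fin m' → Λ)),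
      (∀ i, ExtZ Λ (i + 1) ((Fin m' → Λ) ⧸ LinearMap.range q') Λ) ∧
      ∀ (N : Type u) [AddCommGroup N] [Module R N] [Module Λ N] [IsScalarTower R Λ N],
      IsMCM R N → ∀ Φ : (Fin m₁ → Λ) →ₗ[Λ] N,
      (∀ u, q u ∈ smulTop Λ 𝔟 (Fin m → Λ) → Φ u ∈ smulTop Λ 𝔟 N) →
      ∃ Φ' : (Fin m₁' → Λ) →ₗ[Λ] N, (∀ u, q' u = 0 → Φ' u = 0) ∧
        ((∃ A : (Fin m' → Λ) →ₗ[Λ] N, ∀ u, Φ' u = A (q' u)) →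
          ∃ A : (Fin m → Λ) →ₗ[Λ] N, ∀ u, Φ u - A (q u) ∈ smulTop Λ 𝔟 N) ∧
        ∀ (X : Type u) [AddCommGroup X] [Module R X] [Module Λ X] [IsScalarTower R Λ X],
        IsMCM R X → ∀ f : N →ₗ[Λ] X,
        (∃ B : (Fin m → Λ) →ₗ[Λ] X, ∀ u, f (Φ u) - B (q u) ∈ smulTop Λ 𝔟 X) →
        ∃ B : (Fin m' → Λ) →ₗ[Λ] X, ∀ u, f (Φ' u) = B (q' u) := by
  induction h generalizing m₁ m with
  | zero =>
    refine ⟨m₁, m, q, fun i => hE i (Nat.zero_le _), fun N _ _ _ _ hN Φ hΦ => ⟨Φ, fun u hu => ?_,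
      fun ⟨A, hA⟩ => ⟨A, fun u => ?_⟩, fun X _ _ _ _ hX f ⟨B, hB⟩ => ⟨B, fun u => ?_⟩⟩⟩
    · have := hΦ u (by rw [hu]; exact zero_mem _)
      rwa [smulTop_bot, Submodule.mem_bot] at this
    · rw [hA, sub_self]
      exact zero_mem _
    · have := hB u
      rwa [smulTop_bot, Submodule.mem_bot, sub_eq_zero] at this
  | @succ k 𝔟 h y hy hreg ih =>
    have := hΛ.1
    have hnoeth : IsNoetherianRing Λ := isNoetherian_of_tower R inferInstance
    obtain ⟨m₂, p, hp⟩ := Module.Finite.exists_fin' Λ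
      ((smulTop Λ 𝔟 (Fin m → Λ)).comap q)
    let q₁ : (Fin m₂ → Λ) →ₗ[Λ] (Fin m₁ → Λ) := Submodule.subtype _ ∘ₗ p
    have hq₁ : ∀ u, q u ∈ smulTop Λ 𝔟 (Fin m → Λ) ↔ ∃ s, q₁ s = u := by
      intro u
      constructor
      · intro hu
        obtain ⟨s, hs⟩ := hp ⟨u, hu⟩
        exact ⟨s, congrArg Subtype.val hs⟩
      · rintro ⟨s, rfl⟩
        exact (p s).2
    have hF : IsMCM R (Fin m → Λ) := IsMCM.of_projective_algebra hΛ
    obtain ⟨m₁', m', q', hE', H⟩ := ih q₁ (fun v hv => (hq₁ v).1 (map_mem_smulTop Λ q hv))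
      (climb_ext le_sup_left hq hq₁ (h.ext_quotient hR hF fun _ => ExtZ.of_projective) hE)
    refine ⟨m₁', m', q', hE', fun N _ _ _ _ hN Φ hΦ => ?_⟩
    obtain ⟨Φ₁, hΦ₁⟩ := exists_div Λ (𝔟 := 𝔟) (y := y ^ 2) (Φ ∘ₗ q₁) fun s =>
      hΦ _ (smulTop_mono Λ le_sup_left ((hq₁ _).2 ⟨s, rfl⟩))
    have hregN := h.regOn hR hN hreg.sq
    obtain ⟨Φ', h1, h2, h3⟩ := H N hN Φ₁ fun s hs => hregN.mem_smulTop (y := y ^ 2) (by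
      have h4 := hΦ₁ s
      have h5 := map_mem_smulTop Λ Φ hs
      have := sub_mem h5 h4
      rwa [show Φ (q₁ s) - ((Φ ∘ₗ q₁) s - y ^ 2 • Φ₁ s) = y ^ 2 • Φ₁ s from
        sub_sub_cancel _ _] at this)
    refine ⟨Φ', h1, fun hA => ?_, fun X _ _ _ _ hX f ⟨B, hB⟩ => h3 X hX f ?_⟩
    · obtain ⟨A₁, hA₁⟩ := h2 hA
      exact climb_extends hregN hq hΦ (fun u hu => (hq₁ u).1 hu) hΦ₁ hA₁
    · exact climb_comp (h.regOn hR hX hreg.sq) (fun s => (hq₁ _).2 ⟨s, rfl⟩) hΦ₁ f hB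

end ClimbAll

section Factor

variable {Λ : Type u} [Ring Λ] {F₁ F N : Type u} [AddCommGroup F₁] [Module Λ F₁]
  [AddCommGroup F] [Module Λ F] [AddCommGroup N] [Module Λ N]

/-- A map on a cover of a submodule `range q` descends and extends along the inclusion. -/
theorem ExtZ.exists_factor {q : F₁ →ₗ[Λ] F} (h : ExtZ Λ 1 (F ⧸ LinearMap.range q) N)
    {Φ : F₁ →ₗ[Λ] N} (hq : ∀ u, q u = 0 → Φ u = 0) : ∃ A : F →ₗ[Λ] N, ∀ u, Φ u = A (q u) := by
  obtain ⟨φ, hφ⟩ := exists_desc q.rangeRestrict q.surjective_rangeRestrict Φ fun u hu =>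
    hq u (congrArg Subtype.val hu)
  obtain ⟨A, hA⟩ := h.extend (A := LinearMap.range q) (f := (LinearMap.range q).subtype)
    (g := (LinearMap.range q).mkQ) (Submodule.subtype_injective _)
    (LinearMap.exact_subtype_mkQ _) (Submodule.mkQ_surjective _) φ
  exact ⟨A, fun u => by rw [← hφ, ← hA]; rfl⟩

end Factor

section Frobenius

variable {R : Type u} [CommRing R] [IsNoetherianRing R] {I 𝔟 : Ideal R} {k : ℕ}

/-- `R / 𝔟` is self-injective. -/
theorem RegSeq.baer (h : RegSeq I k 𝔟) (hk : InjDim R k) : Module.Baer (R ⧸ 𝔟) (R ⧸ 𝔟) := by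
  intro J g
  obtain ⟨m₁, p, hp⟩ := Module.Finite.exists_fin' R (J.comap (Ideal.Quotient.mk 𝔟))
  let q : (Fin m₁ → R) →ₗ[R] (Fin 1 → R) :=
    LinearMap.pi fun _ => (J.comap (Ideal.Quotient.mk 𝔟)).subtype ∘ₗ p
  have hqp : ∀ u, q u 0 = p u := fun u => rfl
  let g' : (Fin m₁ → R) →ₗ[R] R ⧸ 𝔟 :=
    { toFun := fun u => g ⟨Ideal.Quotient.mk 𝔟 (p u), (p u).2⟩
      map_add' := fun a b => by
        rw [← map_add]
        congr 1
        ext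
        simp
      map_smul' := fun r a => by
        refine Eq.trans ?_ (map_smul g (Ideal.Quotient.mk 𝔟 r) _)
        congr 1
        ext
        simp }
  obtain ⟨Φ, hΦ⟩ := exists_lift 𝔟.mkQ g' fun u => Submodule.mkQ_surjective _ _
  replace hΦ : ∀ u, Ideal.Quotient.mk 𝔟 (Φ u) = g ⟨Ideal.Quotient.mk 𝔟 (p u), (p u).2⟩ := hΦ
  have hself : ∀ x : R, x ∈ smulTop R 𝔟 R ↔ x ∈ 𝔟 := fun x => by
    rw [mem_smulTop, smul_eq_mul, Ideal.mul_top]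
  obtain ⟨m₁', m', q', hE', H⟩ := h.climb hk (IsMCM.of_projective (N := R)) q
    (fun v hv => by
      rw [mem_smulTop, mem_smul_top_pi] at hv
      obtain ⟨u, hu⟩ := hp ⟨v 0, by
        rw [Ideal.mem_comap, Ideal.Quotient.eq_zero_iff_mem.2 (hv 0)]; exact J.zero_mem⟩
      refine ⟨u, ?_⟩
      ext j
      rw [Subsingleton.elim j 0, hqp, hu])
    (hk _ inferInstance)
  obtain ⟨Φ', h1, h2, -⟩ := H R (IsMCM.of_projective (N := R)) Φ fun u hu => by
    rw [mem_smulTop, mem_smul_top_pi] at hu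
    rw [hself, ← Ideal.Quotient.eq_zero_iff_mem, hΦ]
    rw [show (⟨Ideal.Quotient.mk 𝔟 (p u), (p u).2⟩ : J) = 0 from
      Subtype.ext (Ideal.Quotient.eq_zero_iff_mem.2 (hu 0)), map_zero]
  obtain ⟨A, hA⟩ := h2 ((hE' 0).exists_factor h1)
  refine ⟨LinearMap.toSpanSingleton (R ⧸ 𝔟) (R ⧸ 𝔟) (Ideal.Quotient.mk 𝔟 (A fun _ => 1)),
    fun x hx => ?_⟩
  obtain ⟨x, rfl⟩ := Ideal.Quotient.mk_surjective x
  obtain ⟨u, hu⟩ := hp ⟨x, hx⟩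
  have h3 := hA u
  rw [hself, ← Ideal.Quotient.eq_zero_iff_mem, map_sub, sub_eq_zero, hΦ] at h3
  have h4 : q u = x • fun _ => 1 := by
    ext j
    rw [Subsingleton.elim j 0, hqp, hu]
    simp
  rw [h4, map_smul, smul_eq_mul, map_mul] at h3
  rw [LinearMap.toSpanSingleton_apply, smul_eq_mul, ← h3]
  congr 1
  ext
  rw [hu]

variable {L L' : Type u} [AddCommGroup L] [Module R L] [AddCommGroup L'] [Module R L']

/-- Functionals with values in `R / 𝔟` extend along injections of modules killed by `𝔟`. -/
theorem RegSeq.exists_extend (h : RegSeq I k 𝔟) (hk : InjDim R k)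
    (hL : ∀ r ∈ 𝔟, ∀ x : L, r • x = 0) (f : L' →ₗ[R] L) (hf : Function.Injective f)
    (φ : L' →ₗ[R] R ⧸ 𝔟) : ∃ ψ : L →ₗ[R] R ⧸ 𝔟, ∀ x, ψ (f x) = φ x := by
  have hL1 : Module.IsTorsionBySet R L 𝔟 := fun x r => hL r r.2 x
  have hL2 : Module.IsTorsionBySet R L' 𝔟 := fun x r => hf (by
    rw [map_smul, map_zero]; exact hL r r.2 _)
  let _ := hL1.module
  let _ := hL2.module
  let f' : L' →ₗ[R ⧸ 𝔟] L := ⟨f.toAddHom, fun c x => by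
    obtain ⟨c, rfl⟩ := Ideal.Quotient.mk_surjective c
    exact map_smul f c x⟩
  let φ' : L' →ₗ[R ⧸ 𝔟] R ⧸ 𝔟 := ⟨φ.toAddHom, fun c x => by
    obtain ⟨c, rfl⟩ := Ideal.Quotient.mk_surjective c
    exact map_smul φ c x⟩
  obtain ⟨ψ, hψ⟩ := (h.baer hk).extension_property f' hf φ'
  exact ⟨⟨ψ.toAddHom, fun c x => map_smul ψ (Ideal.Quotient.mk 𝔟 c) x⟩,
    fun x => LinearMap.congr_fun hψ x⟩

/-- Functionals with values in `R / 𝔟` separate points of modules killed by `𝔟`. -/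
theorem RegSeq.exists_ne_zero [IsLocalRing R] (h : RegSeq I k 𝔟) (hk : InjDim R k)
    {ι : (R ⧸ IsLocalRing.maximalIdeal R) →ₗ[R] R ⧸ 𝔟} (hι : Function.Injective ι)
    (hL : ∀ r ∈ 𝔟, ∀ x : L, r • x = 0) {x : L} (hx : x ≠ 0) :
    ∃ ψ : L →ₗ[R] R ⧸ 𝔟, ψ x ≠ 0 := by
  have hx' : ∀ r, r • x = 0 → r ∈ IsLocalRing.maximalIdeal R := fun r hr hu => hx (by
    obtain ⟨s, hs⟩ := hu.exists_left_inv
    rw [← one_smul R x, ← hs, mul_smul, hr, smul_zero])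
  let s := LinearMap.toSpanSingleton R L x
  obtain ⟨φ, hφ⟩ := exists_desc s.rangeRestrict s.surjective_rangeRestrict
    (ι ∘ₗ (IsLocalRing.maximalIdeal R).mkQ) fun r hr => by
      have h1 : r • x = 0 := congrArg Subtype.val hr
      rw [LinearMap.comp_apply, Submodule.mkQ_apply, (Submodule.Quotient.mk_eq_zero _).2 (hx' r h1),
        map_zero]
  obtain ⟨ψ, hψ⟩ := h.exists_extend hk hL (LinearMap.range s).subtype
    (Submodule.subtype_injective _) φ
  refine ⟨ψ, fun h0 => ?_⟩
  have h1 : ψ x = ι (Submodule.Quotient.mk 1) := by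
    have h2 := hφ 1
    rw [← hψ] at h2
    rw [show (LinearMap.range s).subtype (s.rangeRestrict 1) = x from one_smul R x] at h2
    exact h2
  rw [h0] at h1
  have h3 := hι (h1.symm.trans (map_zero ι).symm)
  rw [Submodule.Quotient.mk_eq_zero] at h3
  exact (IsLocalRing.maximalIdeal.isMaximal R).ne_top ((Ideal.eq_top_iff_one _).2 h3)

/-- A point outside a submodule is separated from it by a functional. -/
theorem RegSeq.exists_separating [IsLocalRing R] (h : RegSeq I k 𝔟) (hk : InjDim R k)
    {ι : (R ⧸ IsLocalRing.maximalIdeal R) →ₗ[R] R ⧸ 𝔟} (hι : Function.Injective ι)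
    (hL : ∀ r ∈ 𝔟, ∀ x : L, r • x = 0) {T : Submodule R L} {x : L} (hx : x ∉ T) :
    ∃ ψ : L →ₗ[R] R ⧸ 𝔟, (∀ y ∈ T, ψ y = 0) ∧ ψ x ≠ 0 := by
  obtain ⟨ψ, hψ⟩ := h.exists_ne_zero hk hι (L := L ⧸ T) (fun r hr x => by
    obtain ⟨x, rfl⟩ := Submodule.Quotient.mk_surjective _ x
    rw [← Submodule.Quotient.mk_smul, hL r hr, Submodule.Quotient.mk_zero])
    (x := Submodule.Quotient.mk x) (by rwa [Ne, Submodule.Quotient.mk_eq_zero])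
  exact ⟨ψ ∘ₗ T.mkQ, fun y hy => by
    rw [LinearMap.comp_apply, Submodule.mkQ_apply, (Submodule.Quotient.mk_eq_zero _).2 hy,
      map_zero], hψ⟩

end Frobenius

section Retract

variable {Λ : Type u} [Ring Λ] {X : Type w} {Y : Type w₁} {Z : Type w₂} [AddCommGroup X] [Module Λ X]
  [AddCommGroup Y] [Module Λ Y] [AddCommGroup Z] [Module Λ Z]

variable (Λ X Y) in
/-- `X` is a direct summand of `Y`, up to isomorphism. -/
def IsRetract : Prop := ∃ (i : X →ₗ[Λ] Y) (p : Y →ₗ[Λ] X), ∀ x, p (i x) = x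

theorem IsRetract.of_equiv (e : X ≃ₗ[Λ] Y) : IsRetract Λ X Y :=
  ⟨e, e.symm, e.symm_apply_apply⟩

theorem IsRetract.trans (h : IsRetract Λ X Y) (h' : IsRetract Λ Y Z) : IsRetract Λ X Z := by
  obtain ⟨i, p, hp⟩ := h
  obtain ⟨i', p', hp'⟩ := h'
  exact ⟨i' ∘ₗ i, p ∘ₗ p', fun x => by simp [hp, hp']⟩

theorem IsRetract.inl : IsRetract Λ X (X × Y) :=
  ⟨LinearMap.inl Λ X Y, LinearMap.fst Λ X Y, fun _ => rfl⟩

theorem IsRetract.projective (h : IsRetract Λ X Y) [Module.Projective Λ Y] :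
    Module.Projective Λ X := by
  obtain ⟨i, p, hp⟩ := h
  exact Module.Projective.of_split i p (LinearMap.ext hp)

theorem IsRetract.finite (h : IsRetract Λ X Y) [Module.Finite Λ Y] : Module.Finite Λ X := by
  obtain ⟨i, p, hp⟩ := h
  exact Module.Finite.of_surjective p fun x => ⟨i x, hp x⟩

theorem isRetract_of_isUnit {i : X →ₗ[Λ] Y} {p : Y →ₗ[Λ] X}
    (h : IsUnit (p ∘ₗ i : Module.End Λ X)) : IsRetract Λ X Y := by
  obtain ⟨g, hg⟩ := h.exists_left_inv
  exact ⟨i, g ∘ₗ p, LinearMap.congr_fun hg⟩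

theorem IsRetract.prod (h : IsLocalRing (Module.End Λ X)) (hX : IsRetract Λ X (Y × Z)) :
    IsRetract Λ X Y ∨ IsRetract Λ X Z := by
  obtain ⟨i, p, hp⟩ := hX
  have h1 : ((p ∘ₗ LinearMap.inl Λ Y Z) ∘ₗ (LinearMap.fst Λ Y Z ∘ₗ i) +
      (p ∘ₗ LinearMap.inr Λ Y Z) ∘ₗ (LinearMap.snd Λ Y Z ∘ₗ i) : Module.End Λ X) = 1 := by
    ext x
    simp only [LinearMap.add_apply, LinearMap.comp_apply, ← map_add]
    simp [hp]
  obtain h2 | h2 := IsLocalRing.isUnit_or_isUnit_of_add_one h1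
  · exact .inl (isRetract_of_isUnit h2)
  · exact .inr (isRetract_of_isUnit h2)

theorem IsRetract.pi (h : IsLocalRing (Module.End Λ X)) {m : ℕ}
    (hX : IsRetract Λ X (Fin m → Y)) : IsRetract Λ X Y := by
  induction m with
  | zero =>
    obtain ⟨i, p, hp⟩ := hX
    have : Subsingleton X := ⟨fun x y => by rw [← hp x, ← hp y, Subsingleton.elim (i x) (i y)]⟩
    exact (not_subsingleton (Module.End Λ X) inferInstance).elim
  | succ m ih =>
    obtain h1 | h1 := IsRetract.prod h
      (hX.trans (IsRetract.of_equiv (Fin.consLinearEquiv Λ fun _ => Y).symm))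
    · exact h1
    · exact ih h1

theorem isRetract_prod_pi {m n : ℕ} (hX : IsRetract Λ X (Fin m → Z))
    (hY : IsRetract Λ Y (Fin n → Z)) : IsRetract Λ (X × Y) (Fin (m + n) → Z) := by
  obtain ⟨i, p, hp⟩ := hX
  obtain ⟨j, q, hq⟩ := hY
  have h : IsRetract Λ ((Fin m → Z) × (Fin n → Z)) (Fin (m + n) → Z) :=
    IsRetract.of_equiv ((LinearEquiv.sumArrowLequivProdArrow (Fin m) (Fin n) Λ Z).symm.trans
      (LinearEquiv.funCongrLeft Λ Z finSumFinEquiv.symm))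
  exact IsRetract.trans ⟨i.prodMap j, p.prodMap q, fun x => by simp [hp, hq]⟩ h

theorem isRetract_range {e : Module.End Λ Y} (he : e * e = e) :
    IsRetract Λ (LinearMap.range e) Y :=
  ⟨(LinearMap.range e).subtype, e.rangeRestrict, fun ⟨x, y, hy⟩ => Subtype.ext (by
    subst hy; exact LinearMap.congr_fun he y)⟩

theorem bijective_of_leftInverse {i : X →ₗ[Λ] Y} {p : Y →ₗ[Λ] X} (hp : ∀ x, p (i x) = x)
    (hY : IsIndecomposableModule Λ Y) [Nontrivial X] : Function.Bijective i := by
  have hi : Function.Injective i := Function.LeftInverse.injective hp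
  have hc : IsCompl (LinearMap.range i) (LinearMap.ker p) := by
    constructor
    · rw [Submodule.disjoint_def]
      rintro _ ⟨x, rfl⟩ hx
      rw [LinearMap.mem_ker, hp] at hx
      rw [hx, map_zero]
    · rw [codisjoint_iff, eq_top_iff]
      intro y _
      rw [← add_sub_cancel (i (p y)) y]
      exact Submodule.add_mem_sup ⟨_, rfl⟩ (by rw [LinearMap.mem_ker, map_sub, hp, sub_self])
  obtain h1 | h1 := hY.2 _ _ hc
  · obtain ⟨x, hx⟩ := exists_ne (0 : X)
    have h2 : i x = 0 := by
      have : i x ∈ LinearMap.range i := ⟨x, rfl⟩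
      rwa [h1, Submodule.mem_bot] at this
    exact (hx (hi (h2.trans (map_zero i).symm))).elim
  · refine ⟨hi, fun y => ⟨p y, ?_⟩⟩
    have : y - i (p y) ∈ LinearMap.ker p := by rw [LinearMap.mem_ker, map_sub, hp, sub_self]
    rw [h1, Submodule.mem_bot, sub_eq_zero] at this
    exact this.symm

theorem IsRetract.nonempty_equiv (h : IsRetract Λ X Y) (hY : IsIndecomposableModule Λ Y)
    [Nontrivial X] : Nonempty (X ≃ₗ[Λ] Y) := by
  obtain ⟨i, p, hp⟩ := h
  exact ⟨LinearEquiv.ofBijective i (bijective_of_leftInverse hp hY)⟩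

theorem nontrivial_of_isLocalRing_end (h : IsLocalRing (Module.End Λ X)) : Nontrivial X := by
  by_contra hX
  rw [not_nontrivial_iff_subsingleton] at hX
  exact not_subsingleton (Module.End Λ X) inferInstance

theorem isIndecomposableModule_of_isLocalRing_end (h : IsLocalRing (Module.End Λ X)) :
    IsIndecomposableModule Λ X := by
  refine ⟨nontrivial_of_isLocalRing_end h, fun P Q hPQ => ?_⟩
  have key : ∀ P Q : Submodule Λ X, ∀ hPQ : IsCompl P Q, IsUnit (P.projection Q hPQ) → Q = ⊥ := by
    intro P Q hPQ hu
    rw [eq_bot_iff]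
    intro x hx
    refine ((Module.End.isUnit_iff _).1 hu).1 ?_
    rw [map_zero, Submodule.projection_apply_eq_zero_iff]
    exact hx
  obtain h1 | h1 := IsLocalRing.isUnit_or_isUnit_of_add_one
    (a := P.projection Q hPQ) (b := Q.projection P hPQ.symm) (by
      ext x
      exact Submodule.projection_add_projection_eq_self hPQ x)
  · exact .inr (key _ _ _ h1)
  · exact .inl (key _ _ _ h1)

theorem isLocalRing_end_congr (e : X ≃ₗ[Λ] Y) (h : IsLocalRing (Module.End Λ X)) :
    IsLocalRing (Module.End Λ Y) := by
  have := nontrivial_of_isLocalRing_end h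
  have : Nontrivial Y := e.symm.toEquiv.nontrivial
  refine .of_isUnit_or_isUnit_one_sub_self fun a => ?_
  let φ : Module.End Λ Y ≃+* Module.End Λ X := e.symm.conjRingEquiv
  obtain h1 | h1 := IsLocalRing.isUnit_or_isUnit_of_add_one (add_sub_cancel (φ a) 1)
  · exact .inl ((MulEquiv.isUnit_map φ).1 h1)
  · exact .inr ((MulEquiv.isUnit_map φ).1 (by rwa [map_sub, map_one]))

end Retract

section FiniteAlgebra

variable (R : Type u) [CommRing R] [IsNoetherianRing R] [IsLocalRing R]
  [IsAdicComplete (IsLocalRing.maximalIdeal R) R] {Λ : Type u} [Ring Λ] [Algebra R Λ]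
  [Module.Finite R Λ]

include R

theorem isLocalRing_end {M : Type w} [AddCommGroup M] [Module Λ M] [Module.Finite Λ M]
    (hM : IsIndecomposableModule Λ M) : IsLocalRing (Module.End Λ M) := by
  let _ : Module R M := Module.compHom M (algebraMap R Λ)
  have : IsScalarTower R Λ M := ⟨fun r l m => by rw [Algebra.smul_def, mul_smul]; rfl⟩
  have := hM.1
  exact .of_isUnit_or_isUnit_one_sub_self (isUnit_or_isUnit_one_sub (R := R) hM)

omit [IsLocalRing R] [IsAdicComplete (IsLocalRing.maximalIdeal R) R] in
/-- A finitely generated module has finitely many indecomposable summands. -/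
theorem finite_retracts (M : Type u) [AddCommGroup M] [Module Λ M] [Module.Finite Λ M] :
    ∃ (r : ℕ) (Q : Fin r → ModuleCat.{u} Λ), ∀ (X : Type u) [AddCommGroup X] [Module Λ X],
      IsLocalRing (Module.End Λ X) → IsRetract Λ X M → ∃ j, Nonempty (X ≃ₗ[Λ] Q j) := by
  have : IsNoetherianRing Λ := isNoetherian_of_tower R inferInstance
  refine decomposition_induction (Λ := Λ) (M := M) (fun M _ _ =>
    ∃ (r : ℕ) (Q : Fin r → ModuleCat.{u} Λ), ∀ (X : Type u) [AddCommGroup X] [Module Λ X],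
      IsLocalRing (Module.End Λ X) → IsRetract Λ X M → ∃ j, Nonempty (X ≃ₗ[Λ] Q j)) ?_ ?_ ?_ ?_
  · rintro M N _ _ _ _ e ⟨r, Q, h⟩
    exact ⟨r, Q, fun X _ _ hX hXN => h X hX (hXN.trans (.of_equiv e.symm))⟩
  · intro M _ _ hM
    refine ⟨0, Fin.elim0, fun X _ _ hX ⟨i, p, hp⟩ => ?_⟩
    have := nontrivial_of_isLocalRing_end hX
    have : Subsingleton X := ⟨fun x y => by rw [← hp x, ← hp y, Subsingleton.elim (i x) (i y)]⟩
    exact (not_subsingleton X inferInstance).elim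
  · intro M _ _ _ hM
    refine ⟨1, fun _ => ModuleCat.of Λ M, fun X _ _ hX hXM => ⟨0, ?_⟩⟩
    have := nontrivial_of_isLocalRing_end hX
    exact hXM.nonempty_equiv hM
  · rintro M N _ _ _ _ ⟨r, Q, h⟩ ⟨r', Q', h'⟩
    refine ⟨r + r', Fin.append Q Q', fun X _ _ hX hXMN => ?_⟩
    obtain h1 | h1 := hXMN.prod hX
    · obtain ⟨j, hj⟩ := h X hX h1
      exact ⟨Fin.castAdd r' j, by rwa [Fin.append_left]⟩
    · obtain ⟨j, hj⟩ := h' X hX h1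
      exact ⟨Fin.natAdd r j, by rwa [Fin.append_right]⟩

end FiniteAlgebra

section Idempotents

variable {Λ : Type u} [Ring Λ] {X : Type w} [AddCommGroup X] [Module Λ X]

/-- Primitive idempotents. -/
def IsPrimitiveIdem {S : Type w} [Ring S] (e : S) : Prop :=
  e * e = e ∧ e ≠ 0 ∧ ∀ g, g * g = g → e * g = g → g * e = g → g = 0 ∨ g = e

theorem apply_eq_of_mem_range {e : Module.End Λ X} (he : e * e = e) {x : X}
    (hx : x ∈ LinearMap.range e) : e x = x := by
  obtain ⟨y, rfl⟩ := hx
  exact LinearMap.congr_fun he y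

theorem nonempty_range_equiv_iff {e f : Module.End Λ X} (he : e * e = e) (hf : f * f = f) :
    Nonempty (LinearMap.range e ≃ₗ[Λ] LinearMap.range f) ↔
      ∃ a b : Module.End Λ X, a * b = f ∧ b * a = e := by
  constructor
  · rintro ⟨ε⟩
    refine ⟨(LinearMap.range f).subtype ∘ₗ ε.toLinearMap ∘ₗ e.rangeRestrict,
      (LinearMap.range e).subtype ∘ₗ ε.symm.toLinearMap ∘ₗ f.rangeRestrict, ?_, ?_⟩
    · ext x
      have : e.rangeRestrict (ε.symm (f.rangeRestrict x)).1 = ε.symm (f.rangeRestrict x) :=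
        Subtype.ext (apply_eq_of_mem_range he (ε.symm (f.rangeRestrict x)).2)
      simp [this]
    · ext x
      have : f.rangeRestrict (ε (e.rangeRestrict x)).1 = ε (e.rangeRestrict x) :=
        Subtype.ext (apply_eq_of_mem_range hf (ε (e.rangeRestrict x)).2)
      simp [this]
  · rintro ⟨a, b, hab, hba⟩
    have h1 : ∀ x, f (a (e x)) = a (e x) := fun x => by
      have : f * (a * e) = a * e := by
        rw [← hba, ← mul_assoc a, hab, ← mul_assoc, hf]
      exact LinearMap.congr_fun this x
    have h2 : ∀ x, e (b (f x)) = b (f x) := fun x => by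
      have : e * (b * f) = b * f := by
        rw [← hab, ← mul_assoc b, hba, ← mul_assoc, he]
      exact LinearMap.congr_fun this x
    refine ⟨LinearEquiv.ofLinearMap
      ((a ∘ₗ (LinearMap.range e).subtype).codRestrict (LinearMap.range f) ?_)
      ((b ∘ₗ (LinearMap.range f).subtype).codRestrict (LinearMap.range e) ?_) ?_ ?_⟩
    · rintro ⟨_, x, rfl⟩
      exact ⟨_, h1 x⟩
    · rintro ⟨_, x, rfl⟩
      exact ⟨_, h2 x⟩
    · ext ⟨x, hx⟩
      exact (LinearMap.congr_fun hab x).trans (apply_eq_of_mem_range hf hx)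
    · ext ⟨x, hx⟩
      exact (LinearMap.congr_fun hba x).trans (apply_eq_of_mem_range he hx)

theorem isIndecomposableModule_range_iff {e : Module.End Λ X} (he : e * e = e) :
    IsIndecomposableModule Λ (LinearMap.range e) ↔ IsPrimitiveIdem e := by
  constructor
  · intro h
    refine ⟨he, ?_, fun g hg heg hge => ?_⟩
    · rintro rfl
      have := h.1
      obtain ⟨⟨_, x, rfl⟩, hx⟩ := exists_ne (0 : LinearMap.range (0 : Module.End Λ X))
      exact hx (Subtype.ext rfl)
    · have hge' : ∀ x, g (e x) = g x := LinearMap.congr_fun hge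
      have heg' : ∀ x, e (g x) = g x := LinearMap.congr_fun heg
      have hg' : ∀ x, g (g x) = g x := LinearMap.congr_fun hg
      obtain h1 | h1 := h.2 ((LinearMap.range g).comap (LinearMap.range e).subtype)
        ((LinearMap.ker g).comap (LinearMap.range e).subtype) (by
          constructor
          · rw [Submodule.disjoint_def]
            rintro ⟨x, hx⟩ ⟨y, hy⟩ h
            change g x = 0 at h
            refine Subtype.ext ?_
            change g y = x at hy
            rw [← hy, hg', hy] at h
            exact h
          · rw [codisjoint_iff, eq_top_iff]
            rintro ⟨_, x, rfl⟩ -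
            have : (⟨e x, x, rfl⟩ : LinearMap.range e) = ⟨g x, g x, heg' x⟩ +
                ⟨e x - g x, x - g x, by rw [map_sub, heg']⟩ :=
              Subtype.ext (add_sub_cancel _ _).symm
            rw [this]
            refine Submodule.add_mem_sup ⟨x, rfl⟩ ?_
            change g (e x - g x) = 0
            rw [map_sub, hge', hg', sub_self])
      · left
        ext x
        have : (⟨g x, g x, heg' x⟩ : LinearMap.range e) ∈
            (LinearMap.range g).comap (LinearMap.range e).subtype := ⟨x, rfl⟩
        rw [h1, Submodule.mem_bot] at this
        exact congrArg Subtype.val this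
      · right
        ext x
        have : (⟨e x - g x, x - g x, by rw [map_sub, heg']⟩ : LinearMap.range e) ∈
            (LinearMap.ker g).comap (LinearMap.range e).subtype := by
          change g (e x - g x) = 0
          rw [map_sub, hge', hg', sub_self]
        rw [h1, Submodule.mem_bot] at this
        exact (sub_eq_zero.1 (congrArg Subtype.val this)).symm
  · intro ⟨_, h0, h⟩
    have he' : ∀ x, e (e x) = e x := LinearMap.congr_fun he
    refine ⟨?_, fun P Q hPQ => ?_⟩
    · by_contra hn
      rw [not_nontrivial_iff_subsingleton] at hn
      refine h0 (LinearMap.ext fun x => ?_)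
      exact congrArg Subtype.val (Subsingleton.elim (⟨e x, x, rfl⟩ : LinearMap.range e) 0)
    · let g : Module.End Λ X :=
        (LinearMap.range e).subtype ∘ₗ (P.projection Q hPQ) ∘ₗ e.rangeRestrict
      have hr : ∀ x : LinearMap.range e, e.rangeRestrict x.1 = x := fun x =>
        Subtype.ext (apply_eq_of_mem_range he x.2)
      have hgx : ∀ x : LinearMap.range e, g x.1 = (P.projection Q hPQ x).1 := fun x => by
        simp only [g, LinearMap.comp_apply, hr]; rfl
      obtain h1 | h1 := h g (by
          ext x
          simp only [g, Module.End.mul_apply, LinearMap.comp_apply, Submodule.subtype_apply, hr]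
          congr 1
          exact Submodule.projection_eq_self_iff hPQ _ |>.2 (by simp)) (by
          ext x
          exact apply_eq_of_mem_range he (Subtype.prop _)) (by
          ext x
          simp only [g, Module.End.mul_apply, LinearMap.comp_apply]
          congr 2
          exact Subtype.ext (he' x))
      · left
        rw [eq_bot_iff]
        intro x hx
        have h2 : P.projection Q hPQ x = x := (Submodule.projection_eq_self_iff hPQ _).2 hx
        have h3 := hgx x
        rw [h1, h2] at h3
        exact Subtype.ext h3.symm
      · right
        rw [eq_bot_iff]
        intro x hx
        have h2 : P.projection Q hPQ x = 0 := (Submodule.projection_apply_eq_zero_iff hPQ).2 hx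
        have h3 := hgx x
        rw [h1, h2, apply_eq_of_mem_range he x.2] at h3
        exact Subtype.ext h3

end Idempotents

section Datum

variable {R : Type u} [CommRing R] {Λ : Type u} [Ring Λ] [Algebra R Λ]
  {W : Type u} [AddCommGroup W] [Module R W] [Module Λ W] [IsScalarTower R Λ W] {t : W →ₗ[R] R}

theorem IsDatum.extZ_iff [IsNoetherianRing Λ] (ht : IsDatum Λ t) (hΛ : IsMCM R Λ) (i : ℕ) :
    ∀ (L : Type u) [AddCommGroup L] [Module R L] [Module Λ L] [IsScalarTower R Λ L],
      Module.Finite Λ L → (ExtZ Λ (i + 1) L W ↔ ExtZ R (i + 1) L R) := by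
  induction i with
  | zero =>
    intro L _ _ _ _ hL
    obtain ⟨m, q, hq⟩ := Module.Finite.exists_fin' Λ L
    constructor
    · intro h
      have hF : IsMCM R (Fin m → Λ) := IsMCM.of_projective_algebra hΛ
      rw [extZ_one_iff]
      refine Ext1Z.of_presentation (extZ_one_iff.1 (hF.2 0))
        (f := (LinearMap.ker q).subtype.restrictScalars R) (g := q.restrictScalars R)
        (LinearMap.exact_subtype_ker_map q) hq fun φ => ?_
      obtain ⟨f, hf⟩ := ht.exists_hom (X := LinearMap.ker q) φ
      obtain ⟨g, hg⟩ := h.extend (Submodule.injective_subtype _)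
        (LinearMap.exact_subtype_ker_map q) hq f
      exact ⟨t ∘ₗ g.restrictScalars R, fun x => (congrArg t (hg x)).trans (hf x)⟩
    · intro h
      refine ExtZ.of_extend (Submodule.injective_subtype _)
        (LinearMap.exact_subtype_ker_map q) hq fun φ => ?_
      obtain ⟨ψ, hψ⟩ := h.extend (f := (LinearMap.ker q).subtype.restrictScalars R)
        (g := q.restrictScalars R) (Submodule.injective_subtype _)
        (LinearMap.exact_subtype_ker_map q) hq (t ∘ₗ φ.restrictScalars R)
      obtain ⟨f, hf⟩ := ht.exists_hom ψ
      refine ⟨f, LinearMap.congr_fun (ht.ext (f := f ∘ₗ (LinearMap.ker q).subtype) fun x => ?_)⟩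
      exact (hf _).trans (hψ x)
  | succ i ih =>
    intro L _ _ _ _ hL
    obtain ⟨m, q, hq⟩ := Module.Finite.exists_fin' Λ L
    have hF : IsMCM R (Fin m → Λ) := IsMCM.of_projective_algebra hΛ
    have h1 := ih (LinearMap.ker q) inferInstance
    have hex : Function.Exact ((LinearMap.ker q).subtype.restrictScalars R)
      (q.restrictScalars R) := LinearMap.exact_subtype_ker_map q
    have hinj : Function.Injective ((LinearMap.ker q).subtype.restrictScalars R) :=
      Submodule.injective_subtype _
    constructor
    · intro h
      exact ExtZ.right (f := (LinearMap.ker q).subtype.restrictScalars R)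
        (g := q.restrictScalars R) hinj hex hq
        (h1.1 (ExtZ.left (Submodule.injective_subtype _) (LinearMap.exact_subtype_ker_map q) hq
          ExtZ.of_projective h)) (hF.2 _)
    · intro h
      exact ExtZ.right (Submodule.injective_subtype _) (LinearMap.exact_subtype_ker_map q) hq
        (h1.2 (ExtZ.left (f := (LinearMap.ker q).subtype.restrictScalars R)
          (g := q.restrictScalars R) hinj hex hq (hF.2 _) h)) ExtZ.of_projective

variable [IsNoetherianRing R] {n : ℕ}

/-- The endomorphism rings of `Λ` and of the dualizing module agree. -/
theorem IsDatum.exists_end (ht : IsDatum Λ t) (hΛ : IsMCM R Λ) (hR : InjDim R n) :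
    ∃ Φ : Module.End Λ Λ → Module.End Λ W, Function.Bijective Φ ∧
      (∀ f g, Φ (f * g) = Φ f * Φ g) ∧ Φ 0 = 0 := by
  have h (f : Module.End Λ Λ) : ∃ ψ : W →ₗ[Λ] W, ∀ w, t (ψ w) = t (f 1 • w) :=
    ht.exists_hom (t ∘ₗ Algebra.lsmul R R W (f 1))
  choose Φ hΦ using h
  refine ⟨Φ, ⟨fun f f' hff => ?_, fun ψ => ?_⟩, fun f g => ht.ext fun w => ?_,
    ht.ext fun w => ?_⟩
  · refine LinearMap.ext_ring (sub_eq_zero.1 (hΛ.eq_zero hR fun φ => ?_))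
    obtain ⟨w, hw⟩ := ht.exists_eq φ
    rw [hw, sub_smul, map_sub, ← hΦ, ← hΦ, hff, sub_self]
  · let j : W →ₗ[R] Module.Dual R Λ :=
      { toFun := fun w => t ∘ₗ (LinearMap.toSpanSingleton Λ W w).restrictScalars R
        map_add' := fun x y => by ext l; simp
        map_smul' := fun r x => by
          ext l
          simp only [LinearMap.comp_apply, LinearMap.coe_restrictScalars,
            LinearMap.toSpanSingleton_apply, LinearMap.smul_apply, RingHom.id_apply, ← map_smul]
          rw [← algebraMap_smul Λ r x, ← algebraMap_smul Λ r (l • x), ← mul_smul, ← mul_smul,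
            Algebra.commutes] }
    have hj : Function.Bijective j := by
      constructor
      · rw [← LinearMap.ker_eq_bot, LinearMap.ker_eq_bot']
        exact fun w hw => ht.eq_zero w fun l => LinearMap.congr_fun hw l
      · intro φ
        obtain ⟨w, hw⟩ := ht.exists_eq φ
        exact ⟨w, LinearMap.ext fun l => (hw l).symm⟩
    let e := LinearEquiv.ofBijective j hj
    obtain ⟨a, ha⟩ := hΛ.exists_eval hR (t ∘ₗ ψ.restrictScalars R ∘ₗ e.symm.toLinearMap)
    refine ⟨LinearMap.toSpanSingleton Λ Λ a, ht.ext fun w => ?_⟩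
    have h1 := ha (e w)
    simp only [LinearMap.comp_apply, LinearEquiv.coe_coe, LinearEquiv.symm_apply_apply,
      LinearMap.coe_restrictScalars] at h1
    rw [hΦ, LinearMap.toSpanSingleton_apply, one_smul, h1]
    rfl
  · rw [hΦ, Module.End.mul_apply, Module.End.mul_apply, hΦ, ← map_smul, hΦ, ← mul_smul,
      ← smul_eq_mul, ← map_smul, smul_eq_mul, mul_one]
  · rw [hΦ]
    simp

end Datum

section Order

variable (R : Type u) [CommRing R] (Λ : Type u) [Ring Λ] [Algebra R Λ]

/-- Gorenstein orders over a Gorenstein ring, in terms of a dualizing functional. -/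
structure IsGorensteinOrder : Prop where
  finite : Module.Finite R Λ
  mcm : IsMCM R Λ
  injDim : ∃ n, InjDim R n
  datum : ∃ (W : Type u) (_ : AddCommGroup W) (_ : Module R W) (_ : Module Λ W)
    (_ : IsScalarTower R Λ W) (t : W →ₗ[R] R), IsDatum Λ t

variable {R}

/-- Finitely generated modules without extensions by the ring. -/
structure IsCM (N : Type u) [AddCommGroup N] [Module Λ N] : Prop where
  finite : Module.Finite Λ N
  ext : ∀ i, ExtZ Λ (i + 1) N Λ

variable {Λ} {N : Type u} [AddCommGroup N] [Module Λ N] {A B C : Type u} [AddCommGroup A]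
  [Module Λ A] [AddCommGroup B] [Module Λ B] [AddCommGroup C] [Module Λ C]

theorem IsCM.of_projective [Module.Finite Λ N] [Module.Projective Λ N] : IsCM Λ N :=
  ⟨inferInstance, fun _ => ExtZ.of_projective⟩

theorem IsCM.congr (h : IsCM Λ A) (e : A ≃ₗ[Λ] B) : IsCM Λ B :=
  ⟨have := h.1; Module.Finite.equiv e, fun i => (h.2 i).congr e.symm⟩

theorem IsCM.of_isRetract (h : IsCM Λ B) (hA : IsRetract Λ A B) : IsCM Λ A :=
  ⟨have := h.1; hA.finite, fun i => by
    obtain ⟨f, p, hp⟩ := hA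
    exact (h.2 i).of_retract f p hp⟩

theorem IsCM.prod (hA : IsCM Λ A) (hB : IsCM Λ B) : IsCM Λ (A × B) :=
  ⟨have := hA.1; have := hB.1; inferInstance, fun i => (hA.2 i).prod (hB.2 i)⟩

theorem IsCM.of_subsingleton [Subsingleton A] : IsCM Λ A :=
  ⟨inferInstance, fun _ => ExtZ.of_subsingleton⟩

theorem IsCM.mid (hA : IsCM Λ A) (hC : IsCM Λ C) {f : A →ₗ[Λ] B} {g : B →ₗ[Λ] C}
    (hf : Function.Injective f) (hfg : Function.Exact f g) (hg : Function.Surjective g) :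
    IsCM Λ B := by
  refine ⟨?_, fun i => ExtZ.mid hf hfg hg (hA.2 i) (hC.2 i)⟩
  have := hA.1
  have := hC.1
  have : Module.Finite Λ (LinearMap.ker g) := by
    rw [LinearMap.exact_iff.1 hfg]
    infer_instance
  have : Module.Finite Λ (B ⧸ LinearMap.ker g) :=
    Module.Finite.equiv (g.quotKerEquivOfSurjective hg).symm
  exact Module.Finite.of_submodule_quotient (LinearMap.ker g)

theorem IsCM.syzygy [IsNoetherianRing Λ] (hB : IsCM Λ B) (hC : IsCM Λ C) {f : A →ₗ[Λ] B}
    {g : B →ₗ[Λ] C} (hf : Function.Injective f) (hfg : Function.Exact f g)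
    (hg : Function.Surjective g) : IsCM Λ A :=
  ⟨have := hB.1; Module.Finite.of_injective f hf, fun i => ExtZ.left hf hfg hg (hB.2 i) (hC.2 _)⟩

/-- Vanishing of `Ext` into the ring gives vanishing into finitely generated projectives. -/
theorem ExtZ.of_projective₂ {n : ℕ} (h : ExtZ Λ n N Λ) [Module.Finite Λ A]
    [Module.Projective Λ A] : ExtZ Λ n N A := by
  obtain ⟨m, q, hq⟩ := Module.Finite.exists_fin' Λ A
  obtain ⟨s, hs⟩ := Module.projective_lifting_property q LinearMap.id hq
  exact (h.finPi₂ m).of_retract₂ s q (LinearMap.congr_fun hs)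

end Order

section Retract

variable {R : Type u} [CommRing R] {Λ : Type u} [Ring Λ] [Algebra R Λ]
  {W : Type u} [AddCommGroup W] [Module R W] [Module Λ W] [IsScalarTower R Λ W] {t : W →ₗ[R] R}
  [IsNoetherianRing R] {n : ℕ} [IsLocalRing R] [IsAdicComplete (IsLocalRing.maximalIdeal R) R]
  [Module.Finite R Λ]

omit [IsNoetherianRing R] [IsLocalRing R] [IsAdicComplete (IsLocalRing.maximalIdeal R) R] in
theorem exists_idem_of_isRetract {X P : Type u} [AddCommGroup X] [Module Λ X] [AddCommGroup P]
    [Module Λ P] (h : IsRetract Λ P X) :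
    ∃ e : Module.End Λ X, e * e = e ∧ Nonempty (P ≃ₗ[Λ] LinearMap.range e) := by
  obtain ⟨i, p, hp⟩ := h
  refine ⟨i ∘ₗ p, LinearMap.ext fun x => by simp [hp], ⟨LinearEquiv.ofBijective
    (i.codRestrict (LinearMap.range (i ∘ₗ p)) fun x => ⟨i x, by simp [hp]⟩) ⟨fun x y hxy => ?_, ?_⟩⟩⟩
  · rw [← hp x, ← hp y]
    exact congrArg p (congrArg Subtype.val hxy)
  · rintro ⟨_, x, rfl⟩
    exact ⟨p x, rfl⟩

variable (R) in
include R in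
theorem isIndecomposableModule_congr {X Y : Type u} [AddCommGroup X] [Module Λ X] [AddCommGroup Y]
    [Module Λ Y] [Module.Finite Λ X] (e : X ≃ₗ[Λ] Y) (h : IsIndecomposableModule Λ X) :
    IsIndecomposableModule Λ Y :=
  isIndecomposableModule_of_isLocalRing_end (isLocalRing_end_congr e (isLocalRing_end R h))

theorem IsDatum.isRetract_pi (ht : IsDatum Λ t) (hΛ : IsMCM R Λ) (hR : InjDim R n)
    (P : Type u) [AddCommGroup P] [Module Λ P] [Module.Finite Λ P] [Module.Projective Λ P] :
    ∃ m : ℕ, IsRetract Λ P (Fin m → W) := by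
  have : IsNoetherianRing Λ := isNoetherian_of_tower R inferInstance
  have := ht.finite
  have := ht.projective
  obtain ⟨Φ, ⟨hinj, hsurj⟩, hmul, h0⟩ := ht.exists_end hΛ hR
  have hprim : ∀ e, IsPrimitiveIdem e → IsPrimitiveIdem (Φ e) := by
    rintro e ⟨he, he0, h⟩
    refine ⟨by rw [← hmul, he], fun hc => he0 (hinj (hc.trans h0.symm)), fun g hg heg hge => ?_⟩
    obtain ⟨g, rfl⟩ := hsurj g
    rw [← hmul] at hg heg hge
    obtain rfl | rfl := h g (hinj hg) (hinj heg) (hinj hge)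
    · exact .inl h0
    · exact .inr rfl
  let S := {P : ModuleCat.{u} Λ // Module.Finite Λ P ∧ Module.Projective Λ P ∧
    IsIndecomposableModule Λ P}
  have hstep : ∀ P : S, ∃ (Q : S) (e : Module.End Λ Λ), e * e = e ∧
      Nonempty (P.1 ≃ₗ[Λ] LinearMap.range e) ∧ Nonempty (Q.1 ≃ₗ[Λ] LinearMap.range (Φ e)) := by
    rintro ⟨P, h1, h2, h3⟩
    obtain ⟨m, q, hq⟩ := Module.Finite.exists_fin' Λ P
    obtain ⟨s, hs⟩ := Module.projective_lifting_property q LinearMap.id hq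
    have hP : IsRetract Λ P Λ :=
      IsRetract.pi (isLocalRing_end R h3) ⟨s, q, LinearMap.congr_fun hs⟩
    obtain ⟨e, he, ⟨ε⟩⟩ := exists_idem_of_isRetract hP
    have h4 := hprim e
      ((isIndecomposableModule_range_iff he).1 (isIndecomposableModule_congr R ε h3))
    have h5 := isRetract_range h4.1
    exact ⟨⟨ModuleCat.of Λ (LinearMap.range (Φ e)), h5.finite, h5.projective,
      (isIndecomposableModule_range_iff h4.1).2 h4⟩, e, he, ⟨ε⟩, ⟨LinearEquiv.refl _ _⟩⟩
  choose F e he hPe hQe using hstep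
  let setoid : Setoid S :=
    { r := fun P Q => Nonempty (P.1 ≃ₗ[Λ] Q.1)
      iseqv := ⟨fun P => ⟨.refl _ _⟩, fun ⟨f⟩ => ⟨f.symm⟩, fun ⟨f⟩ ⟨g⟩ => ⟨f.trans g⟩⟩ }
  have hF : ∀ P Q, F P ≈ F Q → P ≈ Q := by
    rintro P Q ⟨f⟩
    obtain ⟨f1⟩ := hQe P
    obtain ⟨f2⟩ := hQe Q
    obtain ⟨f3⟩ := hPe P
    obtain ⟨f4⟩ := hPe Q
    obtain ⟨a, b, hab, hba⟩ := (nonempty_range_equiv_iff (by rw [← hmul, he]) (by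
      rw [← hmul, he])).1 ⟨f1.symm.trans (f.trans f2)⟩
    obtain ⟨a, rfl⟩ := hsurj a
    obtain ⟨b, rfl⟩ := hsurj b
    rw [← hmul] at hab hba
    obtain ⟨f5⟩ := (nonempty_range_equiv_iff (he P) (he Q)).2 ⟨a, b, hinj hab, hinj hba⟩
    exact ⟨f3.trans (f5.trans f4.symm)⟩
  have hfin : Finite (Quotient setoid) := by
    obtain ⟨r, Q, hQ⟩ := finite_retracts (Λ := Λ) R Λ
    have h (q : Quotient setoid) : ∃ j, Nonempty (q.out.1 ≃ₗ[Λ] Q j) := by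
      obtain ⟨P, h1, h2, h3⟩ := q.out
      obtain ⟨m, q, hq⟩ := Module.Finite.exists_fin' Λ P
      obtain ⟨s, hs⟩ := Module.projective_lifting_property q LinearMap.id hq
      have h4 := isLocalRing_end R h3
      exact hQ P h4 (IsRetract.pi h4 ⟨s, q, LinearMap.congr_fun hs⟩)
    choose j hj using h
    refine Finite.of_injective j fun q q' hqq => ?_
    obtain ⟨f⟩ := hj q
    obtain ⟨g⟩ := hj q'
    rw [← hqq] at g
    rw [← q.out_eq, ← q'.out_eq]
    exact Quotient.sound ⟨f.trans g.symm⟩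
  have hG : Function.Surjective (fun q : Quotient setoid => (⟦F q.out⟧ : Quotient setoid)) := by
    rw [← Finite.injective_iff_surjective]
    intro q q' h
    rw [← q.out_eq, ← q'.out_eq]
    exact Quotient.sound (hF _ _ (Quotient.exact h))
  have : IsNoetherian Λ P := inferInstance
  refine (?_ : Module.Finite Λ P → Module.Projective Λ P → ∃ m : ℕ, IsRetract Λ P (Fin m → W))
    inferInstance inferInstance
  refine decomposition_induction (Λ := Λ) (M := P) (fun P _ _ => Module.Finite Λ P →
    Module.Projective Λ P → ∃ m : ℕ, IsRetract Λ P (Fin m → W)) ?_ ?_ ?_ ?_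
  · intro M N _ _ _ _ e h h1 h2
    obtain ⟨m, hm⟩ := h (Module.Finite.equiv e.symm) (Module.Projective.of_equiv e.symm)
    exact ⟨m, (IsRetract.of_equiv e.symm).trans hm⟩
  · intro M _ _ _ _ _
    exact ⟨0, 0, 0, fun x => Subsingleton.elim _ _⟩
  · intro M _ _ _ h1 h2 h3
    obtain ⟨q, hq⟩ := hG ⟦⟨ModuleCat.of Λ M, h2, h3, h1⟩⟧
    obtain ⟨f⟩ := Quotient.exact hq
    obtain ⟨g⟩ := hQe q.out
    refine ⟨1, (IsRetract.of_equiv (f.symm.trans g)).trans ((isRetract_range ?_).trans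
      (.of_equiv (LinearEquiv.funUnique (Fin 1) Λ W).symm))⟩
    rw [← hmul, he]
  · intro M N _ _ _ _ hM hN h1 h2
    have h3 : IsRetract Λ M (M × N) := IsRetract.inl
    have h4 : IsRetract Λ N (M × N) := ⟨LinearMap.inr Λ M N, LinearMap.snd Λ M N, fun _ => rfl⟩
    obtain ⟨m, hm⟩ := hM h3.finite h3.projective
    obtain ⟨m', hm'⟩ := hN h4.finite h4.projective
    exact ⟨m + m', isRetract_prod_pi hm hm'⟩

end Retract

section GorensteinOrder

variable {R : Type u} [CommRing R] [IsNoetherianRing R] [IsLocalRing R]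
  [IsAdicComplete (IsLocalRing.maximalIdeal R) R] {Λ : Type u} [Ring Λ] [Algebra R Λ]

omit [IsLocalRing R] [IsAdicComplete (IsLocalRing.maximalIdeal R) R] in
theorem IsGorensteinOrder.isNoetherianRing (h : IsGorensteinOrder R Λ) : IsNoetherianRing Λ :=
  have := h.finite
  isNoetherian_of_tower R inferInstance

theorem IsGorensteinOrder.extZ_iff (h : IsGorensteinOrder R Λ) {L : Type u} [AddCommGroup L]
    [Module R L] [Module Λ L] [IsScalarTower R Λ L] (hL : Module.Finite Λ L) (i : ℕ) :
    ExtZ Λ (i + 1) L Λ ↔ ExtZ R (i + 1) L R := by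
  obtain ⟨W, _, _, _, _, t, ht⟩ := h.datum
  obtain ⟨n, hn⟩ := h.injDim
  have := h.finite
  have := h.isNoetherianRing
  have := ht.finite
  have := ht.projective
  rw [← ht.extZ_iff h.mcm i L hL]
  refine ⟨fun h1 => h1.of_projective₂, fun h1 => ?_⟩
  obtain ⟨m, f, p, hp⟩ := ht.isRetract_pi h.mcm hn Λ
  exact (h1.finPi₂ m).of_retract₂ f p hp

theorem IsGorensteinOrder.isMCM_iff (h : IsGorensteinOrder R Λ) {N : Type u} [AddCommGroup N]
    [Module R N] [Module Λ N] [IsScalarTower R Λ N] : IsMCM R N ↔ IsCM Λ N := by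
  have := h.finite
  constructor
  · intro hN
    have h1 := hN.1
    have h2 : Module.Finite Λ N := Module.Finite.of_restrictScalars_finite R Λ N
    exact ⟨h2, fun i => (h.extZ_iff h2 i).2 (hN.2 i)⟩
  · intro hN
    have h1 := hN.1
    exact ⟨Module.Finite.trans Λ N, fun i => (h.extZ_iff h1 i).1 (hN.2 i)⟩

variable (R) in
/-- The `R`-module underlying a `Λ`-module. -/
abbrev restrictModule (Λ : Type u) [Ring Λ] [Algebra R Λ] (N : Type w) [AddCommGroup N]
    [Module Λ N] : Module R N := Module.compHom N (algebraMap R Λ)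

omit [IsNoetherianRing R] [IsLocalRing R] [IsAdicComplete (IsLocalRing.maximalIdeal R) R] in
variable (R) in
theorem restrictModule_isScalarTower (N : Type w) [AddCommGroup N] [Module Λ N] :
    letI := restrictModule R Λ N
    IsScalarTower R Λ N := by
  let _ := restrictModule R Λ N
  exact ⟨fun r l m => by rw [Algebra.smul_def, mul_smul]; rfl⟩

theorem IsGorensteinOrder.ext_of_injDim (h : IsGorensteinOrder R Λ) {n : ℕ} (hn : InjDim R n)
    (L : Type u) [AddCommGroup L] [Module Λ L] (hL : Module.Finite Λ L) {i : ℕ} (hi : n ≤ i) :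
    ExtZ Λ (i + 1) L Λ := by
  let _ := restrictModule R Λ L
  have := restrictModule_isScalarTower R (Λ := Λ) L
  have := h.finite
  exact (h.extZ_iff hL i).2 (hn L (Module.Finite.trans Λ L) i hi)

/-- Maximal Cohen–Macaulay modules embed into projectives with maximal Cohen–Macaulay cokernel. -/
theorem IsGorensteinOrder.exists_cosyzygy (h : IsGorensteinOrder R Λ) {N : Type u} [AddCommGroup N]
    [Module Λ N] (hN : IsCM Λ N) : ∃ (Q C : Type u) (_ : AddCommGroup Q) (_ : Module Λ Q)
      (_ : AddCommGroup C) (_ : Module Λ C) (f : N →ₗ[Λ] Q) (g : Q →ₗ[Λ] C),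
      Module.Finite Λ Q ∧ Module.Projective Λ Q ∧ Function.Injective f ∧ Function.Exact f g ∧
      Function.Surjective g ∧ IsCM Λ C := by
  let _ := restrictModule R Λ N
  have := restrictModule_isScalarTower R (Λ := Λ) N
  obtain ⟨W, _, _, _, _, t, ht⟩ := h.datum
  obtain ⟨n, hn⟩ := h.injDim
  have := ht.finite
  have := ht.projective
  obtain ⟨m, f, hf, -, hC⟩ := IsMCM.exists_embedding ht h.mcm hn (h.isMCM_iff.2 hN)
  exact ⟨_, _, _, _, _, _, f, Submodule.mkQ _, inferInstance, projective_finPi m, hf,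
    LinearMap.exact_map_mkQ_range f, Submodule.mkQ_surjective _, h.isMCM_iff.1 hC⟩

end GorensteinOrder

section Lift

variable {Λ : Type u} [Ring Λ] {X : Type w} {A : Type w₁} {B : Type w₂} {C : Type w₃}
  [AddCommGroup X] [Module Λ X] [AddCommGroup A] [Module Λ A] [AddCommGroup B] [Module Λ B]
  [AddCommGroup C] [Module Λ C]

/-- Maps lift along surjections whose kernel has no extensions. -/
theorem Ext1Z.lift (h : Ext1Z Λ X A) {f : A →ₗ[Λ] B} {g : B →ₗ[Λ] C}
    (hf : Function.Injective f) (hfg : Function.Exact f g) (hg : Function.Surjective g)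
    (φ : X →ₗ[Λ] C) : ∃ ψ : X →ₗ[Λ] B, ∀ x, g (ψ x) = φ x := by
  let E : Submodule Λ (X × B) :=
    LinearMap.ker (φ ∘ₗ LinearMap.fst Λ X B - g ∘ₗ LinearMap.snd Λ X B)
  have hE : ∀ z : X × B, z ∈ E ↔ φ z.1 = g z.2 := fun z => by
    rw [LinearMap.mem_ker, LinearMap.sub_apply, sub_eq_zero]
    rfl
  let i : A →ₗ[Λ] E := (LinearMap.inr Λ X B ∘ₗ f).codRestrict E fun a =>
    (hE _).2 (by simp [hfg.apply_apply_eq_zero])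
  let p : E →ₗ[Λ] X := LinearMap.fst Λ X B ∘ₗ E.subtype
  have hp : Function.Surjective p := fun x => by
    obtain ⟨b, hb⟩ := hg (φ x)
    exact ⟨⟨(x, b), (hE _).2 hb.symm⟩, rfl⟩
  have hi : Function.Injective i := fun a a' haa => hf
    (congrArg Prod.snd (congrArg Subtype.val haa))
  have hip : Function.Exact i p := by
    rintro ⟨⟨x, b⟩, hz⟩
    constructor
    · intro h0
      have hx : x = 0 := h0
      subst hx
      obtain ⟨a, rfl⟩ := (hfg b).1 (((hE _).1 hz).symm.trans (map_zero φ))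
      exact ⟨a, rfl⟩
    · rintro ⟨a, ha⟩
      rw [← ha]
      rfl
  obtain ⟨r, hr⟩ := h.extend hi hip hp LinearMap.id
  obtain ⟨ψ, hψ⟩ := exists_desc p hp (LinearMap.snd Λ X B ∘ₗ E.subtype - f ∘ₗ r) fun z hz => by
    obtain ⟨a, rfl⟩ := (hip z).1 hz
    rw [LinearMap.sub_apply, LinearMap.comp_apply, LinearMap.comp_apply, hr]
    exact sub_self _
  refine ⟨ψ, fun x => ?_⟩
  obtain ⟨z, rfl⟩ := hp x
  rw [hψ, LinearMap.sub_apply, map_sub, LinearMap.comp_apply, LinearMap.comp_apply f,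
    hfg.apply_apply_eq_zero, sub_zero]
  exact ((hE _).1 z.2).symm

end Lift

section LiftQuotient

variable {R : Type u} [CommRing R] [IsNoetherianRing R] {Λ : Type u} [Ring Λ] [Algebra R Λ]
  {I 𝔟 : Ideal R} {n k : ℕ}
  {N : Type u} [AddCommGroup N] [Module R N] [Module Λ N] [IsScalarTower R Λ N]
  {X : Type u} [AddCommGroup X] [Module Λ X]

theorem RegSeq.exists_lift (hR : InjDim R n) (h : RegSeq I k 𝔟) (hN : IsMCM R N)
    (hX : ∀ i, ExtZ Λ (i + 1) X N) (g : X →ₗ[Λ] N ⧸ smulTop Λ 𝔟 N) :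
    ∃ g' : X →ₗ[Λ] N, ∀ x, Submodule.Quotient.mk (g' x) = g x := by
  induction h with
  | zero =>
    refine ⟨(Submodule.quotEquivOfEqBot _ (smulTop_bot R Λ N)).toLinearMap ∘ₗ g, fun x => ?_⟩
    obtain ⟨y, hy⟩ := Submodule.Quotient.mk_surjective _ (g x)
    rw [LinearMap.comp_apply, ← hy]
    rfl
  | @succ k 𝔟 h y hy hreg ih =>
    obtain ⟨a, b, hf, hfg, hg, -, hb⟩ := (h.regOn hR hN hreg.sq).exact_sequence (Λ := Λ)
    obtain ⟨g₁, hg₁⟩ := (extZ_one_iff.1 (h.ext_quotient₂ hR hN hX 0)).lift hf hfg hg g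
    obtain ⟨g₂, hg₂⟩ := ih g₁
    exact ⟨g₂, fun x => by rw [← hg₁, ← hg₂, hb]⟩

/-- If the elements of `I` act on `N` through projectives, then maps to `N / 𝔟 N` lift modulo `I`. -/
theorem RegSeq.exists_lift_mod (hR : InjDim R n) (hΛ : IsMCM R Λ) (h : RegSeq I k 𝔟)
    (hN : IsMCM R N) (hX : ∀ i, ExtZ Λ (i + 1) X Λ)
    (hI : ∀ y ∈ I, ∃ (m : ℕ) (α : N →ₗ[Λ] (Fin m → Λ)) (β : (Fin m → Λ) →ₗ[Λ] N),
      ∀ x, β (α x) = y • x) (g : X →ₗ[Λ] N ⧸ smulTop Λ 𝔟 N) :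
    ∃ g' : X →ₗ[Λ] N, ∀ x n, Submodule.Quotient.mk n = g x → n - g' x ∈ smulTop Λ I N := by
  induction h with
  | zero =>
    refine ⟨(Submodule.quotEquivOfEqBot _ (smulTop_bot R Λ N)).toLinearMap ∘ₗ g, fun x n hn => ?_⟩
    rw [LinearMap.comp_apply, ← hn, show (Submodule.quotEquivOfEqBot _ (smulTop_bot R Λ N)).toLinearMap
      (Submodule.Quotient.mk n) = n from rfl, sub_self]
    exact zero_mem _
  | @succ k 𝔟 h y hy hreg ih =>
    obtain ⟨m, α, β, hβα⟩ := hI y hy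
    have hQ : IsMCM R (Fin m → Λ) := IsMCM.of_projective_algebra hΛ
    let αq : (N ⧸ smulTop Λ (𝔟 ⊔ Ideal.span {y ^ 2}) N) →ₗ[Λ]
        ((Fin m → Λ) ⧸ smulTop Λ (𝔟 ⊔ Ideal.span {y ^ 2}) (Fin m → Λ)) :=
      Submodule.mapQ _ _ α fun x hx => map_mem_smulTop Λ α hx
    obtain ⟨a, b, hf, hfg, hg, -, hb⟩ := (h.regOn hR hQ hreg.sq).exact_sequence (Λ := Λ)
    obtain ⟨l, hl⟩ := (extZ_one_iff.1 (h.ext_quotient₂ hR hQ (fun i => (hX i).finPi₂ m) 0)).lift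
      hf hfg hg (αq ∘ₗ g)
    obtain ⟨c, d, hc, hcd, hd, hc', hd'⟩ := (h.regOn hR hN hreg).exact_sequence (Λ := Λ)
    let βq : ((Fin m → Λ) ⧸ smulTop Λ 𝔟 (Fin m → Λ)) →ₗ[Λ] (N ⧸ smulTop Λ 𝔟 N) :=
      Submodule.mapQ _ _ β fun x hx => map_mem_smulTop Λ β hx
    have key : ∀ x n, Submodule.Quotient.mk n = g x →
        ∃ n', βq (l x) = Submodule.Quotient.mk (y • (n + y • n')) := fun x n hn => by
      obtain ⟨q, hq⟩ := Submodule.Quotient.mk_surjective _ (l x)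
      have h1 := hl x
      rw [← hq, hb, LinearMap.comp_apply, ← hn] at h1
      obtain ⟨q', hq'⟩ := (mem_smulTop_sup_span Λ).1 ((Submodule.Quotient.eq _).1
        (h1 : Submodule.Quotient.mk q = Submodule.Quotient.mk (α n)))
      refine ⟨β q', ?_⟩
      rw [← hq]
      refine (Submodule.Quotient.eq _).2 ?_
      have h2 := map_mem_smulTop Λ β hq'
      rw [map_sub, map_sub, hβα, LinearMap.map_smul_of_tower] at h2
      rwa [smul_add, smul_smul, ← pow_two, ← sub_sub]
    obtain ⟨g'', hg''⟩ := exists_codlift c hc (βq ∘ₗ l) fun x => by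
      obtain ⟨n, hn⟩ := Submodule.Quotient.mk_surjective _ (g x)
      obtain ⟨n', hn'⟩ := key x n hn
      exact ⟨Submodule.Quotient.mk (n + y • n'), by rw [hc', LinearMap.comp_apply, hn']⟩
    obtain ⟨g', hg'⟩ := ih g''
    refine ⟨g', fun x n hn => ?_⟩
    obtain ⟨n', hn'⟩ := key x n hn
    have h1 : g'' x = Submodule.Quotient.mk (n + y • n') := hc (by
      rw [hg'', hc', LinearMap.comp_apply, hn'])
    have h2 := hg' x _ h1.symm
    rw [show n - g' x = (n + y • n' - g' x) - y • n' by abel]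
    exact sub_mem h2 (smul_mem_smulTop Λ hy n')

end LiftQuotient

section Functional

variable {R : Type u} [CommRing R] [IsNoetherianRing R] {I 𝔟 : Ideal R} {n k : ℕ}
  {N : Type u} [AddCommGroup N] [Module R N]

omit [IsNoetherianRing R] in
theorem smulTop_self : smulTop R 𝔟 R = 𝔟 := by
  ext x
  rw [mem_smulTop, smul_eq_mul, Ideal.mul_top]

/-- Functionals with values in `R / 𝔟` lift to `R`. -/
theorem RegSeq.exists_lift_functional (hR : InjDim R n) (h : RegSeq I k 𝔟) (hN : IsMCM R N)
    (φ : N →ₗ[R] R ⧸ 𝔟) : ∃ φ' : N →ₗ[R] R, ∀ x, Submodule.Quotient.mk (φ' x) = φ x := by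
  let e := Submodule.quotEquivOfEq (smulTop R 𝔟 R) 𝔟 smulTop_self
  obtain ⟨φ', hφ'⟩ := h.exists_lift hR (IsMCM.of_projective (N := R)) hN.2 (e.symm.toLinearMap ∘ₗ φ)
  refine ⟨φ', fun x => e.symm.injective (hφ' x)⟩

/-- An element on which all functionals take values in `𝔟` lies in `𝔟 N`. -/
theorem RegSeq.mem_of_forall_dual (hR : InjDim R n) (h : RegSeq I k 𝔟) (hN : IsMCM R N) {x : N}
    (hx : ∀ φ : N →ₗ[R] R, φ x ∈ 𝔟) : x ∈ (𝔟 • ⊤ : Submodule R N) := by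
  obtain ⟨m, f, hf, -, hC⟩ := IsMCM.exists_embedding isDatum_self
    (IsMCM.of_projective (N := R)) hR hN
  exact h.isPure hR hf (LinearMap.exact_map_mkQ_range f) (Submodule.mkQ_surjective _) hC x
    (mem_smul_top_pi.2 fun j => hx (LinearMap.proj j ∘ₗ f))

theorem RegSeq.exists_eval (hR : InjDim R n) (h : RegSeq I k 𝔟) (hN : IsMCM R N)
    (θ : Module.Dual R N →ₗ[R] R ⧸ 𝔟) :
    ∃ x : N, ∀ φ : Module.Dual R N, Submodule.Quotient.mk (φ x) = θ φ := by
  obtain ⟨θ', hθ'⟩ := h.exists_lift_functional hR (hN.dual hR) θ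
  obtain ⟨x, hx⟩ := hN.exists_eval hR θ'
  exact ⟨x, fun φ => by rw [← hθ', hx]⟩

end Functional

section Duality

variable {R : Type u} [CommRing R] [IsNoetherianRing R] {I 𝔟 : Ideal R} {n k : ℕ}
  {Λ : Type u} [Ring Λ] [Algebra R Λ] {N X : Type u}
  [AddCommGroup N] [Module R N] [Module Λ N] [IsScalarTower R Λ N]
  [AddCommGroup X] [Module R X] [Module Λ X] [IsScalarTower R Λ X]

omit [IsNoetherianRing R] in
theorem smul_quotient_smulTop {r : R} (hr : r ∈ 𝔟) (x : N ⧸ smulTop Λ 𝔟 N) : r • x = 0 := by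
  obtain ⟨x, rfl⟩ := Submodule.Quotient.mk_surjective _ x
  rw [← Submodule.Quotient.mk_smul, Submodule.Quotient.mk_eq_zero]
  exact smul_mem_smulTop Λ hr x

omit [IsNoetherianRing R] in
theorem mk_apply_eq_of_mem (φ : N →ₗ[R] R) {x y : N} (h : x - y ∈ smulTop Λ 𝔟 N) :
    (Submodule.Quotient.mk (φ x) : R ⧸ 𝔟) = Submodule.Quotient.mk (φ y) := by
  refine (Submodule.Quotient.eq _).2 ?_
  have h1 := map_mem_smulTop R φ ((mem_smulTop R).2 ((mem_smulTop Λ).1 h))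
  rwa [smulTop_self, map_sub] at h1

/-- Functionals on `Hom(N, N / 𝔟 N)` as traces. -/
theorem RegSeq.exists_trace [Module.Finite Λ N] (hR : InjDim R n) (h : RegSeq I k 𝔟)
    (hk : InjDim R k) (hN : IsMCM R N) {m : ℕ} {t : Fin m → Module.Dual R N}
    (ht : Submodule.span R (Set.range t) = ⊤) (ρ : (N →ₗ[Λ] N ⧸ smulTop Λ 𝔟 N) →ₗ[R] R ⧸ 𝔟) :
    ∃ c : Fin m → N, ∀ g : N →ₗ[Λ] N ⧸ smulTop Λ 𝔟 N, ∀ y : Fin m → N,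
      (∀ j, Submodule.Quotient.mk (y j) = g (c j)) →
      ρ g = ∑ j, (Submodule.Quotient.mk (t j (y j)) : R ⧸ 𝔟) := by
  obtain ⟨s, x, hx⟩ := Module.Finite.exists_fin (R := Λ) (M := N)
  let ev : (N →ₗ[Λ] N ⧸ smulTop Λ 𝔟 N) →ₗ[R] (Fin s → N ⧸ smulTop Λ 𝔟 N) :=
    { toFun := fun g i => g (x i), map_add' := fun _ _ => rfl, map_smul' := fun _ _ => rfl }
  have hev : Function.Injective ev := fun g g' hg => by
    refine LinearMap.ext_on_range hx fun i => congrFun hg i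
  obtain ⟨ψ, hψ⟩ := h.exists_extend hk (L := Fin s → N ⧸ smulTop Λ 𝔟 N)
    (fun r hr z => funext fun i => smul_quotient_smulTop hr (z i)) ev hev ρ
  choose φ hφ using fun i : Fin s => h.exists_lift_functional hR hN
    (ψ ∘ₗ LinearMap.single R (fun _ : Fin s => N ⧸ smulTop Λ 𝔟 N) i ∘ₗ
      (smulTop Λ 𝔟 N).mkQ.restrictScalars R)
  have hspan : ∀ i, ∃ a : Fin m → R, ∑ j, a j • t j = φ i := fun i =>
    (Submodule.mem_span_range_iff_exists_fun R).1 (ht ▸ Submodule.mem_top)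
  choose a ha using hspan
  refine ⟨fun j => ∑ i, a i j • x i, fun g y hy => ?_⟩
  choose z hz using fun i => Submodule.Quotient.mk_surjective _ (g (x i))
  have h1 : ∀ j, (Submodule.Quotient.mk (t j (y j)) : R ⧸ 𝔟) =
      Submodule.Quotient.mk (t j (∑ i, a i j • z i)) := fun j => by
    refine mk_apply_eq_of_mem (Λ := Λ) _ ((Submodule.Quotient.eq _).1 ?_)
    rw [hy, map_sum]
    change _ = (smulTop Λ 𝔟 N).mkQ _
    rw [map_sum]
    refine Finset.sum_congr rfl fun i _ => ?_
    rw [LinearMap.map_smul_of_tower, ← hz, LinearMap.map_smul_of_tower]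
    rfl
  rw [Finset.sum_congr rfl fun j _ => h1 j, ← hψ]
  have h2 : ev g = ∑ i, Pi.single i (Submodule.Quotient.mk (z i)) := by
    rw [Finset.univ_sum_single]
    exact funext fun i => (hz i).symm
  rw [h2, map_sum]
  have h3 : ∀ i, ψ (Pi.single i (Submodule.Quotient.mk (z i))) =
      𝔟.mkQ (∑ j, a i j • t j (z i)) := fun i => by
    refine (hφ i (z i)).symm.trans ?_
    rw [← ha, LinearMap.sum_apply]
    rfl
  rw [Finset.sum_congr rfl fun i _ => h3 i]
  change _ = ∑ j, 𝔟.mkQ _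
  rw [← map_sum, ← map_sum, Finset.sum_comm]
  congr 1
  refine Finset.sum_congr rfl fun j _ => ?_
  rw [map_sum]
  exact Finset.sum_congr rfl fun i _ => (map_smul _ _ _).symm

/-- Vanishing of a trace form against all maps `X → N / 𝔟 N` is a factorization property. -/
theorem RegSeq.exists_of_trace_eq_zero [IsLocalRing R] [Module.Finite R Λ] (hR : InjDim R n)
    (h : RegSeq I k 𝔟) (hk : InjDim R k)
    {ι : (R ⧸ IsLocalRing.maximalIdeal R) →ₗ[R] R ⧸ 𝔟} (hι : Function.Injective ι)
    (hN : IsMCM R N) {m : ℕ} {t : Fin m → Module.Dual R N}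
    (ht : Submodule.span R (Set.range t) = ⊤) {m' : ℕ} {l : Fin m' → Fin m → Λ}
    (hl : ∀ c : Fin m → Λ, (∀ x : N, ∑ j, t j (c j • x) = 0) → c ∈ Submodule.span R (Set.range l))
    (z : Fin m → X) (hz : ∀ (g : X →ₗ[Λ] N ⧸ smulTop Λ 𝔟 N) (y : Fin m → N),
      (∀ j, Submodule.Quotient.mk (y j) = g (z j)) →
      ∑ j, (Submodule.Quotient.mk (t j (y j)) : R ⧸ 𝔟) = 0) :
    ∃ x : Fin m' → X, ∀ j, z j - ∑ i, l i j • x i ∈ smulTop Λ 𝔟 X := by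
  let τ : (Fin m' → X ⧸ smulTop Λ 𝔟 X) →ₗ[R] (Fin m → X ⧸ smulTop Λ 𝔟 X) :=
    LinearMap.pi fun j => ∑ i, Algebra.lsmul R R _ (l i j) ∘ₗ LinearMap.proj i
  have hτ : ∀ x j, τ x j = ∑ i, l i j • x i := fun x j => by simp [τ]
  by_cases hmem : (fun j => Submodule.Quotient.mk (z j)) ∈ LinearMap.range τ
  · obtain ⟨x, hx⟩ := hmem
    choose x' hx' using fun i => Submodule.Quotient.mk_surjective _ (x i)
    refine ⟨x', fun j => (Submodule.Quotient.eq _).1 ?_⟩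
    rw [← congrFun hx j, hτ]
    change _ = (smulTop Λ 𝔟 X).mkQ _
    rw [map_sum]
    refine Finset.sum_congr rfl fun i _ => ?_
    rw [map_smul, ← hx']
    rfl
  exfalso
  obtain ⟨σ, hσ, hσ0⟩ := h.exists_separating hk hι (L := Fin m → X ⧸ smulTop Λ 𝔟 X)
    (fun r hr z => funext fun i => smul_quotient_smulTop hr (z i)) hmem
  let S : (Fin m → Λ) →ₗ[R] X →ₗ[R] R ⧸ 𝔟 :=
    LinearMap.mk₂ R (fun c x => σ fun j => c j • Submodule.Quotient.mk x)
      (fun c c' x => by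
        rw [← map_add]; congr 1; ext j; exact add_smul _ _ _)
      (fun r c x => by
        rw [← map_smul]; congr 1; ext j; exact smul_assoc _ _ _)
      (fun c x x' => by
        rw [← map_add]; congr 1; ext j; rw [Submodule.Quotient.mk_add]; exact smul_add _ _ _)
      (fun r c x => by
        rw [← map_smul]; congr 1; ext j; rw [Submodule.Quotient.mk_smul]; exact smul_comm _ _ _)
  have hS : ∀ c x, S c x = σ fun j => c j • Submodule.Quotient.mk x := fun _ _ => rfl
  let E : (Fin m → Λ) →ₗ[R] Module.Dual R N :=
    ∑ j, LinearMap.compr₂ ((Algebra.lsmul R R N).toLinearMap) (t j) ∘ₗ LinearMap.proj j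
  have hE : ∀ c x, E c x = ∑ j, t j (c j • x) := fun c x => by simp [E]
  have hEs : Function.Surjective E := fun φ => by
    obtain ⟨a, rfl⟩ := (Submodule.mem_span_range_iff_exists_fun R).1
      (show φ ∈ Submodule.span R (Set.range t) from ht ▸ Submodule.mem_top)
    refine ⟨fun j => algebraMap R Λ (a j), LinearMap.ext fun x => ?_⟩
    rw [hE, LinearMap.sum_apply]
    exact Finset.sum_congr rfl fun j _ => by rw [algebraMap_smul, map_smul, LinearMap.smul_apply]
  obtain ⟨Θ, hΘ⟩ := exists_desc E hEs S fun c hc => by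
    have h1 : c ∈ LinearMap.ker S := by
      refine Submodule.span_le.2 ?_ (hl c fun x => by rw [← hE, hc]; rfl)
      rintro _ ⟨i, rfl⟩
      refine LinearMap.mem_ker.2 (LinearMap.ext fun x => ?_)
      rw [hS]
      refine hσ _ ⟨Pi.single i (Submodule.Quotient.mk x), funext fun j => ?_⟩
      rw [hτ, Finset.sum_eq_single i (fun i' _ hi' => by rw [Pi.single_eq_of_ne hi', smul_zero])
        (by simp), Pi.single_eq_same]
    exact h1
  choose y hy using fun x : X => h.exists_eval hR hN (LinearMap.flip Θ x)
  have huniq : ∀ (a b : N), (∀ φ : Module.Dual R N,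
      (Submodule.Quotient.mk (φ a) : R ⧸ 𝔟) = Submodule.Quotient.mk (φ b)) →
      (Submodule.Quotient.mk a : N ⧸ smulTop Λ 𝔟 N) = Submodule.Quotient.mk b := fun a b hab => by
    refine (Submodule.Quotient.eq _).2 (h.mem_of_forall_dual hR hN fun φ => ?_)
    rw [map_sub]
    exact (Submodule.Quotient.eq _).1 (hab φ)
  let g : X →ₗ[Λ] N ⧸ smulTop Λ 𝔟 N :=
    { toFun := fun x => Submodule.Quotient.mk (y x)
      map_add' := fun a b => huniq _ (y a + y b) fun φ => by
        rw [map_add, Submodule.Quotient.mk_add, hy, hy, hy, map_add]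
        rfl
      map_smul' := fun c x => huniq _ (c • y x) fun φ => by
        obtain ⟨d, rfl⟩ := hEs φ
        rw [hy, LinearMap.flip_apply, hΘ, hS]
        have h1 : E d (c • y x) = E (fun j => d j * c) (y x) := by
          rw [hE, hE]
          simp only [mul_smul]
        rw [h1, hy, LinearMap.flip_apply, hΘ, hS]
        congr 1
        ext j
        rw [mul_smul]
        rfl }
  refine hσ0 ?_
  rw [← hz g (fun j => y (z j)) fun j => rfl]
  have h2 : ∀ j, t j = E (Pi.single j 1) := fun j => LinearMap.ext fun x => by
    rw [hE, Finset.sum_eq_single j (fun j' _ hj => by rw [Pi.single_eq_of_ne hj, zero_smul, map_zero])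
      (by simp), Pi.single_eq_same, one_smul]
  rw [← Finset.univ_sum_single (fun j => (Submodule.Quotient.mk (z j) : X ⧸ smulTop Λ 𝔟 X)), map_sum]
  refine Finset.sum_congr rfl fun j _ => ?_
  rw [hy, LinearMap.flip_apply, h2, hΘ, hS]
  congr 1
  ext j'
  obtain rfl | hj := eq_or_ne j' j
  · simp
  · rw [Pi.single_eq_of_ne hj, Pi.single_eq_of_ne hj, zero_smul]

end Duality

section FactorsProj

variable {Λ : Type u} [Ring Λ] {X : Type w} {Y : Type w₁} {Z : Type w₂}
  [AddCommGroup X] [Module Λ X] [AddCommGroup Y] [Module Λ Y] [AddCommGroup Z] [Module Λ Z]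

/-- Maps that factor through a finitely generated free module. -/
def FactorsProj (f : X →ₗ[Λ] Y) : Prop :=
  ∃ (m : ℕ) (α : X →ₗ[Λ] (Fin m → Λ)) (β : (Fin m → Λ) →ₗ[Λ] Y), ∀ x, β (α x) = f x

theorem FactorsProj.comp_left {f : X →ₗ[Λ] Y} (h : FactorsProj f) (g : Y →ₗ[Λ] Z) :
    FactorsProj (g ∘ₗ f) := by
  obtain ⟨m, α, β, h⟩ := h
  exact ⟨m, α, g ∘ₗ β, fun x => congrArg g (h x)⟩

theorem FactorsProj.comp_right {g : Y →ₗ[Λ] Z} (h : FactorsProj g) (f : X →ₗ[Λ] Y) :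
    FactorsProj (g ∘ₗ f) := by
  obtain ⟨m, α, β, h⟩ := h
  exact ⟨m, α ∘ₗ f, β, fun x => h (f x)⟩

theorem FactorsProj.of_projective {P : Type w₃} [AddCommGroup P] [Module Λ P] [Module.Finite Λ P]
    [Module.Projective Λ P] (f : X →ₗ[Λ] P) (g : P →ₗ[Λ] Y) : FactorsProj (g ∘ₗ f) := by
  obtain ⟨m, q, hq⟩ := Module.Finite.exists_fin' Λ P
  obtain ⟨s, hs⟩ := Module.projective_lifting_property q LinearMap.id hq
  exact ⟨m, s ∘ₗ f, g ∘ₗ q, fun x => congrArg g (LinearMap.congr_fun hs (f x))⟩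

theorem FactorsProj.congr {f g : X →ₗ[Λ] Y} (h : FactorsProj f) (hfg : ∀ x, f x = g x) :
    FactorsProj g := by
  rwa [← LinearMap.ext hfg]

theorem FactorsProj.zero : FactorsProj (0 : X →ₗ[Λ] Y) := ⟨0, 0, 0, fun _ => rfl⟩

theorem FactorsProj.add {f g : X →ₗ[Λ] Y} (hf : FactorsProj f) (hg : FactorsProj g) :
    FactorsProj (f + g) := by
  obtain ⟨m, α, β, h⟩ := hf
  obtain ⟨m', α', β', h'⟩ := hg
  refine ((FactorsProj.of_projective (α.prod α') (β.coprod β'))).congr fun x => ?_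
  rw [LinearMap.add_apply, ← h, ← h']
  rfl

theorem FactorsProj.neg {f : X →ₗ[Λ] Y} (hf : FactorsProj f) : FactorsProj (-f) := by
  obtain ⟨m, α, β, h⟩ := hf
  exact ⟨m, α, -β, fun x => congrArg Neg.neg (h x)⟩

theorem FactorsProj.sub {f g : X →ₗ[Λ] Y} (hf : FactorsProj f) (hg : FactorsProj g) :
    FactorsProj (f - g) := by
  rw [sub_eq_add_neg]
  exact hf.add hg.neg

theorem FactorsProj.sum {ι : Type*} (s : Finset ι) {f : ι → X →ₗ[Λ] Y}
    (h : ∀ i ∈ s, FactorsProj (f i)) : FactorsProj (∑ i ∈ s, f i) :=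
  Finset.sum_induction f FactorsProj (fun _ _ h h' => h.add h') FactorsProj.zero h

/-- Split monomorphisms of modules. -/
def HasRetraction (f : X →ₗ[Λ] Y) : Prop := ∃ r : Y →ₗ[Λ] X, ∀ x, r (f x) = x

end FactorsProj

section AlmostSplit

variable {R : Type u} [CommRing R] [IsNoetherianRing R] [IsLocalRing R]
  {Λ : Type u} [Ring Λ] [Algebra R Λ] {I 𝔟 : Ideal R} {n k : ℕ}
  {N : Type u} [AddCommGroup N] [Module R N] [Module Λ N] [IsScalarTower R Λ N]

omit [IsNoetherianRing R] [IsLocalRing R] in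
/-- The maps `N → N / 𝔟 N` which are congruent to noninvertible endomorphisms modulo `I`. -/
def nonunitHoms (hN : IsLocalRing (Module.End Λ N)) (h : 𝔟 ≤ I) :
    Submodule R (N →ₗ[Λ] N ⧸ smulTop Λ 𝔟 N) where
  carrier := {g | ∃ a : Module.End Λ N, ¬ IsUnit a ∧
    ∀ x y, Submodule.Quotient.mk y = g x → y - a x ∈ smulTop Λ I N}
  zero_mem' := ⟨0, not_isUnit_zero, fun x y hy => by
    rw [LinearMap.zero_apply, Submodule.Quotient.mk_eq_zero] at hy
    rw [LinearMap.zero_apply, sub_zero]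
    exact smulTop_mono Λ h hy⟩
  add_mem' := by
    rintro g g' ⟨a, ha, h⟩ ⟨a', ha', h'⟩
    refine ⟨a + a', IsLocalRing.nonunits_add ha ha', fun x y hy => ?_⟩
    obtain ⟨z, hz⟩ := Submodule.Quotient.mk_surjective _ (g x)
    have h1 := h' x (y - z) (by
      rw [Submodule.Quotient.mk_sub, hz, hy, LinearMap.add_apply, add_sub_cancel_left])
    have h2 := add_mem (h x z hz) h1
    rwa [show z - a x + (y - z - a' x) = y - (a + a') x by
      rw [LinearMap.add_apply]; abel] at h2
  smul_mem' := by
    rintro r g ⟨a, ha, h'⟩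
    refine ⟨algebraMap R (Module.End Λ N) r * a, fun hu => ha
    ((Algebra.commute_algebraMap_left r a).isUnit_mul_iff.1 hu).2,
      fun x y hy => ?_⟩
    obtain ⟨z, hz⟩ := Submodule.Quotient.mk_surjective _ (g x)
    rw [LinearMap.smul_apply, ← hz, ← Submodule.Quotient.mk_smul, Submodule.Quotient.eq] at hy
    have h1 := add_mem (smulTop_mono Λ h hy) (smul_mem_smulTop_of_mem Λ r (h' x z hz))
    rwa [smul_sub, sub_add_sub_cancel] at h1

omit [IsNoetherianRing R] [IsLocalRing R] [Module R N] [IsScalarTower R Λ N] in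
theorem linearCombination_comp_mem {m m' : ℕ} {S : Submodule Λ N} {l : Fin m' → Fin m → Λ}
    {z : Fin m → N} {x : Fin m' → N} (h : ∀ j, z j - ∑ i, l i j • x i ∈ S) (v : Fin m → Λ) :
    Fintype.linearCombination Λ z v - Fintype.linearCombination Λ x
      (Fintype.linearCombination Λ (fun j i => l i j) v) ∈ S := by
  have h1 : Fintype.linearCombination Λ x (Fintype.linearCombination Λ (fun j i => l i j) v) =
      ∑ j, v j • ∑ i, l i j • x i := by
    rw [Fintype.linearCombination_apply Λ (fun j i => l i j), map_sum]
    refine Finset.sum_congr rfl fun j _ => ?_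
    rw [map_smul, Fintype.linearCombination_apply]
  rw [h1, Fintype.linearCombination_apply, ← Finset.sum_sub_distrib]
  refine Submodule.sum_mem _ fun j _ => ?_
  rw [← smul_sub]
  exact S.smul_mem _ (h j)

theorem RegSeq.exists_presentation [IsAdicComplete (IsLocalRing.maximalIdeal R) R]
    (h : IsGorensteinOrder R Λ) (hR : InjDim R n)
    (hreg : RegSeq I k 𝔟) (hk : InjDim R k) (hI : I ≤ IsLocalRing.maximalIdeal R)
    {ι : (R ⧸ IsLocalRing.maximalIdeal R) →ₗ[R] R ⧸ 𝔟} (hι : Function.Injective ι)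
    (hN : IsMCM R N) (hloc : IsLocalRing (Module.End Λ N)) (hnp : ¬ Module.Projective Λ N)
    (hIN : ∀ y ∈ I, FactorsProj (y • (LinearMap.id : N →ₗ[Λ] N))) :
    ∃ (m m' : ℕ) (q : (Fin m → Λ) →ₗ[Λ] (Fin m' → Λ)) (η : (Fin m → Λ) →ₗ[Λ] N),
      (∀ v, q v ∈ smulTop Λ 𝔟 (Fin m' → Λ) → η v ∈ smulTop Λ 𝔟 N) ∧
      (¬ ∃ x : (Fin m' → Λ) →ₗ[Λ] N, ∀ v, η v - x (q v) ∈ smulTop Λ 𝔟 N) ∧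
      ∀ (X : Type u) [AddCommGroup X] [Module R X] [Module Λ X] [IsScalarTower R Λ X],
        IsMCM R X → ∀ f : N →ₗ[Λ] X, ¬ HasRetraction f →
        ∃ x : (Fin m' → Λ) →ₗ[Λ] X, ∀ v, f (η v) - x (q v) ∈ smulTop Λ 𝔟 X := by
  have := h.finite
  have := hN.1
  have := h.isNoetherianRing
  have hNf : Module.Finite Λ N := Module.Finite.of_restrictScalars_finite R Λ N
  have hDf : Module.Finite R (Module.Dual R N) := finite_hom (Λ := R) N R
  obtain ⟨ρ, hρ, hρ1⟩ := hreg.exists_separating hk hι (L := N →ₗ[Λ] N ⧸ smulTop Λ 𝔟 N)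
    (fun r hr g => LinearMap.ext fun x => smul_quotient_smulTop hr (g x))
    (T := nonunitHoms hloc hreg.le) (x := (smulTop Λ 𝔟 N).mkQ) (by
      rintro ⟨a, ha, h'⟩
      exact ha (isUnit_of_sub_mem (R := R) a fun x =>
        (mem_smulTop Λ).1 (smulTop_mono Λ hI (h' x x rfl))))
  obtain ⟨m, t, ht⟩ := Module.Finite.exists_fin (R := R) (M := Module.Dual R N)
  obtain ⟨c, hc⟩ := hreg.exists_trace hR hk hN ht ρ
  let U : Submodule R (Fin m → Λ) :=
    { carrier := {c | ∀ x : N, ∑ j, t j (c j • x) = 0}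
      zero_mem' := fun x => by simp
      add_mem' := fun {a b} ha hb x => by
        simp only [Pi.add_apply, add_smul, map_add, Finset.sum_add_distrib]
        rw [ha, hb, add_zero]
      smul_mem' := fun r a ha x => by
        simp only [Pi.smul_apply, smul_assoc, map_smul]
        rw [← Finset.smul_sum, ha, smul_zero] }
  have hUf : Module.Finite R U := inferInstance
  obtain ⟨m', l', hl'⟩ := Module.Finite.exists_fin (R := R) (M := U)
  let l : Fin m' → Fin m → Λ := fun i => l' i
  have hlU : ∀ i x, ∑ j, t j (l i j • x) = 0 := fun i => (l' i).2
  have hl : ∀ c : Fin m → Λ, (∀ x : N, ∑ j, t j (c j • x) = 0) →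
      c ∈ Submodule.span R (Set.range l) := fun c hc => by
    have h1 : (⟨c, hc⟩ : U) ∈ Submodule.span R (Set.range l') := hl' ▸ Submodule.mem_top
    have h2 := Submodule.mem_map_of_mem (f := U.subtype) h1
    rwa [Submodule.map_span, ← Set.range_comp] at h2
  have hfac : ∀ (X : Type u) [AddCommGroup X] [Module R X] [Module Λ X] [IsScalarTower R Λ X],
      IsMCM R X → ∀ f : N →ₗ[Λ] X, ¬ HasRetraction f →
      ∃ x : (Fin m' → Λ) →ₗ[Λ] X, ∀ v, f (Fintype.linearCombination Λ c v) -
        x (Fintype.linearCombination Λ (fun j i => l i j) v) ∈ smulTop Λ 𝔟 X := by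
    intro X _ _ _ _ hX f hf
    obtain ⟨x, hx⟩ := hreg.exists_of_trace_eq_zero hR hk hι hN ht hl (fun j => f (c j))
      fun g y hy => by
        rw [← hc (g ∘ₗ f) y hy]
        refine hρ _ ?_
        obtain ⟨g', hg'⟩ := hreg.exists_lift_mod hR h.mcm hN (h.isMCM_iff.1 hX).2 hIN g
        refine ⟨g' ∘ₗ f, fun hu => hf ?_, fun x y hy => hg' _ _ hy⟩
        obtain ⟨b, hb⟩ := hu.exists_left_inv
        exact ⟨b ∘ₗ g', LinearMap.congr_fun hb⟩
    refine ⟨Fintype.linearCombination Λ x, fun v => ?_⟩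
    have h1 := linearCombination_comp_mem hx v
    rwa [show f (Fintype.linearCombination Λ c v) =
      Fintype.linearCombination Λ (fun j => f (c j)) v by simp [Fintype.linearCombination_apply]]
  refine ⟨m, m', Fintype.linearCombination Λ fun j i => l i j, Fintype.linearCombination Λ c,
    fun v hv => ?_, ?_, hfac⟩
  · obtain ⟨W, _, _, _, _, s, hs⟩ := h.datum
    have := hs.1
    have := hs.2
    obtain ⟨r, f, hf, -, hC⟩ := IsMCM.exists_embedding hs h.mcm hR hN
    have hp := projective_finPi (Λ := Λ) (P := W) r
    obtain ⟨x, hx⟩ := hfac (Fin r → W) (IsMCM.of_projective_algebra h.mcm) f fun ⟨p, hp'⟩ =>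
      hnp (Module.Projective.of_split f p (LinearMap.ext hp'))
    have h1 := add_mem (hx v) (map_mem_smulTop Λ x hv)
    rw [sub_add_cancel] at h1
    let f' : N →ₗ[R] (Fin r → W) := f.restrictScalars R
    let g' : (Fin r → W) →ₗ[R] ((Fin r → W) ⧸ LinearMap.range f) :=
      (LinearMap.range f).mkQ.restrictScalars R
    have h2 : Function.Exact f' g' := LinearMap.exact_map_mkQ_range f
    have h3 : Function.Surjective g' := Submodule.mkQ_surjective (LinearMap.range f)
    exact hreg.isPure hR (f := f') (g := g') hf h2 h3 hC _ h1
  · rintro ⟨x, hx⟩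
    refine hρ1 ?_
    rw [hc _ c fun j => rfl]
    have h1 : ∀ j, (Submodule.Quotient.mk (t j (c j)) : R ⧸ 𝔟) =
        𝔟.mkQ (∑ i, t j (l i j • x (Pi.single i 1))) := fun j => by
      rw [← map_sum]
      refine mk_apply_eq_of_mem (Λ := Λ) (t j) ?_
      have h2 := hx (Pi.single j 1)
      rw [Fintype.linearCombination_apply_single, Fintype.linearCombination_apply_single, one_smul,
        one_smul, pi_eq_sum_univ' (fun i => l i j), map_sum] at h2
      simpa using h2
    rw [Finset.sum_congr rfl fun j _ => h1 j, ← map_sum, Finset.sum_comm,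
      Finset.sum_congr rfl fun i _ => hlU i _, Finset.sum_const_zero, map_zero]

end AlmostSplit

section Pushout

variable {Λ : Type u} [Ring Λ] {A F N : Type w} [AddCommGroup A] [Module Λ A] [AddCommGroup F]
  [Module Λ F] [AddCommGroup N] [Module Λ N] {T : Type w₁} [AddCommGroup T] [Module Λ T]

/-- Pushout of an extension along a map on its kernel. -/
theorem exists_pushout {j : A →ₗ[Λ] F} {g : F →ₗ[Λ] T} (hj : Function.Injective j)
    (hjg : Function.Exact j g) (hg : Function.Surjective g) (φ : A →ₗ[Λ] N) :
    ∃ (E : Type w) (_ : AddCommGroup E) (_ : Module Λ E) (e : N →ₗ[Λ] E) (p : E →ₗ[Λ] T)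
      (b : F →ₗ[Λ] E), Function.Injective e ∧ Function.Exact e p ∧ Function.Surjective p ∧
      (∀ a, b (j a) = e (φ a)) ∧ (∀ x, p (b x) = g x) ∧
      ∀ (X : Type w₂) [AddCommGroup X] [Module Λ X] (f : N →ₗ[Λ] X) (c : F →ₗ[Λ] X),
        (∀ a, c (j a) = f (φ a)) → ∃ d : E →ₗ[Λ] X, (∀ x, d (e x) = f x) ∧ ∀ x, d (b x) = c x := by
  let S : Submodule Λ (N × F) := LinearMap.range (φ.prod (-j))
  have hS : ∀ z, z ∈ S ↔ ∃ a, φ a = z.1 ∧ -j a = z.2 := fun z => by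
    refine ⟨fun ⟨a, ha⟩ => ⟨a, ?_, ?_⟩, fun ⟨a, h1, h2⟩ => ⟨a, Prod.ext h1 h2⟩⟩ <;> rw [← ha] <;> rfl
  obtain ⟨p, hp⟩ := exists_desc S.mkQ S.mkQ_surjective (g ∘ₗ LinearMap.snd Λ N F) fun z hz => by
    rw [Submodule.mkQ_apply, Submodule.Quotient.mk_eq_zero, hS] at hz
    obtain ⟨a, -, h2⟩ := hz
    rw [LinearMap.comp_apply, LinearMap.snd_apply, ← h2, map_neg, hjg.apply_apply_eq_zero, neg_zero]
  refine ⟨(N × F) ⧸ S, inferInstance, inferInstance, S.mkQ ∘ₗ LinearMap.inl Λ N F, p,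
    S.mkQ ∘ₗ LinearMap.inr Λ N F, ?_, ?_, ?_, ?_, ?_, ?_⟩
  · refine (injective_iff_map_eq_zero _).2 fun n hn => ?_
    rw [LinearMap.comp_apply, Submodule.mkQ_apply, Submodule.Quotient.mk_eq_zero, hS] at hn
    obtain ⟨a, h1, h2⟩ := hn
    have h3 : a = 0 := hj (by simpa using h2)
    rw [h3, map_zero] at h1
    exact h1.symm
  · intro x
    obtain ⟨⟨n, y⟩, rfl⟩ := S.mkQ_surjective x
    rw [hp]
    constructor
    · intro h
      obtain ⟨a, rfl⟩ := (hjg y).1 h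
      refine ⟨n + φ a, (Submodule.Quotient.eq _).2 ((hS _).2 ⟨a, ?_, ?_⟩)⟩ <;> simp
    · rintro ⟨m, hm⟩
      rw [← hp, ← hm, LinearMap.comp_apply, hp]
      simp
  · intro t
    obtain ⟨y, rfl⟩ := hg t
    exact ⟨S.mkQ (0, y), hp _⟩
  · intro a
    refine ((Submodule.Quotient.eq _).2 ((hS _).2 ⟨-a, ?_, ?_⟩)) <;> simp
  · intro x
    exact hp _
  · intro X _ _ f c hfc
    obtain ⟨d, hd⟩ := exists_desc S.mkQ S.mkQ_surjective (f.coprod c) fun z hz => by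
      rw [Submodule.mkQ_apply, Submodule.Quotient.mk_eq_zero, hS] at hz
      obtain ⟨a, h1, h2⟩ := hz
      rw [LinearMap.coprod_apply, ← h1, ← h2, map_neg, hfc, add_neg_cancel]
    exact ⟨d, fun x => by rw [LinearMap.comp_apply, hd]; simp,
      fun x => by rw [LinearMap.comp_apply, hd]; simp⟩

end Pushout

section Climb

variable {R : Type u} [CommRing R] [IsNoetherianRing R] [IsLocalRing R]
  [IsAdicComplete (IsLocalRing.maximalIdeal R) R]
  {Λ : Type u} [Ring Λ] [Algebra R Λ] {I 𝔟 : Ideal R} {n k : ℕ}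

theorem RegSeq.exists_climb (h : IsGorensteinOrder R Λ) (hR : InjDim R n)
    (hreg : RegSeq I k 𝔟) (hk : InjDim R k) {m₁ m : ℕ} (q : (Fin m₁ → Λ) →ₗ[Λ] (Fin m → Λ)) :
    ∃ (m₁' m' : ℕ) (q' : (Fin m₁' → Λ) →ₗ[Λ] (Fin m' → Λ)),
      IsCM Λ ((Fin m' → Λ) ⧸ LinearMap.range q') ∧
      ∀ (N : Type u) [AddCommGroup N] [Module R N] [Module Λ N] [IsScalarTower R Λ N],
      IsMCM R N → ∀ η : (Fin m₁ → Λ) →ₗ[Λ] N,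
      (∀ u, q u ∈ smulTop Λ 𝔟 (Fin m → Λ) → η u ∈ smulTop Λ 𝔟 N) →
      ∃ φ : LinearMap.range q' →ₗ[Λ] N,
        ((∃ A : (Fin m' → Λ) →ₗ[Λ] N, ∀ u : LinearMap.range q', A u = φ u) →
          ∃ A : (Fin m → Λ) →ₗ[Λ] N, ∀ u, η u - A (q u) ∈ smulTop Λ 𝔟 N) ∧
        ∀ (X : Type u) [AddCommGroup X] [Module R X] [Module Λ X] [IsScalarTower R Λ X],
        IsMCM R X → ∀ f : N →ₗ[Λ] X,
        (∃ B : (Fin m → Λ) →ₗ[Λ] X, ∀ u, f (η u) - B (q u) ∈ smulTop Λ 𝔟 X) →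
        ∃ B : (Fin m' → Λ) →ₗ[Λ] X, ∀ u : LinearMap.range q', B u = f (φ u) := by
  have := h.isNoetherianRing
  obtain ⟨m₂, p, hp⟩ := Module.Finite.exists_fin' Λ (smulTop Λ 𝔟 (Fin m → Λ))
  let e : (Fin (m₁ + m₂) → Λ) ≃ₗ[Λ] (Fin m₁ → Λ) × (Fin m₂ → Λ) :=
    (LinearEquiv.funCongrLeft Λ Λ finSumFinEquiv).trans
      (LinearEquiv.sumArrowLequivProdArrow (Fin m₁) (Fin m₂) Λ Λ)
  let Q : (Fin (m₁ + m₂) → Λ) →ₗ[Λ] (Fin m → Λ) :=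
    (q.coprod ((smulTop Λ 𝔟 (Fin m → Λ)).subtype ∘ₗ p)) ∘ₗ e.toLinearMap
  have hQ : ∀ u, Q (e.symm u) = q u.1 + p u.2 := fun u => by
    simp only [Q, LinearMap.comp_apply, LinearEquiv.coe_coe, LinearEquiv.apply_symm_apply]
    rfl
  obtain ⟨m₁', m', q', hq', H⟩ := hreg.climb hR h.mcm Q (fun v hv => by
    obtain ⟨u, hu⟩ := hp ⟨v, hv⟩
    exact ⟨e.symm (0, u), by rw [hQ, hu, map_zero, zero_add]⟩)
    fun i hi => h.ext_of_injDim hk _ inferInstance hi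
  refine ⟨m₁', m', q', ⟨inferInstance, hq'⟩, ?_⟩
  intro N _ _ _ _ hN η hη
  let Φ : (Fin (m₁ + m₂) → Λ) →ₗ[Λ] N := (η ∘ₗ LinearMap.fst Λ _ _) ∘ₗ e.toLinearMap
  have hΦ : ∀ u, Φ (e.symm u) = η u.1 := fun u => by
    simp only [Φ, LinearMap.comp_apply, LinearEquiv.coe_coe, LinearEquiv.apply_symm_apply]
    rfl
  obtain ⟨Φ', h0, h1, h2⟩ := H N hN Φ fun u hu => by
    obtain ⟨u, rfl⟩ := e.symm.surjective u
    rw [hΦ]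
    rw [hQ] at hu
    exact hη _ ((add_mem_cancel_right (p u.2).2).1 hu)
  obtain ⟨φ, hφ⟩ := exists_desc q'.rangeRestrict q'.surjective_rangeRestrict Φ' fun u hu =>
    h0 u (congrArg Subtype.val hu)
  refine ⟨φ, fun ⟨A, hA⟩ => ?_, ?_⟩
  · obtain ⟨A', hA'⟩ := h1 ⟨A, fun u => by rw [← hφ, ← hA]; rfl⟩
    refine ⟨A', fun u => ?_⟩
    have h3 := hA' (e.symm (u, 0))
    rwa [hΦ, hQ, map_zero, ZeroMemClass.coe_zero, add_zero] at h3
  · rintro X _ _ _ _ hX f ⟨B, hB⟩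
    obtain ⟨B', hB'⟩ := h2 X hX f ⟨B, fun u => by
      obtain ⟨u, rfl⟩ := e.symm.surjective u
      rw [hΦ, hQ, map_add, ← sub_sub]
      exact sub_mem (hB _) (map_mem_smulTop Λ B (p u.2).2)⟩
    refine ⟨B', fun u => ?_⟩
    obtain ⟨u, rfl⟩ := q'.surjective_rangeRestrict u
    rw [hφ, hB']
    rfl

theorem IsGorensteinOrder.exists_almostSplit (h : IsGorensteinOrder R Λ) {N : Type u}
    [AddCommGroup N] [Module R N] [Module Λ N] [IsScalarTower R Λ N] (hN : IsCM Λ N)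
    (hloc : IsLocalRing (Module.End Λ N)) (hnp : ¬ Module.Projective Λ N)
    {a : ℕ} (ha : ∀ y ∈ IsLocalRing.maximalIdeal R ^ a,
      FactorsProj (y • (LinearMap.id : N →ₗ[Λ] N))) :
    ∃ (E : Type u) (_ : AddCommGroup E) (_ : Module Λ E) (e : N →ₗ[Λ] E), IsCM Λ E ∧
      ¬ HasRetraction e ∧ ∀ (X : Type u) [AddCommGroup X] [Module Λ X], IsCM Λ X →
        ∀ f : N →ₗ[Λ] X, ¬ HasRetraction f → ∃ f' : E →ₗ[Λ] X, ∀ x, f' (e x) = f x := by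
  obtain ⟨n, hR⟩ := h.injDim
  obtain ⟨k, 𝔟, hreg, hk, ι, hι⟩ := exists_regSeq hR (Nat.succ_ne_zero a)
  obtain ⟨m, m', q, η, h1, h2, h3⟩ := hreg.exists_presentation h hR hk
    (Ideal.pow_le_self (Nat.succ_ne_zero a)) hι (h.isMCM_iff.2 hN) hloc hnp
    fun y hy => ha y (Ideal.pow_le_pow_right (Nat.le_succ a) hy)
  obtain ⟨m₁', m₂', q', hT, H⟩ := hreg.exists_climb h hR hk q
  obtain ⟨φ, h4, h5⟩ := H N (h.isMCM_iff.2 hN) η h1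
  obtain ⟨E, _, _, e, p, b, he, hep, hp, hb, -, hd⟩ := exists_pushout
    (j := (LinearMap.range q').subtype) (g := (LinearMap.range q').mkQ)
    (Submodule.subtype_injective _) (LinearMap.exact_subtype_mkQ _) (Submodule.mkQ_surjective _) φ
  refine ⟨E, _, _, e, hN.mid hT he hep hp, fun ⟨r, hr⟩ => h2 (h4 ⟨r ∘ₗ b, fun u => ?_⟩),
    fun X _ _ hX f hf => ?_⟩
  · have h6 := hb u
    rw [Submodule.subtype_apply] at h6
    rw [LinearMap.comp_apply, h6, hr]
  · let _ := restrictModule R Λ X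
    have := restrictModule_isScalarTower R (Λ := Λ) X
    obtain ⟨B, hB⟩ := h5 X (h.isMCM_iff.2 hX) f (h3 X (h.isMCM_iff.2 hX) f hf)
    obtain ⟨d, hd1, -⟩ := hd X f B hB
    exact ⟨d, hd1⟩

end Climb

section Tester

variable {Λ : Type u} [Ring Λ] {M : Type w} [AddCommGroup M] [Module Λ M] {N : Type w₁}
  [AddCommGroup N] [Module Λ N]

/-- Extend a partially defined map by one generator. -/
theorem exists_extend_sup_span (S : Submodule Λ M) (ρ : S →ₗ[Λ] N) (x : M) (Φ : Λ →ₗ[Λ] N)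
    (h : ∀ (l : Λ) (hl : l • x ∈ S), Φ l = ρ ⟨l • x, hl⟩) :
    ∃ (ρ' : (S ⊔ Submodule.span Λ {x} : Submodule Λ M) →ₗ[Λ] N),
      ∀ s (hs : s ∈ S), ρ' ⟨s, Submodule.mem_sup_left hs⟩ = ρ ⟨s, hs⟩ := by
  let c : S × Λ →ₗ[Λ] (S ⊔ Submodule.span Λ {x} : Submodule Λ M) :=
    (S.subtype.coprod (LinearMap.toSpanSingleton Λ M x)).codRestrict _ fun z => by
      rw [LinearMap.coprod_apply]
      exact Submodule.add_mem_sup z.1.2 (Submodule.mem_span_singleton.2 ⟨z.2, rfl⟩)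
  have hc : ∀ z, (c z : M) = z.1 + z.2 • x := fun z => rfl
  obtain ⟨ρ', hρ'⟩ := exists_desc c (fun ⟨y, hy⟩ => by
    obtain ⟨s, hs, t, ht, rfl⟩ := Submodule.mem_sup.1 hy
    obtain ⟨l, rfl⟩ := Submodule.mem_span_singleton.1 ht
    exact ⟨(⟨s, hs⟩, l), Subtype.ext (hc _)⟩) (ρ.coprod Φ) fun z hz => by
      have h1 : (z.1 : M) + z.2 • x = 0 := by rw [← hc, hz]; rfl
      have h2 : z.2 • x = ((-z.1 : S) : M) := by
        rw [Submodule.coe_neg]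
        exact (neg_eq_of_add_eq_zero_right h1).symm
      have h3 : z.2 • x ∈ S := h2 ▸ (-z.1).2
      rw [LinearMap.coprod_apply, h z.2 h3, ← map_add]
      convert map_zero ρ
      exact Subtype.ext h1
  refine ⟨ρ', fun s hs => ?_⟩
  have h1 := hρ' (⟨s, hs⟩, 0)
  rw [LinearMap.coprod_apply, map_zero, add_zero] at h1
  rw [← h1]
  congr 1
  exact Subtype.ext (by rw [hc]; simp)

/-- A map into `N` extends from an artinian submodule chain if it extends along the radical. -/
theorem exists_extend_of_jacobson [IsNoetherian Λ M] [IsArtinian Λ M] {T : Submodule Λ Λ}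
    [IsArtinian Λ (Λ ⧸ T)] (hT : ∀ t ∈ T, ∀ x : M, t • x = 0)
    (hN : ∀ φ : (Module.jacobson Λ (Λ ⧸ T)).comap T.mkQ →ₗ[Λ] N,
      (∀ t (ht : t ∈ T), φ ⟨t, by simp [(Submodule.Quotient.mk_eq_zero T).2 ht]⟩ = 0) →
      ∃ Φ : Λ →ₗ[Λ] N, ∀ x (hx : x ∈ (Module.jacobson Λ (Λ ⧸ T)).comap T.mkQ), Φ x = φ ⟨x, hx⟩)
    (S₀ : Submodule Λ M) (ρ₀ : S₀ →ₗ[Λ] N) : ∃ ρ : M →ₗ[Λ] N, ∀ s : S₀, ρ s = ρ₀ s := by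
  let 𝒮 : Set (Submodule Λ M) := {S | ∃ (h : S₀ ≤ S) (ρ : S →ₗ[Λ] N),
    ∀ s : S₀, ρ (Submodule.inclusion h s) = ρ₀ s}
  obtain ⟨S, ⟨hS, ρ, hρ⟩, hmax⟩ := set_has_maximal_iff_noetherian.2 ‹IsNoetherian Λ M› 𝒮
    ⟨S₀, le_rfl, ρ₀, fun s => rfl⟩
  by_cases htop : S = ⊤
  · subst htop
    exact ⟨ρ ∘ₗ Submodule.topEquiv.symm.toLinearMap, fun s => hρ s⟩
  exfalso
  have hnt : Nontrivial (M ⧸ S) := Submodule.Quotient.nontrivial_iff.2 htop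
  obtain ⟨X, hX⟩ := IsAtomic.exists_atom (Submodule Λ (M ⧸ S))
  have hXs : IsSimpleModule Λ X := isSimpleModule_iff_isAtom.2 hX
  have := IsSimpleModule.nontrivial Λ X
  obtain ⟨⟨x, hxX⟩, hx⟩ := exists_ne (0 : X)
  obtain ⟨x, rfl⟩ := S.mkQ_surjective x
  have hxS : x ∉ S := fun h => hx (Subtype.ext ((Submodule.Quotient.mk_eq_zero S).2 h))
  let J := Module.jacobson Λ (Λ ⧸ T)
  have hK : ∀ l ∈ J.comap T.mkQ, l • x ∈ S := by
    intro l hl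
    obtain ⟨f, hf⟩ := exists_desc T.mkQ T.mkQ_surjective
      (LinearMap.toSpanSingleton Λ X ⟨S.mkQ x, hxX⟩) fun t ht => by
        rw [Submodule.mkQ_apply, Submodule.Quotient.mk_eq_zero] at ht
        refine Subtype.ext ?_
        change t • S.mkQ x = 0
        rw [← map_smul, hT t ht, map_zero]
    have h1 := Module.map_jacobson_le f (Submodule.mem_map_of_mem hl)
    rw [IsSimpleModule.jacobson_eq_bot, Submodule.mem_bot, hf] at h1
    have h2 := congrArg Subtype.val h1
    change l • S.mkQ x = 0 at h2
    rwa [← map_smul, Submodule.mkQ_apply, Submodule.Quotient.mk_eq_zero] at h2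
  let L : Submodule Λ Λ := S.comap (LinearMap.toSpanSingleton Λ M x)
  have hKL : J.comap T.mkQ ≤ L := hK
  obtain ⟨φ, hφ⟩ : ∃ φ : L →ₗ[Λ] N, ∀ l (hl : l ∈ L), φ ⟨l, hl⟩ = ρ ⟨l • x, hl⟩ :=
    ⟨ρ ∘ₗ ((LinearMap.toSpanSingleton Λ M x).restrict (p := L) (q := S) fun l hl => hl),
      fun l hl => rfl⟩
  obtain ⟨A, hA⟩ := hN (φ ∘ₗ Submodule.inclusion hKL) fun t ht => by
    refine (hφ t _).trans ?_
    convert map_zero ρ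
    exact Subtype.ext (hT t ht x)
  have hss : IsSemisimpleModule Λ ((Λ ⧸ T) ⧸ J) :=
    IsArtinian.isSemisimpleModule_iff_jacobson _ _ |>.2 (Module.jacobson_quotient_jacobson _ _)
  let c : L →ₗ[Λ] ((Λ ⧸ T) ⧸ J) := (J.mkQ ∘ₗ T.mkQ) ∘ₗ L.subtype
  obtain ⟨δ, hδ⟩ := exists_desc c.rangeRestrict c.surjective_rangeRestrict (φ - A ∘ₗ L.subtype)
    fun l hl => by
      have h1 : J.mkQ (T.mkQ l) = 0 := congrArg Subtype.val hl
      rw [Submodule.mkQ_apply, Submodule.Quotient.mk_eq_zero] at h1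
      exact sub_eq_zero.2 (hA l h1).symm
  obtain ⟨B, hB⟩ := IsSemisimpleModule.extension_property (LinearMap.range c).subtype
    (Submodule.subtype_injective _) δ
  obtain ⟨ρ', hρ'⟩ := exists_extend_sup_span S ρ x (A + B ∘ₗ J.mkQ ∘ₗ T.mkQ) fun l hl => by
    have h1 := hδ ⟨l, hl⟩
    rw [← hB] at h1
    have h2 : B (J.mkQ (T.mkQ l)) = φ ⟨l, hl⟩ - A l := h1
    rw [LinearMap.add_apply, LinearMap.comp_apply, LinearMap.comp_apply, h2, add_sub_cancel]
    exact hφ l hl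
  refine hmax (S ⊔ Submodule.span Λ {x}) ⟨hS.trans le_sup_left, ρ', fun s => ?_⟩
    (lt_of_le_of_ne le_sup_left fun he => hxS ?_)
  · exact (hρ' s (hS s.2)).trans (hρ s)
  · rw [he]
    exact Submodule.mem_sup_right (Submodule.mem_span_singleton_self x)

end Tester

section Tester

variable {R : Type u} [CommRing R] [IsNoetherianRing R] [IsLocalRing R] {I 𝔟 : Ideal R} {n k : ℕ}

/-- Modulo a maximal regular sequence the ring is artinian. -/
theorem RegSeq.isArtinian (h : RegSeq I k 𝔟) (hk : InjDim R k)
    {ι : (R ⧸ IsLocalRing.maximalIdeal R) →ₗ[R] R ⧸ 𝔟} (hι : Function.Injective ι) :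
    IsArtinian R (R ⧸ 𝔟) := by
  have hb : ∀ r ∈ 𝔟, ∀ x : R ⧸ 𝔟, r • x = 0 := fun r hr x => by
    obtain ⟨x, rfl⟩ := Submodule.Quotient.mk_surjective _ x
    rw [← Submodule.Quotient.mk_smul, Submodule.Quotient.mk_eq_zero, smul_eq_mul, mul_comm]
    exact 𝔟.mul_mem_left x hr
  let an : Submodule R (R ⧸ 𝔟) → Ideal R := fun T =>
    { carrier := {r | ∀ x ∈ T, r • x = 0}
      zero_mem' := fun x _ => zero_smul R x
      add_mem' := fun {a b} ha hb x hx => by rw [add_smul, ha x hx, hb x hx, add_zero]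
      smul_mem' := fun c a ha x hx => by rw [smul_assoc, ha x hx, smul_zero] }
  have han : StrictAnti an := by
    intro T T' hTT
    refine lt_of_le_of_ne (fun r hr x hx => hr x (hTT.le hx)) fun he => ?_
    obtain ⟨x, hx, hxT⟩ := Set.exists_of_ssubset (show (T : Set (R ⧸ 𝔟)) ⊂ T' from hTT)
    obtain ⟨ψ, hψ, hψx⟩ := h.exists_separating hk hι (L := R ⧸ 𝔟) hb hxT
    obtain ⟨r, hr⟩ := Submodule.Quotient.mk_surjective _ (ψ (Submodule.Quotient.mk 1))
    have hψ' : ∀ y, ψ y = r • y := fun y => by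
      obtain ⟨y, rfl⟩ := Submodule.Quotient.mk_surjective _ y
      have h1 : (Submodule.Quotient.mk y : R ⧸ 𝔟) = y • Submodule.Quotient.mk 1 := by
        rw [← Submodule.Quotient.mk_smul, smul_eq_mul, mul_one]
      rw [h1, map_smul, ← hr, ← Submodule.Quotient.mk_smul, ← Submodule.Quotient.mk_smul,
        ← Submodule.Quotient.mk_smul, smul_eq_mul, smul_eq_mul, smul_eq_mul, mul_one, mul_comm]
    have h1 : r ∈ an T := fun y hy => by rw [← hψ', hψ y hy]
    rw [← he] at h1
    exact hψx (by rw [hψ', h1 x hx])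
  exact han.wellFoundedLT

theorem isArtinian_of_forall_smul_eq_zero {S : Type u} [CommRing S] {𝔟 : Ideal S}
    [IsArtinian S (S ⧸ 𝔟)] {L : Type w} [AddCommGroup L] [Module S L] [Module.Finite S L]
    (hL : ∀ r ∈ 𝔟, ∀ x : L, r • x = 0) : IsArtinian S L := by
  obtain ⟨m, z, hz⟩ := Module.Finite.exists_fin (R := S) (M := L)
  let c : Fin m → (S ⧸ 𝔟) →ₗ[S] L := fun i => 𝔟.liftQ (LinearMap.toSpanSingleton S L (z i))
    fun r hr => hL r hr _
  refine isArtinian_of_surjective (Fin m → S ⧸ 𝔟) (LinearMap.lsum S (fun _ => S ⧸ 𝔟) S c) ?_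
  rw [← LinearMap.range_eq_top, ← top_le_iff, ← hz, Submodule.span_le]
  rintro _ ⟨i, rfl⟩
  refine ⟨Pi.single i (Submodule.Quotient.mk 1), ?_⟩
  rw [LinearMap.lsum_piSingle]
  exact one_smul S (z i)

theorem RegSeq.isArtinian_of_smul_eq_zero (h : RegSeq I k 𝔟) (hk : InjDim R k)
    {ι : (R ⧸ IsLocalRing.maximalIdeal R) →ₗ[R] R ⧸ 𝔟} (hι : Function.Injective ι)
    {L : Type w} [AddCommGroup L] [Module R L] [Module.Finite R L]
    (hL : ∀ r ∈ 𝔟, ∀ x : L, r • x = 0) : IsArtinian R L := by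
  have := h.isArtinian hk hι
  exact isArtinian_of_forall_smul_eq_zero hL

variable [IsAdicComplete (IsLocalRing.maximalIdeal R) R] {Λ : Type u} [Ring Λ] [Algebra R Λ]

/-- A single module detects nonprojective Cohen–Macaulay modules. -/
theorem IsGorensteinOrder.exists_tester (h : IsGorensteinOrder R Λ) :
    ∃ (K : Type u) (_ : AddCommGroup K) (_ : Module Λ K), IsCM Λ K ∧
      ∀ (N : Type u) [AddCommGroup N] [Module Λ N], IsCM Λ N → ¬ Module.Projective Λ N →
        ∃ φ : K →ₗ[Λ] N, ¬ FactorsProj φ := by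
  obtain ⟨n, hR⟩ := h.injDim
  obtain ⟨k, 𝔟, hreg, hk, ι, hι⟩ := exists_regSeq hR one_ne_zero
  have h𝔟 : 𝔟 ≤ IsLocalRing.maximalIdeal R := hreg.le.trans (Ideal.pow_le_self one_ne_zero)
  have := h.isNoetherianRing
  have := h.finite
  let T : Submodule Λ Λ := smulTop Λ 𝔟 Λ
  let K₀ : Submodule Λ Λ := (Module.jacobson Λ (Λ ⧸ T)).comap T.mkQ
  obtain ⟨m₁, p, hp⟩ := Module.Finite.exists_fin' Λ K₀
  let e : Λ ≃ₗ[Λ] (Fin 1 → Λ) := (LinearEquiv.funUnique (Fin 1) Λ Λ).symm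
  obtain ⟨m₁', m', q', hT, H⟩ := hreg.exists_climb h hR hk
    (e.toLinearMap ∘ₗ K₀.subtype ∘ₗ p)
  refine ⟨LinearMap.range q', inferInstance, inferInstance,
    IsCM.syzygy (f := (LinearMap.range q').subtype) (g := (LinearMap.range q').mkQ)
      IsCM.of_projective hT (Submodule.subtype_injective _) (LinearMap.exact_subtype_mkQ _)
      (Submodule.mkQ_surjective _), ?_⟩
  intro N _ _ hN hnp
  let _ := restrictModule R Λ N
  have := restrictModule_isScalarTower R (Λ := Λ) N
  by_contra hcon
  push Not at hcon
  refine hnp ?_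
  have hNM := h.isMCM_iff.2 hN
  have key : ∀ η : (Fin m₁ → Λ) →ₗ[Λ] N, (∀ u, (p u : Λ) ∈ T → η u ∈ smulTop Λ 𝔟 N) →
      ∃ A : Λ →ₗ[Λ] N, ∀ u, η u - A (p u) ∈ smulTop Λ 𝔟 N := by
    intro η hη
    obtain ⟨φ, hφ, -⟩ := H N hNM η fun u hu => hη u (by
      have h1 := map_mem_smulTop Λ e.symm.toLinearMap hu
      simpa using h1)
    obtain ⟨A, hA⟩ := hφ (by
      obtain ⟨s, α, β, hαβ⟩ := hcon φ
      obtain ⟨α', hα'⟩ := ((hT.2 0).finPi₂ s).extend (f := (LinearMap.range q').subtype)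
        (g := (LinearMap.range q').mkQ) (Submodule.subtype_injective _)
        (LinearMap.exact_subtype_mkQ _) (Submodule.mkQ_surjective _) α
      exact ⟨β ∘ₗ α', fun u => by rw [← hαβ, ← hα']; rfl⟩)
    exact ⟨A ∘ₗ e.toLinearMap, hA⟩
  obtain ⟨Q, C, _, _, _, _, f, g, hQf, hQp, hf, hfg, hg, hC⟩ := h.exists_cosyzygy hN
  let _ := restrictModule R Λ Q
  have := restrictModule_isScalarTower R (Λ := Λ) Q
  let _ := restrictModule R Λ C
  have := restrictModule_isScalarTower R (Λ := Λ) C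
  have hpure : ∀ x, f x ∈ smulTop Λ 𝔟 Q → x ∈ smulTop Λ 𝔟 N := by
    let f' : N →ₗ[R] Q := f.restrictScalars R
    let g' : Q →ₗ[R] C := g.restrictScalars R
    have h2 : Function.Exact f' g' := hfg
    have h3 : Function.Surjective g' := hg
    exact hreg.isPure hR (f := f') (g := g') hf h2 h3 (h.isMCM_iff.2 hC)
  have hQR : Module.Finite R Q := Module.Finite.trans Λ Q
  have hNR := hNM.1
  have hNf := hN.1
  have hkill : ∀ (L : Type u) [AddCommGroup L] [Module R L] [Module Λ L] [IsScalarTower R Λ L],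
      ∀ r ∈ 𝔟, ∀ x : L ⧸ smulTop Λ 𝔟 L, r • x = 0 := fun L _ _ _ _ r hr x =>
    smul_quotient_smulTop hr x
  have hartQ : IsArtinian Λ (Q ⧸ smulTop Λ 𝔟 Q) := isArtinian_of_tower R
    (hreg.isArtinian_of_smul_eq_zero hk hι (hkill Q))
  have hartΛ : IsArtinian Λ (Λ ⧸ T) := isArtinian_of_tower R
    (hreg.isArtinian_of_smul_eq_zero hk hι (hkill Λ))
  let fbar : (N ⧸ smulTop Λ 𝔟 N) →ₗ[Λ] (Q ⧸ smulTop Λ 𝔟 Q) :=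
    (smulTop Λ 𝔟 N).mapQ (smulTop Λ 𝔟 Q) f fun x hx => map_mem_smulTop Λ f hx
  have hfbar : Function.Injective fbar := (injective_iff_map_eq_zero _).2 fun x hx => by
    obtain ⟨x, rfl⟩ := Submodule.Quotient.mk_surjective _ x
    rw [Submodule.mapQ_apply, Submodule.Quotient.mk_eq_zero] at hx
    exact (Submodule.Quotient.mk_eq_zero _).2 (hpure x hx)
  obtain ⟨ρ, hρ⟩ := exists_extend_of_jacobson (M := Q ⧸ smulTop Λ 𝔟 Q) (T := T)
    (N := N ⧸ smulTop Λ 𝔟 N) (fun t ht x => by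
      obtain ⟨x, rfl⟩ := Submodule.Quotient.mk_surjective _ x
      rw [← Submodule.Quotient.mk_smul, Submodule.Quotient.mk_eq_zero]
      exact map_mem_smulTop Λ (LinearMap.toSpanSingleton Λ Q x) ht)
    (fun φ hφ => by
      obtain ⟨η, hη⟩ := exists_lift (smulTop Λ 𝔟 N).mkQ (φ ∘ₗ p)
        fun u => Submodule.mkQ_surjective _ _
      obtain ⟨A, hA⟩ := key η fun u hu => by
        have h1 := hη u
        rw [LinearMap.comp_apply, show p u = ⟨(p u : Λ), (p u).2⟩ from rfl, hφ _ hu] at h1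
        exact (Submodule.Quotient.mk_eq_zero _).1 h1
      refine ⟨(smulTop Λ 𝔟 N).mkQ ∘ₗ A, fun x hx => ?_⟩
      obtain ⟨u, hu⟩ := hp ⟨x, hx⟩
      have h1 := hA u
      rw [hu] at h1
      have h2 := (Submodule.Quotient.eq _).2 h1
      rw [← hu]
      exact h2.symm.trans (hη u))
    (LinearMap.range fbar) (LinearEquiv.ofInjective fbar hfbar).symm.toLinearMap
  obtain ⟨g', hg'⟩ := exists_lift (smulTop Λ 𝔟 N).mkQ (ρ ∘ₗ (smulTop Λ 𝔟 Q).mkQ)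
    fun u => Submodule.mkQ_surjective _ _
  have hu : IsUnit (g' ∘ₗ f : Module.End Λ N) := isUnit_of_sub_mem (R := R) _ fun x => by
    refine (mem_smulTop Λ).1 (smulTop_mono Λ h𝔟 ((Submodule.Quotient.eq _).1 ?_))
    have h1 := hg' (f x)
    have h2 := hρ ⟨fbar (Submodule.Quotient.mk x), ⟨_, rfl⟩⟩
    exact ((h1.trans h2).trans ((LinearEquiv.symm_apply_eq _).2 (Subtype.ext rfl))).symm
  obtain ⟨b, hb⟩ := hu.exists_left_inv
  exact Module.Projective.of_split f (b ∘ₗ g') hb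

end Tester

section Nilpotence

variable {Λ : Type u} [Ring Λ]

/-- Extensions of countable direct sums of Cohen–Macaulay modules. -/
def IsCMExt (Λ : Type u) [Ring Λ] (H : Type u) [AddCommGroup H] [Module Λ H] : Prop :=
  ∃ (M C : ℕ → ModuleCat.{u} Λ) (e : (Π₀ i, M i) →ₗ[Λ] H) (p : H →ₗ[Λ] (Π₀ i, C i)),
    (∀ i, IsCM Λ (M i)) ∧ (∀ i, IsCM Λ (C i)) ∧ Function.Injective e ∧ Function.Exact e p ∧
      Function.Surjective p

open Classical in
/-- Internal direct sum decomposition into finitely generated submodules. -/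
def HasFGDecomposition (Λ : Type u) [Ring Λ] (H : Type u) [AddCommGroup H] [Module Λ H] : Prop :=
  ∃ (ι : Type w) (P : ι → Submodule Λ H), DirectSum.IsInternal P ∧ ∀ i, (P i).FG

/-- Composites along a sequence of maps. -/
def seqComp {M : ℕ → Type u} [∀ i, AddCommGroup (M i)] [∀ i, Module Λ (M i)]
    (f : ∀ i, M i →ₗ[Λ] M (i + 1)) : ∀ t, M 0 →ₗ[Λ] M t
  | 0 => LinearMap.id
  | t + 1 => f t ∘ₗ seqComp f t

/-- Maps into a directed union lift through covers of its members on direct sums of finitely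
generated modules. -/
theorem exists_section_of_decomposition {V H : Type u} [AddCommGroup V] [Module Λ V]
    [AddCommGroup H] [Module Λ H] (hH : HasFGDecomposition.{u, w} Λ H) (π : V →ₗ[Λ] H)
    (S : ℕ → Submodule Λ V) (hmono : Monotone fun n => (S n).map π)
    (htop : ∀ x : H, ∃ n, x ∈ (S n).map π) (hinj : ∀ n, ∀ x ∈ S n, π x = 0 → x = 0) :
    ∃ σ : H →ₗ[Λ] V, ∀ x, π (σ x) = x := by
  classical
  obtain ⟨ι, P, hP, hfg⟩ := hH
  have h1 : ∀ i, ∃ L : P i →ₗ[Λ] V, ∀ x, π (L x) = x := by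
    intro i
    obtain ⟨n, hn⟩ : ∃ n, P i ≤ (S n).map π := by
      obtain ⟨s, hs⟩ := hfg i
      rw [← hs]
      clear hs
      induction s using Finset.induction_on with
      | empty => exact ⟨0, by simp⟩
      | insert a s _ ih =>
        obtain ⟨n, hn⟩ := ih
        obtain ⟨m, hm⟩ := htop a
        refine ⟨max n m, ?_⟩
        rw [Finset.coe_insert, Submodule.span_insert, sup_le_iff, Submodule.span_le,
          Set.singleton_subset_iff]
        exact ⟨hmono (le_max_right n m) hm, hn.trans (hmono (le_max_left n m))⟩
    obtain ⟨L, hL⟩ := exists_codlift (π ∘ₗ (S n).subtype)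
      ((injective_iff_map_eq_zero _).2 fun x hx => Subtype.ext (hinj n x x.2 hx)) (P i).subtype
      fun x => by
        obtain ⟨y, hy, hyx⟩ := hn x.2
        exact ⟨⟨y, hy⟩, hyx⟩
    exact ⟨(S n).subtype ∘ₗ L, hL⟩
  choose L hL using h1
  let e : (DirectSum ι fun i => P i) ≃ₗ[Λ] H :=
    LinearEquiv.ofBijective (DirectSum.coeLinearMap P) hP
  refine ⟨DirectSum.toModule Λ ι V L ∘ₗ e.symm.toLinearMap, fun x => ?_⟩
  obtain ⟨x, rfl⟩ := e.surjective x
  rw [LinearMap.comp_apply, LinearEquiv.coe_coe, LinearEquiv.symm_apply_apply]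
  change (π ∘ₗ DirectSum.toModule Λ ι V L) x = DirectSum.coeLinearMap P x
  congr 1
  refine DirectSum.linearMap_ext Λ fun i => LinearMap.ext fun y => ?_
  simp [hL]

variable {M : ℕ → Type u} [∀ i, AddCommGroup (M i)] [∀ i, Module Λ (M i)]

theorem dfinsupp_induction_lsingle {p : (Π₀ i, M i) → Prop} (h0 : p 0)
    (hs : ∀ i x, p (DFinsupp.lsingle (R := Λ) i x)) (ha : ∀ x y, p x → p y → p (x + y))
    (x : Π₀ i, M i) : p x := by
  induction x using DFinsupp.induction with
  | h0 => exact h0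
  | ha i b f _ _ h => exact ha _ _ (hs i b) h

/-- One minus the shift along a sequence of maps. -/
def oneSubShift (f : ∀ i, M i →ₗ[Λ] M (i + 1)) : (Π₀ i, M i) →ₗ[Λ] (Π₀ i, M i) :=
  LinearMap.id - DFinsupp.lsum ℕ fun i => DFinsupp.lsingle (i + 1) ∘ₗ f i

variable (f : ∀ i, M i →ₗ[Λ] M (i + 1))

theorem oneSubShift_lsingle (i : ℕ) (x : M i) : oneSubShift f (DFinsupp.lsingle (R := Λ) i x) =
    DFinsupp.lsingle (R := Λ) i x - DFinsupp.lsingle (R := Λ) (i + 1) (f i x) := by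
  simp [oneSubShift]

theorem oneSubShift_apply_zero (u : Π₀ i, M i) : oneSubShift f u 0 = u 0 := by
  refine dfinsupp_induction_lsingle (Λ := Λ) (p := fun u => oneSubShift f u 0 = u 0) ?_ ?_ ?_ u
  · simp
  · intro i x
    rw [oneSubShift_lsingle, DFinsupp.sub_apply]
    simp
  · intro x y hx hy
    rw [map_add, DFinsupp.add_apply, hx, hy, DFinsupp.add_apply]

theorem oneSubShift_apply_succ (u : Π₀ i, M i) (k : ℕ) :
    oneSubShift f u (k + 1) = u (k + 1) - f k (u k) := by
  refine dfinsupp_induction_lsingle (Λ := Λ)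
    (p := fun u => oneSubShift f u (k + 1) = u (k + 1) - f k (u k)) ?_ ?_ ?_ u
  · simp
  · intro i x
    rw [oneSubShift_lsingle, DFinsupp.sub_apply]
    congr 1
    by_cases h : i = k
    · subst h
      simp
    · rw [DFinsupp.lsingle_apply, DFinsupp.lsingle_apply, DFinsupp.single_eq_of_ne (by omega),
        DFinsupp.single_eq_of_ne (by omega), map_zero]
  · intro x y hx hy
    rw [map_add, DFinsupp.add_apply, hx, hy, DFinsupp.add_apply, DFinsupp.add_apply, map_add]
    abel

end Nilpotence

section Nilpotence

variable {Λ : Type u} [Ring Λ] {M : ℕ → Type u} [∀ i, AddCommGroup (M i)] [∀ i, Module Λ (M i)]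

theorem exists_forall_apply_eq_zero {N : Type u} [AddCommGroup N] [Module Λ N] [Module.Finite Λ N]
    (φ : N →ₗ[Λ] Π₀ i, M i) : ∃ t, ∀ x, φ x t = 0 := by
  classical
  obtain ⟨s, hs⟩ := (Module.Finite.fg_top : (⊤ : Submodule Λ N).FG)
  obtain ⟨t, ht⟩ := Infinite.exists_notMem_finset (s.biUnion fun x => (φ x).support)
  refine ⟨t, fun x => ?_⟩
  have hx : x ∈ LinearMap.ker (DFinsupp.lapply (R := Λ) t ∘ₗ φ) := by
    have h : (⊤ : Submodule Λ N) ≤ LinearMap.ker (DFinsupp.lapply (R := Λ) t ∘ₗ φ) := by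
      rw [← hs, Submodule.span_le]
      intro y hy
      simp only [Finset.mem_biUnion, not_exists, not_and] at ht
      simpa using ht y hy
    exact h trivial
  exact hx

/-- If extensions of countable direct sums of Cohen–Macaulay modules decompose into finitely
generated modules, then sequences of non-split maps between Cohen–Macaulay modules with local
endomorphism rings are stably nilpotent. -/
theorem exists_factorsProj_seqComp
    (hdec : ∀ (H : Type u) [AddCommGroup H] [Module Λ H], IsCMExt Λ H →
      HasFGDecomposition.{u, w} Λ H)
    (hcos : ∀ (N : Type u) [AddCommGroup N] [Module Λ N], IsCM Λ N →
      ∃ (Q C : Type u) (_ : AddCommGroup Q) (_ : Module Λ Q) (_ : AddCommGroup C)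
        (_ : Module Λ C) (f : N →ₗ[Λ] Q) (g : Q →ₗ[Λ] C), Module.Finite Λ Q ∧
          Module.Projective Λ Q ∧ Function.Injective f ∧ Function.Exact f g ∧
          Function.Surjective g ∧ IsCM Λ C)
    (hM : ∀ i, IsCM Λ (M i)) (hloc : ∀ i, IsLocalRing (Module.End Λ (M i)))
    (f : ∀ i, M i →ₗ[Λ] M (i + 1)) (hf : ∀ i, ¬ HasRetraction (f i)) :
    ∃ t, FactorsProj (seqComp f t) := by
  classical
  have hcos' := fun i => hcos (M i) (hM i)
  choose Q C hQ1 hQ2 hC1 hC2 j g hQf hQp hj hjg hg hC using hcos'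
  let J : (Π₀ i, M i) →ₗ[Λ] (Π₀ i, Q i) := DFinsupp.mapRange.linearMap j
  let G : (Π₀ i, Q i) →ₗ[Λ] (Π₀ i, C i) := DFinsupp.mapRange.linearMap g
  have hJa : ∀ u i, J u i = j i (u i) := fun u i => rfl
  have hGa : ∀ u i, G u i = g i (u i) := fun u i => rfl
  have hJ : Function.Injective J := (DFinsupp.mapRange_injective _ fun i => map_zero (j i)).2 hj
  have hG : Function.Surjective G := (DFinsupp.mapRange_surjective _ fun i => map_zero (g i)).2 hg
  have hJG : Function.Exact J G := by
    intro q
    constructor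
    · intro hq
      have h1 : ∀ i, ∃ x, j i x = q i := fun i => (hjg i (q i)).1 (by rw [← hGa, hq]; rfl)
      choose x hx using h1
      refine ⟨DFinsupp.mk q.support fun i => x i, ?_⟩
      ext i
      rw [hJa, DFinsupp.mk_apply]
      split_ifs with h
      · exact hx i
      · rw [map_zero, DFinsupp.notMem_support_iff.1 h]
    · rintro ⟨x, rfl⟩
      ext i
      rw [hGa, hJa, (hjg i).apply_apply_eq_zero]
      rfl
  obtain ⟨H, i1, i2, e, p, b, he, hep, hp, hbe, hpb, -⟩ :=
    exists_pushout.{u, u, u, u} hJ hJG hG (oneSubShift f)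
  have hext : IsCMExt Λ H :=
    ⟨fun i => ModuleCat.of Λ (M i), fun i => ModuleCat.of Λ (C i), e, p, hM, hC, he, hep, hp⟩
  obtain ⟨π, hπ⟩ : ∃ π : (Π₀ i, M i) × (Π₀ i, Q i) →ₗ[Λ] H, ∀ u q, π (u, q) = e u + b q :=
    ⟨e.coprod b, fun _ _ => rfl⟩
  obtain ⟨κ, hκ⟩ : ∃ κ : (Π₀ i, M i) →ₗ[Λ] (Π₀ i, M i) × (Π₀ i, Q i),
      ∀ u, κ u = (oneSubShift f u, - J u) := ⟨(oneSubShift f).prod (-J), fun _ => rfl⟩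
  have hker : ∀ z, π z = 0 → ∃ u, κ u = z := by
    rintro ⟨u, q⟩ hz
    rw [hπ] at hz
    have h1 : G q = 0 := by
      rw [← hpb, ← map_zero p, ← hz, map_add, hep.apply_apply_eq_zero, zero_add]
    obtain ⟨a, rfl⟩ := (hJG q).1 h1
    rw [hbe, ← map_add] at hz
    have h2 := (map_eq_zero_iff e he).1 hz
    refine ⟨-a, ?_⟩
    rw [hκ, map_neg, map_neg, neg_neg, ← eq_neg_of_add_eq_zero_left h2]
  have hπκ : ∀ u, π (κ u) = 0 := fun u => by rw [hκ, hπ, map_neg, hbe, add_neg_cancel]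
  have hκi : Function.Injective κ := by
    intro x y hxy
    rw [hκ, hκ, Prod.mk.injEq, neg_inj] at hxy
    exact hJ hxy.2
  let S : ℕ → Submodule Λ ((Π₀ i, M i) × (Π₀ i, Q i)) := fun n =>
    { carrier := {z | (∀ i, i ≠ n → z.1 i = 0) ∧ ∀ i, n ≤ i → z.2 i = 0}
      add_mem' := by
        rintro x y ⟨h1, h2⟩ ⟨h3, h4⟩
        exact ⟨fun i hi => by simp [h1 i hi, h3 i hi], fun i hi => by simp [h2 i hi, h4 i hi]⟩
      zero_mem' := ⟨fun i _ => rfl, fun i _ => rfl⟩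
      smul_mem' := by
        rintro r x ⟨h1, h2⟩
        exact ⟨fun i hi => by simp [h1 i hi], fun i hi => by simp [h2 i hi]⟩ }
  have hS : ∀ n z, z ∈ S n ↔ (∀ i, i ≠ n → z.1 i = 0) ∧ ∀ i, n ≤ i → z.2 i = 0 :=
    fun n z => Iff.rfl
  have hsingle : ∀ n (x : M n), ∀ i, i ≠ n → DFinsupp.lsingle (R := Λ) (M := M) n x i = 0 :=
    fun n x i hi => by rw [DFinsupp.lsingle_apply, DFinsupp.single_eq_of_ne hi]
  have hsingleQ : ∀ n (x : Q n), ∀ i, i ≠ n → DFinsupp.lsingle (R := Λ) (M := Q) n x i = 0 :=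
    fun n x i hi => by rw [DFinsupp.lsingle_apply, DFinsupp.single_eq_of_ne hi]
  have hJs : ∀ n (x : M n), J (DFinsupp.lsingle (R := Λ) n x) =
      DFinsupp.lsingle (R := Λ) n (j n x) := fun n x => by
    simp only [J, DFinsupp.lsingle_apply]
    exact DFinsupp.mapRange_single (hf := fun i => map_zero (j i))
  have hstep : ∀ n (x : M n), e (DFinsupp.lsingle (R := Λ) n x) =
      π (DFinsupp.lsingle (R := Λ) (n + 1) (f n x), DFinsupp.lsingle (R := Λ) n (j n x)) := by
    intro n x
    rw [hπ, ← hJs, hbe, oneSubShift_lsingle, map_sub]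
    abel
  have heq : ∀ n (u : Π₀ i, M i), (∀ i, i ≠ n → u i = 0) →
      u = DFinsupp.lsingle (R := Λ) n (u n) := by
    intro n u hu
    ext i
    by_cases h : i = n
    · subst h
      simp
    · rw [hu i h, hsingle n _ i h]
  have hmono : Monotone fun n => (S n).map π := by
    refine monotone_nat_of_le_succ fun n => ?_
    rintro _ ⟨⟨u, q⟩, ⟨h1, h2⟩, rfl⟩
    simp only at h1 h2
    have h3 : π (u, q) = π (DFinsupp.lsingle (R := Λ) (n + 1) (f n (u n)),
        DFinsupp.lsingle (R := Λ) n (j n (u n)) + q) := by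
      rw [hπ, heq n u h1, hstep, hπ, hπ, map_add]
      simp [add_assoc]
    rw [h3]
    refine ⟨_, ⟨fun i hi => hsingle _ _ i hi, fun i hi => ?_⟩, rfl⟩
    change (DFinsupp.lsingle (R := Λ) n (j n (u n)) + q) i = 0
    rw [DFinsupp.add_apply, hsingleQ n _ i (by omega), h2 i (by omega), add_zero]
  have hle : ∀ n (x : M n), e (DFinsupp.lsingle (R := Λ) n x) ∈ (S n).map π := fun n x =>
    ⟨(DFinsupp.lsingle (R := Λ) n x, 0), ⟨fun i hi => hsingle _ _ i hi, fun _ _ => rfl⟩, by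
      rw [hπ, map_zero, add_zero]⟩
  have hle' : ∀ n (x : Q n), b (DFinsupp.lsingle (R := Λ) n x) ∈ (S (n + 1)).map π := fun n x =>
    ⟨(0, DFinsupp.lsingle (R := Λ) n x), ⟨fun _ _ => rfl, fun i hi => hsingleQ _ _ i (by omega)⟩,
      by rw [hπ, map_zero, zero_add]⟩
  have hadd : ∀ x y : H, (∃ n, x ∈ (S n).map π) → (∃ n, y ∈ (S n).map π) →
      ∃ n, x + y ∈ (S n).map π := by
    rintro x y ⟨n, hn⟩ ⟨m, hm⟩
    exact ⟨max n m, add_mem (hmono (le_max_left n m) hn) (hmono (le_max_right n m) hm)⟩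
  have hπs : ∀ x, ∃ z, π z = x := by
    intro x
    obtain ⟨q, hq⟩ := hG (p x)
    obtain ⟨u, hu⟩ := (hep (x - b q)).1 (by rw [map_sub, hpb, hq, sub_self])
    exact ⟨(u, q), by rw [hπ, hu, sub_add_cancel]⟩
  have htop : ∀ x : H, ∃ n, x ∈ (S n).map π := by
    intro x
    obtain ⟨⟨u, q⟩, rfl⟩ := hπs x
    rw [hπ]
    refine hadd _ _ ?_ ?_
    · refine dfinsupp_induction_lsingle (Λ := Λ) (p := fun u => ∃ n, e u ∈ (S n).map π) ?_ ?_ ?_ u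
      · exact ⟨0, by simp⟩
      · exact fun i x => ⟨i, hle i x⟩
      · exact fun x y hx hy => by rw [map_add]; exact hadd _ _ hx hy
    · refine dfinsupp_induction_lsingle (Λ := Λ) (p := fun u => ∃ n, b u ∈ (S n).map π) ?_ ?_ ?_ q
      · exact ⟨0, by simp⟩
      · exact fun i x => ⟨i + 1, hle' i x⟩
      · exact fun x y hx hy => by rw [map_add]; exact hadd _ _ hx hy
  have hinj : ∀ n, ∀ x ∈ S n, π x = 0 → x = 0 := by
    intro n z hz hz0
    obtain ⟨u, rfl⟩ := hker z hz0
    rw [hκ, hS] at hz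
    obtain ⟨h1, h2⟩ := hz
    have h3 : ∀ i, n ≤ i → u i = 0 := by
      intro i hi
      refine (map_eq_zero_iff (j i) (hj i)).1 ?_
      have := h2 i hi
      simpa [hJa] using this
    have h4 : ∀ i, i < n → u i = 0 := by
      intro i
      induction i with
      | zero =>
        intro hi
        rw [← oneSubShift_apply_zero f u]
        exact h1 0 (by omega)
      | succ i ih =>
        intro hi
        have h5 := oneSubShift_apply_succ f u i
        rw [ih (by omega), map_zero, sub_zero] at h5
        rw [← h5]
        exact h1 (i + 1) (by omega)
    have h5 : u = 0 := by
      ext i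
      exact (lt_or_ge i n).elim (h4 i) (h3 i)
    rw [h5, map_zero]
  obtain ⟨σ, hσ⟩ := exists_section_of_decomposition.{u, w} (hdec H hext) π S hmono htop hinj
  obtain ⟨ρ, hρ⟩ := exists_codlift κ hκi (LinearMap.id - σ ∘ₗ π) fun z => by
    obtain ⟨u, hu⟩ := hker (z - σ (π z)) (by rw [map_sub, hσ, sub_self])
    exact ⟨u, by simpa using hu⟩
  have hρκ : ∀ u, ρ (κ u) = u := fun u => hκi (by rw [hρ]; simp [hπκ])
  obtain ⟨a, ha⟩ : ∃ a : ∀ t k, M k →ₗ[Λ] M t, ∀ t k x,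
      a t k x = ρ (DFinsupp.lsingle (R := Λ) k x, 0) t :=
    ⟨fun t k => DFinsupp.lapply t ∘ₗ ρ ∘ₗ LinearMap.inl Λ _ _ ∘ₗ DFinsupp.lsingle k,
      fun _ _ _ => rfl⟩
  obtain ⟨c, hc⟩ : ∃ c : ∀ t k, Q k →ₗ[Λ] M t, ∀ t k x,
      c t k x = ρ (0, DFinsupp.lsingle (R := Λ) k x) t :=
    ⟨fun t k => DFinsupp.lapply t ∘ₗ ρ ∘ₗ LinearMap.inr Λ _ _ ∘ₗ DFinsupp.lsingle k,
      fun _ _ _ => rfl⟩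
  have key : ∀ t k x, a t k x - a t (k + 1) (f k x) - c t k (j k x) =
      DFinsupp.lsingle (R := Λ) (M := M) k x t := by
    intro t k x
    rw [ha, ha, hc, ← hJs, ← DFinsupp.sub_apply, ← DFinsupp.sub_apply, ← map_sub, ← map_sub]
    have h1 := hρκ (DFinsupp.lsingle (R := Λ) k x)
    rw [hκ, oneSubShift_lsingle] at h1
    conv_rhs => rw [← h1]
    congr 2
    ext <;> simp
  have hproj : ∀ t k, FactorsProj (c t k ∘ₗ j k) := fun t k => by
    have := hQf k
    have := hQp k
    exact (FactorsProj.of_projective (j k) (c t k))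
  obtain ⟨t, ht⟩ : ∃ t, ∀ x, a t 0 x = 0 := by
    have := (hM 0).finite
    obtain ⟨t, ht⟩ := exists_forall_apply_eq_zero
      (ρ ∘ₗ LinearMap.inl Λ _ (Π₀ i, Q i) ∘ₗ DFinsupp.lsingle (R := Λ) (M := M) 0)
    exact ⟨t, fun x => by rw [ha]; exact ht x⟩
  refine ⟨t, ?_⟩
  have h1 : ∀ k, k ≤ t → FactorsProj (a t k ∘ₗ seqComp f k) := by
    intro k
    induction k with
    | zero => exact fun _ => FactorsProj.zero.congr fun x => (ht x).symm
    | succ k ih =>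
      intro hk
      refine ((ih (by omega)).sub ((hproj t k).comp_right (seqComp f k))).congr fun x => ?_
      have h2 := key t k (seqComp f k x)
      rw [hsingle k _ t (by omega), sub_eq_zero, sub_eq_iff_eq_add] at h2
      change a t k (seqComp f k x) - c t k (j k (seqComp f k x)) = a t (k + 1) (f k (seqComp f k x))
      rw [h2]
      abel
  have h2 : FactorsProj ((1 + a t (t + 1) ∘ₗ f t : Module.End Λ (M t)) ∘ₗ seqComp f t) := by
    refine ((h1 t le_rfl).sub ((hproj t t).comp_right (seqComp f t))).congr fun x => ?_
    have h3 := key t t (seqComp f t x)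
    rw [DFinsupp.lsingle_apply, DFinsupp.single_eq_same, sub_eq_iff_eq_add, sub_eq_iff_eq_add] at h3
    change a t t (seqComp f t x) - c t t (j t (seqComp f t x)) =
      seqComp f t x + a t (t + 1) (f t (seqComp f t x))
    rw [h3]
    abel
  have h3 : IsUnit (1 + a t (t + 1) ∘ₗ f t : Module.End Λ (M t)) := by
    have := hloc t
    obtain h | h := IsLocalRing.isUnit_or_isUnit_of_add_one
      (show (1 + a t (t + 1) ∘ₗ f t : Module.End Λ (M t)) + -(a t (t + 1) ∘ₗ f t) = 1 by abel)
    · exact h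
    · obtain ⟨w, hw⟩ := h.neg.exists_left_inv
      refine absurd ⟨w ∘ₗ a t (t + 1), fun x => ?_⟩ (hf t)
      have := LinearMap.congr_fun hw x
      simpa using this
  obtain ⟨w, hw⟩ := h3.exists_left_inv
  exact (h2.comp_left w).congr fun x => LinearMap.congr_fun hw (seqComp f t x)

end Nilpotence

section FiniteRep

variable {Λ : Type u} [Ring Λ]

/-- The modules satisfying `S` fall into finitely many isomorphism classes. -/
def FinRep (S : ModuleCat.{u} Λ → Prop) : Prop :=
  ∃ l : List (ModuleCat.{u} Λ), ∀ X, S X → ∃ Y ∈ l, Nonempty (X ≃ₗ[Λ] Y)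

theorem FinRep.mono {S T : ModuleCat.{u} Λ → Prop} (h : FinRep T) (hST : ∀ X, S X → T X) :
    FinRep S := by
  obtain ⟨l, hl⟩ := h
  exact ⟨l, fun X hX => hl X (hST X hX)⟩

theorem FinRep.or {S T : ModuleCat.{u} Λ → Prop} (hS : FinRep S) (hT : FinRep T) :
    FinRep fun X => S X ∨ T X := by
  obtain ⟨l, hl⟩ := hS
  obtain ⟨l', hl'⟩ := hT
  refine ⟨l ++ l', ?_⟩
  rintro X (hX | hX)
  · obtain ⟨Y, hY, h⟩ := hl X hX
    exact ⟨Y, List.mem_append_left _ hY, h⟩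
  · obtain ⟨Y, hY, h⟩ := hl' X hX
    exact ⟨Y, List.mem_append_right _ hY, h⟩

theorem FinRep.iUnion {ι : Type} [Fintype ι] {S : ι → ModuleCat.{u} Λ → Prop}
    (h : ∀ i, FinRep (S i)) : FinRep fun X => ∃ i, S i X := by
  choose l hl using h
  refine ⟨Finset.univ.toList.flatMap l, ?_⟩
  rintro X ⟨i, hX⟩
  obtain ⟨Y, hY, h⟩ := hl i X hX
  exact ⟨Y, List.mem_flatMap.2 ⟨i, by simp, hY⟩, h⟩

theorem FinRep.of_equiv (N : ModuleCat.{u} Λ) : FinRep fun X : ModuleCat.{u} Λ =>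
    Nonempty (X ≃ₗ[Λ] N) := ⟨[N], fun X hX => ⟨N, by simp, hX⟩⟩

variable (Λ) in
/-- A finite decomposition of a module into indecomposable modules. -/
theorem exists_indecomposable_family (M : Type u) [AddCommGroup M] [Module Λ M]
    [IsNoetherian Λ M] :
    ∃ (ι : Type) (_ : Fintype ι) (D : ι → ModuleCat.{u} Λ) (i : ∀ s, D s →ₗ[Λ] M)
      (p : ∀ s, M →ₗ[Λ] D s), (∀ s, IsIndecomposableModule Λ (D s)) ∧ (∀ s x, p s (i s x) = x) ∧
        ∀ x, ∑ s, i s (p s x) = x := by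
  refine decomposition_induction (Λ := Λ) (M := M) (fun M _ _ =>
    ∃ (ι : Type) (_ : Fintype ι) (D : ι → ModuleCat.{u} Λ) (i : ∀ s, D s →ₗ[Λ] M)
      (p : ∀ s, M →ₗ[Λ] D s), (∀ s, IsIndecomposableModule Λ (D s)) ∧ (∀ s x, p s (i s x) = x) ∧
        ∀ x, ∑ s, i s (p s x) = x) ?_ ?_ ?_ ?_
  · rintro M N _ _ _ _ e ⟨ι, _, D, i, p, h1, h2, h3⟩
    refine ⟨ι, inferInstance, D, fun s => e ∘ₗ i s, fun s => p s ∘ₗ e.symm, h1, ?_, ?_⟩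
    · intro s x
      simp [h2]
    · intro x
      simp only [LinearMap.comp_apply, LinearEquiv.coe_coe, ← map_sum, h3, e.apply_symm_apply]
  · intro M _ _ hM
    exact ⟨Empty, inferInstance, fun s => s.elim, fun s => s.elim, fun s => s.elim,
      fun s => s.elim, fun s => s.elim, fun x => Subsingleton.elim _ _⟩
  · intro M _ _ _ hM
    exact ⟨Unit, inferInstance, fun _ => ModuleCat.of Λ M, fun _ => LinearMap.id,
      fun _ => LinearMap.id, fun _ => hM, fun _ _ => rfl, fun x => by simp⟩
  · rintro M N _ _ _ _ ⟨ι, _, D, i, p, h1, h2, h3⟩ ⟨ι', _, D', i', p', h1', h2', h3'⟩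
    refine ⟨ι ⊕ ι', inferInstance, Sum.elim D D',
      fun s => match s with
        | .inl s => LinearMap.inl Λ M N ∘ₗ i s
        | .inr s => LinearMap.inr Λ M N ∘ₗ i' s,
      fun s => match s with
        | .inl s => p s ∘ₗ LinearMap.fst Λ M N
        | .inr s => p' s ∘ₗ LinearMap.snd Λ M N, ?_, ?_, ?_⟩
    · rintro (s | s)
      exacts [h1 s, h1' s]
    · rintro (s | s) x
      exacts [h2 s x, h2' s x]
    · rintro ⟨x, y⟩
      rw [Fintype.sum_sum_type]
      change ∑ s, LinearMap.inl Λ M N (i s (p s x)) + ∑ s, LinearMap.inr Λ M N (i' s (p' s y)) = _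
      rw [← map_sum, ← map_sum, h3, h3']
      simp

end FiniteRep

section Necessity

variable {R Λ : Type u} [CommRing R] [IsNoetherianRing R] [IsLocalRing R]
  [IsAdicComplete (IsLocalRing.maximalIdeal R) R] [Ring Λ] [Algebra R Λ]

theorem not_projective_of_not_factorsProj {K N : Type u} [AddCommGroup K] [Module Λ K]
    [AddCommGroup N] [Module Λ N] [Module.Finite Λ N] {g : K →ₗ[Λ] N} (hg : ¬ FactorsProj g) :
    ¬ Module.Projective Λ N := fun _ =>
  hg ((FactorsProj.of_projective g LinearMap.id).congr fun _ => rfl)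

omit [IsAdicComplete (IsLocalRing.maximalIdeal R) R] in
/-- A power of the maximal ideal annihilates stable endomorphisms when sequences are stably
nilpotent. -/
theorem IsGorensteinOrder.exists_annihilator (h : IsGorensteinOrder R Λ)
    (hnil : ∀ (M : ℕ → ModuleCat.{u} Λ), (∀ i, IsCM Λ (M i)) →
      (∀ i, IsLocalRing (Module.End Λ (M i))) → ∀ f : ∀ i, M i →ₗ[Λ] M (i + 1),
        (∀ i, ¬ HasRetraction (f i)) → ∃ t, FactorsProj (seqComp (M := fun i => M i) f t))
    {N : Type u} [AddCommGroup N] [Module R N] [Module Λ N] [IsScalarTower R Λ N]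
    (hN : IsCM Λ N) (hloc : IsLocalRing (Module.End Λ N)) :
    ∃ a, ∀ y ∈ IsLocalRing.maximalIdeal R ^ a, FactorsProj (y • (LinearMap.id : N →ₗ[Λ] N)) := by
  have := h.finite
  have := hN.finite
  have : Module.Finite R N := Module.Finite.trans Λ N
  have := nontrivial_of_isLocalRing_end hloc
  let J : Ideal R :=
    { carrier := {r | FactorsProj (r • (LinearMap.id : N →ₗ[Λ] N))}
      add_mem' := fun {x y} hx hy => (FactorsProj.add hx hy).congr fun z => by simp [add_smul]
      zero_mem' := FactorsProj.zero.congr fun z => by simp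
      smul_mem' := fun c x hx =>
        (FactorsProj.comp_left hx (c • LinearMap.id)).congr fun z => by simp [mul_smul] }
  have hJ : IsLocalRing.maximalIdeal R ≤ J.radical := by
    intro y hy
    have h1 : ¬ HasRetraction (y • (LinearMap.id : N →ₗ[Λ] N)) := by
      rintro ⟨r, hr⟩
      have h2 : (⊤ : Submodule R N) = ⊥ := by
        refine Submodule.eq_bot_of_le_smul_of_le_jacobson_bot (IsLocalRing.maximalIdeal R) _
          Module.Finite.fg_top (fun x _ => ?_) (IsLocalRing.maximalIdeal_le_jacobson _)
        have h3 : y • r x = x := by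
          have := hr x
          simpa [LinearMap.map_smul_of_tower] using this
        rw [← h3]
        exact Submodule.smul_mem_smul hy trivial
      exact bot_ne_top h2.symm
    obtain ⟨t, ht⟩ := hnil (fun _ => ModuleCat.of Λ N) (fun _ => hN) (fun _ => hloc)
      (fun _ => y • (LinearMap.id : N →ₗ[Λ] N)) fun _ => h1
    refine ⟨t, ?_⟩
    refine FactorsProj.congr (X := N) (Y := N) ht fun x => ?_
    clear ht
    induction t with
    | zero => simp [seqComp]
    | succ t ih =>
      change y • seqComp (M := fun _ => N) (fun _ => y • (LinearMap.id : N →ₗ[Λ] N)) t x = _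
      change seqComp (M := fun _ => N) (fun _ => y • (LinearMap.id : N →ₗ[Λ] N)) t x = _ at ih
      rw [ih]
      simp [pow_succ', mul_smul]
  obtain ⟨a, ha⟩ := Ideal.exists_pow_le_of_le_radical_of_fg hJ
    ((isNoetherianRing_iff_ideal_fg R).1 inferInstance _)
  exact ⟨a, fun y hy => ha hy⟩

/-- Stable nilpotence of sequences of Cohen–Macaulay modules forces finite type. -/
theorem IsGorensteinOrder.finRep (h : IsGorensteinOrder R Λ)
    (hnil : ∀ (M : ℕ → ModuleCat.{u} Λ), (∀ i, IsCM Λ (M i)) →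
      (∀ i, IsLocalRing (Module.End Λ (M i))) → ∀ f : ∀ i, M i →ₗ[Λ] M (i + 1),
        (∀ i, ¬ HasRetraction (f i)) → ∃ t, FactorsProj (seqComp (M := fun i => M i) f t)) :
    FinRep fun X : ModuleCat.{u} Λ => IsCM Λ X ∧ IsIndecomposableModule Λ X := by
  have := h.finite
  have := h.isNoetherianRing
  obtain ⟨K, _, _, hK, hKN⟩ := h.exists_tester
  let T := Σ N : ModuleCat.{u} Λ, {g : K →ₗ[Λ] N //
    IsCM Λ N ∧ IsLocalRing (Module.End Λ N) ∧ ¬ FactorsProj g}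
  let r : T → T → Prop := fun x y => ∃ k : y.1 →ₗ[Λ] x.1, ¬ HasRetraction k ∧
    ∀ z, k (y.2.1 z) = x.2.1 z
  have hwf : WellFounded r := by
    rw [wellFounded_iff_isEmpty_descending_chain]
    refine ⟨?_⟩
    rintro ⟨x, hx⟩
    choose k hk hkx using hx
    obtain ⟨t, ht⟩ := hnil (fun i => (x i).1) (fun i => (x i).2.2.1) (fun i => (x i).2.2.2.1) k hk
    refine (x t).2.2.2.2 ((ht.comp_right (x 0).2.1).congr fun z => ?_)
    clear ht
    induction t with
    | zero => rfl
    | succ t ih =>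
      rw [← hkx]
      exact congrArg (k t) ih
  have key : ∀ x : T, FinRep fun X : ModuleCat.{u} Λ => IsCM Λ X ∧ IsIndecomposableModule Λ X ∧
      ∃ k : x.1 →ₗ[Λ] X, ¬ FactorsProj (k ∘ₗ x.2.1) := by
    intro x
    induction x using hwf.induction with
    | _ x ih =>
    obtain ⟨N, g, hN, hloc, hg⟩ := x
    let _ := restrictModule R Λ N
    have := restrictModule_isScalarTower R (Λ := Λ) N
    have := hN.finite
    have := nontrivial_of_isLocalRing_end hloc
    obtain ⟨a, ha⟩ := h.exists_annihilator hnil hN hloc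
    obtain ⟨E, _, _, e, hE, hne, hEX⟩ := h.exists_almostSplit hN hloc
      (not_projective_of_not_factorsProj hg) ha
    have := hE.finite
    obtain ⟨ι, _, D, i, p, h1, h2, h3⟩ := exists_indecomposable_family Λ E
    have hD : ∀ s, IsCM Λ (D s) := fun s => hE.of_isRetract ⟨i s, p s, h2 s⟩
    have hs : ∀ s, FinRep fun X : ModuleCat.{u} Λ => IsCM Λ X ∧ IsIndecomposableModule Λ X ∧
        ∃ k : D s →ₗ[Λ] X, ¬ FactorsProj (k ∘ₗ p s ∘ₗ e ∘ₗ g) := by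
      intro s
      by_cases hps : FactorsProj (p s ∘ₗ e ∘ₗ g)
      · exact ⟨[], fun X hX => by
          obtain ⟨-, -, k, hk⟩ := hX
          exact absurd (hps.comp_left k) hk⟩
      · have := (hD s).finite
        refine ih ⟨D s, p s ∘ₗ e ∘ₗ g, hD s, isLocalRing_end R (h1 s), hps⟩ ⟨p s ∘ₗ e, ?_,
          fun _ => rfl⟩
        rintro ⟨q, hq⟩
        exact hne ⟨q ∘ₗ p s, hq⟩
    refine ((FinRep.of_equiv N).or (FinRep.iUnion hs)).mono ?_
    rintro X ⟨hX, hXi, k, hk⟩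
    by_cases hkr : HasRetraction k
    · obtain ⟨q, hq⟩ := hkr
      obtain ⟨w⟩ := IsRetract.nonempty_equiv (X := N) (Y := X) ⟨k, q, hq⟩ hXi
      exact .inl ⟨w.symm⟩
    · obtain ⟨k', hk'⟩ := hEX X hX k hkr
      right
      by_contra hcon
      push Not at hcon
      refine hk ((FactorsProj.sum Finset.univ fun s _ => hcon s hX hXi (k' ∘ₗ i s)).congr
        fun x => ?_)
      simp only [LinearMap.sum_apply, LinearMap.comp_apply]
      rw [← map_sum, h3, hk']
  have := hK.finite
  obtain ⟨ι, _, D, i, p, h1, h2, h3⟩ := exists_indecomposable_family Λ K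
  have hD : ∀ s, IsCM Λ (D s) := fun s => hK.of_isRetract ⟨i s, p s, h2 s⟩
  have hs : ∀ s, FinRep fun X : ModuleCat.{u} Λ => IsCM Λ X ∧ IsIndecomposableModule Λ X ∧
      ∃ k : D s →ₗ[Λ] X, ¬ FactorsProj (k ∘ₗ p s) := by
    intro s
    by_cases hps : FactorsProj (p s)
    · exact ⟨[], fun X hX => by
        obtain ⟨-, -, k, hk⟩ := hX
        exact absurd (hps.comp_left k) hk⟩
    · have := (hD s).finite
      exact key ⟨D s, p s, hD s, isLocalRing_end R (h1 s), hps⟩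
  obtain ⟨m, Q, hQ⟩ := finite_retracts R (Λ := Λ) Λ
  have hpr : FinRep fun X : ModuleCat.{u} Λ => IsCM Λ X ∧ IsIndecomposableModule Λ X ∧
      Module.Projective Λ X := by
    refine ⟨List.ofFn Q, ?_⟩
    rintro X ⟨hX, hXi, _⟩
    have := hX.finite
    obtain ⟨n, q, hq⟩ := Module.Finite.exists_fin' Λ X
    obtain ⟨s, hs⟩ := Module.projective_lifting_property q LinearMap.id hq
    have hXl := isLocalRing_end R hXi
    obtain ⟨j, hj⟩ := hQ X hXl (IsRetract.pi hXl ⟨s, q, LinearMap.congr_fun hs⟩)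
    exact ⟨Q j, by simp, hj⟩
  refine (hpr.or (FinRep.iUnion hs)).mono ?_
  rintro X ⟨hX, hXi⟩
  by_cases hXp : Module.Projective Λ X
  · exact .inl ⟨hX, hXi, hXp⟩
  · right
    obtain ⟨φ, hφ⟩ := hKN X hX hXp
    by_contra hcon
    push Not at hcon
    refine hφ ((FactorsProj.sum Finset.univ fun s _ => hcon s hX hXi (φ ∘ₗ i s)).congr
      fun x => ?_)
    simp only [LinearMap.sum_apply, LinearMap.comp_apply]
    rw [← map_sum, h3]

/-- If extensions of countable direct sums of Cohen–Macaulay modules decompose into finitely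
generated modules, then there are finitely many indecomposable Cohen–Macaulay modules. -/
theorem IsGorensteinOrder.finRep_of_decomposition (h : IsGorensteinOrder R Λ)
    (hdec : ∀ (H : Type u) [AddCommGroup H] [Module Λ H], IsCMExt Λ H →
      HasFGDecomposition.{u, w} Λ H) :
    FinRep fun X : ModuleCat.{u} Λ => IsCM Λ X ∧ IsIndecomposableModule Λ X :=
  h.finRep fun M hM hloc f hf => exists_factorsProj_seqComp (M := fun i => M i) hdec
    (fun _ _ _ hN => h.exists_cosyzygy hN) hM hloc f hf

end Necessity

section Ext1Z

variable {Λ : Type u} [Ring Λ] {A : Type w₁} {B : Type w₂} {C : Type w₃} {N : Type w₄}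
  [AddCommGroup A] [Module Λ A] [AddCommGroup B] [Module Λ B] [AddCommGroup C] [Module Λ C]
  [AddCommGroup N] [Module Λ N]

theorem Ext1Z.mid (hA : Ext1Z Λ A N) (hC : Ext1Z Λ C N) {f : A →ₗ[Λ] B} {g : B →ₗ[Λ] C}
    (hf : Function.Injective f) (hfg : Function.Exact f g) (hg : Function.Surjective g) :
    Ext1Z Λ B N := by
  let q := Finsupp.linearCombination Λ (id : B → B)
  have hq : Function.Surjective q := linearCombination_id_surjective
  refine Ext1Z.of_presentation (K := LinearMap.ker q) Ext1Z.of_projective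
    (LinearMap.exact_subtype_ker_map q) hq fun φ => ?_
  obtain ⟨i, hi⟩ : ∃ i : LinearMap.ker q →ₗ[Λ] LinearMap.ker (g ∘ₗ q), ∀ x, (i x).1 = x.1 :=
    ⟨Submodule.inclusion fun x hx => by
      rw [LinearMap.mem_ker] at hx ⊢
      rw [LinearMap.comp_apply, hx, map_zero], fun _ => rfl⟩
  obtain ⟨s, hs⟩ : ∃ s : LinearMap.ker (g ∘ₗ q) →ₗ[Λ] A, ∀ x, f (s x) = q x.1 := by
    let qs : LinearMap.ker (g ∘ₗ q) →ₗ[Λ] B := q ∘ₗ (LinearMap.ker (g ∘ₗ q)).subtype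
    exact exists_codlift (P := LinearMap.ker (g ∘ₗ q)) f hf qs fun x => (hfg (qs x)).1 x.2
  have h1 : Function.Injective i := fun x y hxy => Subtype.ext (by rw [← hi, hxy, hi])
  have h2 : Function.Exact i s := by
    intro x
    constructor
    · intro hx
      have h1 := hs x
      rw [hx, map_zero] at h1
      exact ⟨⟨x.1, h1.symm⟩, Subtype.ext (hi _)⟩
    · rintro ⟨y, rfl⟩
      refine hf ?_
      rw [hs, map_zero, hi]
      exact y.2
  have h3 : Function.Surjective s := by
    intro a
    obtain ⟨x, hx⟩ := hq (f a)
    refine ⟨⟨x, by rw [LinearMap.mem_ker, LinearMap.comp_apply, hx,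
      hfg.apply_apply_eq_zero]⟩, hf ?_⟩
    rw [hs]
    exact hx
  obtain ⟨φ', hφ'⟩ := hA.extend (K := LinearMap.ker q) (F := LinearMap.ker (g ∘ₗ q)) h1 h2 h3 φ
  obtain ⟨ψ, hψ⟩ := hC.extend (Submodule.subtype_injective _)
    (LinearMap.exact_subtype_ker_map (g ∘ₗ q)) (hg.comp hq) φ'
  refine ⟨ψ, fun x => ?_⟩
  rw [← hφ', ← hψ, Submodule.subtype_apply, Submodule.subtype_apply, hi]

theorem Ext1Z.congr (h : Ext1Z Λ A N) (e : A ≃ₗ[Λ] B) : Ext1Z Λ B N := by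
  refine Ext1Z.mid (A := PUnit.{1}) (C := A) Ext1Z.of_projective h (f := 0) (g := e.symm)
    (Function.injective_of_subsingleton _) (fun x => ?_) e.symm.surjective
  rw [LinearEquiv.coe_coe, LinearEquiv.map_eq_zero_iff]
  simp [eq_comm]

theorem Ext1Z.of_retract₂ {N' : Type w₅} [AddCommGroup N'] [Module Λ N'] (h : Ext1Z Λ A N)
    (i : N' →ₗ[Λ] N) (r : N →ₗ[Λ] N') (hr : ∀ x, r (i x) = x) : Ext1Z Λ A N' := by
  intro φ
  obtain ⟨ψ, hψ⟩ := h (i ∘ₗ φ)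
  exact ⟨r ∘ₗ ψ, fun x => by rw [LinearMap.comp_apply, hψ, LinearMap.comp_apply, hr]⟩

section DFinsupp

variable {ι : Type w} {M : ι → Type w₁} {M' : ι → Type w₂} {M'' : ι → Type w₃}
  [∀ i, AddCommGroup (M i)] [∀ i, Module Λ (M i)] [∀ i, AddCommGroup (M' i)]
  [∀ i, Module Λ (M' i)] [∀ i, AddCommGroup (M'' i)] [∀ i, Module Λ (M'' i)]
  {f : ∀ i, M i →ₗ[Λ] M' i} {g : ∀ i, M' i →ₗ[Λ] M'' i}

theorem mapRange_injective (h : ∀ i, Function.Injective (f i)) :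
    Function.Injective (DFinsupp.mapRange.linearMap f) :=
  (DFinsupp.mapRange_injective _ fun i => map_zero (f i)).2 h

theorem mapRange_surjective (h : ∀ i, Function.Surjective (f i)) :
    Function.Surjective (DFinsupp.mapRange.linearMap f) :=
  (DFinsupp.mapRange_surjective _ fun i => map_zero (f i)).2 h

theorem mapRange_exact (h : ∀ i, Function.Exact (f i) (g i)) :
    Function.Exact (DFinsupp.mapRange.linearMap f) (DFinsupp.mapRange.linearMap g) := by
  classical
  intro q
  constructor
  · intro hq
    have h1 : ∀ i, ∃ x, f i x = q i := fun i => (h i (q i)).1 (DFunLike.congr_fun hq i)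
    choose x hx using h1
    refine ⟨DFinsupp.mk q.support fun i => x i, ?_⟩
    ext i
    rw [DFinsupp.mapRange.linearMap_apply, DFinsupp.mapRange_apply, DFinsupp.mk_apply]
    split_ifs with h
    · exact hx i
    · rw [map_zero, DFinsupp.notMem_support_iff.1 h]
  · rintro ⟨x, rfl⟩
    ext i
    exact (h i).apply_apply_eq_zero _

theorem Ext1Z.dfinsupp (h : ∀ i, Ext1Z Λ (M i) N) : Ext1Z Λ (Π₀ i, M i) N := by
  classical
  let q := fun i => Finsupp.linearCombination Λ (id : M i → M i)
  refine Ext1Z.of_presentation (F := Π₀ i, (M i →₀ Λ)) Ext1Z.of_projective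
    (mapRange_exact fun i => LinearMap.exact_subtype_ker_map (q i))
    (mapRange_surjective fun i => linearCombination_id_surjective) fun φ => ?_
  have h1 := fun i => h i (φ ∘ₗ DFinsupp.lsingle (M := fun i => LinearMap.ker (q i)) i)
  choose ψ hψ using h1
  refine ⟨DFinsupp.lsum ℕ ψ, fun x => ?_⟩
  induction x using DFinsupp.induction with
  | h0 => simp
  | ha i b x _ _ ih =>
    rw [map_add, map_add, map_add, ih]
    congr 1
    rw [DFinsupp.mapRange.linearMap_apply, DFinsupp.mapRange_single]
    simp only [DFinsupp.lsum_single, Submodule.subtype_apply]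
    rw [hψ]
    rfl

end DFinsupp

theorem IsCM.ext1Z_of_projective [IsNoetherianRing Λ] {M : Type u} [AddCommGroup M] [Module Λ M]
    (hM : IsCM Λ M) [Module.Projective Λ N] : Ext1Z Λ M N := by
  classical
  obtain ⟨s, hs⟩ := Module.projective_lifting_property
    (Finsupp.linearCombination Λ (id : N → N)) LinearMap.id linearCombination_id_surjective
  refine Ext1Z.of_retract₂ (N := N →₀ Λ) ?_ s
    (Finsupp.linearCombination Λ (id : N → N)) (LinearMap.congr_fun hs)
  have := hM.finite
  obtain ⟨m, q, hq⟩ := Module.Finite.exists_fin' Λ M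
  refine Ext1Z.of_presentation Ext1Z.of_projective (LinearMap.exact_subtype_ker_map q) hq
    fun φ => ?_
  have h1 : Ext1Z Λ M Λ := extZ_one_iff.1 (hM.ext 0)
  have h2 := fun x : N => h1.extend (Submodule.subtype_injective _)
    (LinearMap.exact_subtype_ker_map q) hq (Finsupp.lapply x ∘ₗ φ)
  choose ψ hψ using h2
  obtain ⟨t, ht⟩ : ∃ t : Finset N, ∀ y, (φ y).support ⊆ t := by
    have : Module.Finite Λ (LinearMap.ker q) := inferInstance
    obtain ⟨S, hS⟩ := this.fg_top
    refine ⟨S.biUnion fun y => (φ y).support, fun y => ?_⟩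
    have h3 : (⊤ : Submodule Λ (LinearMap.ker q)) ≤
        (Finsupp.supported Λ Λ (S.biUnion fun y => (φ y).support : Set N)).comap φ := by
      rw [← hS, Submodule.span_le]
      intro z hz
      rw [SetLike.mem_coe, Submodule.mem_comap, Finsupp.mem_supported]
      exact fun n hn => Finset.mem_coe.2 (Finset.mem_biUnion.2 ⟨z, hz, hn⟩)
    exact Finset.coe_subset.1 ((Finsupp.mem_supported Λ (φ y)).1 (h3 (x := y) trivial))
  refine ⟨∑ x ∈ t, Finsupp.lsingle x ∘ₗ ψ x, fun y => ?_⟩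
  rw [LinearMap.sum_apply]
  conv_rhs => rw [← Finsupp.sum_single (φ y), Finsupp.sum_of_support_subset _ (ht y) _ (by simp)]
  refine Finset.sum_congr rfl fun x _ => ?_
  rw [LinearMap.comp_apply, hψ]
  rfl

end Ext1Z

section CMExt

variable {Λ : Type u} [Ring Λ]

theorem IsCMExt.ext1Z [IsNoetherianRing Λ] {H : Type u} [AddCommGroup H] [Module Λ H]
    (h : IsCMExt Λ H) (N : Type w₄) [AddCommGroup N] [Module Λ N] [Module.Projective Λ N] :
    Ext1Z Λ H N := by
  obtain ⟨M, C, e, p, hM, hC, he, hep, hp⟩ := h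
  exact Ext1Z.mid (Ext1Z.dfinsupp fun i => (hM i).ext1Z_of_projective)
    (Ext1Z.dfinsupp fun i => (hC i).ext1Z_of_projective) he hep hp

theorem IsCM.isCMExt {N : Type u} [AddCommGroup N] [Module Λ N] (hN : IsCM Λ N) :
    IsCMExt Λ N := by
  let M : ℕ → ModuleCat.{u} Λ := fun i =>
    match i with
    | 0 => ModuleCat.of Λ N
    | _ + 1 => ModuleCat.of Λ PUnit.{u + 1}
  refine ⟨M, fun _ => ModuleCat.of Λ PUnit.{u + 1}, DFinsupp.lapply (M := fun i => M i) 0, 0, ?_,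
    fun _ => IsCM.of_subsingleton, ?_, ?_, fun x => ⟨0, Subsingleton.elim _ _⟩⟩
  · rintro (_ | i)
    · exact hN
    · exact IsCM.of_subsingleton (A := PUnit.{u + 1})
  · intro x y hxy
    ext i
    obtain _ | i := i
    · exact hxy
    · exact Subsingleton.elim (α := PUnit.{u + 1}) _ _
  · intro x
    refine ⟨fun _ => ⟨DFinsupp.lsingle (R := Λ) (M := fun i => M i) 0 x, ?_⟩,
      fun _ => Subsingleton.elim _ _⟩
    rw [DFinsupp.lapply_apply, DFinsupp.lsingle_apply, DFinsupp.single_eq_same]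

/-- The relation of being linked by a short exact sequence with projective middle term. -/
def IsLinked (X Y : ModuleCat.{w} Λ) : Prop :=
  ∃ (P : ModuleCat.{w} Λ) (f : X →ₗ[Λ] P) (g : P →ₗ[Λ] Y), Module.Projective Λ P ∧
    Function.Injective f ∧ Function.Exact f g ∧ Function.Surjective g

theorem IsCMExt.exists_next [IsNoetherianRing Λ]
    (hcos : ∀ (N : Type u) [AddCommGroup N] [Module Λ N], IsCM Λ N →
      ∃ (Q C : Type u) (_ : AddCommGroup Q) (_ : Module Λ Q) (_ : AddCommGroup C)
        (_ : Module Λ C) (f : N →ₗ[Λ] Q) (g : Q →ₗ[Λ] C), Module.Finite Λ Q ∧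
          Module.Projective Λ Q ∧ Function.Injective f ∧ Function.Exact f g ∧
          Function.Surjective g ∧ IsCM Λ C)
    {H : ModuleCat.{u} Λ} (h : IsCMExt Λ H) :
    ∃ H' : ModuleCat.{u} Λ, IsCMExt Λ H' ∧ IsLinked H H' := by
  obtain ⟨M, C, e, p, hM, hC, he, hep, hp⟩ := h
  have hM' := fun i => hcos (M i) (hM i)
  choose Q M' hQ1 hQ2 hM1 hM2 j g hQf hQp hj hjg hg hM' using hM'
  have hC' := fun i => hcos (C i) (hC i)
  choose Q' C' hQ1' hQ2' hC1 hC2 j' g' hQf' hQp' hj' hjg' hg' hC' using hC'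
  have hJ := mapRange_injective hj
  have hG := mapRange_surjective hg
  have hJG := mapRange_exact hjg
  have hJ' := mapRange_injective hj'
  have hG' := mapRange_surjective hg'
  have hJG' := mapRange_exact hjg'
  set J := DFinsupp.mapRange.linearMap j
  set G := DFinsupp.mapRange.linearMap g
  set J' := DFinsupp.mapRange.linearMap j'
  set G' := DFinsupp.mapRange.linearMap g'
  obtain ⟨α, hα⟩ := (Ext1Z.dfinsupp fun i => (hC i).ext1Z_of_projective
    (N := Π₀ i, Q i)).extend he hep hp J
  let f : H →ₗ[Λ] (Π₀ i, Q i) × (Π₀ i, Q' i) := α.prod (J' ∘ₗ p)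
  have hfa : ∀ x, f x = (α x, J' (p x)) := fun _ => rfl
  have hf : Function.Injective f := by
    refine (injective_iff_map_eq_zero f).2 fun x hx => ?_
    rw [hfa, Prod.mk_eq_zero] at hx
    obtain ⟨u, rfl⟩ := (hep x).1 ((map_eq_zero_iff J' hJ').1 hx.2)
    rw [hα] at hx
    rw [(map_eq_zero_iff J hJ).1 hx.1, map_zero]
  let q := (LinearMap.range f).mkQ
  have hfq : Function.Exact f q := LinearMap.exact_map_mkQ_range f
  have hq : Function.Surjective q := Submodule.mkQ_surjective _
  obtain ⟨e', he'⟩ := exists_desc G hG (q ∘ₗ LinearMap.inl Λ _ _) fun x hx => by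
    obtain ⟨u, rfl⟩ := (hJG x).1 hx
    refine (hfq _).2 ⟨e u, ?_⟩
    rw [hfa, hα, hep.apply_apply_eq_zero, map_zero]
    rfl
  obtain ⟨p', hp'⟩ := exists_desc q hq (G' ∘ₗ LinearMap.snd Λ _ _) fun x hx => by
    obtain ⟨u, rfl⟩ := (hfq x).1 hx
    exact hJG'.apply_apply_eq_zero _
  have h1 : Function.Injective e' := by
    refine (injective_iff_map_eq_zero e').2 fun x hx => ?_
    obtain ⟨x, rfl⟩ := hG x
    rw [he'] at hx
    obtain ⟨y, hy⟩ := (hfq _).1 hx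
    rw [hfa, LinearMap.inl_apply, Prod.mk.injEq] at hy
    obtain ⟨u, rfl⟩ := (hep y).1 ((map_eq_zero_iff J' hJ').1 hy.2)
    rw [← hy.1, hα, hJG.apply_apply_eq_zero]
  have h2 : Function.Exact e' p' := by
    intro x
    constructor
    · intro hx
      obtain ⟨⟨x, y⟩, rfl⟩ := hq x
      rw [hp'] at hx
      obtain ⟨c, hc⟩ := (hJG' y).1 hx
      obtain ⟨z, rfl⟩ := hp c
      refine ⟨G (x - α z), ?_⟩
      rw [he', LinearMap.comp_apply, ← sub_eq_zero, ← map_sub]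
      refine (hfq _).2 ⟨-z, ?_⟩
      rw [hfa, map_neg, map_neg, map_neg, hc]
      ext <;> simp
    · rintro ⟨x, rfl⟩
      obtain ⟨x, rfl⟩ := hG x
      rw [he', LinearMap.comp_apply, hp']
      exact map_zero G'
  have h3 : Function.Surjective p' := by
    intro y
    obtain ⟨y, rfl⟩ := hG' y
    exact ⟨q (0, y), hp' _⟩
  have : Module.Projective Λ ((Π₀ i, Q i) × (Π₀ i, Q' i)) := inferInstance
  exact ⟨ModuleCat.of Λ (((Π₀ i, Q i) × (Π₀ i, Q' i)) ⧸ LinearMap.range f),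
    ⟨fun i => ModuleCat.of Λ (M' i), fun i => ModuleCat.of Λ (C' i), e', p', hM', hC', h1, h2, h3⟩,
    ModuleCat.of Λ ((Π₀ i, Q i) × (Π₀ i, Q' i)), f, q, this, hf, hfq, hq⟩

theorem IsCMExt.exists_prev [IsNoetherianRing Λ] {H : ModuleCat.{u} Λ} (h : IsCMExt Λ H) :
    ∃ H' : ModuleCat.{u} Λ, IsCMExt Λ H' ∧ IsLinked H' H := by
  have hcov : ∀ (N : Type u) [AddCommGroup N] [Module Λ N], IsCM Λ N →
      ∃ (m : ℕ) (g : (Fin m → Λ) →ₗ[Λ] N), Function.Surjective g ∧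
        IsCM Λ (LinearMap.ker g) := fun N _ _ hN => by
    have := hN.finite
    obtain ⟨m, q, hq⟩ := Module.Finite.exists_fin' Λ N
    exact ⟨m, q, hq, IsCM.syzygy IsCM.of_projective hN (Submodule.subtype_injective _)
      (LinearMap.exact_subtype_ker_map q) hq⟩
  obtain ⟨M, C, e, p, hM, hC, he, hep, hp⟩ := h
  have hM' := fun i => hcov (M i) (hM i)
  choose m g hg hM' using hM'
  have hC' := fun i => hcov (C i) (hC i)
  choose m' g' hg' hC' using hC'
  have hJ := mapRange_injective fun i => Submodule.subtype_injective (LinearMap.ker (g i))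
  have hG := mapRange_surjective hg
  have hJG := mapRange_exact fun i => LinearMap.exact_subtype_ker_map (g i)
  have hJ' := mapRange_injective fun i => Submodule.subtype_injective (LinearMap.ker (g' i))
  have hG' := mapRange_surjective hg'
  have hJG' := mapRange_exact fun i => LinearMap.exact_subtype_ker_map (g' i)
  set J := DFinsupp.mapRange.linearMap fun i => (LinearMap.ker (g i)).subtype
  set G := DFinsupp.mapRange.linearMap g
  set J' := DFinsupp.mapRange.linearMap fun i => (LinearMap.ker (g' i)).subtype
  set G' := DFinsupp.mapRange.linearMap g'
  obtain ⟨l, hl⟩ := Module.projective_lifting_property p G' hp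
  replace hl : ∀ x, p (l x) = G' x := LinearMap.congr_fun hl
  let f : (Π₀ i, (Fin (m i) → Λ)) × (Π₀ i, (Fin (m' i) → Λ)) →ₗ[Λ] H := (e ∘ₗ G).coprod l
  have hfa : ∀ x y, f (x, y) = e (G x) + l y := fun _ _ => rfl
  have hf : Function.Surjective f := by
    intro z
    obtain ⟨y, hy⟩ := hG' (p z)
    obtain ⟨u, hu⟩ := (hep (z - l y)).1 (by rw [map_sub, hl, hy, sub_self])
    obtain ⟨x, rfl⟩ := hG u
    exact ⟨(x, y), by rw [hfa, hu, sub_add_cancel]⟩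
  have hpf : ∀ x y, p (f (x, y)) = G' y := fun x y => by
    rw [hfa, map_add, hep.apply_apply_eq_zero, zero_add, hl]
  obtain ⟨e', he'⟩ : ∃ e' : (Π₀ i, LinearMap.ker (g i)) →ₗ[Λ] LinearMap.ker f,
      ∀ x, (e' x).1 = (J x, 0) :=
    ⟨(LinearMap.inl Λ _ _ ∘ₗ J).codRestrict _ fun x => by
      rw [LinearMap.mem_ker, LinearMap.comp_apply, LinearMap.inl_apply, hfa,
        hJG.apply_apply_eq_zero, map_zero, map_zero, add_zero], fun _ => rfl⟩
  obtain ⟨p', hp'⟩ : ∃ p' : LinearMap.ker f →ₗ[Λ] Π₀ i, LinearMap.ker (g' i),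
      ∀ x, J' (p' x) = x.1.2 := by
    let s : LinearMap.ker f →ₗ[Λ] (Π₀ i, (Fin (m' i) → Λ)) :=
      LinearMap.snd Λ _ _ ∘ₗ (LinearMap.ker f).subtype
    exact exists_codlift (K := Π₀ i, LinearMap.ker (g' i)) (P := LinearMap.ker f) J' hJ' s fun x => (hJG' (s x)).1 (by
      change G' x.1.2 = 0
      rw [← hpf x.1.1]
      exact (congrArg p x.2).trans (map_zero p))
  have h1 : Function.Injective e' := fun x y hxy => hJ (by
    have := congrArg (fun z => z.1.1) hxy
    simpa [he'] using this)
  have h2 : Function.Exact e' p' := by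
    intro x
    constructor
    · intro hx
      have h3 := hp' x
      rw [hx, map_zero] at h3
      have h4 : f x.1 = 0 := x.2
      rw [← Prod.mk.eta (p := x.1), hfa, ← h3, map_zero, add_zero] at h4
      obtain ⟨u, hu⟩ := (hJG _).1 ((map_eq_zero_iff e he).1 h4)
      refine ⟨u, Subtype.ext ?_⟩
      rw [he', hu, h3]
    · rintro ⟨y, rfl⟩
      refine hJ' ?_
      rw [hp', he', map_zero]
  have h3 : Function.Surjective p' := by
    intro y
    obtain ⟨u, hu⟩ := (hep (l (J' y))).1 (by rw [hl, hJG'.apply_apply_eq_zero])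
    obtain ⟨x, rfl⟩ := hG u
    refine ⟨⟨(-x, J' y), ?_⟩, hJ' (hp' _)⟩
    rw [LinearMap.mem_ker, hfa, map_neg, map_neg, hu, neg_add_cancel]
  have : Module.Projective Λ ((Π₀ i, (Fin (m i) → Λ)) × (Π₀ i, (Fin (m' i) → Λ))) := inferInstance
  exact ⟨ModuleCat.of Λ (LinearMap.ker f),
    ⟨fun i => ModuleCat.of Λ (LinearMap.ker (g i)), fun i => ModuleCat.of Λ (LinearMap.ker (g' i)),
      e', p', hM', hC', h1, h2, h3⟩,
    ModuleCat.of Λ ((Π₀ i, (Fin (m i) → Λ)) × (Π₀ i, (Fin (m' i) → Λ))),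
    (LinearMap.ker f).subtype, f, this, Submodule.subtype_injective _,
    LinearMap.exact_subtype_ker_map f, hf⟩

/-- Extending an element to a two-sided chain. -/
theorem exists_int_chain {α : Type w} (r : α → α → Prop) (hnext : ∀ x, ∃ y, r x y)
    (hprev : ∀ y, ∃ x, r x y) (x : α) : ∃ z : ℤ → α, z 0 = x ∧ ∀ i, r (z i) (z (i + 1)) := by
  choose s hs using hnext
  choose t ht using hprev
  refine ⟨fun i => match i with
    | .ofNat n => s^[n] x
    | .negSucc n => t^[n + 1] x, rfl, ?_⟩
  rintro (n | n)
  · change r (s^[n] x) (s^[n + 1] x)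
    rw [Function.iterate_succ_apply']
    exact hs _
  · obtain _ | n := n
    · exact ht x
    · change r (t^[n + 1 + 1] x) (t^[n + 1] x)
      rw [Function.iterate_succ_apply']
      exact ht _

end CMExt

section Complex

variable {Λ : Type u} [Ring Λ]

theorem isGorensteinProjective_of_chain (Z P : ℤ → ModuleCat.{max u v} Λ)
    (f : ∀ i, Z i →ₗ[Λ] P i) (g : ∀ i, P i →ₗ[Λ] Z (i + 1)) (hP : ∀ i, Module.Projective Λ (P i))
    (hf : ∀ i, Function.Injective (f i)) (hfg : ∀ i, Function.Exact (f i) (g i))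
    (hg : ∀ i, Function.Surjective (g i))
    (hext : ∀ i, ∀ L : ModuleCat.{max u v} Λ, Module.Projective Λ L → Ext1Z Λ (Z i) L) :
    IsGorensteinProjective.{v} (Z 0) := by
  let X := CochainComplex.of P (fun i => ModuleCat.ofHom (f (i + 1) ∘ₗ g i)) fun i => by
    ext x
    change f (i + 1 + 1) (g (i + 1) (f (i + 1) (g i x))) = 0
    rw [(hfg (i + 1)).apply_apply_eq_zero, map_zero]
  have hd : ∀ i, X.d i (i + 1) = ModuleCat.ofHom (f (i + 1) ∘ₗ g i) := fun i =>
    CochainComplex.of_d P (fun i => ModuleCat.ofHom (f (i + 1) ∘ₗ g i)) i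
  refine ⟨X, fun i => ?_, fun i => ?_, fun L hL i φ hφ => ?_, ?_⟩
  · exact (IsProjective.iff_projective (P i)).1 (hP i)
  · obtain ⟨k, rfl⟩ : ∃ k, i = k + 1 := ⟨i - 1, by ring⟩
    rw [HomologicalComplex.exactAt_iff' X k (k + 1) (k + 1 + 1) (by simp) (by simp),
      ShortComplex.ShortExact.moduleCat_exact_iff_function_exact]
    change Function.Exact (X.d k (k + 1)) (X.d (k + 1) (k + 1 + 1))
    rw [hd, hd]
    intro x
    change f (k + 1 + 1) (g (k + 1) x) = 0 ↔ ∃ y, f (k + 1) (g k y) = x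
    rw [map_eq_zero_iff _ (hf _)]
    constructor
    · intro hx
      obtain ⟨z, rfl⟩ := (hfg (k + 1) x).1 hx
      obtain ⟨y, rfl⟩ := hg k z
      exact ⟨y, rfl⟩
    · rintro ⟨y, rfl⟩
      exact (hfg (k + 1)).apply_apply_eq_zero _
  · obtain ⟨k, rfl⟩ : ∃ k, i = k + 1 := ⟨i - 1, by ring⟩
    rw [add_sub_cancel_right, hd] at hφ
    have h1 : ∀ x, φ (f (k + 1) x) = 0 := by
      intro x
      obtain ⟨y, rfl⟩ := hg k x
      exact congrArg (fun h => h.hom y) hφ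
    obtain ⟨φ', hφ'⟩ := exists_desc (g (k + 1)) (hg (k + 1)) φ.hom fun x hx => by
      obtain ⟨y, rfl⟩ := (hfg (k + 1) x).1 hx
      exact h1 y
    obtain ⟨ψ, hψ⟩ := (hext (k + 1 + 1 + 1) L ((IsProjective.iff_projective L).2 hL)).extend
      (hf (k + 1 + 1)) (hfg (k + 1 + 1)) (hg (k + 1 + 1)) φ'
    refine ⟨ModuleCat.ofHom ψ, ?_⟩
    rw [hd]
    ext x
    change ψ (f (k + 1 + 1) (g (k + 1) x)) = φ x
    rw [hψ, hφ']
  · have h1 : Function.Exact (f 0) (X.d 0 1) := by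
      have h2 : X.d 0 1 = ModuleCat.ofHom (f 1 ∘ₗ g 0) := hd 0
      rw [h2]
      intro x
      change f 1 (g 0 x) = 0 ↔ _
      exact (map_eq_zero_iff _ (hf _)).trans (hfg 0 x)
    exact ⟨(((LinearEquiv.ofInjective (f 0) (hf 0)).trans
      (LinearEquiv.ofEq _ _ (LinearMap.exact_iff.1 h1).symm)).toModuleIso).trans
        (ModuleCat.kernelIsoKer (X.d 0 1)).symm⟩

theorem isGorensteinProjective_congr {X Y : ModuleCat.{max u v} Λ}
    (h : IsGorensteinProjective.{v} X) (e : X ≃ₗ[Λ] Y) : IsGorensteinProjective.{v} Y := by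
  obtain ⟨C, h1, h2, h3, ⟨i⟩⟩ := h
  exact ⟨C, h1, h2, h3, ⟨e.toModuleIso.symm.trans i⟩⟩

theorem IsCMExt.isGorensteinProjective [IsNoetherianRing Λ]
    (hcos : ∀ (N : Type u) [AddCommGroup N] [Module Λ N], IsCM Λ N →
      ∃ (Q C : Type u) (_ : AddCommGroup Q) (_ : Module Λ Q) (_ : AddCommGroup C)
        (_ : Module Λ C) (f : N →ₗ[Λ] Q) (g : Q →ₗ[Λ] C), Module.Finite Λ Q ∧
          Module.Projective Λ Q ∧ Function.Injective f ∧ Function.Exact f g ∧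
          Function.Surjective g ∧ IsCM Λ C)
    {H : ModuleCat.{u} Λ} (h : IsCMExt Λ H) {M : ModuleCat.{max u v} Λ} (e : H ≃ₗ[Λ] M) :
    IsGorensteinProjective.{v} M := by
  obtain ⟨z, hz0, hz⟩ := exists_int_chain
    (fun X Y : {H : ModuleCat.{u} Λ // IsCMExt Λ H} => IsLinked X.1 Y.1)
    (fun X => by
      obtain ⟨Y, hY, hXY⟩ := X.2.exists_next hcos
      exact ⟨⟨Y, hY⟩, hXY⟩)
    (fun Y => by
      obtain ⟨X, hX, hXY⟩ := Y.2.exists_prev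
      exact ⟨⟨X, hX⟩, hXY⟩) ⟨H, h⟩
  choose P f g hP hf hfg hg using hz
  have hM := isGorensteinProjective_of_chain.{v, u}
    (fun i => ModuleCat.of Λ (ULift.{max u v} (z i).1)) (fun i => ModuleCat.of Λ (ULift.{max u v} (P i)))
    (fun i => ULift.moduleEquiv.symm.toLinearMap ∘ₗ f i ∘ₗ ULift.moduleEquiv.toLinearMap)
    (fun i => ULift.moduleEquiv.symm.toLinearMap ∘ₗ g i ∘ₗ ULift.moduleEquiv.toLinearMap)
    (fun i => Module.Projective.of_equiv' ULift.moduleEquiv.symm)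
    (fun i => ULift.moduleEquiv.symm.injective.comp ((hf i).comp ULift.moduleEquiv.injective))
    (fun i => by
      intro x
      obtain ⟨x, rfl⟩ := ULift.moduleEquiv (R := Λ).symm.surjective x
      constructor
      · intro hx
        obtain ⟨y, hy⟩ := (hfg i x).1 (congrArg ULift.down hx)
        exact ⟨ULift.up y, congrArg ULift.up hy⟩
      · rintro ⟨y, hy⟩
        exact congrArg ULift.up ((hfg i x).2 ⟨y.down, congrArg ULift.down hy⟩))
    (fun i => ULift.moduleEquiv.symm.surjective.comp ((hg i).comp ULift.moduleEquiv.surjective))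
    (fun i L _ => ((z i).2.ext1Z L).congr ULift.moduleEquiv.symm)
  refine isGorensteinProjective_congr hM ?_
  rw [hz0]
  exact ULift.moduleEquiv.trans e

end Complex

section Sections

variable {Λ : Type u} [Ring Λ] {M : Type w} [AddCommGroup M] [Module Λ M]

/-- Split epimorphisms of modules. -/
def HasSection {X : Type w₁} [AddCommGroup X] [Module Λ X] (f : X →ₗ[Λ] M) : Prop :=
  ∃ s : M →ₗ[Λ] X, ∀ x, f (s x) = x

theorem hasSection_of_isUnit {X : Type w₁} [AddCommGroup X] [Module Λ X] {f : X →ₗ[Λ] M}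
    {g : M →ₗ[Λ] X} (h : IsUnit (f ∘ₗ g : Module.End Λ M)) : HasSection f := by
  obtain ⟨b, hb⟩ := h.exists_right_inv
  exact ⟨g ∘ₗ b, LinearMap.congr_fun hb⟩

theorem hasRetraction_of_isUnit {X : Type w₁} [AddCommGroup X] [Module Λ X] {f : X →ₗ[Λ] M}
    {g : M →ₗ[Λ] X} (h : IsUnit (f ∘ₗ g : Module.End Λ M)) : HasRetraction g := by
  obtain ⟨b, hb⟩ := h.exists_left_inv
  exact ⟨b ∘ₗ f, LinearMap.congr_fun hb⟩

theorem exists_isUnit_comp (hloc : IsLocalRing (Module.End Λ M)) {ι : Type w₂} (s : Finset ι)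
    {X : ι → Type w₁} [∀ i, AddCommGroup (X i)] [∀ i, Module Λ (X i)] (f : ∀ i, X i →ₗ[Λ] M)
    (g : ∀ i, M →ₗ[Λ] X i) (h : ∀ x, ∑ i ∈ s, f i (g i x) = x) :
    ∃ i ∈ s, IsUnit (f i ∘ₗ g i : Module.End Λ M) := by
  refine IsLocalRing.exists_of_isUnit_sum (f := fun i => (f i ∘ₗ g i : Module.End Λ M)) ?_
  rw [show ∑ i ∈ s, (f i ∘ₗ g i : Module.End Λ M) = 1 from ?_]
  · exact isUnit_one
  · ext x
    rw [LinearMap.sum_apply]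
    exact h x

theorem isUnit_or_isUnit_comp (hloc : IsLocalRing (Module.End Λ M)) {X : Type w₁} {Y : Type w₂}
    [AddCommGroup X] [Module Λ X] [AddCommGroup Y] [Module Λ Y] {f : X →ₗ[Λ] M} {g : M →ₗ[Λ] X}
    {f' : Y →ₗ[Λ] M} {g' : M →ₗ[Λ] Y} (h : ∀ x, f (g x) + f' (g' x) = x) :
    IsUnit (f ∘ₗ g : Module.End Λ M) ∨ IsUnit (f' ∘ₗ g' : Module.End Λ M) :=
  IsLocalRing.isUnit_or_isUnit_of_add_one (LinearMap.ext h)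

end Sections

section AlmostSplit

variable {R Λ : Type u} [CommRing R] [IsNoetherianRing R] [IsLocalRing R]
  [IsAdicComplete (IsLocalRing.maximalIdeal R) R] [Ring Λ] [Algebra R Λ]
  {T : Type u} [AddCommGroup T] [Module Λ T]

omit [IsLocalRing R] [IsAdicComplete (IsLocalRing.maximalIdeal R) R] in
/-- Right almost split maps exist onto every indecomposable module if there is a module containing
all indecomposables as direct summands. -/
theorem exists_right_almostSplit [Module.Finite R Λ] [Module R T] [IsScalarTower R Λ T]
    [Module.Finite Λ T]
    (hT : ∀ (D : Type u) [AddCommGroup D] [Module Λ D], IsCM Λ D → IsIndecomposableModule Λ D →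
      IsRetract Λ D T) {M : Type u} [AddCommGroup M] [Module R M] [Module Λ M]
    [IsScalarTower R Λ M] [Module.Finite Λ M] (hloc : IsLocalRing (Module.End Λ M)) :
    ∃ (m : ℕ) (π : (Fin m → T) →ₗ[Λ] M), ¬ HasSection π ∧
      ∀ (C : Type u) [AddCommGroup C] [Module Λ C], IsCM Λ C → ∀ f : C →ₗ[Λ] M, ¬ HasSection f →
        ∃ g : C →ₗ[Λ] (Fin m → T), ∀ x, π (g x) = f x := by
  have : IsNoetherianRing Λ := isNoetherian_of_tower R inferInstance
  let rad : Submodule R (T →ₗ[Λ] M) :=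
    { carrier := {f | ¬ HasSection f}
      zero_mem' := by
        rintro ⟨s, hs⟩
        have := nontrivial_of_isLocalRing_end hloc
        obtain ⟨x, hx⟩ := exists_ne (0 : M)
        exact hx (hs x).symm
      add_mem' := by
        rintro f g hf hg ⟨s, hs⟩
        rcases isUnit_or_isUnit_comp hloc (f := f) (f' := g) hs with hu | hu
        · exact hf (hasSection_of_isUnit hu)
        · exact hg (hasSection_of_isUnit hu)
      smul_mem' := by
        rintro r f hf ⟨s, hs⟩
        exact hf ⟨r • s, fun x => by
          rw [LinearMap.smul_apply, LinearMap.map_smul_of_tower]; exact hs x⟩ }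
  have hrad : ∀ f, f ∈ rad ↔ ¬ HasSection f := fun _ => Iff.rfl
  have : Module.Finite R T := Module.Finite.trans Λ T
  have : Module.Finite R M := Module.Finite.trans Λ M
  have := finite_hom (R := R) (Λ := Λ) T M
  obtain ⟨m, s, hs⟩ := Module.Finite.exists_fin (R := R) (M := rad)
  obtain ⟨π, hπ⟩ : ∃ π : (Fin m → T) →ₗ[Λ] M, ∀ v, π v = ∑ i, (s i).1 (v i) :=
    ⟨∑ i, (s i).1 ∘ₗ LinearMap.proj i, fun v => by
      rw [LinearMap.sum_apply]
      rfl⟩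
  refine ⟨m, π, ?_, fun C _ _ hC f hf => ?_⟩
  · rintro ⟨t, ht⟩
    obtain ⟨i, -, hu⟩ := exists_isUnit_comp hloc Finset.univ (fun i => (s i).1)
      (fun i => LinearMap.proj i ∘ₗ t) fun x => (hπ (t x)).symm.trans (ht x)
    exact (s i).2 (hasSection_of_isUnit hu)
  · have := hC.1
    obtain ⟨ι, _, D, i, p, hD, hpi, hsum⟩ := exists_indecomposable_family Λ C
    have key : ∀ j, ∃ g : C →ₗ[Λ] (Fin m → T), ∀ x, π (g x) = f (i j (p j x)) := by
      intro j
      obtain ⟨a, b, hab⟩ := hT (D j) (hC.of_isRetract ⟨i j, p j, hpi j⟩) (hD j)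
      have h1 : f ∘ₗ i j ∘ₗ b ∈ rad := fun ⟨t, ht⟩ => hf ⟨i j ∘ₗ b ∘ₗ t, ht⟩
      have h2 : (⟨_, h1⟩ : rad) ∈ Submodule.span R (Set.range s) := hs ▸ Submodule.mem_top
      obtain ⟨c, hc⟩ := (Submodule.mem_span_range_iff_exists_fun R).1 h2
      refine ⟨LinearMap.pi fun k => c k • (a ∘ₗ p j), fun x => ?_⟩
      have h3 := LinearMap.congr_fun (congrArg Subtype.val hc) (a (p j x))
      rw [hπ]
      change _ = f (i j (b (a (p j x)))) at h3
      rw [hab] at h3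
      rw [← h3, Submodule.coe_sum, LinearMap.sum_apply]
      refine Finset.sum_congr rfl fun k _ => ?_
      change (s k).1 (c k • a (p j x)) = c k • (s k).1 (a (p j x))
      exact LinearMap.map_smul_of_tower _ _ _
    choose g hg using key
    refine ⟨∑ j, g j, fun x => ?_⟩
    rw [LinearMap.sum_apply, map_sum]
    conv_rhs => rw [← hsum x, map_sum]
    exact Finset.sum_congr rfl fun j _ => hg j x

end AlmostSplit

section Annihilator

theorem mem_of_forall_sub_pow_smul_mem {R : Type u} [CommRing R] [IsNoetherianRing R]
    [IsLocalRing R] {H : Type w} [AddCommGroup H] [Module R H] [Module.Finite R H]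
    (S : Submodule R H) {x : R} (hx : x ∈ IsLocalRing.maximalIdeal R) {α : H}
    (h : ∀ j, ∃ η, α - x ^ j • η ∈ S) : α ∈ S := by
  rw [← Submodule.Quotient.mk_eq_zero]
  refine IsHausdorff.haus (I := IsLocalRing.maximalIdeal R) inferInstance _ fun j => ?_
  rw [SModEq.zero]
  obtain ⟨η, hη⟩ := h j
  rw [(Submodule.Quotient.eq S).2 hη, Submodule.Quotient.mk_smul]
  exact Submodule.smul_mem_smul (Ideal.pow_mem_pow hx j) Submodule.mem_top

variable {R Λ : Type u} [CommRing R] [IsNoetherianRing R] [IsLocalRing R]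
  [IsAdicComplete (IsLocalRing.maximalIdeal R) R] [Ring Λ] [Algebra R Λ]
  {T : Type u} [AddCommGroup T] [Module Λ T] [Module.Finite Λ T]

omit [IsAdicComplete (IsLocalRing.maximalIdeal R) R] in
theorem IsGorensteinOrder.exists_pow_factorsProj (h : IsGorensteinOrder R Λ)
    (hT : ∀ (D : Type u) [AddCommGroup D] [Module Λ D], IsCM Λ D → IsIndecomposableModule Λ D →
      IsRetract Λ D T) {M : Type u} [AddCommGroup M] [Module R M] [Module Λ M]
    [IsScalarTower R Λ M] (hM : IsCM Λ M) (hloc : IsLocalRing (Module.End Λ M))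
    (hnp : ¬ Module.Projective Λ M) {x : R} (hx : x ∈ IsLocalRing.maximalIdeal R) :
    ∃ k, FactorsProj (x ^ k • (LinearMap.id : M →ₗ[Λ] M)) := by
  have := h.finite
  have := hM.1
  have : IsNoetherianRing Λ := isNoetherian_of_tower R inferInstance
  let _ := restrictModule R Λ T
  have := restrictModule_isScalarTower R (Λ := Λ) T
  by_contra! hne
  obtain ⟨m, π, hπ, hfac⟩ := exists_right_almostSplit (R := R) hT hloc
  refine hπ ?_
  have hΛ : IsCM Λ Λ := .of_projective
  have hsurj : Function.Surjective π := by
    intro y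
    obtain ⟨g, hg⟩ := hfac Λ hΛ (LinearMap.toSpanSingleton Λ M y) fun ⟨s, hs⟩ =>
      hnp (Module.Projective.of_split s (LinearMap.toSpanSingleton Λ M y) (LinearMap.ext hs))
    exact ⟨g 1, (hg 1).trans (one_smul _ _)⟩
  obtain ⟨k, f, hf⟩ := Module.Finite.exists_fin' Λ M
  obtain ⟨θ, hθ⟩ := Module.projective_lifting_property π f hsurj
  replace hθ : ∀ u, π (θ u) = f u := LinearMap.congr_fun hθ
  have : Module.Finite R T := Module.Finite.trans Λ T
  have : Module.Finite R (LinearMap.ker f) := Module.Finite.trans Λ _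
  have : Module.Finite R (LinearMap.ker π) := Module.Finite.trans Λ _
  have hK : IsCM Λ (LinearMap.ker f) :=
    IsCM.syzygy (B := Fin k → Λ) .of_projective hM (LinearMap.ker f).injective_subtype
      (LinearMap.exact_subtype_ker_map f) hf
  obtain ⟨α, hα⟩ : ∃ α : LinearMap.ker f →ₗ[Λ] LinearMap.ker π, ∀ u, (α u : Fin m → T) = θ u :=
    ⟨(θ ∘ₗ (LinearMap.ker f).subtype).codRestrict _ fun u => (hθ u).trans u.2, fun _ => rfl⟩
  have := finite_hom (R := R) (Λ := Λ) (LinearMap.ker f) (LinearMap.ker π)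
  let S : Submodule R (LinearMap.ker f →ₗ[Λ] LinearMap.ker π) :=
    { carrier := {φ | ∃ ρ : (Fin k → Λ) →ₗ[Λ] LinearMap.ker π, ∀ u : LinearMap.ker f, ρ u = φ u}
      zero_mem' := ⟨0, fun _ => rfl⟩
      add_mem' := by
        rintro φ φ' ⟨ρ, hρ⟩ ⟨ρ', hρ'⟩
        exact ⟨ρ + ρ', fun u => congrArg₂ (· + ·) (hρ u) (hρ' u)⟩
      smul_mem' := by
        rintro r φ ⟨ρ, hρ⟩
        exact ⟨r • ρ, fun u => congrArg (r • ·) (hρ u)⟩ }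
  have hdiv : ∀ j, ∃ η : LinearMap.ker f →ₗ[Λ] LinearMap.ker π, α - x ^ j • η ∈ S := by
    intro j
    let E : Submodule Λ (M × (Fin k → Λ)) :=
      LinearMap.ker ((x ^ j • LinearMap.id) ∘ₗ LinearMap.fst Λ M (Fin k → Λ) -
        f ∘ₗ LinearMap.snd Λ M (Fin k → Λ))
    have hE : ∀ v, v ∈ E ↔ x ^ j • v.1 = f v.2 := fun v => sub_eq_zero
    obtain ⟨ι, hι⟩ : ∃ ι : LinearMap.ker f →ₗ[Λ] E, ∀ u, (ι u : M × (Fin k → Λ)) = (0, u.1) :=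
      ⟨(LinearMap.inr Λ M (Fin k → Λ) ∘ₗ (LinearMap.ker f).subtype).codRestrict _
        fun u => (hE _).2 ((smul_zero _).trans u.2.symm), fun _ => rfl⟩
    obtain ⟨p, hp⟩ : ∃ p : E →ₗ[Λ] M, ∀ v, p v = v.1.1 :=
      ⟨LinearMap.fst Λ M (Fin k → Λ) ∘ₗ E.subtype, fun _ => rfl⟩
    have hCM : IsCM Λ E := by
      refine IsCM.mid hK hM (f := ι) (g := p) ?_ ?_ ?_
      · intro u v huv
        have h1 := congrArg (fun z : E => z.1.2) huv
        simp only [hι] at h1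
        exact Subtype.ext h1
      · intro v
        rw [hp]
        constructor
        · intro hv
          have h1 := (hE v.1).1 v.2
          rw [hv, smul_zero] at h1
          refine ⟨⟨v.1.2, h1.symm⟩, Subtype.ext ?_⟩
          rw [hι]
          exact Prod.ext hv.symm rfl
        · rintro ⟨u, rfl⟩
          rw [hι]
      · intro y
        obtain ⟨u, hu⟩ := hf (x ^ j • y)
        exact ⟨⟨(y, u), (hE _).2 hu.symm⟩, hp _⟩
    obtain ⟨g, hg⟩ := hfac E hCM p fun ⟨s, hs⟩ => hne j
      ((FactorsProj.of_projective (LinearMap.snd Λ M (Fin k → Λ) ∘ₗ E.subtype ∘ₗ s) f).congr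
        fun y => by
          change f (s y).1.2 = x ^ j • y
          rw [← (hE _).1 (s y).2, ← hp, hs])
    have hg0 : ∀ u, π (g (ι u)) = 0 := fun u => by rw [hg, hp, hι]
    refine ⟨(g ∘ₗ ι).codRestrict _ hg0, ?_⟩
    obtain ⟨σ, hσ⟩ : ∃ σ : (Fin k → Λ) →ₗ[Λ] E, ∀ u, (σ u : M × (Fin k → Λ)) = (f u, x ^ j • u) :=
      ⟨(f.prod (x ^ j • (LinearMap.id : (Fin k → Λ) →ₗ[Λ] (Fin k → Λ)))).codRestrict _
        fun u => (hE _).2 (show x ^ j • f u = f (x ^ j • u) from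
          (LinearMap.map_smul_of_tower f (x ^ j) u).symm), fun _ => rfl⟩
    refine ⟨(θ - g ∘ₗ σ).codRestrict _ fun u => ?_, fun u => Subtype.ext ?_⟩
    · change π (θ u - g (σ u)) = 0
      rw [map_sub, hθ, hg, hp, hσ, sub_self]
    · change θ u - g (σ u) = (α u : Fin m → T) - x ^ j • g (ι u)
      rw [hα, ← LinearMap.map_smul_of_tower g]
      congr 2
      refine Subtype.ext ?_
      rw [hσ]
      change _ = x ^ j • (ι u : M × (Fin k → Λ))
      rw [hι, u.2]
      exact Prod.ext (smul_zero _).symm rfl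
  have hαS : α ∈ S := mem_of_forall_sub_pow_smul_mem
    (H := LinearMap.ker f →ₗ[Λ] LinearMap.ker π) S hx hdiv
  obtain ⟨ρ, hρ⟩ := hαS
  obtain ⟨s, hs⟩ := exists_desc f hf (θ - (LinearMap.ker π).subtype ∘ₗ ρ) fun u hu => by
    have h1 := congrArg (Submodule.subtype _) (hρ ⟨u, hu⟩)
    change θ u - (ρ u : Fin m → T) = 0
    rw [sub_eq_zero, ← hα ⟨u, hu⟩]
    exact h1.symm
  refine ⟨s, fun y => ?_⟩
  obtain ⟨u, rfl⟩ := hf y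
  rw [hs]
  change π (θ u - (ρ u : Fin m → T)) = f u
  rw [map_sub, (ρ u).2, sub_zero, hθ]

theorem IsGorensteinOrder.exists_annihilator_of_isRetract (h : IsGorensteinOrder R Λ)
    (hT : ∀ (D : Type u) [AddCommGroup D] [Module Λ D], IsCM Λ D → IsIndecomposableModule Λ D →
      IsRetract Λ D T) {M : Type u} [AddCommGroup M] [Module R M] [Module Λ M]
    [IsScalarTower R Λ M] (hM : IsCM Λ M) (hind : IsIndecomposableModule Λ M) :
    ∃ a, ∀ y ∈ IsLocalRing.maximalIdeal R ^ a, FactorsProj (y • (LinearMap.id : M →ₗ[Λ] M)) := by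
  have := h.finite
  have := hM.1
  by_cases hp : Module.Projective Λ M
  · exact ⟨0, fun y _ => (FactorsProj.of_projective LinearMap.id (y • LinearMap.id)).congr
      fun _ => rfl⟩
  let J : Ideal R :=
    { carrier := {y | FactorsProj (y • (LinearMap.id : M →ₗ[Λ] M))}
      zero_mem' := FactorsProj.zero.congr fun _ => (zero_smul _ _).symm
      add_mem' := fun hy hz => (FactorsProj.add hy hz).congr fun _ => (add_smul _ _ _).symm
      smul_mem' := fun r y hy => (FactorsProj.comp_left hy (r • LinearMap.id)).congr
        fun _ => (mul_smul _ _ _).symm }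
  obtain ⟨a, ha⟩ := Ideal.exists_pow_le_of_le_radical_of_fg (I := IsLocalRing.maximalIdeal R)
    (J := J) (fun x hx => h.exists_pow_factorsProj hT hM (isLocalRing_end R hind) hp hx)
    (IsNoetherian.noetherian _)
  exact ⟨a, fun y hy => ha hy⟩

end Annihilator

section Nonsplit

variable {Λ : Type u} [Ring Λ] {X : Type w} [AddCommGroup X] [Module Λ X]
  {U : Type u} [AddCommGroup U] [Module Λ U]

/-- Maps which factor through a map to a Cohen–Macaulay module that is not a split
monomorphism. -/
def FactorsNonsplit (f : U →ₗ[Λ] X) : Prop :=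
  ∃ (C : ModuleCat.{u} Λ) (r : U →ₗ[Λ] C) (g : C →ₗ[Λ] X),
    IsCM Λ C ∧ ¬ HasRetraction r ∧ ∀ x, g (r x) = f x

theorem FactorsNonsplit.add (hloc : IsLocalRing (Module.End Λ U)) {f f' : U →ₗ[Λ] X}
    (h : FactorsNonsplit f) (h' : FactorsNonsplit f') : FactorsNonsplit (f + f') := by
  obtain ⟨C, r, g, hC, hr, hg⟩ := h
  obtain ⟨C', r', g', hC', hr', hg'⟩ := h'
  refine ⟨ModuleCat.of Λ (C × C'), r.prod r', g.coprod g', hC.prod hC', ?_, fun x => ?_⟩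
  · rintro ⟨s, hs⟩
    rcases isUnit_or_isUnit_comp hloc (f := s ∘ₗ LinearMap.inl Λ C C')
      (f' := s ∘ₗ LinearMap.inr Λ C C') (g := r) (g' := r') (fun x => by
        refine Eq.trans ?_ (hs x)
        change s (r x, 0) + s (0, r' x) = s (r x, r' x)
        rw [← map_add, Prod.mk_add_mk, add_zero, zero_add]) with hu | hu
    · exact hr (hasRetraction_of_isUnit hu)
    · exact hr' (hasRetraction_of_isUnit hu)
  · exact congrArg₂ (· + ·) (hg x) (hg' x)

theorem FactorsNonsplit.comp_left {f : U →ₗ[Λ] X} (h : FactorsNonsplit f) {Y : Type w₁}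
    [AddCommGroup Y] [Module Λ Y] (g : X →ₗ[Λ] Y) : FactorsNonsplit (g ∘ₗ f) := by
  obtain ⟨C, r, g', hC, hr, hg⟩ := h
  exact ⟨C, r, g ∘ₗ g', hC, hr, fun x => congrArg g (hg x)⟩

theorem FactorsNonsplit.neg {f : U →ₗ[Λ] X} (h : FactorsNonsplit f) : FactorsNonsplit (-f) :=
  h.comp_left (-LinearMap.id)

theorem FactorsNonsplit.comp_equiv {f : U →ₗ[Λ] X} (h : FactorsNonsplit f) {U' : Type u}
    [AddCommGroup U'] [Module Λ U'] (e : U' ≃ₗ[Λ] U) :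
    FactorsNonsplit (f ∘ₗ e.toLinearMap) := by
  obtain ⟨C, r, g, hC, hr, hg⟩ := h
  exact ⟨C, r ∘ₗ e.toLinearMap, g, hC, fun ⟨s, hs⟩ => hr ⟨e.toLinearMap ∘ₗ s, fun x => by
    have h1 := hs (e.symm x)
    simp only [LinearMap.comp_apply, LinearEquiv.coe_coe, e.apply_symm_apply] at h1
    exact (LinearEquiv.symm_apply_eq _).1 h1.symm |>.symm⟩, fun x => hg (e x)⟩

/-- A map from a noetherian module is a split monomorphism as soon as it is one on indecomposable
direct summands. -/
theorem hasRetraction_of_forall_indecomposable {N : Type u} [AddCommGroup N] [Module Λ N]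
    [IsNoetherian Λ N] {C : Type w} [AddCommGroup C] [Module Λ C] (f : N →ₗ[Λ] C)
    (h : ∀ (U : Type u) [AddCommGroup U] [Module Λ U], IsIndecomposableModule Λ U →
      ∀ a : U →ₗ[Λ] N, HasRetraction a → HasRetraction (f ∘ₗ a)) : HasRetraction f := by
  revert f
  refine decomposition_induction (Λ := Λ) (M := N) (fun N _ _ => ∀ f : N →ₗ[Λ] C,
    (∀ (U : Type u) [AddCommGroup U] [Module Λ U], IsIndecomposableModule Λ U →
      ∀ a : U →ₗ[Λ] N, HasRetraction a → HasRetraction (f ∘ₗ a)) → HasRetraction f) ?_ ?_ ?_ ?_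
  · intro M N _ _ _ _ e hM f hf
    obtain ⟨r, hr⟩ := hM (f ∘ₗ e.toLinearMap) fun U _ _ hU a ⟨s, hs⟩ =>
      hf U hU (e.toLinearMap ∘ₗ a) ⟨s ∘ₗ e.symm.toLinearMap, fun x => by simp [hs]⟩
    exact ⟨e.toLinearMap ∘ₗ r, fun x => by
      have h1 := hr (e.symm x)
      simp only [LinearMap.comp_apply, LinearEquiv.coe_coe, e.apply_symm_apply] at h1
      exact (LinearEquiv.symm_apply_eq _).1 h1.symm |>.symm⟩
  · intro N _ _ _ f _
    exact ⟨0, fun x => Subsingleton.elim _ _⟩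
  · intro N _ _ _ hN f hf
    exact hf N hN LinearMap.id ⟨LinearMap.id, fun _ => rfl⟩
  · intro A B _ _ _ _ hA hB f hf
    obtain ⟨p, hp⟩ := hA (f ∘ₗ LinearMap.inl Λ A B) fun U _ _ hU a ⟨s, hs⟩ =>
      hf U hU (LinearMap.inl Λ A B ∘ₗ a) ⟨s ∘ₗ LinearMap.fst Λ A B, hs⟩
    replace hp : ∀ x : A, p (f (x, 0)) = x := hp
    obtain ⟨q, hq⟩ : ∃ q : C →ₗ[Λ] C, ∀ c, q c = c - f (p c, 0) :=
      ⟨LinearMap.id - f ∘ₗ LinearMap.inl Λ A B ∘ₗ p, fun _ => rfl⟩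
    obtain ⟨r, hr⟩ := hB (q ∘ₗ f ∘ₗ LinearMap.inr Λ A B) fun U _ _ hU a ⟨s, hs⟩ => by
      obtain ⟨t, ht⟩ := hf U hU ((-(p ∘ₗ f ∘ₗ LinearMap.inr Λ A B ∘ₗ a)).prod a)
        ⟨s ∘ₗ LinearMap.snd Λ A B, hs⟩
      refine ⟨t, fun x => ?_⟩
      refine Eq.trans (congrArg t ?_) (ht x)
      change q (f (0, a x)) = f (-p (f (0, a x)), a x)
      rw [hq, ← map_sub, Prod.mk_sub_mk, sub_zero, zero_sub]
    replace hr : ∀ y : B, r (q (f (0, y))) = y := hr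
    obtain ⟨r', hr'⟩ : ∃ r' : C →ₗ[Λ] A × B,
        ∀ c, r' c = (p c - p (f (0, r (q c))), r (q c)) :=
      ⟨(p - p ∘ₗ f ∘ₗ LinearMap.inr Λ A B ∘ₗ r ∘ₗ q).prod (r ∘ₗ q), fun _ => rfl⟩
    refine ⟨r', fun ⟨x, y⟩ => ?_⟩
    have h1 : f (x, y) = f (x, 0) + f (0, y) := by
      rw [← map_add, Prod.mk_add_mk, add_zero, zero_add]
    have h2 : r (q (f (x, y))) = y := by
      rw [h1, map_add, hq (f (x, 0)), hp, sub_self, zero_add, hr]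
    rw [hr', h2, h1, map_add, hp, add_sub_cancel_right]

end Nonsplit

section Family

variable {Λ : Type u} [Ring Λ] {X : Type w} [AddCommGroup X] [Module Λ X]
  {ι : Type w₁} {M : ι → Type u} [∀ i, AddCommGroup (M i)] [∀ i, Module Λ (M i)]

/-- A linear map into a direct sum whose image is supported in a subset of the index set. -/
def SupportedIn {U : Type w₂} [AddCommGroup U] [Module Λ U] (B : Set ι)
    (a : U →ₗ[Λ] Π₀ i, M i) : Prop :=
  ∀ x, ∀ i ∉ B, a x i = 0

/-- A map from a finite module into a direct sum factors through a finite subsum. -/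
theorem exists_factor_finite {U : Type u} [AddCommGroup U] [Module Λ U] [Module.Finite Λ U]
    (a : U →ₗ[Λ] Π₀ i, M i) :
    ∃ (m : ℕ) (b : Fin m → ι) (j : (∀ k, M (b k)) →ₗ[Λ] Π₀ i, M i)
      (p : (Π₀ i, M i) →ₗ[Λ] ∀ k, M (b k)), (∀ k, ∃ x, a x (b k) ≠ 0) ∧ (∀ v, p (j v) = v) ∧
      SupportedIn (Set.range b) j ∧ ∀ x, j (p (a x)) = a x := by
  classical
  obtain ⟨s, hs⟩ : ∃ s : Finset ι, ∀ x, ∀ i ∉ s, a x i = 0 := by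
    obtain ⟨t, ht⟩ := (Module.Finite.fg_top : (⊤ : Submodule Λ U).FG)
    refine ⟨t.biUnion fun x => (a x).support, fun x i hi => ?_⟩
    have h : (⊤ : Submodule Λ U) ≤ LinearMap.ker (DFinsupp.lapply (R := Λ) (M := M) i ∘ₗ a) := by
      rw [← ht, Submodule.span_le]
      intro y hy
      by_contra hne
      exact hi (Finset.mem_biUnion.2 ⟨y, hy, DFinsupp.mem_support_iff.2 hne⟩)
    exact h Submodule.mem_top
  let s' := s.filter fun i => ∃ x, a x i ≠ 0
  have hs' : ∀ x, ∀ i ∉ s', a x i = 0 := by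
    intro x i hi
    by_contra hne
    refine hi (Finset.mem_filter.2 ⟨?_, x, hne⟩)
    by_contra his
    exact hne (hs x i his)
  let b : Fin s'.card → ι := fun k => (s'.equivFin.symm k).1
  have hb : ∀ k, b k ∈ s' := fun k => (s'.equivFin.symm k).2
  have hinj : Function.Injective b := Subtype.val_injective.comp s'.equivFin.symm.injective
  have hrange : ∀ i ∈ s', ∃ k, b k = i := fun i hi =>
    ⟨s'.equivFin ⟨i, hi⟩, congrArg Subtype.val (s'.equivFin.symm_apply_apply _)⟩
  obtain ⟨j, hj⟩ : ∃ j : (∀ k, M (b k)) →ₗ[Λ] Π₀ i, M i,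
      ∀ v, j v = ∑ k, DFinsupp.single (b k) (v k) :=
    ⟨∑ k, DFinsupp.lsingle (b k) ∘ₗ LinearMap.proj k, fun v => by
      rw [LinearMap.sum_apply]
      rfl⟩
  have hj1 : ∀ v k, j v (b k) = v k := by
    intro v k
    rw [hj, DFinsupp.finsetSum_apply, Finset.sum_eq_single k, DFinsupp.single_eq_same]
    · exact fun l _ hl => DFinsupp.single_eq_of_ne (hinj.ne hl).symm
    · exact fun h => absurd (Finset.mem_univ k) h
  have hj2 : SupportedIn (Set.range b) j := by
    intro v i hi
    rw [hj, DFinsupp.finsetSum_apply]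
    exact Finset.sum_eq_zero fun k _ => DFinsupp.single_eq_of_ne fun h => hi ⟨k, h.symm⟩
  refine ⟨s'.card, b, j, LinearMap.pi fun k => DFinsupp.lapply (b k),
    fun k => (Finset.mem_filter.1 (hb k)).2, fun v => funext fun k => hj1 v k, hj2, fun x => ?_⟩
  ext i
  by_cases hi : ∃ k, b k = i
  · obtain ⟨k, rfl⟩ := hi
    exact hj1 _ k
  · rw [hj2 _ i hi, hs' x i fun h => hi (hrange i h)]

/-- Independence of a family of maps to `X` modulo the maps that factor through a map which is not
a split monomorphism. -/
def Independent (π : (Π₀ i, M i) →ₗ[Λ] X) (B : Set ι) : Prop :=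
  ∀ (i : ι) (a : M i →ₗ[Λ] Π₀ i, M i), SupportedIn B a → HasRetraction a →
    ¬ FactorsNonsplit (π ∘ₗ a)

theorem exists_maximal_independent [∀ i, Module.Finite Λ (M i)] [∀ i, Nontrivial (M i)]
    (π : (Π₀ i, M i) →ₗ[Λ] X) : ∃ B, Maximal (Independent π) B := by
  refine zorn_subset {B | Independent π B} fun c hc hchain => ?_
  rcases c.eq_empty_or_nonempty with rfl | hne
  · refine ⟨∅, fun i a ha ⟨r, hr⟩ _ => ?_, fun s hs => hs.elim⟩
    obtain ⟨x, hx⟩ := exists_ne (0 : M i)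
    refine hx ?_
    rw [← hr x, show a x = 0 from DFinsupp.ext fun i => ha x i (Set.notMem_empty i), map_zero]
  · refine ⟨⋃₀ c, fun i a ha hr => ?_, fun s hs => Set.subset_sUnion_of_mem hs⟩
    obtain ⟨m, b, j, p, hb, -, hj, hjp⟩ := exists_factor_finite a
    obtain ⟨B, hB, hbB⟩ := DirectedOn.exists_mem_subset_of_finite_of_subset_sUnion hne
      hchain.directedOn (Set.finite_range b) (s := Set.range b) (by
        rintro _ ⟨k, rfl⟩
        obtain ⟨x, hx⟩ := hb k
        by_contra hk
        exact hx (ha x _ hk))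
    refine hc hB i a (fun x l hl => ?_) hr
    rw [← hjp x]
    exact hj _ l fun h => hl (hbB h)

theorem HasRetraction.of_add {U : Type u} {Y : Type w₂} [AddCommGroup U] [Module Λ U]
    [AddCommGroup Y] [Module Λ Y] (hloc : IsLocalRing (Module.End Λ U)) {a b : U →ₗ[Λ] Y}
    (h : HasRetraction (a + b)) : HasRetraction a ∨ HasRetraction b := by
  obtain ⟨r, hr⟩ := h
  rcases isUnit_or_isUnit_comp hloc (f := r) (g := a) (f' := r) (g' := b) (fun x => by
    rw [← map_add]; exact hr x) with h | h
  · exact .inl (hasRetraction_of_isUnit h)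
  · exact .inr (hasRetraction_of_isUnit h)

theorem exists_supported_sub [DecidableEq ι] [∀ i, Module.Finite Λ (M i)]
    (hind : ∀ i, IsIndecomposableModule Λ (M i))
    (hloc : ∀ i, IsLocalRing (Module.End Λ (M i))) (hCM : ∀ i, IsCM Λ (M i))
    {π : (Π₀ i, M i) →ₗ[Λ] X} {B : Set ι} (hB : Maximal (Independent π) B) {φ : ∀ i, M i →ₗ[Λ] X}
    (hπ : ∀ i x, π (DFinsupp.lsingle (R := Λ) i x) = φ i x) (i : ι) :
    ∃ a : M i →ₗ[Λ] Π₀ i, M i, SupportedIn B a ∧ FactorsNonsplit (φ i - π ∘ₗ a) := by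
  have hzero : FactorsNonsplit (0 : M i →ₗ[Λ] X) := by
    have := (hind i).1
    refine ⟨ModuleCat.of Λ PUnit.{u + 1}, 0, 0, IsCM.of_subsingleton, fun ⟨r, hr⟩ => ?_, fun _ => rfl⟩
    obtain ⟨x, hx⟩ := exists_ne (0 : M i)
    exact hx ((hr x).symm.trans (map_zero r))
  by_cases hi : i ∈ B
  · refine ⟨DFinsupp.lsingle i, fun x k hk => DFinsupp.single_eq_of_ne fun h => hk (h ▸ hi), ?_⟩
    convert hzero using 1
    ext x
    exact sub_eq_zero.2 (hπ i x).symm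
  · have hins : ¬ Independent π (insert i B) := fun h =>
      hi (hB.2 h (Set.subset_insert i B) (Set.mem_insert i B))
    unfold Independent at hins
    push Not at hins
    obtain ⟨k, a, ha, hr, hf⟩ := hins
    obtain ⟨c, hc⟩ : ∃ c : M k →ₗ[Λ] M i, ∀ x, c x = a x i :=
      ⟨DFinsupp.lapply i ∘ₗ a, fun _ => rfl⟩
    obtain ⟨a', ha'⟩ : ∃ a' : M k →ₗ[Λ] Π₀ i, M i, a' = a - DFinsupp.lsingle i ∘ₗ c := ⟨_, rfl⟩
    have ha : a = a' + DFinsupp.lsingle i ∘ₗ c := by rw [ha', sub_add_cancel]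
    have hsupp : SupportedIn B a' := by
      intro x l hl
      rw [ha', LinearMap.sub_apply, DFinsupp.sub_apply, LinearMap.comp_apply,
        DFinsupp.lsingle_apply, sub_eq_zero]
      by_cases hli : l = i
      · subst hli
        rw [DFinsupp.single_eq_same, hc]
      · rw [DFinsupp.single_eq_of_ne hli]
        exact ‹SupportedIn (insert i B) a› x l fun h => h.elim hli hl
    have hπa : π ∘ₗ a = π ∘ₗ a' + φ i ∘ₗ c := by
      rw [ha]
      ext x
      change π (a' x + DFinsupp.lsingle (R := Λ) i (c x)) = π (a' x) + φ i (c x)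
      rw [map_add, hπ]
    have := (hind k).1
    by_cases hcr : HasRetraction c
    · obtain ⟨r, hcr⟩ := hcr
      let e := LinearEquiv.ofBijective c (bijective_of_leftInverse hcr (hind i))
      have he : ∀ y, c (e.symm y) = y := e.apply_symm_apply
      refine ⟨-(a' ∘ₗ e.symm.toLinearMap), fun x l hl => ?_, ?_⟩
      · rw [LinearMap.neg_apply, DFinsupp.neg_apply, LinearMap.comp_apply, hsupp _ l hl, neg_zero]
      · convert hf.comp_equiv e.symm using 1
        rw [hπa]
        ext x
        change φ i x - π (-a' (e.symm x)) = π (a' (e.symm x)) + φ i (c (e.symm x))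
        rw [he, map_neg, sub_neg_eq_add, add_comm]
    · exfalso
      rw [ha] at hr
      rcases hr.of_add (hloc k) with h | ⟨r, hr⟩
      · refine hB.1 k a' hsupp h ?_
        have h1 : FactorsNonsplit (φ i ∘ₗ c) :=
          ⟨ModuleCat.of Λ (M i), c, φ i, hCM i, hcr, fun _ => rfl⟩
        convert hf.add (hloc k) h1.neg using 1
        rw [hπa, add_neg_cancel_right]
      · exact hcr ⟨r ∘ₗ DFinsupp.lsingle i, hr⟩

end Family

section Faithful

variable {R : Type u} [CommRing R] [IsNoetherianRing R] [IsLocalRing R]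
  [IsAdicComplete (IsLocalRing.maximalIdeal R) R] {Λ : Type u} [Ring Λ] [Algebra R Λ]
  {X : Type w} [AddCommGroup X] [Module Λ X]
  {ι : Type w₁} {M : ι → Type u} [∀ i, AddCommGroup (M i)] [∀ i, Module Λ (M i)]

theorem IsCM.pi {m : ℕ} {N : Fin m → Type u} [∀ k, AddCommGroup (N k)] [∀ k, Module Λ (N k)]
    (h : ∀ k, IsCM Λ (N k)) : IsCM Λ (∀ k, N k) := by
  induction m with
  | zero => exact .of_subsingleton
  | succ m ih => exact ((h 0).prod (ih fun k => h k.succ)).congr (Fin.consLinearEquiv Λ N)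

/-- A split submodule of a finite direct sum is isomorphic to one of the summands. -/
theorem exists_equiv_of_hasRetraction {m : ℕ} {N : Fin m → Type w} [∀ k, AddCommGroup (N k)]
    [∀ k, Module Λ (N k)] (hind : ∀ k, IsIndecomposableModule Λ (N k)) {U : Type u}
    [AddCommGroup U] [Module Λ U] (hloc : IsLocalRing (Module.End Λ U))
    {a : U →ₗ[Λ] ∀ k, N k} (ha : HasRetraction a) : ∃ k, Nonempty (U ≃ₗ[Λ] N k) := by
  classical
  obtain ⟨r, hr⟩ := ha
  obtain ⟨k, -, hk⟩ := exists_isUnit_comp hloc Finset.univ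
    (fun k => r ∘ₗ LinearMap.single Λ N k) (fun k => LinearMap.proj k ∘ₗ a) fun x => by
      refine Eq.trans ?_ (hr x)
      change ∑ k, r (Pi.single k (a x k)) = _
      rw [← map_sum, Finset.univ_sum_single]
  have := nontrivial_of_isLocalRing_end hloc
  obtain ⟨s, hs⟩ := hasRetraction_of_isUnit hk
  exact ⟨k, IsRetract.nonempty_equiv ⟨_, s, hs⟩ (hind k)⟩

theorem IsGorensteinOrder.factorsProj_of_comp (h : IsGorensteinOrder R Λ)
    (hind : ∀ i, IsIndecomposableModule Λ (M i)) (hCM : ∀ i, IsCM Λ (M i))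
    {π : (Π₀ i, M i) →ₗ[Λ] X} {B : Set ι} (hB : Independent π B) {U : Type u} [AddCommGroup U]
    [Module Λ U] (hU : IsCM Λ U) {w : U →ₗ[Λ] Π₀ i, M i} (hw : SupportedIn B w)
    (hπ : FactorsProj (π ∘ₗ w)) : FactorsProj w := by
  have := h.finite
  have := h.isNoetherianRing
  have := hU.1
  have := fun i => (hCM i).1
  obtain ⟨m, b, j, p, hb, hpj, hj, hjp⟩ := exists_factor_finite w
  have hbB : Set.range b ⊆ B := by
    rintro _ ⟨k, rfl⟩
    obtain ⟨x, hx⟩ := hb k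
    by_contra hk
    exact hx (hw x _ hk)
  obtain ⟨Q, C, _, _, _, _, i, g, hQ, hQp, hi, hig, hg, hC⟩ := h.exists_cosyzygy hU
  obtain ⟨c, hc⟩ : ∃ c : Q →ₗ[Λ] X, ∀ x, c (i x) = (π ∘ₗ j) ((p ∘ₗ w) x) := by
    obtain ⟨l, α, β, hαβ⟩ := hπ
    obtain ⟨α', hα'⟩ := (hC.ext1Z_of_projective (N := Fin l → Λ)).extend hi hig hg α
    refine ⟨β ∘ₗ α', fun x => ?_⟩
    rw [LinearMap.comp_apply, hα', hαβ]
    exact congrArg π (hjp x).symm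
  obtain ⟨E, _, _, e, q, b', he, heq, hq, hbe, -, hd⟩ := exists_pushout hi hig hg (p ∘ₗ w)
  obtain ⟨d, hd, -⟩ := hd X (π ∘ₗ j) c hc
  have hN : IsCM Λ (∀ k, M (b k)) := .pi fun k => hCM (b k)
  have hE : IsCM Λ E := hN.mid hC he heq hq
  have hN' := hN.1
  have hret : HasRetraction e := by
    refine hasRetraction_of_forall_indecomposable e fun U' _ _ hU' a ha => ?_
    by_contra hea
    obtain ⟨r, hr⟩ := ha
    have : Module.Finite Λ U' := .of_surjective r fun x => ⟨_, hr x⟩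
    have hloc := isLocalRing_end R hU'
    obtain ⟨k, ⟨θ⟩⟩ := exists_equiv_of_hasRetraction (fun k => hind (b k)) hloc ⟨r, hr⟩
    have hf : FactorsNonsplit (π ∘ₗ j ∘ₗ a) :=
      ⟨ModuleCat.of Λ E, e ∘ₗ a, d, hE, hea, fun x => hd (a x)⟩
    refine hB (b k) (j ∘ₗ a ∘ₗ θ.symm.toLinearMap) (fun x l hl => hj _ l fun h => hl (hbB h))
      ⟨θ.toLinearMap ∘ₗ r ∘ₗ p, fun x => ?_⟩ (hf.comp_equiv θ.symm)
    simp [hpj, hr]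
  obtain ⟨ρ, hρ⟩ := hret
  refine (FactorsProj.of_projective i (j ∘ₗ ρ ∘ₗ b')).congr fun x => ?_
  refine Eq.trans ?_ (hjp x)
  change j (ρ (b' (i x))) = j (p (w x))
  rw [hbe, hρ]
  rfl

end Faithful

section Descent

variable {R : Type u} [CommRing R] [IsNoetherianRing R] [IsLocalRing R]

instance isArtinian_quotient_pow (a : ℕ) :
    IsArtinian R (R ⧸ IsLocalRing.maximalIdeal R ^ (a + 1)) := by
  have : IsArtinianRing (R ⧸ IsLocalRing.maximalIdeal R ^ (a + 1)) := by
    refine IsLocalRing.quotient_artinian_of_mem_minimalPrimes_of_isLocalRing _ ?_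
    rw [← Ideal.radical_minimalPrimes, Ideal.radical_pow _ (Nat.succ_ne_zero a),
      (IsLocalRing.maximalIdeal.isMaximal R).isPrime.radical,
      Ideal.minimalPrimes_eq_subsingleton_self]
    rfl
  let F : Submodule R (R ⧸ IsLocalRing.maximalIdeal R ^ (a + 1)) →
      Ideal (R ⧸ IsLocalRing.maximalIdeal R ^ (a + 1)) := fun N =>
    { carrier := N
      zero_mem' := N.zero_mem
      add_mem' := N.add_mem
      smul_mem' := fun c x hx => by
        obtain ⟨r, rfl⟩ := Ideal.Quotient.mk_surjective c
        exact N.smul_mem r hx }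
  exact ⟨Subrelation.wf (fun {_ _} (h : _ < _) => h) (InvImage.wf F wellFounded_lt)⟩

/-- Submodules of a finite module, compared modulo a power of the maximal ideal, satisfy the
descending chain condition. -/
theorem wellFounded_lt_sup_pow_smul (a : ℕ) (H : Type w) [AddCommGroup H] [Module R H]
    [Module.Finite R H] : WellFounded fun Y' Y : Submodule R H =>
      Y' ≤ Y ∧ ¬ Y ≤ Y' ⊔ IsLocalRing.maximalIdeal R ^ (a + 1) • ⊤ := by
  have : IsArtinian R (H ⧸ (IsLocalRing.maximalIdeal R ^ (a + 1) • ⊤ : Submodule R H)) := by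
    refine isArtinian_of_forall_smul_eq_zero (𝔟 := IsLocalRing.maximalIdeal R ^ (a + 1))
      fun r hr x => ?_
    obtain ⟨x, rfl⟩ := Submodule.Quotient.mk_surjective _ x
    rw [← Submodule.Quotient.mk_smul, Submodule.Quotient.mk_eq_zero]
    exact Submodule.smul_mem_smul hr Submodule.mem_top
  refine Subrelation.wf ?_ (InvImage.wf (Submodule.map (Submodule.mkQ
    (IsLocalRing.maximalIdeal R ^ (a + 1) • ⊤ : Submodule R H))) wellFounded_lt)
  rintro Y' Y ⟨h1, h2⟩
  refine lt_of_le_of_ne (Submodule.map_mono h1) fun h => h2 ?_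
  rw [sup_comm, ← Submodule.comap_map_mkQ, ← Submodule.map_le_iff_le_comap]
  exact h.ge

end Descent

section Surjective

variable {R : Type u} [CommRing R] [IsNoetherianRing R] [IsLocalRing R]
  [IsAdicComplete (IsLocalRing.maximalIdeal R) R] {Λ : Type u} [Ring Λ] [Algebra R Λ]
  {X : Type w} [AddCommGroup X] [Module Λ X]
  {ι : Type w₁} {M : ι → Type u} [∀ i, AddCommGroup (M i)] [∀ i, Module Λ (M i)]
  {U : Type u} [AddCommGroup U] [Module Λ U]

/-- Maps to `X` that lift, up to maps factoring through projectives, to the part of a direct sum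
supported in `B`. -/
def LiftsTo (π : (Π₀ i, M i) →ₗ[Λ] X) (B : Set ι) (f : U →ₗ[Λ] X) : Prop :=
  ∃ a : U →ₗ[Λ] Π₀ i, M i, SupportedIn B a ∧ FactorsProj (f - π ∘ₗ a)

variable {π : (Π₀ i, M i) →ₗ[Λ] X} {B : Set ι} {f f' : U →ₗ[Λ] X}

theorem FactorsProj.liftsTo (h : FactorsProj f) : LiftsTo π B f :=
  ⟨0, fun _ _ _ => rfl, h.congr fun x => by simp⟩

theorem LiftsTo.add (h : LiftsTo π B f) (h' : LiftsTo π B f') : LiftsTo π B (f + f') := by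
  obtain ⟨a, ha, hf⟩ := h
  obtain ⟨a', ha', hf'⟩ := h'
  refine ⟨a + a', fun x i hi => ?_, (hf.add hf').congr fun x => ?_⟩
  · rw [LinearMap.add_apply, DFinsupp.add_apply, ha x i hi, ha' x i hi, add_zero]
  · simp only [LinearMap.add_apply, LinearMap.sub_apply, LinearMap.comp_apply, map_add]
    abel

theorem LiftsTo.sum {κ : Type*} (s : Finset κ) {f : κ → U →ₗ[Λ] X}
    (h : ∀ k ∈ s, LiftsTo π B (f k)) : LiftsTo π B (∑ k ∈ s, f k) :=
  Finset.sum_induction f (LiftsTo π B) (fun _ _ h h' => h.add h') FactorsProj.zero.liftsTo h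

theorem LiftsTo.comp_right (h : LiftsTo π B f) {V : Type u} [AddCommGroup V] [Module Λ V]
    (g : V →ₗ[Λ] U) : LiftsTo π B (f ∘ₗ g) := by
  obtain ⟨a, ha, hf⟩ := h
  exact ⟨a ∘ₗ g, fun x => ha (g x), (hf.comp_right g).congr fun _ => rfl⟩

/-- The submodule of maps factoring through a given one. -/
def precompRange {T D D' : Type u} [AddCommGroup T] [Module R T] [Module Λ T]
    [IsScalarTower R Λ T] [AddCommGroup D] [Module Λ D] [AddCommGroup D'] [Module Λ D']
    (p : D →ₗ[Λ] D') : Submodule R (D →ₗ[Λ] T) where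
  carrier := {h | ∃ g : D' →ₗ[Λ] T, h = g ∘ₗ p}
  zero_mem' := ⟨0, by rw [LinearMap.zero_comp]⟩
  add_mem' := by
    rintro _ _ ⟨g, rfl⟩ ⟨g', rfl⟩
    exact ⟨g + g', by rw [LinearMap.add_comp]⟩
  smul_mem' := by
    rintro r _ ⟨g, rfl⟩
    exact ⟨r • g, by rw [LinearMap.smul_comp]⟩

theorem IsGorensteinOrder.liftsTo_comp (h : IsGorensteinOrder R Λ) {T : Type u} [AddCommGroup T]
    [Module Λ T] [Module.Finite Λ T]
    (hT : ∀ (D : Type u) [AddCommGroup D] [Module Λ D], IsCM Λ D → IsIndecomposableModule Λ D →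
      IsRetract Λ D T) {φ : ∀ i, M i →ₗ[Λ] X} (hsub : ∀ i, ∃ a : M i →ₗ[Λ] Π₀ i, M i,
      SupportedIn B a ∧ FactorsNonsplit (φ i - π ∘ₗ a))
    (hφ : ∀ (D : Type u) [AddCommGroup D] [Module Λ D], IsCM Λ D → IsIndecomposableModule Λ D →
      ¬ Module.Projective Λ D → ∀ f : D →ₗ[Λ] X, ∃ (i : ι) (e : D ≃ₗ[Λ] M i),
        ∀ x, φ i (e x) = f x)
    {D₀ : Type u} [AddCommGroup D₀] [Module Λ D₀] (hD₀ : IsCM Λ D₀)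
    (hind₀ : IsIndecomposableModule Λ D₀) {D : Type u} [AddCommGroup D] [Module Λ D]
    (hD : IsCM Λ D) (hindD : IsIndecomposableModule Λ D) (p : D₀ →ₗ[Λ] D) (f : D →ₗ[Λ] X) :
    LiftsTo π B (f ∘ₗ p) := by
  have := h.finite
  have := h.isNoetherianRing
  have := hD₀.1
  let _ := restrictModule R Λ D₀
  have := restrictModule_isScalarTower R (Λ := Λ) D₀
  let _ := restrictModule R Λ T
  have := restrictModule_isScalarTower R (Λ := Λ) T
  have : Module.Finite R T := Module.Finite.trans Λ T
  have := finite_hom (R := R) (Λ := Λ) D₀ T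
  obtain ⟨a, ha⟩ := h.exists_annihilator_of_isRetract hT hD₀ hind₀
  replace ha : ∀ h ∈ (IsLocalRing.maximalIdeal R ^ (a + 1) • ⊤ : Submodule R (D₀ →ₗ[Λ] T)),
      FactorsProj h := fun h hh => by
    refine Submodule.smul_induction_on hh (fun r hr g _ => ?_) fun _ _ => FactorsProj.add
    exact ((ha r (Ideal.pow_le_pow_right a.le_succ hr)).comp_left g).congr fun x =>
      LinearMap.map_smul_of_tower g r x
  obtain ⟨Y, hY⟩ : ∃ Y, Y = precompRange (R := R) (T := T) p := ⟨_, rfl⟩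
  induction Y using (wellFounded_lt_sup_pow_smul (R := R) a (D₀ →ₗ[Λ] T)).induction
    generalizing D with
  | _ Y ih =>
  have := hD.1
  by_cases hproj : Module.Projective Λ D
  · exact (FactorsProj.of_projective p f).liftsTo
  by_cases hp : FactorsProj p
  · exact (hp.comp_left f).liftsTo
  obtain ⟨i, e, he⟩ := hφ D hD hindD hproj f
  obtain ⟨b, hb, C, r, g, hC, hr, hg⟩ := hsub i
  have := hC.1
  obtain ⟨κ, _, E, j, q, hE, hqj, hjq⟩ := exists_indecomposable_family (Λ := Λ) C
  have hsum : f ∘ₗ p = π ∘ₗ (b ∘ₗ e.toLinearMap ∘ₗ p) +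
      ∑ s, (g ∘ₗ j s) ∘ₗ (q s ∘ₗ r ∘ₗ e.toLinearMap ∘ₗ p) := by
    ext x
    rw [LinearMap.add_apply, LinearMap.sum_apply]
    change f (p x) = π (b (e (p x))) + ∑ s, g (j s (q s (r (e (p x)))))
    rw [← map_sum, hjq, hg, LinearMap.sub_apply, he, LinearMap.comp_apply, add_sub_cancel]
  rw [hsum]
  refine LiftsTo.add ⟨b ∘ₗ e.toLinearMap ∘ₗ p, fun x => hb _, FactorsProj.zero.congr fun x => ?_⟩
    (LiftsTo.sum _ fun s _ => ?_)
  · exact (sub_self _).symm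
  · refine ih _ ⟨?_, fun hle => hp ?_⟩ (hC.of_isRetract ⟨j s, q s, hqj s⟩) (hE s) _ _ rfl
    · rw [hY]
      rintro _ ⟨g', rfl⟩
      exact ⟨g' ∘ₗ q s ∘ₗ r ∘ₗ e.toLinearMap, rfl⟩
    · obtain ⟨k, k', hk⟩ := hT D hD hindD
      rw [hY] at hle
      obtain ⟨_, ⟨g', rfl⟩, z, hz, hkp⟩ := Submodule.mem_sup.1 (hle ⟨k, rfl⟩)
      obtain ⟨c, hc⟩ : ∃ c : D →ₗ[Λ] D, ∀ x, c x = k' (g' (q s (r (e x)))) :=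
        ⟨k' ∘ₗ g' ∘ₗ q s ∘ₗ r ∘ₗ e.toLinearMap, fun _ => rfl⟩
      have hloc := isLocalRing_end R hindD
      rcases isUnit_or_isUnit_comp hloc (f := LinearMap.id) (g := c) (f' := LinearMap.id)
        (g' := LinearMap.id - c) (fun x => by simp) with hu | hu
      · exfalso
        obtain ⟨t, ht⟩ : HasRetraction (r ∘ₗ e.toLinearMap) := by
          refine hasRetraction_of_isUnit (f := k' ∘ₗ g' ∘ₗ q s) ?_
          convert hu using 1
          exact LinearMap.ext fun x => (hc x).symm
        refine hr ⟨e.toLinearMap ∘ₗ t, fun x => ?_⟩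
        have := ht (e.symm x)
        simp only [LinearMap.comp_apply, LinearEquiv.coe_coe, e.apply_symm_apply] at this ⊢
        rw [this, e.apply_symm_apply]
      · obtain ⟨t, ht⟩ := hasRetraction_of_isUnit hu
        refine ((ha z hz).comp_left (t ∘ₗ k')).congr fun x => ?_
        refine Eq.trans ?_ (ht (p x))
        change t (k' (z x)) = t (p x - c (p x))
        rw [hc]
        congr 1
        have := LinearMap.congr_fun hkp x
        change g' (q s (r (e (p x)))) + z x = k (p x) at this
        refine eq_sub_of_add_eq' ?_
        rw [← map_add, this, hk]

theorem IsGorensteinOrder.liftsTo (h : IsGorensteinOrder R Λ) {T : Type u} [AddCommGroup T]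
    [Module Λ T] [Module.Finite Λ T]
    (hT : ∀ (D : Type u) [AddCommGroup D] [Module Λ D], IsCM Λ D → IsIndecomposableModule Λ D →
      IsRetract Λ D T) {φ : ∀ i, M i →ₗ[Λ] X} (hsub : ∀ i, ∃ a : M i →ₗ[Λ] Π₀ i, M i,
      SupportedIn B a ∧ FactorsNonsplit (φ i - π ∘ₗ a))
    (hφ : ∀ (D : Type u) [AddCommGroup D] [Module Λ D], IsCM Λ D → IsIndecomposableModule Λ D →
      ¬ Module.Projective Λ D → ∀ f : D →ₗ[Λ] X, ∃ (i : ι) (e : D ≃ₗ[Λ] M i),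
        ∀ x, φ i (e x) = f x)
    (hU : IsCM Λ U) (f : U →ₗ[Λ] X) : LiftsTo π B f := by
  have := h.isNoetherianRing
  have := hU.1
  obtain ⟨κ, _, E, j, q, hE, hqj, hjq⟩ := exists_indecomposable_family (Λ := Λ) U
  have hsum : f = ∑ s, ((f ∘ₗ j s) ∘ₗ LinearMap.id) ∘ₗ q s := by
    ext x
    rw [LinearMap.sum_apply]
    change f x = ∑ s, f (j s (q s x))
    rw [← map_sum, hjq]
  rw [hsum]
  have hCMs := fun s => hU.of_isRetract ⟨j s, q s, hqj s⟩
  exact .sum _ fun s _ => (h.liftsTo_comp hT hsub hφ (hCMs s) (hE s) (hCMs s) (hE s) _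
    _).comp_right (q s)

end Surjective

section Kernel

variable {R : Type u} [CommRing R] [IsNoetherianRing R] [IsLocalRing R]
  [IsAdicComplete (IsLocalRing.maximalIdeal R) R] {Λ : Type u} [Ring Λ] [Algebra R Λ]
  {X : Type w} [AddCommGroup X] [Module Λ X]
  {ι : Type w₁} {M : ι → Type u} [∀ i, AddCommGroup (M i)] [∀ i, Module Λ (M i)]

theorem FactorsProj.of_finsupp {U : Type u} [AddCommGroup U] [Module Λ U] [Module.Finite Λ U]
    (a : U →ₗ[Λ] ι →₀ Λ) : FactorsProj a := by
  classical
  obtain ⟨m, b, j, p, -, -, -, hjp⟩ :=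
    exists_factor_finite (M := fun _ : ι => Λ) ((finsuppLequivDFinsupp Λ).toLinearMap ∘ₗ a)
  refine ⟨m, p ∘ₗ (finsuppLequivDFinsupp Λ).toLinearMap ∘ₗ a,
    (finsuppLequivDFinsupp Λ).symm.toLinearMap ∘ₗ j, fun x => ?_⟩
  refine (congrArg (finsuppLequivDFinsupp Λ).symm (hjp x)).trans ?_
  exact (finsuppLequivDFinsupp Λ).symm_apply_apply _

/-- The elements of a direct sum supported in `B`. -/
def supportedSubmodule (Λ : Type u) [Ring Λ] (M : ι → Type u) [∀ i, AddCommGroup (M i)]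
    [∀ i, Module Λ (M i)] (B : Set ι) : Submodule Λ (Π₀ i, M i) where
  carrier := {m | ∀ i ∉ B, m i = 0}
  add_mem' := fun ha hb i hi => by rw [DFinsupp.add_apply, ha i hi, hb i hi, add_zero]
  zero_mem' := fun i _ => rfl
  smul_mem' := fun r m hm i hi => by rw [DFinsupp.smul_apply, hm i hi, smul_zero]

theorem exists_projection_supportedSubmodule (B : Set ι) :
    ∃ q : (Π₀ i, M i) →ₗ[Λ] supportedSubmodule Λ M B, ∀ x, q x.1 = x := by
  classical
  refine ⟨(DFinsupp.filterLinearMap Λ M (· ∈ B)).codRestrict _ fun x i hi =>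
    DFinsupp.filter_apply_neg _ hi, fun x => Subtype.ext (DFinsupp.ext fun i => ?_)⟩
  change DFinsupp.filter (· ∈ B) x.1 i = x.1 i
  by_cases hi : i ∈ B
  · exact DFinsupp.filter_apply_pos _ hi
  · rw [DFinsupp.filter_apply_neg _ hi, x.2 i hi]

omit [IsLocalRing R] [IsAdicComplete (IsLocalRing.maximalIdeal R) R] in
/-- The submodule supported in `B` together with a free module maps onto `X`, with kernel
right orthogonal to all Cohen–Macaulay modules. -/
theorem IsGorensteinOrder.ext1Z_ker (h : IsGorensteinOrder R Λ)
    {π : (Π₀ i, M i) →ₗ[Λ] X} {B : Set ι}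
    (hI : ∀ (U : Type u) [AddCommGroup U] [Module Λ U], IsCM Λ U → ∀ w : U →ₗ[Λ] Π₀ i, M i,
      SupportedIn B w → FactorsProj (π ∘ₗ w) → FactorsProj w)
    (hS : ∀ (U : Type u) [AddCommGroup U] [Module Λ U], IsCM Λ U → ∀ f : U →ₗ[Λ] X,
      LiftsTo π B f)
    {π' : (supportedSubmodule Λ M B × (X →₀ Λ)) →ₗ[Λ] X}
    (hπ' : ∀ z, π' z = π z.1.1 + Finsupp.linearCombination Λ id z.2)
    {U : Type u} [AddCommGroup U] [Module Λ U] (hU : IsCM Λ U) :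
    Ext1Z Λ U (LinearMap.ker π') := by
  have := h.isNoetherianRing
  have := hU.1
  obtain ⟨m, q, hq⟩ := Module.Finite.exists_fin' Λ U
  have hK : IsCM Λ (LinearMap.ker q) := IsCM.of_projective.syzygy (B := Fin m → Λ) hU
    (f := (LinearMap.ker q).subtype) Subtype.val_injective (LinearMap.exact_subtype_ker_map q) hq
  have := hK.1
  obtain ⟨pr, hpr⟩ := exists_projection_supportedSubmodule (Λ := Λ) (M := M) B
  refine Ext1Z.of_presentation (K := LinearMap.ker q) (F := Fin m → Λ) Ext1Z.of_projective
    (f := (LinearMap.ker q).subtype) (LinearMap.exact_subtype_ker_map q) hq fun φ => ?_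
  obtain ⟨w, hw⟩ : ∃ w : LinearMap.ker q →ₗ[Λ] Π₀ i, M i, ∀ x, w x = (φ x).1.1.1 :=
    ⟨(supportedSubmodule Λ M B).subtype ∘ₗ LinearMap.fst Λ _ _ ∘ₗ
      (LinearMap.ker π').subtype ∘ₗ φ, fun _ => rfl⟩
  obtain ⟨c, hc⟩ : ∃ c : LinearMap.ker q →ₗ[Λ] X →₀ Λ, ∀ x, c x = (φ x).1.2 :=
    ⟨LinearMap.snd Λ _ _ ∘ₗ (LinearMap.ker π').subtype ∘ₗ φ, fun _ => rfl⟩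
  have hcP : FactorsProj c := .of_finsupp c
  have hwP : FactorsProj w := by
    refine hI _ hK w (fun x => hw x ▸ (φ x).1.1.2) ?_
    refine (hcP.comp_left (-Finsupp.linearCombination Λ (id : X → X))).congr fun x => ?_
    have := (hπ' _).symm.trans (φ x).2
    change -(Finsupp.linearCombination Λ id (c x)) = π (w x)
    rw [hc, hw]
    exact (eq_neg_of_add_eq_zero_left this).symm
  obtain ⟨l, α, β, hαβ⟩ : FactorsProj ((LinearMap.ker π').subtype ∘ₗ φ) := by
    refine (((hwP.comp_left pr).comp_left (LinearMap.inl Λ _ (X →₀ Λ))).add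
      (hcP.comp_left (LinearMap.inr Λ (supportedSubmodule Λ M B) _))).congr fun x => ?_
    change (pr (w x), 0) + (0, c x) = (φ x).1
    rw [hw, hpr, hc, Prod.mk_add_mk, add_zero, zero_add]
  obtain ⟨α', hα'⟩ := (hU.ext1Z_of_projective (N := Fin l → Λ)).extend (K := LinearMap.ker q)
    (F := Fin m → Λ) (f := (LinearMap.ker q).subtype) Subtype.val_injective
    (LinearMap.exact_subtype_ker_map q) hq α
  obtain ⟨f, hf⟩ := exists_desc q hq (π' ∘ₗ β ∘ₗ α') fun x hx => by
    have := hα' ⟨x, hx⟩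
    change α' x = _ at this
    change π' (β (α' x)) = 0
    rw [this, hαβ]
    exact (φ ⟨x, hx⟩).2
  obtain ⟨a, ha, l', γ, δ, hγδ⟩ := hS U hU f
  obtain ⟨δ', hδ'⟩ := Module.projective_lifting_property π' δ fun x => by
    refine ⟨(0, Finsupp.single x 1), ?_⟩
    rw [hπ']
    simp
  obtain ⟨θ, hθ⟩ : ∃ θ : U →ₗ[Λ] supportedSubmodule Λ M B × (X →₀ Λ), ∀ x, π' (θ x) = f x := by
    refine ⟨LinearMap.inl Λ _ _ ∘ₗ a.codRestrict (supportedSubmodule Λ M B) ha + δ' ∘ₗ γ,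
      fun x => ?_⟩
    rw [LinearMap.add_apply, map_add]
    refine (congrArg₂ (· + ·) (hπ' _) (LinearMap.congr_fun hδ' (γ x))).trans ?_
    change π (a x) + Finsupp.linearCombination Λ id 0 + δ (γ x) = f x
    rw [hγδ, map_zero, add_zero, LinearMap.sub_apply, LinearMap.comp_apply, add_sub_cancel]
  refine ⟨(β ∘ₗ α' - θ ∘ₗ q).codRestrict (LinearMap.ker π') fun x => ?_, fun x => Subtype.ext ?_⟩
  · rw [LinearMap.mem_ker, LinearMap.sub_apply, map_sub]
    exact sub_eq_zero.2 ((hf x).symm.trans (hθ (q x)).symm)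
  · change β (α' x.1) - θ (q x.1) = (φ x).1
    rw [show q x.1 = 0 from x.2, map_zero, sub_zero]
    exact (congrArg β (hα' x)).trans (hαβ x)

end Kernel

section Injective

variable {Λ : Type u} [Ring Λ]

theorem Ext1Z.of_baer {I : Type w} [AddCommGroup I] [Module Λ I] (hI : Module.Baer Λ I)
    {L : Type w₁} [AddCommGroup L] [Module Λ L] : Ext1Z Λ L I := fun φ => by
  obtain ⟨ψ, hψ⟩ := hI.extension_property
    (M := LinearMap.ker (Finsupp.linearCombination Λ (id : L → L))) (N := L →₀ Λ)
    (Submodule.subtype _) Subtype.val_injective φ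
  exact ⟨ψ, fun x => LinearMap.congr_fun hψ x⟩

theorem baer_of_ext1Z {Z : Type w} [AddCommGroup Z] [Module Λ Z]
    (h : ∀ I : Submodule Λ Λ, Ext1Z Λ (Λ ⧸ I) Z) : Module.Baer Λ Z := fun I g => by
  obtain ⟨g', hg⟩ := (h I).extend (K := I) (F := Λ) (f := Submodule.subtype I) (g := I.mkQ)
    Subtype.val_injective (LinearMap.exact_subtype_mkQ I) (Submodule.mkQ_surjective I) g
  exact ⟨g', fun x hx => hg ⟨x, hx⟩⟩

theorem exists_baer_embedding (Z : Type (max u v)) [AddCommGroup Z] [Module Λ Z] :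
    ∃ (I : ModuleCat.{max u v} Λ) (f : Z →ₗ[Λ] I), Module.Baer Λ I ∧ Function.Injective f := by
  let J := Injective.under (ModuleCat.of Λ Z)
  refine ⟨J, (Injective.ι (ModuleCat.of Λ Z)).hom, ?_, ?_⟩
  · have : Injective (ModuleCat.of Λ J) := inferInstanceAs (Injective J)
    exact Module.Baer.iff_injective.2 ((Module.injective_iff_injective_object Λ J).2 this)
  · exact (ModuleCat.mono_iff_injective _).1 inferInstance

/-- Vanishing of `Ext¹` into `Z` for finite modules `L` with `Ext^{i+1}(L, Λ) = 0` for `i ≥ k`. -/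
def VanishesFrom (Λ : Type u) [Ring Λ] (k : ℕ) (Z : Type w) [AddCommGroup Z] [Module Λ Z] :
    Prop :=
  ∀ (L : Type u) [AddCommGroup L] [Module Λ L], Module.Finite Λ L →
    (∀ i, k ≤ i → ExtZ Λ (i + 1) L Λ) → Ext1Z Λ L Z

variable {Z : Type w} {I : Type w₁} {Z' : Type w₂} [AddCommGroup Z] [Module Λ Z] [AddCommGroup I]
  [Module Λ I] [AddCommGroup Z'] [Module Λ Z'] {f : Z →ₗ[Λ] I} {g : I →ₗ[Λ] Z'}

theorem VanishesFrom.succ [IsNoetherianRing Λ] {k : ℕ} (h : VanishesFrom Λ k Z)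
    (hI : Module.Baer Λ I) (hf : Function.Injective f) (hfg : Function.Exact f g)
    (hg : Function.Surjective g) : VanishesFrom Λ (k + 1) Z' := fun L _ _ _ hL => by
  obtain ⟨m, q, hq⟩ := Module.Finite.exists_fin' Λ L
  have hK : Ext1Z Λ (LinearMap.ker q) Z := h (LinearMap.ker q) inferInstance fun i hi =>
    ExtZ.left (B := Fin m → Λ) (f := (LinearMap.ker q).subtype) Subtype.val_injective
      (LinearMap.exact_subtype_ker_map q) hq ExtZ.of_projective (hL (i + 1) (Nat.succ_le_succ hi))
  refine Ext1Z.of_presentation (K := LinearMap.ker q) (F := Fin m → Λ) Ext1Z.of_projective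
    (f := (LinearMap.ker q).subtype) (LinearMap.exact_subtype_ker_map q) hq fun φ => ?_
  obtain ⟨φ', hφ'⟩ := hK.lift hf hfg hg φ
  obtain ⟨ψ, hψ⟩ := (Ext1Z.of_baer hI (L := L)).extend (K := LinearMap.ker q) (F := Fin m → Λ)
    (f := (LinearMap.ker q).subtype) Subtype.val_injective (LinearMap.exact_subtype_ker_map q) hq φ'
  exact ⟨g ∘ₗ ψ, fun x => (congrArg g (hψ x)).trans (hφ' x)⟩

theorem Ext1Z.of_lift {X : Type w₃} [AddCommGroup X] [Module Λ X] (hI : Ext1Z Λ X I)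
    (hf : Function.Injective f) (hfg : Function.Exact f g)
    (hX : ∀ φ : X →ₗ[Λ] Z', ∃ ψ : X →ₗ[Λ] I, ∀ x, g (ψ x) = φ x) : Ext1Z Λ X Z := fun φ => by
  obtain ⟨ψ, hψ⟩ := hI (f ∘ₗ φ)
  have hq := linearCombination_id_surjective (Λ := Λ) (M := X)
  obtain ⟨q, hqe⟩ : ∃ q, q = Finsupp.linearCombination Λ (id : X → X) := ⟨_, rfl⟩
  rw [← hqe] at hq
  obtain ⟨c, hc⟩ := exists_desc q hq (g ∘ₗ ψ) fun x hx => by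
    have hx' : x ∈ LinearMap.ker (Finsupp.linearCombination Λ (id : X → X)) := by
      rw [← hqe]; exact hx
    exact (congrArg g (hψ ⟨x, hx'⟩)).trans ((hfg _).2 ⟨_, rfl⟩)
  obtain ⟨θ, hθ⟩ := hX c
  obtain ⟨χ, hχ⟩ := exists_codlift f hf (ψ - θ ∘ₗ q) fun x => (hfg _).1 <| by
    rw [LinearMap.sub_apply, map_sub]
    exact sub_eq_zero.2 ((hc x).symm.trans (hθ (q x)).symm)
  refine ⟨χ, fun x => hf ?_⟩
  have hx : q x.1 = 0 := by rw [hqe]; exact x.2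
  rw [hχ, LinearMap.sub_apply, LinearMap.comp_apply, hx, map_zero, sub_zero, hψ]
  rfl

/-- A module with a long enough projective coresolution has no extensions by modules which are
eventually injective. -/
theorem ext1Z_of_coresolution [IsNoetherianRing Λ] (k n : ℕ)
    (hΛ : ∀ (L : Type u) [AddCommGroup L] [Module Λ L], Module.Finite Λ L →
      ∀ i, k + n ≤ i → ExtZ Λ (i + 1) L Λ)
    {Z : Type (max u v)} [AddCommGroup Z] [Module Λ Z] (hZ : VanishesFrom Λ k Z)
    (X P : ℕ → ModuleCat.{w} Λ) (hP : ∀ i, Module.Projective Λ (P i))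
    (a : ∀ i, X i →ₗ[Λ] P i) (b : ∀ i, P i →ₗ[Λ] X (i + 1)) (ha : ∀ i, Function.Injective (a i))
    (hab : ∀ i, Function.Exact (a i) (b i)) (hb : ∀ i, Function.Surjective (b i)) :
    Ext1Z Λ (X 0) Z := by
  induction n generalizing k Z X P with
  | zero =>
    exact .of_baer (baer_of_ext1Z fun I => hZ _ inferInstance fun i hi =>
      hΛ (Λ ⧸ I) inferInstance i hi)
  | succ n ih =>
    obtain ⟨I, f, hI, hf⟩ := exists_baer_embedding.{v} (Λ := Λ) Z
    have hfg := LinearMap.exact_map_mkQ_range f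
    have hg := Submodule.mkQ_surjective (LinearMap.range f)
    have h1 : Ext1Z Λ (X 1) (I ⧸ LinearMap.range f) := ih (k + 1) (fun L _ _ hL i hi =>
      hΛ L hL i (by omega)) (hZ.succ hI hf hfg hg) (fun i => X (i + 1)) (fun i => P (i + 1))
      (fun i => hP _) (fun i => a _) (fun i => b _) (fun i => ha _) (fun i => hab _) fun i => hb _
    refine Ext1Z.of_lift (.of_baer hI) hf hfg fun φ => ?_
    obtain ⟨φ', hφ'⟩ := h1.extend (ha 0) (hab 0) (hb 0) φ
    have := hP 0
    obtain ⟨ψ, hψ⟩ := Module.projective_lifting_property (LinearMap.range f).mkQ φ' hg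
    exact ⟨ψ ∘ₗ a 0, fun x => (LinearMap.congr_fun hψ _).trans (hφ' x)⟩

end Injective

section Chain

variable {Λ : Type u} [Ring Λ]

theorem exists_coresolution {M : ModuleCat.{max u v} Λ} (h : IsGorensteinProjective.{v} M) :
    ∃ (X P : ℕ → ModuleCat.{max u v} Λ) (a : ∀ i, X i →ₗ[Λ] P i)
      (b : ∀ i, P i →ₗ[Λ] X (i + 1)), (∀ i, Module.Projective Λ (P i)) ∧
      (∀ i, Function.Injective (a i)) ∧ (∀ i, Function.Exact (a i) (b i)) ∧
      (∀ i, Function.Surjective (b i)) ∧ Nonempty (M ≃ₗ[Λ] X 0) := by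
  obtain ⟨C, hP, hC, -, ⟨i⟩⟩ := h
  have hd (k : ℕ) (x : C.X k) : (C.d k (k + 1 : ℕ)).hom x ∈
      LinearMap.ker (C.d (k + 1 : ℕ) (k + 1 + 1 : ℕ)).hom := by
    rw [LinearMap.mem_ker, ← LinearMap.comp_apply, ← ModuleCat.hom_comp, C.d_comp_d]
    rfl
  refine ⟨fun k => ModuleCat.of Λ (LinearMap.ker (C.d k (k + 1 : ℕ)).hom), fun k => C.X k,
    fun k => Submodule.subtype _, fun k => LinearMap.codRestrict _ (C.d k (k + 1 : ℕ)).hom (hd k),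
    fun k => (IsProjective.iff_projective _).2 (hP k), fun k => Subtype.val_injective,
    fun k x => ⟨fun hx => ⟨⟨x, congrArg Subtype.val hx⟩, rfl⟩, ?_⟩, fun k y => ?_,
    ⟨(i.trans (ModuleCat.kernelIsoKer (C.d 0 1))).toLinearEquiv⟩⟩
  · rintro ⟨y, rfl⟩
    exact Subtype.ext y.2
  · have hex := (C.exactAt_iff' (k : ℤ) (k + 1 : ℕ) (k + 1 + 1 : ℕ)
      ((ComplexShape.up ℤ).prev_eq' (by simp)) ((ComplexShape.up ℤ).next_eq' (by simp))).1 (hC _)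
    obtain ⟨x, hx⟩ := (ShortComplex.moduleCat_exact_iff _).1 hex y.1 y.2
    exact ⟨x, Subtype.ext hx⟩

end Chain

section Decompose

variable {R : Type u} [CommRing R] [IsNoetherianRing R] [IsLocalRing R]
  [IsAdicComplete (IsLocalRing.maximalIdeal R) R] {Λ : Type u} [Ring Λ] [Algebra R Λ]

theorem isRetract_prod_dfinsupp {ι : Type w₁} {κ : Type w₂} (M : ι → ModuleCat.{u} Λ)
    (N : κ → ModuleCat.{u} Λ) :
    IsRetract Λ ((Π₀ i, M i) × (Π₀ k, N k)) (Π₀ s : ι ⊕ κ, (Sum.elim M N s : ModuleCat Λ)) := by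
  classical
  let S : ι ⊕ κ → ModuleCat.{u} Λ := Sum.elim M N
  let p (s : ι ⊕ κ) : S s →ₗ[Λ] (Π₀ i, M i) × (Π₀ k, N k) :=
    match s with
    | .inl i => LinearMap.inl Λ _ _ ∘ₗ DFinsupp.lsingle (R := Λ) (M := fun i => M i) i
    | .inr k => LinearMap.inr Λ _ _ ∘ₗ DFinsupp.lsingle (R := Λ) (M := fun k => N k) k
  obtain ⟨q, hq⟩ : ∃ q : (Π₀ s, S s) →ₗ[Λ] (Π₀ i, M i) × (Π₀ k, N k), ∀ s (x : S s),
      q (DFinsupp.single s x) = p s x :=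
    ⟨DFinsupp.lsum ℕ p, fun s x => DFinsupp.lsum_single _ _ _ _⟩
  obtain ⟨f, hf⟩ : ∃ f : (Π₀ i, M i) →ₗ[Λ] Π₀ s, S s, ∀ i (x : M i),
      f (DFinsupp.single i x) = DFinsupp.single (.inl i) x :=
    ⟨DFinsupp.lsum ℕ fun i => DFinsupp.lsingle (R := Λ) (M := fun s => S s) (.inl i),
      fun i x => DFinsupp.lsum_single _ _ _ _⟩
  obtain ⟨g, hg⟩ : ∃ g : (Π₀ k, N k) →ₗ[Λ] Π₀ s, S s, ∀ k (x : N k),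
      g (DFinsupp.single k x) = DFinsupp.single (.inr k) x :=
    ⟨DFinsupp.lsum ℕ fun k => DFinsupp.lsingle (R := Λ) (M := fun s => S s) (.inr k),
      fun k x => DFinsupp.lsum_single _ _ _ _⟩
  have h1 : q ∘ₗ f = LinearMap.inl Λ _ _ := DFinsupp.lhom_ext' fun i => LinearMap.ext fun x =>
    (congrArg q (hf i x)).trans (hq _ _)
  have h2 : q ∘ₗ g = LinearMap.inr Λ _ _ := DFinsupp.lhom_ext' fun k => LinearMap.ext fun x =>
    (congrArg q (hg k x)).trans (hq _ _)
  refine ⟨f.coprod g, q, fun x => ?_⟩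
  rw [LinearMap.coprod_apply, map_add]
  refine (congrArg₂ (· + ·) (LinearMap.congr_fun h1 x.1) (LinearMap.congr_fun h2 x.2)).trans ?_
  simp

theorem IsRetract.prodMap {X : Type w₁} {Y : Type w₂} {X' : Type w₃} {Y' : Type w₄}
    [AddCommGroup X] [AddCommGroup Y] [AddCommGroup X'] [AddCommGroup Y'] [Module Λ X]
    [Module Λ Y] [Module Λ X'] [Module Λ Y'] (h : IsRetract Λ X Y) (h' : IsRetract Λ X' Y') :
    IsRetract Λ (X × X') (Y × Y') := by
  obtain ⟨i, p, hp⟩ := h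
  obtain ⟨i', p', hp'⟩ := h'
  exact ⟨i.prodMap i', p.prodMap p', fun x => Prod.ext (hp _) (hp' _)⟩

/-- Finite Cohen–Macaulay representation type makes Gorenstein projective modules direct summands
of direct sums of Cohen–Macaulay modules. -/
theorem IsGorensteinOrder.exists_isRetract_dfinsupp (h : IsGorensteinOrder R Λ) {n : ℕ}
    (rep : Fin n → ModuleCat.{u} Λ)
    (hrep : ∀ (N : Type u) [AddCommGroup N] [Module Λ N], IsCM Λ N → IsIndecomposableModule Λ N →
      ∃ j, Nonempty (N ≃ₗ[Λ] rep j)) {X : ModuleCat.{max u v} Λ}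
    (hX : IsGorensteinProjective.{v} X) :
    ∃ (κ : Type (max u v)) (N : κ → ModuleCat.{u} Λ), (∀ k, IsCM Λ (N k)) ∧
      IsRetract Λ X (Π₀ k, N k) := by
  classical
  have := h.finite
  have := h.isNoetherianRing
  have hself : IsCM Λ Λ := have := Module.Finite.self Λ; IsCM.of_projective
  let J := {j : Fin n // IsCM Λ (rep j) ∧ IsIndecomposableModule Λ (rep j)}
  have hJ (D : Type u) [AddCommGroup D] [Module Λ D] (hD : IsCM Λ D)
      (hD' : IsIndecomposableModule Λ D) : ∃ j : J, Nonempty (D ≃ₗ[Λ] rep j.1) := by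
    obtain ⟨j, ⟨e⟩⟩ := hrep D hD hD'
    have := hD.1
    exact ⟨⟨j, hD.congr e, isIndecomposableModule_congr R e hD'⟩, ⟨e⟩⟩
  have := fun j : J => j.2.1.1
  have hT (D : Type u) [AddCommGroup D] [Module Λ D] (hD : IsCM Λ D)
      (hD' : IsIndecomposableModule Λ D) : IsRetract Λ D (∀ j : J, rep j.1) := by
    obtain ⟨j, ⟨e⟩⟩ := hJ D hD hD'
    exact (IsRetract.of_equiv e).trans ⟨LinearMap.single Λ (fun j : J => rep j.1) j,
      LinearMap.proj j, fun x => Pi.single_eq_same _ _⟩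
  let ι := Σ j : J, rep j.1 →ₗ[Λ] X
  let M : ι → ModuleCat.{u} Λ := fun i => rep i.1.1
  let φ (i : ι) : M i →ₗ[Λ] X := i.2
  have hind (i : ι) : IsIndecomposableModule Λ (M i) := i.1.2.2
  have hCM (i : ι) : IsCM Λ (M i) := i.1.2.1
  have := fun i => (hCM i).1
  have := fun i => (hind i).1
  have hloc (i : ι) : IsLocalRing (Module.End Λ (M i)) := isLocalRing_end R (hind i)
  have hφ (D : Type u) [AddCommGroup D] [Module Λ D] (hD : IsCM Λ D)
      (hD' : IsIndecomposableModule Λ D) (_ : ¬ Module.Projective Λ D) (f : D →ₗ[Λ] X) :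
      ∃ (i : ι) (e : D ≃ₗ[Λ] M i), ∀ x, φ i (e x) = f x := by
    obtain ⟨j, ⟨e⟩⟩ := hJ D hD hD'
    exact ⟨⟨j, f ∘ₗ e.symm⟩, e, fun x => congrArg f (e.symm_apply_apply x)⟩
  obtain ⟨π, hπ⟩ : ∃ π : (Π₀ i, M i) →ₗ[Λ] X, ∀ i (x : M i),
      π (DFinsupp.lsingle (R := Λ) (M := fun i => M i) i x) = φ i x :=
    ⟨DFinsupp.lsum ℕ φ, fun i x => DFinsupp.lsum_single _ _ _ _⟩
  obtain ⟨B, hB⟩ := exists_maximal_independent π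
  obtain ⟨π', hπ'⟩ : ∃ π' : (supportedSubmodule Λ (fun i => M i) B × (X →₀ Λ)) →ₗ[Λ] X,
      ∀ z, π' z = π z.1.1 + Finsupp.linearCombination Λ id z.2 :=
    ⟨(π ∘ₗ Submodule.subtype _).coprod (Finsupp.linearCombination Λ id), fun _ => rfl⟩
  have hZ (U : Type u) [AddCommGroup U] [Module Λ U] (hU : IsCM Λ U) :
      Ext1Z Λ U (LinearMap.ker π') :=
    h.ext1Z_ker (fun U _ _ hU w hw => h.factorsProj_of_comp hind hCM hB.1 hU hw)
      (fun U _ _ hU f => h.liftsTo hT (exists_supported_sub hind hloc hCM hB hπ) hφ hU f) hπ' hU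
  obtain ⟨m, hm⟩ := h.injDim
  obtain ⟨Y, P, a, b, hP, ha, hab, hb, ⟨e⟩⟩ := exists_coresolution hX
  have hYZ : Ext1Z Λ (Y 0) (LinearMap.ker π') := ext1Z_of_coresolution.{v} 0 m
    (fun L _ _ hL i hi => h.ext_of_injDim hm L hL (by omega))
    (fun L _ _ hL hL' => hZ L ⟨hL, fun i => hL' i (Nat.zero_le i)⟩) Y P hP a b ha hab hb
  obtain ⟨σ, hσ⟩ := (hYZ.congr e.symm).lift (f := (LinearMap.ker π').subtype) Subtype.val_injective
    (LinearMap.exact_subtype_ker_map π') (fun x => ⟨(0, Finsupp.single x 1), by simp [hπ']⟩)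
    LinearMap.id
  obtain ⟨q, hq⟩ := exists_projection_supportedSubmodule (Λ := Λ) (M := fun i => M i) B
  refine ⟨ι ⊕ X, Sum.elim M fun _ => ModuleCat.of Λ Λ, ?_, ?_⟩
  · rintro (i | x)
    · exact hCM i
    · exact hself
  · refine IsRetract.trans ⟨σ, π', hσ⟩ (.trans (.prodMap ⟨Submodule.subtype _, q, hq⟩ ?_)
      (isRetract_prod_dfinsupp _ _))
    exact .of_equiv (finsuppLequivDFinsupp Λ)

end Decompose

section Summand

variable {R : Type u} [CommRing R] [IsNoetherianRing R] [IsLocalRing R]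
  [IsAdicComplete (IsLocalRing.maximalIdeal R) R] {Λ : Type u} [Ring Λ] [Algebra R Λ]

open Classical in
theorem isRetract_of_isInternal {X : Type w} [AddCommGroup X] [Module Λ X] {ι : Type w₁}
    {P : ι → Submodule Λ X} (hP : DirectSum.IsInternal P) (i : ι) : IsRetract Λ (P i) X := by
  let e := LinearEquiv.ofBijective (DirectSum.coeLinearMap P) hP
  refine ⟨(P i).subtype, DirectSum.component Λ ι (fun i => P i) i ∘ₗ e.symm, fun x => ?_⟩
  have hx : e.symm ((P i).subtype x) = DirectSum.lof Λ ι (fun i => P i) i x := by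
    rw [LinearEquiv.symm_apply_eq]
    exact (DirectSum.coeLinearMap_lof P i x).symm
  refine (congrArg (DirectSum.component Λ ι (fun i => P i) i) hx).trans ?_
  rw [DirectSum.component.lof_self]

open Classical in
/-- Direct summands of direct sums of finitely generated modules over a finite algebra over a
complete local ring are direct sums of finitely generated submodules. -/
theorem exists_decomposition_of_isRetract [Module.Finite R Λ] {X : Type (max u v)}
    [AddCommGroup X] [Module Λ X] {κ : Type (max u v)} {N : κ → ModuleCat.{u} Λ}
    (hN : ∀ k, Module.Finite Λ (N k)) (h : IsRetract Λ X (Π₀ k, N k)) :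
    ∃ (ι : Type (max u v)) (P : ι → Submodule Λ X), DirectSum.IsInternal P ∧ ∀ i, (P i).FG := by
  have : IsNoetherianRing Λ := isNoetherian_of_tower R inferInstance
  let L (k : κ) := ULift.{v} (N k)
  have (k : κ) : Module.Finite Λ (L k) := Module.Finite.equiv ULift.moduleEquiv.symm
  obtain ⟨i, p, hp⟩ : IsRetract Λ X (Π₀ k, L k) :=
    h.trans (.of_equiv (DFinsupp.mapRange.linearEquiv fun k => ULift.moduleEquiv.symm))
  have hi : Function.Injective i := Function.LeftInverse.injective hp
  have hc : IsCompl (LinearMap.range i) (LinearMap.ker p) := by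
    refine isCompl_of_forall ?_ fun m => ⟨i (p m), ⟨_, rfl⟩, m - i (p m), ?_, by abel⟩
    · rintro _ ⟨x, rfl⟩ hx
      rw [← hp x, show p (i x) = 0 from hx, map_zero]
    · rw [LinearMap.mem_ker, map_sub, hp, sub_self]
  obtain ⟨𝒴, hfg, hind, hsup⟩ := isFGSum_of_isCompl
    (fun L _ _ _ => exchange_of_finite (R := R) L) hc
  have hmap (Y : 𝒴) : (Y.1.comap i).map i = Y.1 := by
    rw [Submodule.map_comap_eq, inf_eq_right, ← hsup]
    exact le_sSup Y.2
  have hint {ι : Type (max u v)} {P : ι → Submodule Λ X} (h1 : iSupIndep P) (h2 : iSup P = ⊤) :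
      DirectSum.IsInternal P := DirectSum.isInternal_submodule_of_iSupIndep_of_iSup_eq_top h1 h2
  refine ⟨𝒴, fun Y => Y.1.comap i, hint ?_ ?_,
    fun Y => Submodule.fg_of_fg_map_injective i hi ((hmap Y).symm ▸ hfg _ Y.2)⟩
  · intro Y
    have hY := (sSupIndep_iff _).1 hind Y
    refine Submodule.disjoint_def.2 fun x hx hx' => hi ?_
    rw [map_zero]
    refine Submodule.disjoint_def.1 hY _ hx ?_
    have := Submodule.mem_map_of_mem (f := i) hx'
    simpa only [Submodule.map_iSup, hmap] using this
  · refine eq_top_iff.2 fun x _ => ?_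
    have hx : i x ∈ (⨆ Y : 𝒴, Y.1.comap i).map i := by
      rw [Submodule.map_iSup]
      simp only [hmap]
      rw [← sSup_eq_iSup', hsup]
      exact ⟨x, rfl⟩
    obtain ⟨y, hy, hyx⟩ := hx
    exact hi hyx ▸ hy

theorem exists_small_equiv (X : Type w) [AddCommGroup X] [Module Λ X] [Module.Finite Λ X] :
    ∃ U : ModuleCat.{u} Λ, Nonempty (U ≃ₗ[Λ] X) := by
  obtain ⟨n, q, hq⟩ := Module.Finite.exists_fin' Λ X
  exact ⟨ModuleCat.of Λ ((Fin n → Λ) ⧸ LinearMap.ker q), ⟨q.quotKerEquivOfSurjective hq⟩⟩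

theorem IsCM.of_isRetract_dfinsupp {U : Type u} [AddCommGroup U] [Module Λ U] [Module.Finite Λ U]
    {κ : Type w₁} {N : κ → ModuleCat.{u} Λ} (hN : ∀ k, IsCM Λ (N k))
    (h : IsRetract Λ U (Π₀ k, N k)) : IsCM Λ U := by
  obtain ⟨i, p, hp⟩ := h
  obtain ⟨m, b, j, q, -, -, -, hjq⟩ := exists_factor_finite i
  exact (IsCM.pi fun k => hN (b k)).of_isRetract ⟨q ∘ₗ i, p ∘ₗ j, fun x =>
    (congrArg p (hjq x)).trans (hp x)⟩

open Classical in
/-- Over a Gorenstein order of finite Cohen–Macaulay representation type, Gorenstein projective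
modules decompose into finitely generated Gorenstein projective modules. -/
theorem IsGorensteinOrder.exists_decomposition (h : IsGorensteinOrder R Λ) {n : ℕ}
    (rep : Fin n → ModuleCat.{u} Λ)
    (hrep : ∀ (N : Type u) [AddCommGroup N] [Module Λ N], IsCM Λ N → IsIndecomposableModule Λ N →
      ∃ j, Nonempty (N ≃ₗ[Λ] rep j)) {X : ModuleCat.{max u v} Λ}
    (hX : IsGorensteinProjective.{v} X) :
    ∃ (ι : Type (max u v)) (P : ι → Submodule Λ X), DirectSum.IsInternal P ∧
      ∀ i, (P i).FG ∧ IsGorensteinProjective.{v} (ModuleCat.of Λ (P i)) := by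
  have := h.finite
  have := h.isNoetherianRing
  obtain ⟨κ, N, hN, hret⟩ := h.exists_isRetract_dfinsupp rep hrep hX
  obtain ⟨ι, P, hP, hfg⟩ := exists_decomposition_of_isRetract.{v} (R := R) (fun k => (hN k).1) hret
  refine ⟨ι, P, hP, fun i => ⟨hfg i, ?_⟩⟩
  have : Module.Finite Λ (P i) := Module.Finite.iff_fg.2 (hfg i)
  obtain ⟨U, ⟨e⟩⟩ := exists_small_equiv (Λ := Λ) (P i)
  have : Module.Finite Λ U := Module.Finite.equiv e.symm
  have hU : IsCM Λ U := .of_isRetract_dfinsupp hN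
    ((IsRetract.of_equiv e).trans ((isRetract_of_isInternal hP i).trans hret))
  exact hU.isCMExt.isGorensteinProjective.{v} (fun N _ _ hN => h.exists_cosyzygy hN)
    (M := ModuleCat.of Λ (P i)) e

end Summand

section Bridge

variable (R : Type u) [CommRing R] [IsNoetherianRing R] (A : Type u) [Ring A] [Algebra R A]

/-- The right module structure on the dual of an algebra. -/
abbrev dualModule : Module Aᵐᵒᵖ (A →ₗ[R] R) := inferInstanceAs (Module Aᵈᵐᵃ (A →ₗ[R] R))

theorem isGorensteinOrder_op [Module.Finite R A] (hR : ∃ n, hasInjDimLE R n (ModuleCat.of R R))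
    (hA : ∀ i : ℕ, 0 < i → Subsingleton (extGrp R i (ModuleCat.of R A) (ModuleCat.of R R)))
    (hd : Module.Projective Aᵈᵐᵃ (A →ₗ[R] R)) : IsGorensteinOrder R Aᵐᵒᵖ where
  finite := inferInstance
  mcm := IsMCM.congr (A := A) ⟨inferInstance, fun i => (extGrp_iff i.succ_pos _ _).1
    (hA _ i.succ_pos)⟩ (MulOpposite.opLinearEquiv R)
  injDim := by
    obtain ⟨n, hn⟩ := hR
    exact ⟨n, fun L _ _ _ i hi => (extGrp_iff i.succ_pos (ModuleCat.of R L) _).1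
      (hn _ (Nat.lt_succ_of_le hi) _)⟩
  datum := by
    let _ := dualModule R A
    have hsmul (a : Aᵐᵒᵖ) (f : A →ₗ[R] R) (x : A) : (a • f) x = f (a.unop * x) := rfl
    have : IsScalarTower R Aᵐᵒᵖ (A →ₗ[R] R) := ⟨fun r a f => LinearMap.ext fun x => by
      rw [hsmul, MulOpposite.unop_smul, smul_mul_assoc, map_smul, LinearMap.smul_apply, hsmul]⟩
    have : Module.Finite R (A →ₗ[R] R) := finite_hom A R
    exact ⟨A →ₗ[R] R, inferInstance, inferInstance, dualModule R A, inferInstance, LinearMap.applyₗ 1,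
      Module.Finite.of_restrictScalars_finite R Aᵐᵒᵖ _, hd,
      fun φ => ⟨φ ∘ₗ (MulOpposite.opLinearEquiv R).toLinearMap, fun l => by
        rw [LinearMap.applyₗ_apply_apply, hsmul, mul_one]; rfl⟩,
      fun w hw => LinearMap.ext fun x => by
        have := hw (MulOpposite.op x)
        rwa [LinearMap.applyₗ_apply_apply, hsmul, mul_one] at this⟩

variable {R} {Λ : Type u} [Ring Λ] [Algebra R Λ]

theorem isCM_iff_extGrp (N : ModuleCat.{u} Λ) : IsCM Λ N ↔ Module.Finite Λ N ∧
    ∀ i : ℕ, 0 < i → Subsingleton (extGrp Λ i N (ModuleCat.of Λ Λ)) := by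
  refine ⟨fun h => ⟨h.1, fun i hi => (extGrp_iff hi _ _).2 ?_⟩, fun h =>
    ⟨h.1, fun i => (extGrp_iff i.succ_pos _ _).1 (h.2 _ i.succ_pos)⟩⟩
  obtain ⟨i, rfl⟩ := Nat.exists_eq_succ_of_ne_zero hi.ne'
  exact h.2 i

open Classical in
theorem hasFGDecomposition_of_isInternal {H : Type u} [AddCommGroup H] [Module Λ H]
    {M : Type w₁} [AddCommGroup M] [Module Λ M] (e : H ≃ₗ[Λ] M) {ι : Type w}
    {P : ι → Submodule Λ M} (hP : DirectSum.IsInternal P) (hfg : ∀ i, (P i).FG) :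
    HasFGDecomposition.{u, w} Λ H := by
  obtain ⟨h1, h2⟩ := (DirectSum.isInternal_submodule_iff_iSupIndep_and_iSup_eq_top P).1 hP
  refine ⟨ι, fun i => (P i).map e.symm.toLinearMap,
    DirectSum.isInternal_submodule_of_iSupIndep_of_iSup_eq_top
      (h1.map_orderIso (Submodule.orderIsoMapComap e.symm)) ?_, fun i => (hfg i).map _⟩
  rw [← Submodule.map_iSup, h2, Submodule.map_top]
  exact LinearEquiv.range e.symm

variable [IsLocalRing R] [IsAdicComplete (IsLocalRing.maximalIdeal R) R]

open Classical in
/-- Finite Cohen–Macaulay representation type, for Gorenstein orders. -/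
theorem IsGorensteinOrder.finite_iff (h : IsGorensteinOrder R Λ) :
    (∃ (n : ℕ) (rep : Fin n → ModuleCat.{u} Λ), ∀ N : ModuleCat.{u} Λ, Module.Finite Λ N →
        IsIndecomposableModule Λ N →
        (∀ i : ℕ, 0 < i → Subsingleton (extGrp Λ i N (ModuleCat.of Λ Λ))) →
        ∃ j : Fin n, Nonempty (N ≅ rep j)) ↔
    ∀ M : ModuleCat.{max u v} Λ, IsGorensteinProjective.{v} M →
      ∃ (ι : Type (max u v)) (P : ι → Submodule Λ M), DirectSum.IsInternal P ∧
        ∀ i : ι, (P i).FG ∧ IsGorensteinProjective.{v} (ModuleCat.of Λ (P i)) := by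
  have := h.finite
  have := h.isNoetherianRing
  refine ⟨fun ⟨n, rep, hrep⟩ M hM => h.exists_decomposition rep (fun N _ _ hN hind => ?_) hM,
    fun hdec => ?_⟩
  · have hN' := (isCM_iff_extGrp (ModuleCat.of Λ N)).1 hN
    obtain ⟨j, ⟨i⟩⟩ := hrep (ModuleCat.of Λ N) hN'.1 hind hN'.2
    exact ⟨j, ⟨i.toLinearEquiv⟩⟩
  · obtain ⟨l, hl⟩ := h.finRep_of_decomposition.{u, max u v} fun H _ _ hH => by
      let e : H ≃ₗ[Λ] ULift.{v} H := ULift.moduleEquiv.symm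
      obtain ⟨ι, P, hP, hfg⟩ := hdec (ModuleCat.of Λ (ULift.{v} H))
        (IsCMExt.isGorensteinProjective.{v} (H := ModuleCat.of Λ H)
          (fun N _ _ hN => h.exists_cosyzygy hN) hH e)
      exact hasFGDecomposition_of_isInternal e hP fun i => (hfg i).1
    refine ⟨l.length, l.get, fun N hN hind hext => ?_⟩
    obtain ⟨Y, hY, ⟨e⟩⟩ := hl N ⟨(isCM_iff_extGrp N).2 ⟨hN, hext⟩, hind⟩
    obtain ⟨j, rfl⟩ := List.get_of_mem hY
    exact ⟨j, ⟨e.toModuleIso⟩⟩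

end Bridge

end GorensteinOrder

open Classical

/-- Let `R` be a complete Gorenstein commutative noetherian local ring and let
`A` be a Gorenstein `R`-order, i.e. a nonzero Noether `R`-algebra which is a maximal
Cohen–Macaulay `R`-module (`Ext^i_R(A, R) = 0` for `i > 0`) such that `Hom_R(A, R)` is
projective as a right `A`-module.  Then `A` is of finite Cohen–Macaulay representation type
(there are, up to isomorphism, only finitely many indecomposable finitely generated right
`A`-modules `N` with `Ext^i_A(N, A) = 0` for all `i > 0`) if and only if every
Gorenstein-projective right `A`-module is a direct sum of finitely generated
Gorenstein-projective right `A`-modules. -/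
theorem finiteCMRepresentationType_iff_gorensteinProjective_decomposes
    (R : Type u) [CommRing R] [IsNoetherianRing R] [IsLocalRing R]
    [IsAdicComplete (IsLocalRing.maximalIdeal R) R]
    -- `R` is Gorenstein: it has finite injective dimension as an `R`-module
    (hGorR : ∃ n : ℕ, hasInjDimLE R n (ModuleCat.of R R))
    (A : Type u) [Ring A] [Algebra R A] [Module.Finite R A] [Nontrivial A]
    -- `A` is a maximal Cohen–Macaulay `R`-module
    (hMCM : ∀ i : ℕ, 0 < i →
      Subsingleton (extGrp R i (ModuleCat.of R A) (ModuleCat.of R R)))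
    -- `Hom_R(A, R)` is projective as a right `A`-module (`A` is a Gorenstein `R`-order)
    (hGorA : Module.Projective Aᵈᵐᵃ (A →ₗ[R] R)) :
    -- (1) `A` is of finite Cohen–Macaulay representation type
    (∃ (n : ℕ) (rep : Fin n → ModuleCat.{u} Aᵐᵒᵖ),
      ∀ N : ModuleCat.{u} Aᵐᵒᵖ, Module.Finite Aᵐᵒᵖ N →
        IsIndecomposableModule Aᵐᵒᵖ N →
        (∀ i : ℕ, 0 < i →
          Subsingleton (extGrp Aᵐᵒᵖ i N (ModuleCat.of Aᵐᵒᵖ Aᵐᵒᵖ))) →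
        ∃ j : Fin n, Nonempty (N ≅ rep j)) ↔
    -- (2) every Gorenstein-projective right `A`-module is a direct sum of finitely
    -- generated Gorenstein-projective right `A`-modules
    (∀ M : ModuleCat.{max u v} Aᵐᵒᵖ, IsGorensteinProjective.{v} M →
      ∃ (ι : Type (max u v)) (P : ι → Submodule Aᵐᵒᵖ M),
        DirectSum.IsInternal P ∧
        ∀ i : ι, (P i).FG ∧
          IsGorensteinProjective.{v} (ModuleCat.of Aᵐᵒᵖ (P i))) :=
  (GorensteinOrder.isGorensteinOrder_op R A hGorR hMCM hGorA).finite_iff
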